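/- Let s ∈ ℕ with s ≥ 2. There exist constants δ > 0, δ₁ ≥ 0, δ₂ ≥ 0 and C₁ > 0, depending only on s, with the following property: for every W ∈ L¹(ℝ³) with W ≥ 0, every B ≥ 1, and every u ∈ C^∞(ℝ × ℝ³; ℂ), Schwartz class in x for each t, solving i ∂_t u = −(1/2)Δu + (W ∗ |u|²)u pointwise on ℝ × ℝ³ and satisfying sup_{t∈ℝ} ‖u(t)‖_{H¹} ≤ B, one has for all t ∈ ℝ: ‖u(t)‖_{H^s} ≤ C₁ B^{δ₁} (1 + ‖W‖_{L¹})^{δ₂} ‖u(0)‖_{H^s} (1 + |t|)^{(s−1)/δ}. (Polynomial-in-time growth of Sobolev norms for the cubic NLS with convolution nonlinearity.) -/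

import Mathlib

noncomputable section

open MeasureTheory Real Set

/-- Three-dimensional Euclidean space `ℝ³`. -/
abbrev E3 := EuclideanSpace ℝ (Fin 3)

/-- The `i`-th standard basis vector of `ℝ³`. -/
def e3 (i : Fin 3) : E3 := EuclideanSpace.single i 1

/-- Partial derivative `∂ᵢ` of a complex-valued function on `ℝ³`. -/
def pd (i : Fin 3) (g : E3 → ℂ) : E3 → ℂ := fun x => fderiv ℝ g x (e3 i)

/-- Partial derivative `∂ᵢ` of a real-valued function on `ℝ³`. -/
def pdR (i : Fin 3) (g : E3 → ℝ) : E3 → ℝ := fun x => fderiv ℝ g x (e3 i)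

/-- Multi-index partial derivative `∂^σ` of a complex-valued function. -/
def mpd (σ : Fin 3 → ℕ) (g : E3 → ℂ) : E3 → ℂ :=
  (pd 0)^[σ 0] ((pd 1)^[σ 1] ((pd 2)^[σ 2] g))

/-- Multi-index partial derivative `∂^σ` of a real-valued function. -/
def mpdR (σ : Fin 3 → ℕ) (g : E3 → ℝ) : E3 → ℝ :=
  (pdR 0)^[σ 0] ((pdR 1)^[σ 1] ((pdR 2)^[σ 2] g))

/-- Degree `|σ|` of a multi-index `σ ∈ ℕ³`. -/
def mdeg (σ : Fin 3 → ℕ) : ℕ := σ 0 + σ 1 + σ 2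

/-- The finite set of multi-indices `σ ∈ ℕ³` with `|σ| ≤ s`. -/
def mIdx (s : ℕ) : Finset (Fin 3 → ℕ) :=
  (Fintype.piFinset fun _ : Fin 3 => Finset.range (s + 1)).filter fun σ => mdeg σ ≤ s

/-- Sobolev norm `‖g‖_{H^s}`, `‖g‖_{H^s}² = Σ_{|σ| ≤ s} ‖∂^σ g‖²_{L²}`. -/
def sobNorm (s : ℕ) (g : E3 → ℂ) : ℝ :=
  Real.sqrt (∑ σ ∈ mIdx s, ∫ x : E3, ‖mpd σ g x‖ ^ 2)

/-- Semiclassical Sobolev norm `‖g‖_{H^s_ε}`,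
`‖g‖²_{H^s_ε} = Σ_{|σ| ≤ s} ε^{2|σ|} ‖∂^σ g‖²_{L²}`. -/
def sobNormE (ε : ℝ) (s : ℕ) (g : E3 → ℂ) : ℝ :=
  Real.sqrt (∑ σ ∈ mIdx s, ε ^ (2 * mdeg σ) * ∫ x : E3, ‖mpd σ g x‖ ^ 2)

/-- Laplacian of a complex-valued function on `ℝ³`. -/
def lapC (g : E3 → ℂ) : E3 → ℂ := fun x => ∑ i : Fin 3, pd i (pd i g) x

/-- Laplacian of a real-valued function on `ℝ³`. -/
def lapR (g : E3 → ℝ) : E3 → ℝ := fun x => ∑ i : Fin 3, pdR i (pdR i g) x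

/-- Convolution `(W ∗ g)(x) = ∫ W(x - y) g(y) dy` on `ℝ³`. -/
def conv3 (W g : E3 → ℝ) : E3 → ℝ := fun x => ∫ y : E3, W (x - y) * g y

/-- A function on `ℝ³` of Schwartz class: smooth with all derivatives rapidly decaying. -/
def IsSchwartzF {F : Type*} [NormedAddCommGroup F] [NormedSpace ℝ F] (g : E3 → F) : Prop :=
  (∀ n : ℕ, ContDiff ℝ n g) ∧
    ∀ k n : ℕ, ∃ C : ℝ, ∀ x : E3, ‖x‖ ^ k * ‖iteratedFDeriv ℝ n g x‖ ≤ C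

namespace NLS
open scoped ENNReal Topology ContDiff

section LB
variable {E : Type*} [NormedAddCommGroup E] [NormedSpace ℝ E] [FiniteDimensional ℝ E]
  [MeasureSpace E] [BorelSpace E]

/-- `f` is continuous with `L²` norm at most `c`. -/
def LB (f : E → ℂ) (c : ℝ) : Prop :=
  Continuous f ∧ eLpNorm f 2 volume ≤ ENNReal.ofReal c

variable {f g : E → ℂ} {a b c : ℝ}

lemma LB.aesm (h : LB f c) : AEStronglyMeasurable f volume := h.1.aestronglyMeasurable

lemma LB.memLp (h : LB f c) : MemLp f 2 volume :=
  ⟨h.aesm, h.2.trans_lt ENNReal.ofReal_lt_top⟩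

lemma LB.mono (h : LB f a) (hab : a ≤ b) : LB f b :=
  ⟨h.1, h.2.trans (ENNReal.ofReal_le_ofReal hab)⟩

lemma LB.add (hf : LB f a) (hg : LB g b) (ha : 0 ≤ a) (hb : 0 ≤ b) :
    LB (fun x => f x + g x) (a + b) := by
  refine ⟨hf.1.add hg.1, ?_⟩
  rw [ENNReal.ofReal_add ha hb]
  exact (eLpNorm_add_le hf.aesm hg.aesm (by norm_num)).trans (add_le_add hf.2 hg.2)

lemma LB.sub (hf : LB f a) (hg : LB g b) (ha : 0 ≤ a) (hb : 0 ≤ b) :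
    LB (fun x => f x - g x) (a + b) := by
  refine ⟨hf.1.sub hg.1, ?_⟩
  rw [ENNReal.ofReal_add ha hb]
  exact (eLpNorm_sub_le hf.aesm hg.aesm (by norm_num)).trans (add_le_add hf.2 hg.2)

lemma LB.of_norm_le (hg : LB g b) (hf : Continuous f) (h : ∀ x, ‖f x‖ ≤ c * ‖g x‖) (hc : 0 ≤ c) :
    LB f (c * b) := by
  refine ⟨hf, ?_⟩
  have := eLpNorm_le_mul_eLpNorm_of_ae_le_mul (μ := (volume : Measure E)) (f := f) (g := g)
    (c := c) (Filter.Eventually.of_forall h) 2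
  rw [ENNReal.ofReal_mul hc]
  exact this.trans (by gcongr; exact hg.2)

lemma LB.const_mul (hf : LB f a) (z : ℂ) : LB (fun x => z * f x) (‖z‖ * a) :=
  hf.of_norm_le (continuous_const.mul hf.1) (fun x => by simp) (norm_nonneg z)

lemma LB.zero : LB (fun _ : E => (0 : ℂ)) c :=
  ⟨continuous_const, by simp⟩

lemma LB.sum {ι : Type*} (s : Finset ι) (F : ι → E → ℂ) (A : ι → ℝ)
    (h : ∀ i ∈ s, LB (F i) (A i)) (hA : ∀ i ∈ s, 0 ≤ A i) :
    LB (fun x => ∑ i ∈ s, F i x) (∑ i ∈ s, A i) := by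
  classical
  induction s using Finset.induction_on with
  | empty => simpa using LB.zero (E := E) (c := 0)
  | insert i s hi ih =>
    simp only [Finset.sum_insert hi]
    exact (h i (by simp)).add (ih (fun j hj => h j (by simp [hj])) fun j hj => hA j (by simp [hj]))
      (hA i (by simp)) (Finset.sum_nonneg fun j hj => hA j (by simp [hj]))

lemma sq_eLpNorm_two (f : E → ℂ) :
    (eLpNorm f 2 (volume : Measure E)) ^ 2 = ∫⁻ x, ‖f x‖ₑ ^ 2 := by
  have := eLpNorm_nnreal_pow_eq_lintegral (f := f) (μ := (volume : Measure E)) (p := 2) (by norm_num)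
  simpa using this

lemma lb_iff_lintegral (hc : 0 ≤ c) :
    LB f c ↔ Continuous f ∧ ∫⁻ x, ‖f x‖ₑ ^ 2 ≤ ENNReal.ofReal (c ^ 2) := by
  unfold LB
  rw [← sq_eLpNorm_two, ENNReal.ofReal_pow hc]
  exact and_congr_right fun _ => (ENNReal.pow_le_pow_left_iff (by norm_num)).symm

lemma LB.integrable_sq (h : LB f c) : Integrable (fun x => ‖f x‖ ^ 2) :=
  h.memLp.integrable_norm_pow (by norm_num)

lemma LB.integrable_mul (hf : LB f a) (hg : LB g b) : Integrable (fun x => ‖f x‖ * ‖g x‖) :=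
  hf.memLp.norm.integrable_mul hg.memLp.norm

lemma lintegral_enorm_sq (hf : Integrable (fun x => ‖f x‖ ^ 2)) :
    ∫⁻ x, ‖f x‖ₑ ^ 2 = ENNReal.ofReal (∫ x, ‖f x‖ ^ 2) := by
  rw [ofReal_integral_eq_lintegral_ofReal hf (Filter.Eventually.of_forall fun x => by positivity)]
  refine lintegral_congr fun x => ?_
  rw [ENNReal.ofReal_pow (norm_nonneg _), ofReal_norm]

lemma LB.of_integral (hf : Continuous f) (hi : Integrable (fun x => ‖f x‖ ^ 2)) (hc : 0 ≤ c)
    (h : ∫ x, ‖f x‖ ^ 2 ≤ c ^ 2) : LB f c := by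
  rw [lb_iff_lintegral hc, lintegral_enorm_sq hi]
  exact ⟨hf, ENNReal.ofReal_le_ofReal h⟩

lemma LB.integral_mul_le (hf : LB f a) (hg : LB g b) (ha : 0 ≤ a) (hb : 0 ≤ b) :
    ∫ x, ‖f x‖ * ‖g x‖ ≤ a * b := by
  have hi := hf.integrable_mul hg
  have h1 : ∀ x, ‖f x‖ * ‖g x‖ = (fun x => (‖f x‖ * ‖g x‖ : ℝ)) x := fun _ => rfl
  have := eLpNorm_smul_le_mul_eLpNorm (μ := (volume : Measure E)) (p := 2) (q := 2) (r := 1)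
    (f := fun x => ‖g x‖) (φ := fun x => ‖f x‖) hg.memLp.norm.1 hf.memLp.norm.1
  rw [eLpNorm_norm, eLpNorm_norm, eLpNorm_one_eq_lintegral_enorm] at this
  have h2 : ∫⁻ x, ‖((fun x => ‖f x‖) • fun x => ‖g x‖) x‖ₑ
      = ENNReal.ofReal (∫ x, ‖f x‖ * ‖g x‖) := by
    rw [ofReal_integral_eq_lintegral_ofReal hi (Filter.Eventually.of_forall fun x => by positivity)]
    refine lintegral_congr fun x => ?_
    simp only [Pi.smul_apply', smul_eq_mul]
    rw [← ofReal_norm, Real.norm_of_nonneg (by positivity)]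
  rw [h2] at this
  have h3 : ENNReal.ofReal (∫ x, ‖f x‖ * ‖g x‖) ≤ ENNReal.ofReal (a * b) := by
    rw [ENNReal.ofReal_mul ha]
    exact this.trans (mul_le_mul' hf.2 hg.2)
  exact (ENNReal.ofReal_le_ofReal_iff (by positivity)).1 h3

/-- Products bounded by `K‖f‖‖g‖` are integrable with the Cauchy-Schwarz bound. -/
lemma LB.integral_le (hf : LB f a) (hg : LB g b) (ha : 0 ≤ a) (hb : 0 ≤ b) {F : Type*}
    [NormedAddCommGroup F] [NormedSpace ℝ F] {H : E → F} {K : ℝ} (hK : 0 ≤ K)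
    (hH : AEStronglyMeasurable H volume) (h : ∀ x, ‖H x‖ ≤ K * (‖f x‖ * ‖g x‖)) :
    Integrable H ∧ ‖∫ x, H x‖ ≤ K * (a * b) ∧ ∫ x, ‖H x‖ ≤ K * (a * b) := by
  have hi := (hf.integrable_mul hg).const_mul K
  have hI : Integrable H := hi.mono' hH (Filter.Eventually.of_forall h)
  have h3 : ∫ x, ‖H x‖ ≤ K * (a * b) := by
    refine (integral_mono hI.norm hi h).trans ?_
    rw [integral_const_mul]
    exact mul_le_mul_of_nonneg_left (hf.integral_mul_le hg ha hb) hK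
  exact ⟨hI, (norm_integral_le_integral_norm _).trans h3, h3⟩

end LB

section tensor
variable {E F : Type*} [NormedAddCommGroup E] [NormedSpace ℝ E] [FiniteDimensional ℝ E]
  [MeasureSpace E] [BorelSpace E] [NormedAddCommGroup F] [NormedSpace ℝ F] [FiniteDimensional ℝ F]
  [MeasureSpace F] [BorelSpace F] [SFinite (volume : Measure E)] [SFinite (volume : Measure F)]

lemma LB.tensor {f : E → ℂ} {g : F → ℂ} {a b : ℝ} (hf : LB f a) (hg : LB g b) (ha : 0 ≤ a)
    (hb : 0 ≤ b) : LB (fun z : E × F => f z.1 * g z.2) (a * b) := by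
  rw [lb_iff_lintegral (by positivity)]
  refine ⟨(hf.1.comp continuous_fst).mul (hg.1.comp continuous_snd), ?_⟩
  have h1 : ∀ z : E × F, ‖f z.1 * g z.2‖ₑ ^ 2 = ‖f z.1‖ₑ ^ 2 * ‖g z.2‖ₑ ^ 2 := fun z => by
    rw [enorm_mul, mul_pow]
  simp_rw [h1]
  rw [Measure.volume_eq_prod, lintegral_prod_mul (f := fun x => ‖f x‖ₑ ^ 2)
    (g := fun x => ‖g x‖ₑ ^ 2) (hf.1.enorm.measurable.pow_const 2).aemeasurable
    (hg.1.enorm.measurable.pow_const 2).aemeasurable, mul_pow, ENNReal.ofReal_mul (by positivity)]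
  exact mul_le_mul' ((lb_iff_lintegral ha).1 hf).2 ((lb_iff_lintegral hb).1 hg).2

end tensor

section Minkowski
variable {X Y : Type*} [MeasurableSpace X] [MeasurableSpace Y] {μ : Measure X} {ν : Measure Y}
  [SFinite μ] [SFinite ν]

lemma lintegral_mul_sq_le {k F : Y → ℝ≥0∞} (hk : AEMeasurable k ν) (hF : AEMeasurable F ν) :
    (∫⁻ y, k y * F y ∂ν) ^ 2 ≤ (∫⁻ y, k y ∂ν) * ∫⁻ y, k y * F y ^ 2 ∂ν := by
  have h := ENNReal.lintegral_mul_le_Lp_mul_Lq ν (p := 2) (q := 2) (by constructor <;> norm_num)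
    (f := fun y => k y ^ (1 / 2 : ℝ)) (g := fun y => k y ^ (1 / 2 : ℝ) * F y)
    (hk.pow_const _) ((hk.pow_const _).mul hF)
  have e1 : ∀ y, k y ^ (1 / 2 : ℝ) * (k y ^ (1 / 2 : ℝ) * F y) = k y * F y := fun y => by
    rw [← mul_assoc, ← ENNReal.rpow_add_of_nonneg _ _ (by norm_num) (by norm_num)]; norm_num
  have e2 : ∀ y, (k y ^ (1 / 2 : ℝ)) ^ (2 : ℝ) = k y := fun y => by
    rw [← ENNReal.rpow_mul]; norm_num
  have e3 : ∀ y, (k y ^ (1 / 2 : ℝ) * F y) ^ (2 : ℝ) = k y * F y ^ 2 := fun y => by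
    rw [ENNReal.mul_rpow_of_nonneg _ _ (by norm_num), e2]; norm_num
  simp only [Pi.mul_apply, e1, e2, e3] at h
  calc (∫⁻ y, k y * F y ∂ν) ^ 2
      ≤ ((∫⁻ y, k y ∂ν) ^ (1 / 2 : ℝ) * (∫⁻ y, k y * F y ^ 2 ∂ν) ^ (1 / 2 : ℝ)) ^ 2 := by
        gcongr
    _ = _ := by
        rw [mul_pow]
        congr 1 <;>
        · rw [← ENNReal.rpow_natCast, ← ENNReal.rpow_mul]; norm_num

/-- Minkowski's inequality for averages of functions in a ball of `L²`. -/
lemma lintegral_average_sq_le {k : Y → ℝ≥0∞} {F : Y → X → ℝ≥0∞} {A : ℝ≥0∞}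
    (hk : Measurable k) (hF : Measurable (Function.uncurry F))
    (h : ∀ y, ∫⁻ x, F y x ^ 2 ∂μ ≤ A) :
    ∫⁻ x, (∫⁻ y, k y * F y x ∂ν) ^ 2 ∂μ ≤ (∫⁻ y, k y ∂ν) ^ 2 * A := by
  have hm : Measurable (Function.uncurry fun x y => k y * F y x ^ 2) :=
    (hk.comp measurable_snd).mul ((hF.comp measurable_swap).pow_const 2)
  calc ∫⁻ x, (∫⁻ y, k y * F y x ∂ν) ^ 2 ∂μ
      ≤ ∫⁻ x, (∫⁻ y, k y ∂ν) * ∫⁻ y, k y * F y x ^ 2 ∂ν ∂μ :=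
        lintegral_mono fun x => lintegral_mul_sq_le hk.aemeasurable
          (hF.comp (measurable_id.prodMk measurable_const)).aemeasurable
    _ = (∫⁻ y, k y ∂ν) * ∫⁻ x, ∫⁻ y, k y * F y x ^ 2 ∂ν ∂μ :=
        lintegral_const_mul _ hm.lintegral_prod_right'
    _ = (∫⁻ y, k y ∂ν) * ∫⁻ y, ∫⁻ x, k y * F y x ^ 2 ∂μ ∂ν := by
        rw [lintegral_lintegral_swap hm.aemeasurable]
    _ ≤ (∫⁻ y, k y ∂ν) * ∫⁻ y, k y * A ∂ν := by
        gcongr with y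
        rw [lintegral_const_mul (f := fun x => F y x ^ 2) _
          ((hF.comp (measurable_const.prodMk measurable_id)).pow_const 2)]
        gcongr
        exact h y
    _ = _ := by rw [lintegral_mul_const _ hk, sq, mul_assoc]

end Minkowski

section dd
variable {G : Type*} [NormedAddCommGroup G] [NormedSpace ℝ G]

/-- Smoothness of a complex-valued function. -/
def Sm (f : G → ℂ) : Prop := ContDiff ℝ ∞ f

/-- Directional derivative. -/
def dd (v : G) (f : G → ℂ) : G → ℂ := fun p => fderiv ℝ f p v

variable {f g : G → ℂ}

lemma Sm.differentiable (hf : Sm f) : Differentiable ℝ f := ContDiff.differentiable hf (by simp)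

lemma Sm.continuous (hf : Sm f) : Continuous f := ContDiff.continuous hf

lemma Sm.dd (hf : Sm f) (v : G) : Sm (dd v f) := by
  have : ContDiff ℝ ∞ (fderiv ℝ f) := ContDiff.fderiv_right hf (by simp)
  exact this.clm_apply contDiff_const

lemma Sm.add (hf : Sm f) (hg : Sm g) : Sm (fun x => f x + g x) := ContDiff.add hf hg
lemma Sm.sub (hf : Sm f) (hg : Sm g) : Sm (fun x => f x - g x) := ContDiff.sub hf hg
lemma Sm.mul (hf : Sm f) (hg : Sm g) : Sm (fun x => f x * g x) := ContDiff.mul hf hg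
lemma Sm.const_mul (hf : Sm f) (c : ℂ) : Sm (fun x => c * f x) :=
  ContDiff.mul contDiff_const hf
lemma Sm.conj (hf : Sm f) : Sm (fun x => (starRingEnd ℂ) (f x)) :=
  Complex.conjCLE.contDiff.comp hf
lemma Sm.sum {ι : Type*} {s : Finset ι} {F : ι → G → ℂ} (h : ∀ i ∈ s, Sm (F i)) :
    Sm (fun x => ∑ i ∈ s, F i x) := ContDiff.sum h

lemma Sm.hasLineDerivAt (hf : Sm f) (x v : G) : HasLineDerivAt ℝ f (NLS.dd v f x) x v :=
  (hf.differentiable x).hasFDerivAt.hasLineDerivAt v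

lemma dd_comm (hf : Sm f) (v w : G) : dd v (dd w f) = dd w (dd v f) := by
  have h1 : Differentiable ℝ (fderiv ℝ f) :=
    (ContDiff.fderiv_right (m := 1) hf (by norm_cast)).differentiable (by simp)
  have key : ∀ (v w : G) (x : G), dd v (dd w f) x = fderiv ℝ (fderiv ℝ f) x v w := fun v w x => by
    unfold dd
    rw [fderiv_clm_apply (h1 x) (differentiableAt_const w)]
    simp
  funext x
  rw [key, key]
  exact (ContDiffAt.isSymmSndFDerivAt (ContDiff.contDiffAt hf)
    (by rw [minSmoothness_of_isRCLikeNormedField]; exact WithTop.coe_le_coe.2 (le_top : (2 : ℕ∞) ≤ ⊤))).eq v w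

lemma dd_add (hf : Sm f) (hg : Sm g) (v : G) :
    dd v (fun x => f x + g x) = fun x => dd v f x + dd v g x := by
  funext x; simp only [dd]; rw [fderiv_fun_add (hf.differentiable x) (hg.differentiable x)]; rfl

lemma dd_sub (hf : Sm f) (hg : Sm g) (v : G) :
    dd v (fun x => f x - g x) = fun x => dd v f x - dd v g x := by
  funext x; simp only [dd]; rw [fderiv_fun_sub (hf.differentiable x) (hg.differentiable x)]; rfl

lemma dd_mul (hf : Sm f) (hg : Sm g) (v : G) :
    dd v (fun x => f x * g x) = fun x => dd v f x * g x + f x * dd v g x := by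
  funext x; simp only [dd]; rw [fderiv_fun_mul (hf.differentiable x) (hg.differentiable x)]
  simp; ring

lemma dd_const_mul (hf : Sm f) (c : ℂ) (v : G) :
    dd v (fun x => c * f x) = fun x => c * dd v f x := by
  funext x; simp only [dd]; rw [fderiv_const_mul (hf.differentiable x)]; simp

lemma dd_conj (hf : Sm f) (v : G) :
    dd v (fun x => (starRingEnd ℂ) (f x)) = fun x => (starRingEnd ℂ) (dd v f x) := by
  funext x
  have := (Complex.conjCLE.toContinuousLinearMap.hasFDerivAt (x := f x)).comp x
    (hf.differentiable x).hasFDerivAt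
  simp only [dd]
  have h2 := congrArg (fun L => L v) this.fderiv
  simpa [Function.comp_def] using h2

lemma dd_sum {ι : Type*} {s : Finset ι} {F : ι → G → ℂ} (h : ∀ i ∈ s, Sm (F i)) (v : G) :
    dd v (fun x => ∑ i ∈ s, F i x) = fun x => ∑ i ∈ s, dd v (F i) x := by
  funext x; simp only [dd]; rw [fderiv_fun_sum fun i hi => (h i hi).differentiable x]; simp

lemma dd_neg_dir (v : G) : dd (-v) f = fun x => -dd v f x := by
  funext x; simp [dd]

end dd

section M2
variable {E : Type*} [NormedAddCommGroup E] [NormedSpace ℝ E] [FiniteDimensional ℝ E]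
  [MeasureSpace E] [BorelSpace E]

/-- Continuous and square integrable. -/
def M2 (f : E → ℂ) : Prop := Continuous f ∧ MemLp f 2 volume

lemma LB.m2 {f : E → ℂ} {c : ℝ} (h : LB f c) : M2 f := ⟨h.1, h.memLp⟩

variable {f g : E → ℂ}

lemma M2.lb (hf : M2 f) : LB f (eLpNorm f 2 volume).toReal :=
  ⟨hf.1, by rw [ENNReal.ofReal_toReal hf.2.eLpNorm_ne_top]⟩

lemma M2.add (hf : M2 f) (hg : M2 g) : M2 (fun x => f x + g x) := ⟨hf.1.add hg.1, hf.2.add hg.2⟩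
lemma M2.sub (hf : M2 f) (hg : M2 g) : M2 (fun x => f x - g x) := ⟨hf.1.sub hg.1, hf.2.sub hg.2⟩
lemma M2.const_mul (hf : M2 f) (c : ℂ) : M2 (fun x => c * f x) :=
  ⟨continuous_const.mul hf.1, hf.2.const_mul c⟩
lemma M2.sum {ι : Type*} {s : Finset ι} {F : ι → E → ℂ} (h : ∀ i ∈ s, M2 (F i)) :
    M2 (fun x => ∑ i ∈ s, F i x) :=
  ⟨continuous_finsetSum _ fun i hi => (h i hi).1, memLp_finsetSum _ fun i hi => (h i hi).2⟩

/-- Real inner product on `ℂ`. -/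
abbrev ip (a b : ℂ) : ℝ := inner ℝ a b

lemma ip_eq (a b : ℂ) : ip a b = a.re * b.re + a.im * b.im := by
  simp [ip, Complex.inner]; ring

lemma abs_ip_le (a b : ℂ) : |ip a b| ≤ ‖a‖ * ‖b‖ := abs_real_inner_le_norm a b

lemma M2.integrable_ip {k : E → ℝ} {K : ℝ} (hf : M2 f) (hg : M2 g) (hk : Continuous k)
    (hK : ∀ x, |k x| ≤ K) : Integrable (fun x => k x * ip (f x) (g x)) := by
  have h := (hf.lb.integrable_mul hg.lb).const_mul K
  refine h.mono' (hk.mul (hf.1.inner hg.1)).aestronglyMeasurable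
    (Filter.Eventually.of_forall fun x => ?_)
  rw [norm_mul, Real.norm_eq_abs, Real.norm_eq_abs]
  exact mul_le_mul (hK x) (abs_ip_le _ _) (abs_nonneg _) ((abs_nonneg _).trans (hK x))

/-- A real kernel with a line derivative, both continuous and bounded. -/
structure Ker (v : E) (k k' : E → ℝ) : Prop where
  cont : Continuous k
  cont' : Continuous k'
  bdd : ∃ K, ∀ x, |k x| ≤ K
  bdd' : ∃ K, ∀ x, |k' x| ≤ K
  deriv : ∀ x, HasLineDerivAt ℝ k (k' x) x v

lemma Ker.sum {ι : Type*} {s : Finset ι} {v : E} {k k' : ι → E → ℝ}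
    (h : ∀ i ∈ s, Ker v (k i) (k' i)) : Ker v (fun x => ∑ i ∈ s, k i x) (fun x => ∑ i ∈ s, k' i x) := by
  classical
  induction s using Finset.induction_on with
  | empty =>
    exact ⟨by simpa using continuous_const, by simpa using continuous_const, ⟨0, by simp⟩,
      ⟨0, by simp⟩, fun x => by simpa [HasLineDerivAt] using hasDerivAt_const (0 : ℝ) (0 : ℝ)⟩
  | insert i s hi ih =>
    have h1 := h i (by simp)
    have h2 := ih fun j hj => h j (by simp [hj])
    simp only [Finset.sum_insert hi]
    obtain ⟨a, ha⟩ := h1.bdd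
    obtain ⟨b, hb⟩ := h2.bdd
    obtain ⟨a', ha'⟩ := h1.bdd'
    obtain ⟨b', hb'⟩ := h2.bdd'
    exact ⟨h1.cont.add h2.cont, h1.cont'.add h2.cont',
      ⟨a + b, fun x => (abs_add_le _ _).trans (add_le_add (ha x) (hb x))⟩,
      ⟨a' + b', fun x => (abs_add_le _ _).trans (add_le_add (ha' x) (hb' x))⟩,
      fun x => HasDerivAt.add (h1.deriv x) (h2.deriv x)⟩

variable [(volume : Measure E).IsAddHaarMeasure]

lemma ibp_ip {v : E} {k k' : E → ℝ} (hk : Ker v k k') (sf : Sm f) (sg : Sm g) (hf : M2 f)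
    (hg : M2 g) (hf' : M2 (dd v f)) (hg' : M2 (dd v g)) :
    (∫ x, k x * ip (dd v f x) (g x)) + (∫ x, k x * ip (f x) (dd v g x))
      = -∫ x, k' x * ip (f x) (g x) := by
  obtain ⟨K, hK⟩ := hk.bdd
  obtain ⟨K', hK'⟩ := hk.bdd'
  have i1 := hf'.integrable_ip hg hk.cont hK
  have i2 := hf.integrable_ip hg' hk.cont hK
  have i3 := hf.integrable_ip hg hk.cont' hK'
  have i4 := hf.integrable_ip hg hk.cont hK
  have i5 : Integrable (fun x => k x * (ip (dd v f x) (g x) + ip (f x) (dd v g x))) := by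
    simp_rw [mul_add]; exact i1.add i2
  rw [← integral_add i1 i2]
  have := integral_bilinear_hasLineDerivAt_right_eq_neg_left_of_integrable
    (μ := (volume : Measure E)) (B := ContinuousLinearMap.mul ℝ ℝ) (v := v)
    (f := k) (f' := k') (g := fun x => ip (f x) (g x))
    (g' := fun x => ip (dd v f x) (g x) + ip (f x) (dd v g x)) i3 i5 i4 (fun x _ => hk.deriv x)
    (fun x _ => by
      have h := HasDerivAt.inner ℝ (sf.hasLineDerivAt x v) (sg.hasLineDerivAt x v)
      simp only [zero_smul, add_zero] at h
      rw [add_comm (ip (dd v f x) (g x))]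
      exact h)
  simp only [ContinuousLinearMap.mul_apply', mul_add] at this
  exact this

end M2

section Morawetz
variable {E : Type*} [NormedAddCommGroup E] [NormedSpace ℝ E] [FiniteDimensional ℝ E]
  [MeasureSpace E] [BorelSpace E] [(volume : Measure E).IsAddHaarMeasure]
variable {ι J : Type*} [Fintype ι] [Fintype J]

/-- Second-order operator `∑ ∂_{d i}²`. -/
def lapd (d : ι → E) (v : E → ℂ) : E → ℂ := fun x => ∑ i, dd (d i) (dd (d i) v) x

lemma Sm.lapd {v : E → ℂ} (hv : Sm v) (d : ι → E) : Sm (lapd d v) :=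
  Sm.sum fun i _ => (hv.dd _).dd _

/-- Virial identity at a fixed time. -/
lemma virial_identity {v : E → ℂ} (sv : Sm v) {d : ι → E} {m : J → E} {κ : J → E → ℝ}
    {K : ι → J → E → ℝ} {Kd : J → E → ℝ} {β' : ι → E → ℝ}
    (hK : ∀ i j, Ker (d i) (κ j) (K i j)) (hKd : ∀ j, Ker (m j) (κ j) (Kd j))
    (hβ : ∀ i, Ker (d i) (fun x => ∑ j, Kd j x) (β' i))
    (h0 : M2 v) (hm : ∀ j, M2 (dd (m j) v)) (hd : ∀ i, M2 (dd (d i) v))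
    (hdd : ∀ i, M2 (dd (d i) (dd (d i) v))) (hmd : ∀ i j, M2 (dd (m j) (dd (d i) v)))
    (hL : ∀ j, M2 (dd (m j) (lapd d v))) :
    ∑ j, ((∫ x, κ j x * ip (v x) (dd (m j) (lapd d v) x)) -
        ∫ x, κ j x * ip (lapd d v x) (dd (m j) v x))
      = 2 * ∑ i, ∑ j, (∫ x, K i j x * ip (dd (d i) v x) (dd (m j) v x)) +
        ∑ i, ∫ x, β' i x * ip (v x) (dd (d i) v x) := by
  have hLap : M2 (lapd d v) := M2.sum fun i _ => hdd i
  have bκ : ∀ j, ∃ C, ∀ x, |κ j x| ≤ C := fun j => (hKd j).bdd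
  have bKd : ∀ j, ∃ C, ∀ x, |Kd j x| ≤ C := fun j => (hKd j).bdd'
  have s1 : ∀ j, (∫ x, κ j x * ip (v x) (dd (m j) (lapd d v) x)) =
      -(∫ x, Kd j x * ip (v x) (lapd d v x)) - ∫ x, κ j x * ip (lapd d v x) (dd (m j) v x) := by
    intro j
    have := ibp_ip (hKd j) sv (sv.lapd d) h0 hLap (hm j) (hL j)
    have e : (∫ x, κ j x * ip (dd (m j) v x) (lapd d v x)) =
      ∫ x, κ j x * ip (lapd d v x) (dd (m j) v x) := by simp_rw [ip, real_inner_comm]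
    linarith
  have exp1 : ∀ j, ∫ x, κ j x * ip (lapd d v x) (dd (m j) v x) =
      ∑ i, ∫ x, κ j x * ip (dd (d i) (dd (d i) v) x) (dd (m j) v x) := by
    intro j
    obtain ⟨C, hC⟩ := bκ j
    rw [← integral_finsetSum _ fun i _ => (hdd i).integrable_ip (hm j) (hKd j).cont hC]
    simp only [lapd, ip, sum_inner, Finset.mul_sum]
  have exp2 : ∑ j, ∫ x, Kd j x * ip (v x) (lapd d v x) =
      ∑ i, ∫ x, (∑ j, Kd j x) * ip (v x) (dd (d i) (dd (d i) v) x) := by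
    rw [← integral_finsetSum, ← integral_finsetSum]
    · refine integral_congr_ae (Filter.Eventually.of_forall fun x => ?_)
      simp only [lapd, ip, inner_sum]
      rw [← Finset.sum_mul, Finset.mul_sum]
    · intro i _
      obtain ⟨C, hC⟩ := (hβ i).bdd
      exact h0.integrable_ip (hdd i) (hβ i).cont hC
    · intro j _
      obtain ⟨C, hC⟩ := bKd j
      exact h0.integrable_ip hLap (hKd j).cont' hC
  have step : ∀ i, -(2 * ∑ j, ∫ x, κ j x * ip (dd (d i) (dd (d i) v) x) (dd (m j) v x)) -
      (∫ x, (∑ j, Kd j x) * ip (v x) (dd (d i) (dd (d i) v) x)) =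
      2 * ∑ j, (∫ x, K i j x * ip (dd (d i) v x) (dd (m j) v x)) +
        ∫ x, β' i x * ip (v x) (dd (d i) v x) := by
    intro i
    have a1 : ∀ j, (∫ x, κ j x * ip (dd (d i) (dd (d i) v) x) (dd (m j) v x)) =
        -(∫ x, K i j x * ip (dd (d i) v x) (dd (m j) v x)) -
        ∫ x, κ j x * ip (dd (d i) v x) (dd (m j) (dd (d i) v) x) := by
      intro j
      have := ibp_ip (hK i j) (sv.dd (d i)) (sv.dd (m j)) (hd i) (hm j) (hdd i)
        (by rw [dd_comm sv]; exact hmd i j)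
      rw [dd_comm sv (d i) (m j)] at this
      linarith
    have a2 : ∀ j, 2 * (∫ x, κ j x * ip (dd (d i) v x) (dd (m j) (dd (d i) v) x)) =
        -∫ x, Kd j x * ip (dd (d i) v x) (dd (d i) v x) := by
      intro j
      have := ibp_ip (hKd j) (sv.dd (d i)) (sv.dd (d i)) (hd i) (hd i) (hmd i j) (hmd i j)
      have e : (∫ x, κ j x * ip (dd (m j) (dd (d i) v) x) (dd (d i) v x)) =
        ∫ x, κ j x * ip (dd (d i) v x) (dd (m j) (dd (d i) v) x) := by simp_rw [ip, real_inner_comm]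
      linarith
    have a3 : ∑ j, (∫ x, Kd j x * ip (dd (d i) v x) (dd (d i) v x)) =
        ∫ x, (∑ j, Kd j x) * ip (dd (d i) v x) (dd (d i) v x) := by
      rw [← integral_finsetSum]
      · simp_rw [Finset.sum_mul]
      · intro j _
        obtain ⟨C, hC⟩ := bKd j
        exact (hd i).integrable_ip (hd i) (hKd j).cont' hC
    have a4 := ibp_ip (hβ i) sv (sv.dd (d i)) h0 (hd i) (hd i) (hdd i)
    have a5 : 2 * ∑ j, ∫ x, κ j x * ip (dd (d i) (dd (d i) v) x) (dd (m j) v x) =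
        -(2 * ∑ j, (∫ x, K i j x * ip (dd (d i) v x) (dd (m j) v x))) +
        ∫ x, (∑ j, Kd j x) * ip (dd (d i) v x) (dd (d i) v x) := by
      rw [← a3, Finset.mul_sum, Finset.mul_sum, ← Finset.sum_neg_distrib, ← Finset.sum_add_distrib]
      refine Finset.sum_congr rfl fun j _ => ?_
      linarith [a1 j, a2 j]
    linarith
  simp_rw [s1]
  have : ∀ j, -(∫ x, Kd j x * ip (v x) (lapd d v x)) -
      (∫ x, κ j x * ip (lapd d v x) (dd (m j) v x)) -
      (∫ x, κ j x * ip (lapd d v x) (dd (m j) v x)) =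
      -(∫ x, Kd j x * ip (v x) (lapd d v x)) -
        2 * ∑ i, ∫ x, κ j x * ip (dd (d i) (dd (d i) v) x) (dd (m j) v x) := by
    intro j; rw [← exp1]; ring
  simp_rw [this]
  rw [Finset.sum_sub_distrib, Finset.sum_neg_distrib, exp2, ← Finset.mul_sum, Finset.sum_comm]
  have := Finset.sum_congr rfl fun i (_ : i ∈ (Finset.univ : Finset ι)) => step i
  rw [Finset.sum_sub_distrib, Finset.sum_neg_distrib, ← Finset.mul_sum, Finset.sum_add_distrib,
    ← Finset.mul_sum] at this
  linarith

end Morawetz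

section slice
variable {E : Type*} [NormedAddCommGroup E] [NormedSpace ℝ E]

/-- The time slice of a function on space-time. -/
def sl (f : ℝ × E → ℂ) (t : ℝ) : E → ℂ := fun x => f (t, x)

/-- Spatial directional derivative of a function on space-time. -/
abbrev sd (v : E) (f : ℝ × E → ℂ) : ℝ × E → ℂ := dd ((0 : ℝ), v) f

/-- Time derivative of a function on space-time. -/
abbrev td (f : ℝ × E → ℂ) : ℝ × E → ℂ := dd ((1 : ℝ), (0 : E)) f

variable {f g : ℝ × E → ℂ}

lemma Sm.sl (hf : Sm f) (t : ℝ) : Sm (sl f t) :=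
  ContDiff.comp hf (contDiff_const.prodMk contDiff_id)

lemma dd_sl (hf : Sm f) (v : E) (t : ℝ) : dd v (sl f t) = sl (sd v f) t := by
  funext x
  have h := (hf.differentiable (t, x)).hasFDerivAt.comp x
    ((hasFDerivAt_const t x).prodMk (hasFDerivAt_id x))
  have h2 : fderiv ℝ (sl f t) x = _ := h.fderiv
  simp [dd, h2, sl]

lemma Sm.hasDerivAt_time (hf : Sm f) (t : ℝ) (x : E) :
    HasDerivAt (fun τ => f (τ, x)) (td f (t, x)) t := by
  have h := (hf.differentiable (t, x)).hasFDerivAt.comp_hasDerivAt t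
    ((hasDerivAt_id' t).prodMk (hasDerivAt_const t x))
  exact h

lemma sd_sd (hf : Sm f) (v w : E) : sd v (sd w f) = sd w (sd v f) := dd_comm hf _ _

lemma sd_td (hf : Sm f) (v : E) : sd v (td f) = td (sd v f) := dd_comm hf _ _

variable {ι : Type*} [Fintype ι]

/-- Schrödinger source term `i ∂_t f + c ∑ ∂_{d i}² f`. -/
def src (c : ℝ) (d : ι → E) (f : ℝ × E → ℂ) : ℝ × E → ℂ :=
  fun p => Complex.I * td f p + (c : ℂ) * ∑ i, sd (d i) (sd (d i) f) p

lemma Sm.src (hf : Sm f) (c : ℝ) (d : ι → E) : Sm (src c d f) :=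
  ((hf.dd _).const_mul _).add ((Sm.sum fun i _ => (hf.dd _).dd _).const_mul _)

lemma dd_src (hf : Sm f) (c : ℝ) (d : ι → E) (v : E) :
    sd v (src c d f) = src c d (sd v f) := by
  have h0 : ∀ i ∈ Finset.univ, Sm (sd (d i) (sd (d i) f)) := fun i _ => (hf.dd _).dd _
  have h2 : Sm (fun p => ∑ i, sd (d i) (sd (d i) f) p) := Sm.sum h0
  unfold src
  rw [sd, dd_add ((hf.dd _).const_mul _) (h2.const_mul _), dd_const_mul (hf.dd _),
    dd_const_mul h2, dd_sum h0]
  funext p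
  simp only [← sd_td hf v, sd_sd (hf.dd (0, d _)) v, sd_sd hf v]

lemma lapd_sl (hf : Sm f) (d : ι → E) (t : ℝ) :
    lapd d (sl f t) = sl (fun p => ∑ i, sd (d i) (sd (d i) f) p) t := by
  unfold lapd
  simp_rw [dd_sl hf, dd_sl (hf.dd _)]
  rfl

end slice

section timeFTC
variable {E : Type*} [NormedAddCommGroup E] [NormedSpace ℝ E] [FiniteDimensional ℝ E]
  [MeasureSpace E] [BorelSpace E] [SFinite (volume : Measure E)]

lemma integrable_prod_of_bound {a b C : ℝ} {H : ℝ × E → ℝ} (hH : Continuous H)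
    (hi : ∀ t ∈ Icc a b, Integrable fun x => H (t, x))
    (hC : ∀ t ∈ Icc a b, ∫ x, ‖H (t, x)‖ ≤ C) :
    Integrable H ((volume.restrict (Ioc a b)).prod (volume : Measure E)) := by
  have hm : AEStronglyMeasurable H ((volume.restrict (Ioc a b)).prod (volume : Measure E)) :=
    hH.aestronglyMeasurable
  have hmem : ∀ᵐ t ∂(volume.restrict (Ioc a b)), t ∈ Icc a b :=
    (ae_restrict_mem measurableSet_Ioc).mono fun t ht => Ioc_subset_Icc_self ht
  rw [integrable_prod_iff hm]
  refine ⟨hmem.mono hi, ?_⟩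
  refine Integrable.mono' (integrable_const (max C 0)) hm.norm.integral_prod_right'
    (hmem.mono fun t ht => ?_)
  rw [Real.norm_of_nonneg (by positivity)]
  exact (hC t ht).trans (le_max_left _ _)

lemma intervalIntegrable_of_bound {a b C : ℝ} (hab : a ≤ b) {H : ℝ × E → ℝ} (hH : Continuous H)
    (hi : ∀ t ∈ Icc a b, Integrable fun x => H (t, x))
    (hC : ∀ t ∈ Icc a b, ∫ x, ‖H (t, x)‖ ≤ C) :
    IntervalIntegrable (fun t => ∫ x, H (t, x)) volume a b := by
  rw [intervalIntegrable_iff_integrableOn_Ioc_of_le hab]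
  exact (integrable_prod_of_bound hH hi hC).integral_prod_left

/-- Fundamental theorem of calculus for spatial integrals. -/
lemma time_ftc {a b C : ℝ} (hab : a ≤ b) {H H' : ℝ × E → ℝ} (hH' : Continuous H')
    (hd : ∀ t x, HasDerivAt (fun τ => H (τ, x)) (H' (t, x)) t)
    (hi0 : ∀ t ∈ Icc a b, Integrable fun x => H (t, x))
    (hi : ∀ t ∈ Icc a b, Integrable fun x => H' (t, x))
    (hC : ∀ t ∈ Icc a b, ∫ x, ‖H' (t, x)‖ ≤ C) :
    (∫ x, H (b, x)) - (∫ x, H (a, x)) = ∫ t in a..b, ∫ x, H' (t, x) := by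
  have hI := integrable_prod_of_bound hH' hi hC
  rw [intervalIntegral.integral_of_le hab, integral_integral_swap (f := fun t x => H' (t, x)) hI,
    ← integral_sub (hi0 b (right_mem_Icc.2 hab)) (hi0 a (left_mem_Icc.2 hab))]
  refine integral_congr_ae (Filter.Eventually.of_forall fun x => ?_)
  simp only
  rw [← intervalIntegral.integral_of_le hab, intervalIntegral.integral_eq_sub_of_hasDerivAt
    (fun t _ => hd t x)]
  exact (hH'.comp (continuous_id.prodMk continuous_const)).intervalIntegrable _ _

end timeFTC

section Morawetz
variable {E : Type*} [NormedAddCommGroup E] [NormedSpace ℝ E] [FiniteDimensional ℝ E]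
  [MeasureSpace E] [BorelSpace E] [(volume : Measure E).IsAddHaarMeasure]
  [SFinite (volume : Measure E)]
variable {ι J : Type*} [Fintype ι] [Fintype J]

/-- Qualitative uniform `L²` control used to justify the virial computation. -/
structure VNice (a b : ℝ) (d : ι → E) (m : J → E) (v : ℝ × E → ℂ) : Prop where
  sm : Sm v
  bdd : ∃ C, 0 ≤ C ∧ ∀ t ∈ Icc a b, LB (sl v t) C ∧ LB (sl (td v) t) C ∧
    (∀ j, LB (sl (sd (m j) v) t) C) ∧ (∀ j, LB (sl (sd (m j) (td v)) t) C) ∧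
    (∀ i, LB (sl (sd (d i) v) t) C) ∧ (∀ i, LB (sl (sd (d i) (sd (d i) v)) t) C) ∧
    (∀ i j, LB (sl (sd (m j) (sd (d i) v)) t) C) ∧
    (∀ i j, LB (sl (sd (m j) (sd (d i) (sd (d i) v))) t) C)

lemma ip_I_mul (a b : ℂ) : ip (Complex.I * a) b = -ip a (Complex.I * b) := by
  simp [ip_eq]; ring

lemma LB.ip_bound {f g : E → ℂ} {A B : ℝ} (hf : LB f A) (hg : LB g B) (hA : 0 ≤ A) (hB : 0 ≤ B)
    {k : E → ℝ} (hk : Continuous k) (hk1 : ∀ x, |k x| ≤ 1) :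
    Integrable (fun x => k x * ip (f x) (g x)) ∧ |∫ x, k x * ip (f x) (g x)| ≤ A * B ∧
      ∫ x, ‖k x * ip (f x) (g x)‖ ≤ A * B := by
  have := hf.integral_le hg hA hB (K := 1) zero_le_one (H := fun x => k x * ip (f x) (g x))
    (hk.mul (hf.1.inner hg.1)).aestronglyMeasurable fun x => by
      rw [norm_mul]
      exact mul_le_mul (hk1 x) (abs_ip_le _ _) (norm_nonneg _) zero_le_one
  simpa using this

/-- Virial (Morawetz) estimate over a time interval. -/
lemma morawetz_bound {a b : ℝ} (hab : a ≤ b) {v : ℝ × E → ℂ} {d : ι → E} {m : J → E}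
    (hv : VNice a b d m v) {κ : J → E → ℝ} (hκ1 : ∀ j x, |κ j x| ≤ 1)
    {K : ι → J → E → ℝ} {Kd : J → E → ℝ} {β' : ι → E → ℝ}
    (hK : ∀ i j, Ker (d i) (κ j) (K i j)) (hKd : ∀ j, Ker (m j) (κ j) (Kd j))
    (hβ : ∀ i, Ker (d i) (fun x => ∑ j, Kd j x) (β' i)) (c : ℝ)
    {A0 A1 : ℝ} (hA0 : 0 ≤ A0) (hA1 : 0 ≤ A1) {l : ℝ → ℝ} (hl : IntervalIntegrable l volume a b)
    (hl0 : ∀ t, 0 ≤ l t)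
    (q0 : ∀ t ∈ Icc a b, LB (sl v t) A0) (q1 : ∀ t ∈ Icc a b, ∀ j, LB (sl (sd (m j) v) t) A1)
    (q2 : ∀ t ∈ Icc a b, LB (sl (src c d v) t) (A0 * l t))
    (q3 : ∀ t ∈ Icc a b, ∀ j, LB (sl (sd (m j) (src c d v)) t) (A1 * l t))
    {P : ℝ → ℝ} (hP : ∀ t, P t = c * (2 * ∑ i, ∑ j, (∫ x, K i j x * ip (sd (d i) v (t, x))
      (sd (m j) v (t, x))) + ∑ i, ∫ x, β' i x * ip (v (t, x)) (sd (d i) v (t, x)))) :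
    IntervalIntegrable P volume a b ∧
      ∫ t in a..b, P t ≤ Fintype.card J * (A0 * A1) * (2 + 2 * ∫ t in a..b, l t) := by
  have sv := hv.sm
  obtain ⟨C, hC0, hC⟩ := hv.bdd
  set F := src c d v with hF
  have sF : Sm F := sv.src c d
  have cκ : ∀ j, Continuous (κ j) := fun j => (hKd j).cont
  -- derivative of the virial functional
  let H : J → ℝ × E → ℝ := fun j p => κ j p.2 * ip (Complex.I * v p) (sd (m j) v p)
  let H1 : J → ℝ × E → ℝ := fun j p => κ j p.2 * ip (Complex.I * td v p) (sd (m j) v p)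
  let H2 : J → ℝ × E → ℝ := fun j p => κ j p.2 * ip (Complex.I * v p) (sd (m j) (td v) p)
  let R1 : J → ℝ × E → ℝ := fun j p => κ j p.2 * ip (F p) (sd (m j) v p)
  let R2 : J → ℝ × E → ℝ := fun j p => κ j p.2 * ip (v p) (sd (m j) F p)
  have lbI : ∀ {f : E → ℂ} {A : ℝ}, LB f A → LB (fun x => Complex.I * f x) A := fun h => by
    simpa using h.const_mul Complex.I
  have cont : ∀ j {f g : ℝ × E → ℂ}, Sm f → Sm g → Continuous fun p : ℝ × E =>
      κ j p.2 * ip (f p) (g p) := fun j f g hf hg =>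
    ((cκ j).comp continuous_snd).mul (hf.continuous.inner hg.continuous)
  have b1 : ∀ t ∈ Icc a b, ∀ j, _ := fun t ht j =>
    LB.ip_bound (lbI (hC t ht).2.1) ((hC t ht).2.2.1 j) hC0 hC0 (cκ j) (hκ1 j)
  have b2 : ∀ t ∈ Icc a b, ∀ j, _ := fun t ht j =>
    LB.ip_bound (lbI (hC t ht).1) ((hC t ht).2.2.2.1 j) hC0 hC0 (cκ j) (hκ1 j)
  have lbF : ∀ t ∈ Icc a b, LB (sl F t) (C + |c| * (Fintype.card ι * C)) := fun t ht => by
    have h1 := LB.sum Finset.univ (fun i => sl (sd (d i) (sd (d i) v)) t) (fun _ => C)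
      (fun i _ => (hC t ht).2.2.2.2.2.1 i) (fun _ _ => hC0)
    have h2 := (lbI (hC t ht).2.1).add (h1.const_mul (c : ℂ)) hC0 (by
      simp only [Finset.sum_const]; positivity)
    have e : sl F t = fun x => Complex.I * sl (td v) t x +
        (c : ℂ) * ∑ i, sl (sd (d i) (sd (d i) v)) t x := rfl
    rw [e]
    simpa using h2
  have lbFj : ∀ t ∈ Icc a b, ∀ j, LB (sl (sd (m j) F) t) (C + |c| * (Fintype.card ι * C)) := by
    intro t ht j
    have h1 := LB.sum Finset.univ (fun i => sl (sd (m j) (sd (d i) (sd (d i) v))) t) (fun _ => C)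
      (fun i _ => (hC t ht).2.2.2.2.2.2.2 i j) (fun _ _ => hC0)
    have h2 := (lbI ((hC t ht).2.2.2.1 j)).add (h1.const_mul (c : ℂ)) hC0 (by
      simp only [Finset.sum_const]; positivity)
    have e : sl (sd (m j) F) t = fun x => Complex.I * sl (sd (m j) (td v)) t x +
        (c : ℂ) * ∑ i, sl (sd (m j) (sd (d i) (sd (d i) v))) t x := by
      rw [hF, dd_src sv]
      funext x
      simp only [sl, src]
      simp only [← sd_td sv (m j), sd_sd (sv.dd (0, d _)) (m j), sd_sd sv (m j)]
    rw [e]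
    simpa using h2
  have hC1 : 0 ≤ C + |c| * (Fintype.card ι * C) := by positivity
  have b3 : ∀ t ∈ Icc a b, ∀ j, _ := fun t ht j =>
    LB.ip_bound (lbF t ht) ((hC t ht).2.2.1 j) hC1 hC0 (cκ j) (hκ1 j)
  have b4 : ∀ t ∈ Icc a b, ∀ j, _ := fun t ht j =>
    LB.ip_bound (hC t ht).1 (lbFj t ht j) hC0 hC1 (cκ j) (hκ1 j)
  have b5 : ∀ t ∈ Icc a b, ∀ j, _ := fun t ht j =>
    LB.ip_bound (q2 t ht) (q1 t ht j) (mul_nonneg hA0 (hl0 t)) hA1 (cκ j) (hκ1 j)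
  have b6 : ∀ t ∈ Icc a b, ∀ j, _ := fun t ht j =>
    LB.ip_bound (q0 t ht) (q3 t ht j) hA0 (mul_nonneg hA1 (hl0 t)) (cκ j) (hκ1 j)
  have b7 : ∀ t ∈ Icc a b, ∀ j, _ := fun t ht j =>
    LB.ip_bound (lbI (q0 t ht)) (q1 t ht j) hA0 hA1 (cκ j) (hκ1 j)
  have sI : ∀ {f : ℝ × E → ℂ}, Sm f → Sm fun p => Complex.I * f p := fun h => h.const_mul _
  have ii1 : ∀ j, IntervalIntegrable (fun t => ∫ x, H1 j (t, x)) volume a b := fun j =>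
    intervalIntegrable_of_bound hab (cont j (sI (sv.dd _)) (sv.dd _)) (fun t ht => (b1 t ht j).1)
      (fun t ht => (b1 t ht j).2.2)
  have ii2 : ∀ j, IntervalIntegrable (fun t => ∫ x, H2 j (t, x)) volume a b := fun j =>
    intervalIntegrable_of_bound hab (cont j (sI sv) ((sv.dd _).dd _)) (fun t ht => (b2 t ht j).1)
      (fun t ht => (b2 t ht j).2.2)
  have ii3 : ∀ j, IntervalIntegrable (fun t => ∫ x, R1 j (t, x)) volume a b := fun j =>
    intervalIntegrable_of_bound hab (cont j sF (sv.dd _)) (fun t ht => (b3 t ht j).1)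
      (fun t ht => (b3 t ht j).2.2)
  have ii4 : ∀ j, IntervalIntegrable (fun t => ∫ x, R2 j (t, x)) volume a b := fun j =>
    intervalIntegrable_of_bound hab (cont j sv (sF.dd _)) (fun t ht => (b4 t ht j).1)
      (fun t ht => (b4 t ht j).2.2)
  have ftc : ∀ j, (∫ x, H j (b, x)) - (∫ x, H j (a, x)) =
      (∫ t in a..b, ∫ x, H1 j (t, x)) + ∫ t in a..b, ∫ x, H2 j (t, x) := by
    intro j
    rw [← intervalIntegral.integral_add (ii1 j) (ii2 j)]
    rw [time_ftc (C := C * C + C * C) hab (H := H j) (H' := fun p => H1 j p + H2 j p)]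
    · refine intervalIntegral.integral_congr fun t ht => ?_
      rw [uIcc_of_le hab] at ht
      exact integral_add (b1 t ht j).1 (b2 t ht j).1
    · exact (cont j (sI (sv.dd _)) (sv.dd _)).add (cont j (sI sv) ((sv.dd _).dd _))
    · intro t x
      have h1 := (HasDerivAt.inner ℝ ((sv.hasDerivAt_time t x).const_mul Complex.I)
        ((sv.dd (0, m j)).hasDerivAt_time t x)).const_mul (κ j x)
      simp only [H, H1, H2]
      rw [← mul_add, add_comm, sd_td sv]
      exact h1
    · exact fun t ht => (b7 t ht j).1
    · exact fun t ht => (b1 t ht j).1.add (b2 t ht j).1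
    · intro t ht
      refine (integral_mono ((b1 t ht j).1.add (b2 t ht j).1).norm
        ((b1 t ht j).1.norm.add (b2 t ht j).1.norm) fun x => norm_add_le _ _).trans ?_
      rw [integral_add' (b1 t ht j).1.norm (b2 t ht j).1.norm]
      exact add_le_add (b1 t ht j).2.2 (b2 t ht j).2.2
  have key : ∀ t ∈ Icc a b, P t = ∑ j, ((∫ x, H1 j (t, x)) + (∫ x, H2 j (t, x)) -
      (∫ x, R1 j (t, x)) + ∫ x, R2 j (t, x)) := by
    intro t ht
    have sl0 := sv.sl t
    have hL : lapd d (sl v t) = sl (fun p => ∑ i, sd (d i) (sd (d i) v) p) t := lapd_sl sv d t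
    have sL : Sm (fun p => ∑ i, sd (d i) (sd (d i) v) p) := Sm.sum fun i _ => (sv.dd _).dd _
    have hLj : ∀ j, dd (m j) (lapd d (sl v t)) =
        fun x => ∑ i, sd (m j) (sd (d i) (sd (d i) v)) (t, x) := fun j => by
      rw [hL, dd_sl sL, sd, dd_sum fun i _ => (sv.dd _).dd _]; rfl
    have m2Lj : ∀ j, M2 (dd (m j) (lapd d (sl v t))) := fun j => by
      rw [hLj]; exact M2.sum fun i _ => ((hC t ht).2.2.2.2.2.2.2 i j).m2
    have m2L : M2 (lapd d (sl v t)) := by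
      rw [hL]; exact M2.sum fun i _ => ((hC t ht).2.2.2.2.2.1 i).m2
    have vir := virial_identity sl0 hK hKd hβ (hC t ht).1.m2
      (fun j => by rw [dd_sl sv]; exact ((hC t ht).2.2.1 j).m2)
      (fun i => by rw [dd_sl sv]; exact ((hC t ht).2.2.2.2.1 i).m2)
      (fun i => by rw [dd_sl sv, dd_sl (sv.dd _)]; exact ((hC t ht).2.2.2.2.2.1 i).m2)
      (fun i j => by rw [dd_sl sv, dd_sl (sv.dd _)]; exact ((hC t ht).2.2.2.2.2.2.1 i j).m2) m2Lj
    have e1 : P t = c * ∑ j, ((∫ x, κ j x * ip (sl v t x) (dd (m j) (lapd d (sl v t)) x)) -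
        ∫ x, κ j x * ip (lapd d (sl v t) x) (dd (m j) (sl v t) x)) := by
      rw [vir, hP]
      simp_rw [dd_sl sv]
      rfl
    rw [e1, Finset.mul_sum]
    refine Finset.sum_congr rfl fun j _ => ?_
    obtain ⟨B, hB⟩ := (hKd j).bdd
    have i5 := (hC t ht).1.m2.integrable_ip (m2Lj j) (cκ j) hB
    have i6 := m2L.integrable_ip ((hC t ht).2.2.1 j).m2 (cκ j) hB
    have i1 : Integrable fun x => H1 j (t, x) := (b1 t ht j).1
    have i2 : Integrable fun x => H2 j (t, x) := (b2 t ht j).1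
    have i3 : Integrable fun x => R1 j (t, x) := (b3 t ht j).1
    have i4 : Integrable fun x => R2 j (t, x) := (b4 t ht j).1
    rw [dd_sl sv]
    have i12 : Integrable fun x => H1 j (t, x) + H2 j (t, x) := i1.add i2
    have i123 : Integrable fun x => H1 j (t, x) + H2 j (t, x) - R1 j (t, x) := i12.sub i3
    rw [← integral_add i1 i2, ← integral_sub i12 i3, ← integral_add i123 i4]
    rw [← integral_sub i5 i6, ← integral_const_mul]
    refine integral_congr_ae (Filter.Eventually.of_forall fun x => ?_)
    have eF : F (t, x) = Complex.I * td v (t, x) + (c : ℂ) * lapd d (sl v t) x := by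
      rw [hL]; rfl
    have eFj : sd (m j) F (t, x) = Complex.I * sd (m j) (td v) (t, x) +
        (c : ℂ) * dd (m j) (lapd d (sl v t)) x := by
      rw [hF, dd_src sv, hLj]
      simp only [src]
      simp only [← sd_td sv (m j), sd_sd (sv.dd (0, d _)) (m j), sd_sd sv (m j)]
    simp only [Pi.add_apply, Pi.sub_apply, sl, ← eF, eFj, H1, H2, R1, R2]
    rw [eF, ip_I_mul (v (t, x))]
    simp only [ip, inner_add_left, inner_add_right, sl]
    have r1 : ∀ z w : ℂ, inner ℝ ((c : ℂ) * z) w = c * inner ℝ z w := fun z w => by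
      rw [← Complex.real_smul, real_inner_smul_left]
    have r2 : ∀ z w : ℂ, inner ℝ w ((c : ℂ) * z) = c * inner ℝ w z := fun z w => by
      rw [← Complex.real_smul, real_inner_smul_right]
    rw [r1, r2]
    ring
  have iP : IntervalIntegrable (fun t => ∑ j, ((∫ x, H1 j (t, x)) + (∫ x, H2 j (t, x)) -
      (∫ x, R1 j (t, x)) + ∫ x, R2 j (t, x))) volume a b := by
    have := IntervalIntegrable.sum (μ := volume) (a := a) (b := b) Finset.univ
      (f := fun j t => (∫ x, H1 j (t, x)) + (∫ x, H2 j (t, x)) -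
      (∫ x, R1 j (t, x)) + ∫ x, R2 j (t, x)) fun j _ =>
      (((ii1 j).add (ii2 j)).sub (ii3 j)).add (ii4 j)
    have e : (fun t => ∑ j, ((∫ x, H1 j (t, x)) + (∫ x, H2 j (t, x)) -
      (∫ x, R1 j (t, x)) + ∫ x, R2 j (t, x))) = ∑ j, fun t => (∫ x, H1 j (t, x)) +
      (∫ x, H2 j (t, x)) - (∫ x, R1 j (t, x)) + ∫ x, R2 j (t, x) := by
      funext t; simp
    rw [e]
    exact this
  have eqP : EqOn (fun t => ∑ j, ((∫ x, H1 j (t, x)) + (∫ x, H2 j (t, x)) -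
      (∫ x, R1 j (t, x)) + ∫ x, R2 j (t, x))) P (uIcc a b) := fun t ht => by
    rw [uIcc_of_le hab] at ht
    exact (key t ht).symm
  refine ⟨iP.congr (eqP.mono uIoc_subset_uIcc), ?_⟩
  rw [← intervalIntegral.integral_congr eqP, intervalIntegral.integral_finsetSum fun j _ =>
      (((ii1 j).add (ii2 j)).sub (ii3 j)).add (ii4 j)]
  have each : ∀ j, ∫ t in a..b, ((∫ x, H1 j (t, x)) + (∫ x, H2 j (t, x)) -
      (∫ x, R1 j (t, x)) + ∫ x, R2 j (t, x)) ≤ (A0 * A1) * (2 + 2 * ∫ t in a..b, l t) := by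
    intro j
    have hR : ∫ t in a..b, (-(∫ x, R1 j (t, x)) + ∫ x, R2 j (t, x)) ≤
        ∫ t in a..b, 2 * (A0 * A1) * l t := by
      refine intervalIntegral.integral_mono_on hab ((ii3 j).neg.add (ii4 j)) (hl.const_mul _) ?_
      intro t ht
      have h1 := (abs_le.1 (b5 t ht j).2.1).1
      have h2 := (abs_le.1 (b6 t ht j).2.1).2
      simp only [sl] at h1 h2
      simp only [R1, R2]
      linarith
    rw [intervalIntegral.integral_const_mul] at hR
    have hs : ∫ t in a..b, ((∫ x, H1 j (t, x)) + (∫ x, H2 j (t, x)) -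
      (∫ x, R1 j (t, x)) + ∫ x, R2 j (t, x)) = (∫ t in a..b, ∫ x, H1 j (t, x)) +
        (∫ t in a..b, ∫ x, H2 j (t, x)) +
        ∫ t in a..b, (-(∫ x, R1 j (t, x)) + ∫ x, R2 j (t, x)) := by
      have i34 : IntervalIntegrable (fun t => -(∫ x, R1 j (t, x)) + ∫ x, R2 j (t, x))
        volume a b := (ii3 j).neg.add (ii4 j)
      rw [← intervalIntegral.integral_add (ii1 j) (ii2 j), ← intervalIntegral.integral_add
        ((ii1 j).add (ii2 j)) i34]
      refine intervalIntegral.integral_congr fun t _ => ?_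
      ring
    have h3 := (abs_le.1 (b7 b (right_mem_Icc.2 hab) j).2.1).2
    have h4 := (abs_le.1 (b7 a (left_mem_Icc.2 hab) j).2.1).1
    have h5 := ftc j
    simp only [sl] at h3 h4
    simp only [H] at h5
    rw [hs]
    linarith
  calc _ ≤ ∑ j : J, (A0 * A1) * (2 + 2 * ∫ t in a..b, l t) := Finset.sum_le_sum fun j _ => each j
    _ = _ := by simp; ring

end Morawetz

section kernels

lemma Ker.congr {E : Type*} [NormedAddCommGroup E] [NormedSpace ℝ E] {v : E} {k k' l l' : E → ℝ}
    (hk : Ker v k k') (h : ∀ x, k x = l x) (h' : ∀ x, k' x = l' x) : Ker v l l' := by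
  obtain rfl : k = l := funext h
  obtain rfl : k' = l' := funext h'
  exact hk

lemma Ker.mul {E : Type*} [NormedAddCommGroup E] [NormedSpace ℝ E] {v : E} {k k' l l' : E → ℝ}
    (hk : Ker v k k') (hl : Ker v l l') :
    Ker v (fun x => k x * l x) (fun x => k' x * l x + k x * l' x) := by
  obtain ⟨A, hA⟩ := hk.bdd
  obtain ⟨A', hA'⟩ := hk.bdd'
  obtain ⟨B, hB⟩ := hl.bdd
  obtain ⟨B', hB'⟩ := hl.bdd'
  refine ⟨hk.cont.mul hl.cont, (hk.cont'.mul hl.cont).add (hk.cont.mul hl.cont'), ⟨A * B, fun x => ?_⟩,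
    ⟨A' * B + A * B', fun x => (abs_add_le _ _).trans (add_le_add ?_ ?_)⟩, fun x => ?_⟩
  · rw [abs_mul]; exact mul_le_mul (hA x) (hB x) (abs_nonneg _) ((abs_nonneg _).trans (hA x))
  · rw [abs_mul]; exact mul_le_mul (hA' x) (hB x) (abs_nonneg _) ((abs_nonneg _).trans (hA' x))
  · rw [abs_mul]; exact mul_le_mul (hA x) (hB' x) (abs_nonneg _) ((abs_nonneg _).trans (hA x))
  · have := HasDerivAt.mul (hk.deriv x) (hl.deriv x)
    exact HasDerivAt.congr_deriv this (by simp)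

lemma Ker.const {E : Type*} [NormedAddCommGroup E] [NormedSpace ℝ E] (v : E) (c : ℝ) :
    Ker v (fun _ => c) (fun _ => 0) :=
  ⟨continuous_const, continuous_const, ⟨|c|, fun _ => le_rfl⟩, ⟨|0|, fun _ => le_rfl⟩,
    fun x => hasDerivAt_const _ _⟩

lemma Ker.diff {E : Type*} [NormedAddCommGroup E] [NormedSpace ℝ E] {v : E} {k k' : E → ℝ}
    (hk : Ker v k k') {a b : E} {c : ℝ} (h : a - b = c • v) :
    Ker (a, b) (fun z : E × E => k (z.1 - z.2)) (fun z => c * k' (z.1 - z.2)) := by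
  have hc : Continuous fun z : E × E => z.1 - z.2 := continuous_fst.sub continuous_snd
  obtain ⟨A, hA⟩ := hk.bdd
  obtain ⟨A', hA'⟩ := hk.bdd'
  refine ⟨hk.cont.comp hc, continuous_const.mul (hk.cont'.comp hc), ⟨A, fun z => hA _⟩,
    ⟨|c| * A', fun z => ?_⟩, fun z => ?_⟩
  · rw [abs_mul]; exact mul_le_mul_of_nonneg_left (hA' _) (abs_nonneg c)
  · have := (hk.deriv (z.1 - z.2)).smul c
    rw [← h] at this
    unfold HasLineDerivAt at this ⊢
    refine (HasDerivAt.congr_deriv this (smul_eq_mul _ _)).congr_of_eventuallyEq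
      (Filter.Eventually.of_forall fun t => ?_)
    simp only [Prod.fst_add, Prod.snd_add, Prod.smul_fst, Prod.smul_snd, smul_sub]
    congr 1
    abel

variable (θ : Fin 3 → ℝ) (h : ℝ)

/-- Reciprocal of the regularised (partial) distance `√(h² + ∑ θ_k z_k²)`. -/
def kg (z : E3) : ℝ := (√(h ^ 2 + ∑ k, θ k * z k ^ 2))⁻¹

/-- Components of the gradient of the regularised distance. -/
def kk (j : Fin 3) (z : E3) : ℝ := θ j * z j * kg θ h z

variable {θ h}

lemma theta_nonneg (hθ : ∀ j, θ j * θ j = θ j) (j : Fin 3) : 0 ≤ θ j := by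
  rw [← hθ j]; exact mul_self_nonneg _

lemma q_pos (hh : 0 < h) (hθ : ∀ j, θ j * θ j = θ j) (z : E3) :
    0 < h ^ 2 + ∑ k, θ k * z k ^ 2 :=
  add_pos_of_pos_of_nonneg (by positivity)
    (Finset.sum_nonneg fun k _ => mul_nonneg (theta_nonneg hθ k) (sq_nonneg _))

lemma kg_pos (hh : 0 < h) (hθ : ∀ j, θ j * θ j = θ j) (z : E3) : 0 < kg θ h z :=
  inv_pos.2 (Real.sqrt_pos.2 (q_pos hh hθ z))

lemma kg_sq (hh : 0 < h) (hθ : ∀ j, θ j * θ j = θ j) (z : E3) :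
    kg θ h z ^ 2 * (h ^ 2 + ∑ k, θ k * z k ^ 2) = 1 := by
  rw [kg, inv_pow, Real.sq_sqrt (q_pos hh hθ z).le, inv_mul_cancel₀ (q_pos hh hθ z).ne']

lemma sum_kk_sq (hh : 0 < h) (hθ : ∀ j, θ j * θ j = θ j) (z : E3) :
    ∑ k, kk θ h k z ^ 2 = 1 - h ^ 2 * kg θ h z ^ 2 := by
  have h1 := kg_sq hh hθ z
  have h2 : ∀ k, kk θ h k z ^ 2 = kg θ h z ^ 2 * (θ k * z k ^ 2) := fun k => by
    unfold kk; linear_combination (z k ^ 2 * kg θ h z ^ 2) * hθ k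
  simp_rw [h2, ← Finset.mul_sum]
  linarith

lemma abs_kk_le (hh : 0 < h) (hθ : ∀ j, θ j * θ j = θ j) (j : Fin 3) (z : E3) :
    |kk θ h j z| ≤ 1 := by
  rw [← sq_le_one_iff_abs_le_one]
  refine (Finset.single_le_sum (f := fun k => kk θ h k z ^ 2) (fun k _ => sq_nonneg _)
    (Finset.mem_univ j)).trans ?_
  rw [sum_kk_sq hh hθ]
  nlinarith [sq_nonneg (h * kg θ h z)]

lemma kg_le (hh : 0 < h) (hθ : ∀ j, θ j * θ j = θ j) (z : E3) : kg θ h z ≤ h⁻¹ := by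
  refine inv_anti₀ hh (Real.le_sqrt_of_sq_le ?_)
  have := Finset.sum_nonneg fun k (_ : k ∈ Finset.univ) =>
    mul_nonneg (theta_nonneg hθ k) (sq_nonneg (z k))
  linarith

lemma continuous_kg (hh : 0 < h) (hθ : ∀ j, θ j * θ j = θ j) : Continuous (kg θ h) := by
  refine Continuous.inv₀ (Real.continuous_sqrt.comp ?_) fun z => (Real.sqrt_pos.2 (q_pos hh hθ z)).ne'
  fun_prop

lemma continuous_kk (hh : 0 < h) (hθ : ∀ j, θ j * θ j = θ j) (j : Fin 3) :
    Continuous (kk θ h j) := by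
  have := continuous_kg hh hθ
  unfold kk
  fun_prop

lemma hasLineDerivAt_coord (i j : Fin 3) (z : E3) :
    HasLineDerivAt ℝ (fun z : E3 => z j) (if i = j then 1 else 0) z (e3 i) := by
  have h1 : (fun t : ℝ => (z + t • e3 i) j) = fun t => z j + t * (if i = j then 1 else 0) := by
    funext t
    simp [e3, EuclideanSpace.single_apply, eq_comm]
  unfold HasLineDerivAt
  rw [h1]
  simpa using ((hasDerivAt_id (0 : ℝ)).mul_const (if i = j then (1 : ℝ) else 0)).const_add (z j)

lemma ker_kg (hh : 0 < h) (hθ : ∀ j, θ j * θ j = θ j) (i : Fin 3) :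
    Ker (e3 i) (kg θ h) (fun z => -(kk θ h i z * kg θ h z ^ 2)) := by
  have c1 := continuous_kg hh hθ
  have c2 := continuous_kk hh hθ i
  have hb : ∀ z, |kg θ h z| ≤ h⁻¹ := fun z => by
    rw [abs_of_pos (kg_pos hh hθ z)]; exact kg_le hh hθ z
  refine ⟨c1, by fun_prop, ⟨h⁻¹, hb⟩, ⟨1 * h⁻¹ ^ 2, fun z => ?_⟩, fun z => ?_⟩
  · rw [abs_neg, abs_mul, abs_pow]
    exact mul_le_mul (abs_kk_le hh hθ i z) (pow_le_pow_left₀ (abs_nonneg _) (hb z) 2)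
      (by positivity) zero_le_one
  · have hq : HasDerivAt (fun t : ℝ => h ^ 2 + ∑ k, θ k * (z + t • e3 i) k ^ 2)
        (2 * θ i * z i) 0 := by
      have := (HasDerivAt.fun_sum (u := Finset.univ) fun k _ =>
        (((hasLineDerivAt_coord i k z : HasDerivAt _ _ _).fun_pow 2).const_mul (θ k))).const_add (h ^ 2)
      refine this.congr_deriv ?_
      simp
      ring
    have h0 : h ^ 2 + ∑ k, θ k * (z + (0 : ℝ) • e3 i) k ^ 2 = h ^ 2 + ∑ k, θ k * z k ^ 2 := by simp
    have hp := q_pos hh hθ z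
    have hs := (hq.sqrt (by rw [h0]; exact hp.ne')).fun_inv
      (by rw [h0]; exact (Real.sqrt_pos.2 hp).ne')
    refine hs.congr_deriv ?_
    rw [h0, kk, kg]
    have := (Real.sqrt_pos.2 hp).ne'
    field_simp

lemma ker_kk (hh : 0 < h) (hθ : ∀ j, θ j * θ j = θ j) (i j : Fin 3) :
    Ker (e3 i) (kk θ h j)
      (fun z => ((if i = j then θ j else 0) - kk θ h i z * kk θ h j z) * kg θ h z) := by
  have c1 := continuous_kg hh hθ
  have c2 := continuous_kk hh hθ i
  have c3 := continuous_kk hh hθ j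
  refine ⟨c3, by fun_prop, ⟨1, abs_kk_le hh hθ j⟩, ⟨(|if i = j then θ j else 0| + 1 * 1) * h⁻¹,
    fun z => ?_⟩, fun z => ?_⟩
  · rw [abs_mul, abs_of_pos (kg_pos hh hθ z)]
    refine mul_le_mul ((abs_sub _ _).trans (add_le_add le_rfl ?_)) (kg_le hh hθ z)
      (kg_pos hh hθ z).le (by positivity)
    rw [abs_mul]
    exact mul_le_mul (abs_kk_le hh hθ i z) (abs_kk_le hh hθ j z) (abs_nonneg _) zero_le_one
  · have h1 := ((hasLineDerivAt_coord i j z : HasDerivAt _ _ _).const_mul (θ j)).fun_mul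
      ((ker_kg hh hθ i).deriv z)
    refine HasDerivAt.congr_deriv h1 ?_
    simp only [zero_smul, add_zero, kk]
    split_ifs <;> ring

end kernels

section kernels2
variable (θ : Fin 3 → ℝ) (h : ℝ)

/-- Hessian of the regularised distance. -/
def k2 (i j : Fin 3) (z : E3) : ℝ :=
  ((if i = j then θ j else 0) - kk θ h i z * kk θ h j z) * kg θ h z

/-- Laplacian of the regularised distance. -/
def kb (z : E3) : ℝ := (∑ j, θ j - 1) * kg θ h z + h ^ 2 * kg θ h z ^ 3

/-- Gradient of `kb`. -/
def kb1 (i : Fin 3) (z : E3) : ℝ :=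
  -((∑ j, θ j - 1) * (kk θ h i z * kg θ h z ^ 2) + 3 * h ^ 2 * (kk θ h i z * kg θ h z ^ 4))

/-- Diagonal second derivatives of `kb`. -/
def kb2 (i : Fin 3) (z : E3) : ℝ :=
  -((θ i - kk θ h i z ^ 2) *
      ((∑ j, θ j - 1) * kg θ h z ^ 3 + 3 * h ^ 2 * kg θ h z ^ 5)) +
    kk θ h i z ^ 2 * (2 * (∑ j, θ j - 1) * kg θ h z ^ 3 + 12 * h ^ 2 * kg θ h z ^ 5)

variable {θ h}

lemma ker_k2 (hh : 0 < h) (hθ : ∀ j, θ j * θ j = θ j) (i j : Fin 3) :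
    Ker (e3 i) (kk θ h j) (k2 θ h i j) := ker_kk hh hθ i j

lemma sum_k2 (hh : 0 < h) (hθ : ∀ j, θ j * θ j = θ j) (z : E3) :
    ∑ j, k2 θ h j j z = kb θ h z := by
  have := sum_kk_sq hh hθ z
  have e : ∑ j, k2 θ h j j z = (∑ j, θ j - ∑ j, kk θ h j z ^ 2) * kg θ h z := by
    rw [← Finset.sum_sub_distrib, Finset.sum_mul]
    simp [k2, sq]
  rw [e, this, kb]
  ring

lemma ker_kb (hh : 0 < h) (hθ : ∀ j, θ j * θ j = θ j) (i : Fin 3) :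
    Ker (e3 i) (kb θ h) (kb1 θ h i) := by
  have g := ker_kg hh hθ i
  have := Ker.sum (s := Finset.univ) (k := ![fun z => (∑ j, θ j - 1) * kg θ h z,
    fun z => h ^ 2 * (kg θ h z * (kg θ h z * kg θ h z))]) (k' := ![_, _]) (v := e3 i) fun j _ => by
      fin_cases j
      · exact (Ker.const _ _).mul g
      · exact (Ker.const _ _).mul (g.mul (g.mul g))
  refine this.congr (fun z => ?_) (fun z => ?_)
  · simp only [Fin.sum_univ_two, Matrix.cons_val_zero, Matrix.cons_val_one, kb]; ring
  · simp [kb1]; ring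

lemma ker_kb1 (hh : 0 < h) (hθ : ∀ j, θ j * θ j = θ j) (i : Fin 3) :
    Ker (e3 i) (kb1 θ h i) (kb2 θ h i) := by
  have g := ker_kg hh hθ i
  have k := ker_kk hh hθ i i
  have := Ker.sum (s := Finset.univ) (k := ![fun z => -(∑ j, θ j - 1) * (kk θ h i z *
      (kg θ h z * kg θ h z)), fun z => -(3 * h ^ 2) * (kk θ h i z * ((kg θ h z * kg θ h z) *
      (kg θ h z * kg θ h z)))]) (k' := ![_, _]) (v := e3 i) fun j _ => by
      fin_cases j
      · exact (Ker.const _ _).mul (k.mul (g.mul g))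
      · exact (Ker.const _ _).mul (k.mul ((g.mul g).mul (g.mul g)))
  refine this.congr (fun z => ?_) (fun z => ?_)
  · simp [kb1]; ring
  · simp [kb2]; ring

lemma sum_kb2 (hh : 0 < h) (z : E3) :
    ∑ i, kb2 (fun _ => 1) h i z = -(15 * h ^ 4 * kg (fun _ => 1) h z ^ 7) := by
  have := sum_kk_sq (θ := fun _ => 1) hh (by simp) z
  have e : ∑ i, kb2 (fun _ => 1) h i z =
      -((3 - ∑ i, kk (fun _ => 1) h i z ^ 2) *
      (2 * kg (fun _ => 1) h z ^ 3 + 3 * h ^ 2 * kg (fun _ => 1) h z ^ 5)) +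
    (∑ i, kk (fun _ => 1) h i z ^ 2) *
      (2 * 2 * kg (fun _ => 1) h z ^ 3 + 12 * h ^ 2 * kg (fun _ => 1) h z ^ 5) := by
    simp only [kb2, Fin.sum_univ_three]
    ring
  rw [e, this]
  ring

lemma k2_quad_nonneg (hh : 0 < h) (z : E3) (ξ : Fin 3 → ℂ) :
    0 ≤ ∑ i, ∑ j, k2 (fun _ => 1) h i j z * ip (ξ i) (ξ j) := by
  have hs := sum_kk_sq (θ := fun _ => 1) hh (by simp) z
  have hg := kg_pos (θ := fun _ => 1) hh (by simp) z
  set κ := fun i => kk (fun _ => 1) h i z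
  have e : ∑ i, ∑ j, k2 (fun _ => 1) h i j z * ip (ξ i) (ξ j) = kg (fun _ => 1) h z *
      ((∑ i, (ξ i).re ^ 2) - (∑ i, κ i * (ξ i).re) ^ 2 +
        ((∑ i, (ξ i).im ^ 2) - (∑ i, κ i * (ξ i).im) ^ 2)) := by
    simp only [k2, ip_eq, Fin.sum_univ_three, κ]
    simp
    ring
  have hk : ∑ i, κ i ^ 2 ≤ 1 := by
    rw [hs]; nlinarith [sq_nonneg (h * kg (fun _ => 1) h z)]
  have cs : ∀ y : Fin 3 → ℝ, (∑ i, κ i * y i) ^ 2 ≤ ∑ i, y i ^ 2 := fun y => by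
    have h1 := Finset.sum_mul_sq_le_sq_mul_sq Finset.univ κ y
    have h2 : 0 ≤ ∑ i, y i ^ 2 := Finset.sum_nonneg fun i _ => sq_nonneg _
    nlinarith
  rw [e]
  have h1 := cs fun i => (ξ i).re
  have h2 := cs fun i => (ξ i).im
  exact mul_nonneg hg.le (by linarith)

end kernels2

section tensor

abbrev E6 := E3 × E3

/-- Tensor product of two functions on space-time. -/
def tens (w p : ℝ × E3 → ℂ) : ℝ × E6 → ℂ := fun q => w (q.1, q.2.1) * p (q.1, q.2.2)

variable {w p : ℝ × E3 → ℂ}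

lemma Sm.tens (hw : Sm w) (hp : Sm p) : Sm (tens w p) :=
  (ContDiff.comp hw (contDiff_fst.prodMk (contDiff_fst.comp contDiff_snd))).mul
    (ContDiff.comp hp (contDiff_fst.prodMk (contDiff_snd.comp contDiff_snd)))

lemma dd_tens (hw : Sm w) (hp : Sm p) (τ : ℝ) (x y : E3) :
    dd (τ, (x, y)) (tens w p) = fun q => tens (dd (τ, x) w) p q + tens w (dd (τ, y) p) q := by
  funext q
  let L1 : ℝ × E6 →L[ℝ] ℝ × E3 := (ContinuousLinearMap.fst ℝ ℝ E6).prod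
    ((ContinuousLinearMap.fst ℝ E3 E3).comp (ContinuousLinearMap.snd ℝ ℝ E6))
  let L2 : ℝ × E6 →L[ℝ] ℝ × E3 := (ContinuousLinearMap.fst ℝ ℝ E6).prod
    ((ContinuousLinearMap.snd ℝ E3 E3).comp (ContinuousLinearMap.snd ℝ ℝ E6))
  have h1 : HasFDerivAt (fun q => w (L1 q)) _ q :=
    (hw.differentiable (L1 q)).hasFDerivAt.comp q L1.hasFDerivAt
  have h2 : HasFDerivAt (fun q => p (L2 q)) _ q :=
    (hp.differentiable (L2 q)).hasFDerivAt.comp q L2.hasFDerivAt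
  have h3 : fderiv ℝ (tens w p) q = _ := (h1.mul h2).fderiv
  simp only [dd, h3, L1, L2]
  simp [tens, dd]
  ring

/-- Uniform `L²` bound on a time interval. -/
def UB {E : Type*} [NormedAddCommGroup E] [NormedSpace ℝ E] [MeasureSpace E] (a b : ℝ)
    (f : ℝ × E → ℂ) : Prop := ∃ C, 0 ≤ C ∧ ∀ t ∈ Icc a b, LB (sl f t) C

section UB
variable {E : Type*} [NormedAddCommGroup E] [NormedSpace ℝ E] [FiniteDimensional ℝ E]
  [MeasureSpace E] [BorelSpace E] {a b : ℝ} {f g : ℝ × E → ℂ}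

lemma UB.add (hf : UB a b f) (hg : UB a b g) : UB a b fun q => f q + g q := by
  obtain ⟨C, h0, hC⟩ := hf
  obtain ⟨D, g0, hD⟩ := hg
  exact ⟨C + D, by positivity, fun t ht => (hC t ht).add (hD t ht) h0 g0⟩

lemma UB.sub (hf : UB a b f) (hg : UB a b g) : UB a b fun q => f q - g q := by
  obtain ⟨C, h0, hC⟩ := hf
  obtain ⟨D, g0, hD⟩ := hg
  exact ⟨C + D, by positivity, fun t ht => (hC t ht).sub (hD t ht) h0 g0⟩

lemma UB.const_mul (hf : UB a b f) (c : ℂ) : UB a b fun q => c * f q := by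
  obtain ⟨C, h0, hC⟩ := hf
  exact ⟨‖c‖ * C, by positivity, fun t ht => (hC t ht).const_mul c⟩

lemma UB.sum {ι : Type*} {s : Finset ι} {F : ι → ℝ × E → ℂ} (h : ∀ i ∈ s, UB a b (F i)) :
    UB a b fun q => ∑ i ∈ s, F i q := by
  classical
  induction s using Finset.induction_on with
  | empty => exact ⟨0, le_rfl, fun t _ => LB.zero⟩
  | insert i s hi ih =>
    simp_rw [Finset.sum_insert hi]
    exact (h i (Finset.mem_insert_self _ _)).add
      (ih fun j hj => h j (Finset.mem_insert_of_mem hj))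

lemma UB.family {ι : Type*} [Finite ι] {F : ι → ℝ × E → ℂ} (h : ∀ i, UB a b (F i)) :
    ∃ C, 0 ≤ C ∧ ∀ t ∈ Icc a b, ∀ i, LB (sl (F i) t) C := by
  have := Fintype.ofFinite ι
  choose C h0 hC using h
  refine ⟨∑ i, C i, Finset.sum_nonneg fun i _ => h0 i, fun t ht i => (hC i t ht).mono
    (Finset.single_le_sum (fun i _ => h0 i) (Finset.mem_univ i))⟩

end UB

lemma UB.tens {a b : ℝ} (hw : UB a b w) (hp : UB a b p) : UB a b (tens w p) := by
  obtain ⟨C, h0, hC⟩ := hw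
  obtain ⟨D, g0, hD⟩ := hp
  exact ⟨C * D, by positivity, fun t ht => (hC t ht).tensor (hD t ht) h0 g0⟩

/-- Qualitative uniform bounds for a factor of a tensor product. -/
structure WNice (a b : ℝ) (w : ℝ × E3 → ℂ) : Prop where
  sm : Sm w
  u0 : UB a b w
  ut : UB a b (td w)
  u1 : ∀ x, UB a b (sd x w)
  u1t : ∀ x, UB a b (sd x (td w))
  u2 : ∀ x y, UB a b (sd x (sd y w))
  u3 : ∀ x y z, UB a b (sd x (sd y (sd z w)))

lemma VNice.of_UB {E ι J : Type*} [NormedAddCommGroup E] [NormedSpace ℝ E]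
    [FiniteDimensional ℝ E] [MeasureSpace E] [BorelSpace E] [Finite ι] [Finite J] {a b : ℝ}
    {v : ℝ × E → ℂ} {d : ι → E} {m : J → E} (sm : Sm v) (h0 : UB a b v) (ht : UB a b (td v))
    (h1 : ∀ x, UB a b (sd x v)) (h1t : ∀ x, UB a b (sd x (td v)))
    (h2 : ∀ x y, UB a b (sd x (sd y v))) (h3 : ∀ x y z, UB a b (sd x (sd y (sd z v)))) :
    VNice a b d m v := by
  refine ⟨sm, ?_⟩
  obtain ⟨C0, p0, b0⟩ := h0
  obtain ⟨Ct, pt, bt⟩ := ht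
  obtain ⟨Cm, pm, bm⟩ := UB.family fun j => h1 (m j)
  obtain ⟨Cmt, pmt, bmt⟩ := UB.family fun j => h1t (m j)
  obtain ⟨Cd, pd, bd⟩ := UB.family fun i => h1 (d i)
  obtain ⟨Cdd, pdd, bdd⟩ := UB.family fun i => h2 (d i) (d i)
  obtain ⟨Cmd, pmd, bmd⟩ := UB.family fun ij : ι × J => h2 (m ij.2) (d ij.1)
  obtain ⟨Cmdd, pmdd, bmdd⟩ := UB.family fun ij : ι × J => h3 (m ij.2) (d ij.1) (d ij.1)
  refine ⟨C0 + Ct + Cm + Cmt + Cd + Cdd + Cmd + Cmdd, by positivity, fun t ht =>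
    ⟨(b0 t ht).mono (by linarith), (bt t ht).mono (by linarith),
      fun j => (bm t ht j).mono (by linarith), fun j => (bmt t ht j).mono (by linarith),
      fun i => (bd t ht i).mono (by linarith), fun i => (bdd t ht i).mono (by linarith),
      fun i j => (bmd t ht (i, j)).mono (by linarith),
      fun i j => (bmdd t ht (i, j)).mono (by linarith)⟩⟩

lemma sd_tens (hw : Sm w) (hp : Sm p) (x : E6) :
    sd x (tens w p) = fun q => tens (sd x.1 w) p q + tens w (sd x.2 p) q := dd_tens hw hp 0 x.1 x.2

lemma td_tens (hw : Sm w) (hp : Sm p) :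
    td (tens w p) = fun q => tens (td w) p q + tens w (td p) q := dd_tens hw hp 1 0 0

lemma sd_add {E : Type*} [NormedAddCommGroup E] [NormedSpace ℝ E] {f g : ℝ × E → ℂ}
    (hf : Sm f) (hg : Sm g) (v : E) :
    sd v (fun x => f x + g x) = fun x => sd v f x + sd v g x := dd_add hf hg _

lemma sd2_tens (hw : Sm w) (hp : Sm p) (x y : E6) :
    sd x (sd y (tens w p)) = fun q => (tens (sd x.1 (sd y.1 w)) p q + tens (sd y.1 w) (sd x.2 p) q) +
      (tens (sd x.1 w) (sd y.2 p) q + tens w (sd x.2 (sd y.2 p)) q) := by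
  rw [sd_tens hw hp, sd_add (Sm.tens (hw.dd _) hp) (Sm.tens hw (hp.dd _)),
    sd_tens (hw.dd _) hp, sd_tens hw (hp.dd _)]

lemma WNice.tens {a b : ℝ} (hw : WNice a b w) (hp : WNice a b p) {ι J : Type*} [Finite ι]
    [Finite J] (d : ι → E6) (m : J → E6) : VNice a b d m (tens w p) := by
  have sw := hw.sm
  have sp := hp.sm
  refine VNice.of_UB (sw.tens sp) (hw.u0.tens hp.u0) ?_ (fun x => ?_) (fun x => ?_)
    (fun x y => ?_) (fun x y z => ?_)
  · rw [td_tens sw sp]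
    exact (hw.ut.tens hp.u0).add (hw.u0.tens hp.ut)
  · rw [sd_tens sw sp]
    exact ((hw.u1 _).tens hp.u0).add (hw.u0.tens (hp.u1 _))
  · rw [td_tens sw sp, sd_add (Sm.tens (sw.dd _) sp) (Sm.tens sw (sp.dd _)),
      sd_tens (sw.dd _) sp, sd_tens sw (sp.dd _)]
    exact (((hw.u1t _).tens hp.u0).add (hw.ut.tens (hp.u1 _))).add
      (((hw.u1 _).tens hp.ut).add (hw.u0.tens (hp.u1t _)))
  · rw [sd2_tens sw sp]
    exact (((hw.u2 _ _).tens hp.u0).add ((hw.u1 _).tens (hp.u1 _))).add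
      (((hw.u1 _).tens (hp.u1 _)).add (hw.u0.tens (hp.u2 _ _)))
  · rw [sd2_tens sw sp, sd_add ((Sm.tens ((sw.dd _).dd _) sp).add (Sm.tens (sw.dd _) (sp.dd _)))
      ((Sm.tens (sw.dd _) (sp.dd _)).add (Sm.tens sw ((sp.dd _).dd _))),
      sd_add (Sm.tens ((sw.dd _).dd _) sp) (Sm.tens (sw.dd _) (sp.dd _)),
      sd_add (Sm.tens (sw.dd _) (sp.dd _)) (Sm.tens sw ((sp.dd _).dd _)),
      sd_tens ((sw.dd _).dd _) sp, sd_tens (sw.dd _) (sp.dd _), sd_tens (sw.dd _) (sp.dd _),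
      sd_tens sw ((sp.dd _).dd _)]
    exact ((((hw.u3 _ _ _).tens hp.u0).add ((hw.u2 _ _).tens (hp.u1 _))).add
      (((hw.u2 _ _).tens (hp.u1 _)).add ((hw.u1 _).tens (hp.u2 _ _)))).add
      ((((hw.u2 _ _).tens (hp.u1 _)).add ((hw.u1 _).tens (hp.u2 _ _))).add
      (((hw.u1 _).tens (hp.u2 _ _)).add (hw.u0.tens (hp.u3 _ _ _))))

/-- Schrödinger source term on `ℝ³`. -/
abbrev src3 (w : ℝ × E3 → ℂ) : ℝ × E3 → ℂ := src (1 / 2) e3 w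

/-- Difference directions. -/
def dm (j : Fin 3) : E6 := (e3 j, -e3 j)

/-- All directions used for the Laplacian on `ℝ³ × ℝ³`. -/
def dpm : Fin 3 ⊕ Fin 3 → E6 := Sum.elim dm fun j => (e3 j, e3 j)

lemma sd_neg (v : E3) (f : ℝ × E3 → ℂ) : sd (-v) f = fun q => -sd v f q := by
  have : ((0 : ℝ), -v) = -((0 : ℝ), v) := by simp
  rw [sd, this, dd_neg_dir]

lemma sd_negf (v : E3) {f : ℝ × E3 → ℂ} (hf : Sm f) : sd v (fun q => -f q) = fun q => -sd v f q := by
  have := dd_const_mul hf (-1) (0, v)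
  simpa using this

lemma src_tens (hw : Sm w) (hp : Sm p) :
    src (1 / 4) dpm (tens w p) = fun q => tens (src3 w) p q + tens w (src3 p) q := by
  funext q
  simp only [src, Fintype.sum_sum_type, dpm, Sum.elim_inl, Sum.elim_inr, dm, sd2_tens hw hp,
    td_tens hw hp, ← Finset.sum_add_distrib]
  simp only [tens, sd_neg, sd_negf _ (hp.dd _), src3, src]
  simp only [Fin.sum_univ_three]
  push_cast
  ring

end tensor

/-- Quantitative bounds for a factor of a tensor product, `l` being a Gronwall-type weight. -/
structure Num (a b : ℝ) (w : ℝ × E3 → ℂ) (w0 w1 : ℝ) (l : ℝ → ℝ) : Prop where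
  n0 : 0 ≤ w0
  n1 : 0 ≤ w1
  q0 : ∀ t ∈ Icc a b, LB (sl w t) w0
  q1 : ∀ t ∈ Icc a b, ∀ j, LB (sl (sd (e3 j) w) t) w1
  q2 : ∀ t ∈ Icc a b, LB (sl (src3 w) t) (w0 * l t)
  q3 : ∀ t ∈ Icc a b, ∀ j, LB (sl (sd (e3 j) (src3 w)) t) (w1 * l t)

instance : (volume : Measure E6).IsAddHaarMeasure :=
  inferInstanceAs ((volume : Measure E3).prod (volume : Measure E3)).IsAddHaarMeasure

section

variable {w p : ℝ × E3 → ℂ} {a b w0 w1 p0 p1 : ℝ} {l : ℝ → ℝ}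

lemma sd_dm_tens (hw : Sm w) (hp : Sm p) (i : Fin 3) : sd (dm i) (tens w p) =
    fun q => tens (sd (e3 i) w) p q - tens w (sd (e3 i) p) q := by
  rw [sd_tens hw hp]
  funext q
  simp [dm, tens, sd_neg, sub_eq_add_neg]

lemma tens_morawetz (hab : a ≤ b) (hw : WNice a b w) (hp : WNice a b p)
    (nw : Num a b w w0 w1 l) (np : Num a b p p0 p1 l) (hl : IntervalIntegrable l volume a b)
    (hl0 : ∀ t, 0 ≤ l t) {θ : Fin 3 → ℝ} {h : ℝ} (hh : 0 < h) (hθ : ∀ j, θ j * θ j = θ j)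
    {P : ℝ → ℝ} (hP : ∀ t, P t = (∑ i, ∑ j, ∫ z : E6, k2 θ h i j (z.1 - z.2) *
      ip (sd (dm i) (tens w p) (t, z)) (sd (dm j) (tens w p) (t, z))) +
      ∑ i, ∫ z : E6, kb1 θ h i (z.1 - z.2) *
        ip (tens w p (t, z)) (sd (dm i) (tens w p) (t, z))) :
    IntervalIntegrable P volume a b ∧ ∫ t in a..b, P t ≤
      3 * (w0 * p0 * (w1 * p0 + w0 * p1)) * (2 + 4 * ∫ t in a..b, l t) := by
  have sw := hw.sm
  have sp := hp.sm
  have dd1 : ∀ i : Fin 3, e3 i - -e3 i = (2 : ℝ) • e3 i := fun i => by rw [two_smul]; abel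
  have dd0 : ∀ i : Fin 3, e3 i - e3 i = (0 : ℝ) • e3 i := fun i => by simp
  have m0 : 0 ≤ w0 * p0 := mul_nonneg nw.n0 np.n0
  have m1 : 0 ≤ w1 * p0 := mul_nonneg nw.n1 np.n0
  have m2 : 0 ≤ w0 * p1 := mul_nonneg nw.n0 np.n1
  have lw0 : ∀ t, 0 ≤ w0 * l t := fun t => mul_nonneg nw.n0 (hl0 t)
  have lp0 : ∀ t, 0 ≤ p0 * l t := fun t => mul_nonneg np.n0 (hl0 t)
  have lw1 : ∀ t, 0 ≤ w1 * l t := fun t => mul_nonneg nw.n1 (hl0 t)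
  have lp1 : ∀ t, 0 ≤ p1 * l t := fun t => mul_nonneg np.n1 (hl0 t)
  have key := morawetz_bound hab (hw.tens hp dpm dm) (κ := fun j z => kk θ h j (z.1 - z.2))
    (K := fun i j z => Sum.elim (fun i => 2 * k2 θ h i j (z.1 - z.2))
      (fun i => 0 * k2 θ h i j (z.1 - z.2)) i) (Kd := fun j z => 2 * k2 θ h j j (z.1 - z.2))
    (β' := fun i z => Sum.elim (fun i => 2 * (2 * kb1 θ h i (z.1 - z.2)))
      (fun i => 2 * (0 * kb1 θ h i (z.1 - z.2))) i)
    (fun j z => abs_kk_le hh hθ j _)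
    (fun i j => by
      rcases i with i | i
      · exact (ker_k2 hh hθ i j).diff (dd1 i)
      · exact (ker_k2 hh hθ i j).diff (dd0 i))
    (fun j => (ker_k2 hh hθ j j).diff (dd1 j))
    (fun i => by
      have e : ∀ z : E6, 2 * kb θ h (z.1 - z.2) = ∑ j, 2 * k2 θ h j j (z.1 - z.2) := fun z => by
        rw [← Finset.mul_sum, sum_k2 hh hθ]
      rcases i with i | i
      · exact (((Ker.const _ 2).mul ((ker_kb hh hθ i).diff (dd1 i))).congr e fun z => by simp)
      · exact (((Ker.const _ 2).mul ((ker_kb hh hθ i).diff (dd0 i))).congr e fun z => by simp))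
    (1 / 4) (A0 := w0 * p0) (A1 := w1 * p0 + w0 * p1) m0 (by positivity) (l := fun t => 2 * l t)
    (hl.const_mul 2) (fun t => mul_nonneg zero_le_two (hl0 t))
    (fun t ht => (nw.q0 t ht).tensor (np.q0 t ht) nw.n0 np.n0)
    (fun t ht j => by
      rw [sd_dm_tens sw sp]
      exact ((nw.q1 t ht j).tensor (np.q0 t ht) nw.n1 np.n0).sub
        ((nw.q0 t ht).tensor (np.q1 t ht j) nw.n0 np.n1) m1 m2)
    (fun t ht => by
      rw [show ((1 : ℝ) / 4) = 1 / 4 from rfl, src_tens sw sp]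
      exact (((nw.q2 t ht).tensor (np.q0 t ht) (lw0 t) np.n0).add
        ((nw.q0 t ht).tensor (np.q2 t ht) nw.n0 (lp0 t)) (mul_nonneg (lw0 t) np.n0)
        (mul_nonneg nw.n0 (lp0 t))).mono (by linarith))
    (fun t ht j => by
      rw [src_tens sw sp, sd_add (Sm.tens (sw.src _ _) sp) (Sm.tens sw (sp.src _ _)),
        sd_dm_tens (sw.src _ _) sp, sd_dm_tens sw (sp.src _ _)]
      have b1 := (nw.q3 t ht j).tensor (np.q0 t ht) (lw1 t) np.n0
      have b2 := (nw.q2 t ht).tensor (np.q1 t ht j) (lw0 t) np.n1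
      have b3 := (nw.q1 t ht j).tensor (np.q2 t ht) nw.n1 (lp0 t)
      have b4 := (nw.q0 t ht).tensor (np.q3 t ht j) nw.n0 (lp1 t)
      have c1 := mul_nonneg (lw1 t) np.n0
      have c2 := mul_nonneg (lw0 t) np.n1
      have c3 := mul_nonneg nw.n1 (lp0 t)
      have c4 := mul_nonneg nw.n0 (lp1 t)
      exact ((b1.sub b2 c1 c2).add (b3.sub b4 c3 c4) (by positivity) (by positivity)).mono
        (by linarith))
    (P := P) (fun t => by
      rw [hP]
      simp only [Fintype.sum_sum_type, Sum.elim_inl, Sum.elim_inr, zero_mul, mul_zero,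
        integral_zero, Finset.sum_const_zero, add_zero, mul_assoc, integral_const_mul,
        ← Finset.mul_sum]
      simp only [dpm, Sum.elim_inl]
      ring)
  refine ⟨key.1, key.2.trans (le_of_eq ?_)⟩
  rw [intervalIntegral.integral_const_mul, Fintype.card_fin]
  push_cast
  ring

lemma lintegral_le_of_slice_le {E : Type*} [MeasureSpace E] (hab : a ≤ b)
    {P : ℝ → ℝ} (iP : IntervalIntegrable P volume a b) {M : ℝ} (hM : ∫ t in a..b, P t ≤ M)
    {H : ℝ → E → ℝ} (h0 : ∀ t x, 0 ≤ H t x) (hi : ∀ t ∈ Icc a b, Integrable (H t))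
    (hle : ∀ t ∈ Icc a b, ∫ x, H t x ≤ P t) :
    ∫⁻ t in Icc a b, ∫⁻ x, ENNReal.ofReal (H t x) ≤ ENNReal.ofReal M := by
  have i1 := (intervalIntegrable_iff_integrableOn_Icc_of_le hab).1 iP
  have p0 : ∀ t ∈ Icc a b, 0 ≤ P t := fun t ht => (integral_nonneg (h0 t)).trans (hle t ht)
  calc _ ≤ ∫⁻ t in Icc a b, ENNReal.ofReal (P t) := by
        refine setLIntegral_mono' measurableSet_Icc fun t ht => ?_
        rw [← ofReal_integral_eq_lintegral_ofReal (hi t ht) (Filter.Eventually.of_forall (h0 t))]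
        exact ENNReal.ofReal_le_ofReal (hle t ht)
    _ = ENNReal.ofReal (∫ t in Icc a b, P t) :=
        (ofReal_integral_eq_lintegral_ofReal i1
          ((ae_restrict_iff' measurableSet_Icc).2 (Filter.Eventually.of_forall p0))).symm
    _ ≤ _ := by
        rw [integral_Icc_eq_integral_Ioc, ← intervalIntegral.integral_of_le hab]
        exact ENNReal.ofReal_le_ofReal hM

lemma UB.m2 {E : Type*} [NormedAddCommGroup E] [NormedSpace ℝ E] [MeasureSpace E]
    [FiniteDimensional ℝ E] [BorelSpace E]
    {f : ℝ × E → ℂ} (h : UB a b f) {t : ℝ} (ht : t ∈ Icc a b) : M2 (sl f t) := by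
  obtain ⟨C, -, hC⟩ := h
  exact (hC t ht).m2

lemma ip_self (z : ℂ) : ip z z = ‖z‖ ^ 2 := real_inner_self_eq_norm_sq z

/-- Regularised interaction Morawetz estimate. -/
lemma rim (hab : a ≤ b) (hw : WNice a b w) (hp : WNice a b p)
    (nw : Num a b w w0 w1 l) (np : Num a b p p0 p1 l) (hl : IntervalIntegrable l volume a b)
    (hl0 : ∀ t, 0 ≤ l t) {h : ℝ} (hh : 0 < h) :
    ∫⁻ t in Icc a b, ∫⁻ z : E6, ENNReal.ofReal (15 * h ^ 4 * kg (fun _ => 1) h (z.1 - z.2) ^ 7) *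
      (‖w (t, z.1)‖ₑ ^ 2 * ‖p (t, z.2)‖ₑ ^ 2) ≤
      ENNReal.ofReal (3 * (w0 * p0 * (w1 * p0 + w0 * p1)) * (2 + 4 * ∫ t in a..b, l t)) := by
  have hθ : ∀ j : Fin 3, ((1 : ℝ)) * 1 = 1 := by simp
  obtain ⟨iP, hP⟩ := tens_morawetz hab hw hp nw np hl hl0 (θ := fun _ => 1) hh hθ fun t => rfl
  have hg0 : ∀ z : E3, 0 ≤ 15 * h ^ 4 * kg (fun _ => 1) h z ^ 7 := fun z => by
    have := kg_pos (θ := fun _ => 1) hh hθ z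
    positivity
  have sw := hw.sm
  have sp := hp.sm
  have sv := sw.tens sp
  have dd1 : ∀ i : Fin 3, e3 i - -e3 i = (2 : ℝ) • e3 i := fun i => by rw [two_smul]; abel
  have K1 : ∀ i, Ker (dm i) (fun z : E6 => kb1 (fun _ => 1) h i (z.1 - z.2))
    (fun z => 2 * kb2 (fun _ => 1) h i (z.1 - z.2)) := fun i => (ker_kb1 hh hθ i).diff (dd1 i)
  have K2 : ∀ i j, Ker (dm i) (fun z : E6 => kk (fun _ => 1) h j (z.1 - z.2))
    (fun z => 2 * k2 (fun _ => 1) h i j (z.1 - z.2)) := fun i j => (ker_k2 hh hθ i j).diff (dd1 i)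
  have mv : ∀ t ∈ Icc a b, M2 (sl (tens w p) t) := fun t ht => (hw.u0.tens hp.u0).m2 ht
  have md : ∀ t ∈ Icc a b, ∀ i, M2 (sl (sd (dm i) (tens w p)) t) := fun t ht i => by
    rw [sd_dm_tens sw sp]
    exact (((hw.u1 _).tens hp.u0).sub (hw.u0.tens (hp.u1 _))).m2 ht
  have ikb2 : ∀ t ∈ Icc a b, ∀ i, Integrable fun z : E6 =>
      2 * kb2 (fun _ => 1) h i (z.1 - z.2) * ip (tens w p (t, z)) (tens w p (t, z)) :=
    fun t ht i => by
      obtain ⟨B, hB⟩ := (K1 i).bdd'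
      exact (mv t ht).integrable_ip (mv t ht) (K1 i).cont' hB
  have eH : ∀ t (z : E6), 15 * h ^ 4 * kg (fun _ => 1) h (z.1 - z.2) ^ 7 * ‖tens w p (t, z)‖ ^ 2 =
      ∑ i, -(1 / 2) * (2 * kb2 (fun _ => 1) h i (z.1 - z.2) *
        ip (tens w p (t, z)) (tens w p (t, z))) := fun t z => by
    rw [← Finset.mul_sum, ← Finset.sum_mul, ← Finset.mul_sum, sum_kb2 hh, ip_self]
    ring
  have := lintegral_le_of_slice_le hab iP hP (H := fun t z => 15 * h ^ 4 *
    kg (fun _ => 1) h (z.1 - z.2) ^ 7 * ‖tens w p (t, z)‖ ^ 2)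
    (fun t z => mul_nonneg (hg0 _) (sq_nonneg _))
    (fun t ht => by
      simp_rw [eH]
      exact integrable_finsetSum _ fun i _ => (ikb2 t ht i).const_mul _)
    (fun t ht => by
      have first : 0 ≤ ∑ i, ∑ j, ∫ z : E6, k2 (fun _ => 1) h i j (z.1 - z.2) *
          ip (sd (dm i) (tens w p) (t, z)) (sd (dm j) (tens w p) (t, z)) := by
        have ii : ∀ i j, Integrable fun z : E6 => k2 (fun _ => 1) h i j (z.1 - z.2) *
            ip (sd (dm i) (tens w p) (t, z)) (sd (dm j) (tens w p) (t, z)) := fun i j => by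
          obtain ⟨B, hB⟩ := (K2 i j).bdd'
          have := ((md t ht i).integrable_ip (md t ht j) (K2 i j).cont' hB).const_mul (1 / 2)
          refine this.congr (Filter.Eventually.of_forall fun z => ?_)
          simp only [sl]
          ring
        simp_rw [← integral_finsetSum _ fun j _ => ii _ j]
        rw [← integral_finsetSum _ fun i _ => integrable_finsetSum _ fun j _ => ii i j]
        exact integral_nonneg fun z => k2_quad_nonneg hh _ fun i => sd (dm i) (tens w p) (t, z)
      have second : ∀ i, ∫ z : E6, kb1 (fun _ => 1) h i (z.1 - z.2) *
          ip (tens w p (t, z)) (sd (dm i) (tens w p) (t, z)) =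
          ∫ z : E6, -(1 / 2) * (2 * kb2 (fun _ => 1) h i (z.1 - z.2) *
        ip (tens w p (t, z)) (tens w p (t, z))) := fun i => by
        have h1 := ibp_ip (K1 i) (sv.sl t) (sv.sl t) (mv t ht) (mv t ht)
          (by rw [dd_sl sv]; exact md t ht i) (by rw [dd_sl sv]; exact md t ht i)
        simp only [dd_sl sv, sl] at h1
        have h2 : ∀ z, ip (sd (dm i) (tens w p) (t, z)) (tens w p (t, z)) =
          ip (tens w p (t, z)) (sd (dm i) (tens w p) (t, z)) := fun z => real_inner_comm _ _
        simp only [h2] at h1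
        rw [integral_const_mul]
        linarith
      simp_rw [eH]
      rw [integral_finsetSum _ fun i _ => (ikb2 t ht i).const_mul _]
      simp_rw [second]
      linarith)
  refine le_trans (le_of_eq ?_) this
  refine lintegral_congr fun t => lintegral_congr fun z => ?_
  rw [ENNReal.ofReal_mul (hg0 _), ENNReal.ofReal_pow (norm_nonneg _), ofReal_norm, tens,
    enorm_mul, mul_pow]

/-- Regularised planewise (directional) interaction Morawetz estimate. -/
lemma planewise (hab : a ≤ b) (hw : WNice a b w) (hp : WNice a b p)
    (nw : Num a b w w0 w1 l) (np : Num a b p p0 p1 l) (hl : IntervalIntegrable l volume a b)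
    (hl0 : ∀ t, 0 ≤ l t) {h : ℝ} (hh : 0 < h) (i : Fin 3) :
    ∫⁻ t in Icc a b, ∫⁻ z : E6, ENNReal.ofReal
      (h ^ 2 * kg (fun j => if j = i then 1 else 0) h (z.1 - z.2) ^ 3) *
      ‖sd (e3 i) w (t, z.1) * (starRingEnd ℂ) (p (t, z.2)) +
        w (t, z.1) * (starRingEnd ℂ) (sd (e3 i) p (t, z.2))‖ₑ ^ 2 ≤
      ENNReal.ofReal (3 * (w0 * p0 * (w1 * p0 + w0 * p1)) * (2 + 4 * ∫ t in a..b, l t)) := by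
  set θ : Fin 3 → ℝ := fun j => if j = i then 1 else 0 with hθdef
  have hθ : ∀ j, θ j * θ j = θ j := fun j => by simp [θ]
  have sθ : ∑ j, θ j = 1 := by simp [θ]
  obtain ⟨iP, hP⟩ := tens_morawetz hab hw hp nw np hl hl0 hh hθ fun t => rfl
  have hg0 : ∀ z : E3, 0 ≤ h ^ 2 * kg θ h z ^ 3 := fun z => by
    have := kg_pos hh hθ z
    positivity
  have sw := hw.sm
  have sp := hp.sm
  have ekb : ∀ z, kb θ h z = h ^ 2 * kg θ h z ^ 3 := fun z => by simp [kb, sθ]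
  have kk0 : ∀ j, j ≠ i → ∀ z, kk θ h j z = 0 := fun j hj z => by simp [kk, θ, hj]
  have ek2 : ∀ z, k2 θ h i i z = kb θ h z := fun z => by
    rw [← sum_k2 hh hθ, Finset.sum_eq_single i (fun j _ hj => by simp [k2, kk0 j hj, θ, hj])
      (by simp)]
  have Kb := ker_kb hh hθ i
  have Kx : Ker (e3 i, (0 : E3)) (fun z : E6 => kb θ h (z.1 - z.2))
    (fun z => 1 * kb1 θ h i (z.1 - z.2)) := Kb.diff (by simp)
  have Ky : Ker ((0 : E3), e3 i) (fun z : E6 => kb θ h (z.1 - z.2))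
    (fun z => -1 * kb1 θ h i (z.1 - z.2)) := Kb.diff (by simp)
  obtain ⟨B, hB⟩ := Kx.bdd
  obtain ⟨B', hB'⟩ := Kx.bdd'
  set wi := sd (e3 i) w with hwi
  set pi := sd (e3 i) p with hpi
  have swi : Sm wi := sw.dd _
  have spi : Sm pi := sp.dd _
  let Y : ℝ → E6 → ℂ := fun t z => wi (t, z.1) * (starRingEnd ℂ) (p (t, z.2)) +
    w (t, z.1) * (starRingEnd ℂ) (pi (t, z.2))
  have lbc : ∀ {f : E3 → ℂ} {c : ℝ}, 0 ≤ c → LB f c → LB (fun x => (starRingEnd ℂ) (f x)) c :=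
    fun {f c} hc hf => by
      simpa using hf.of_norm_le (f := fun x => (starRingEnd ℂ) (f x)) (c := 1)
        (Complex.continuous_conj.comp hf.1) (fun x => by simp) zero_le_one
  have mY : ∀ t ∈ Icc a b, M2 (Y t) := fun t ht => by
    have q1 := (hw.u1 (e3 i)); have q2 := hw.u0
    obtain ⟨A1, n1, h1⟩ := hw.u1 (e3 i)
    obtain ⟨A2, n2, h2⟩ := hw.u0
    obtain ⟨A3, n3, h3⟩ := hp.u1 (e3 i)
    obtain ⟨A4, n4, h4⟩ := hp.u0
    exact ((h1 t ht).tensor (lbc n4 (h4 t ht)) n1 n4).m2.add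
      ((h2 t ht).tensor (lbc n3 (h3 t ht)) n2 n3).m2
  have main : ∀ t ∈ Icc a b, (∫ z : E6, h ^ 2 * kg θ h (z.1 - z.2) ^ 3 * ‖Y t z‖ ^ 2) =
      (∑ j, ∑ k, ∫ z : E6, k2 θ h j k (z.1 - z.2) *
      ip (sd (dm j) (tens w p) (t, z)) (sd (dm k) (tens w p) (t, z))) +
      ∑ j, ∫ z : E6, kb1 θ h j (z.1 - z.2) *
        ip (tens w p (t, z)) (sd (dm j) (tens w p) (t, z)) := by
    intro t ht
    have m00 := (hw.u0.tens hp.u0).m2 ht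
    have m10 := ((hw.u1 (e3 i)).tens hp.u0).m2 ht
    have m01 := (hw.u0.tens (hp.u1 (e3 i))).m2 ht
    have m11 := ((hw.u1 (e3 i)).tens (hp.u1 (e3 i))).m2 ht
    have m20 := ((hw.u2 (e3 i) (e3 i)).tens hp.u0).m2 ht
    have m02 := (hw.u0.tens (hp.u2 (e3 i) (e3 i))).m2 ht
    have r1 : ∑ j, ∑ k, (∫ z : E6, k2 θ h j k (z.1 - z.2) *
        ip (sd (dm j) (tens w p) (t, z)) (sd (dm k) (tens w p) (t, z))) =
        ∫ z : E6, kb θ h (z.1 - z.2) * ip (tens wi p (t, z) - tens w pi (t, z))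
          (tens wi p (t, z) - tens w pi (t, z)) := by
      rw [Finset.sum_eq_single i, Finset.sum_eq_single i]
      · simp only [ek2, sd_dm_tens sw sp]; rfl
      · intro k _ hk
        simp [k2, kk0 k hk, θ, hk]
      · simp
      · intro j _ hj
        refine Finset.sum_eq_zero fun k _ => ?_
        by_cases hjk : j = k
        · subst hjk
          simp [k2, kk0 j hj, θ, hj]
        · simp [k2, kk0 j hj, hjk]
      · simp
    have r2 : ∑ j, (∫ z : E6, kb1 θ h j (z.1 - z.2) *
        ip (tens w p (t, z)) (sd (dm j) (tens w p) (t, z))) =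
        ∫ z : E6, kb1 θ h i (z.1 - z.2) * ip (tens w p (t, z))
          (tens wi p (t, z) - tens w pi (t, z)) := by
      rw [Finset.sum_eq_single i]
      · simp only [sd_dm_tens sw sp]; rfl
      · intro j _ hj
        simp [kb1, kk0 j hj]
      · simp
    have dx : ∀ {f g : ℝ × E3 → ℂ}, Sm f → Sm g → dd (e3 i, (0 : E3)) (sl (tens f g) t) =
        sl (tens (sd (e3 i) f) g) t := fun {f g} hf hg => by
      rw [dd_sl (hf.tens hg), sd_tens hf hg]
      funext z
      have h0 : ((0 : ℝ), (0 : E3)) = 0 := rfl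
      simp [sl, tens, dd, h0]
    have dy : ∀ {f g : ℝ × E3 → ℂ}, Sm f → Sm g → dd ((0 : E3), e3 i) (sl (tens f g) t) =
        sl (tens f (sd (e3 i) g)) t := fun {f g} hf hg => by
      rw [dd_sl (hf.tens hg), sd_tens hf hg]
      funext z
      have h0 : ((0 : ℝ), (0 : E3)) = 0 := rfl
      simp [sl, tens, dd, h0]
    have ex := ibp_ip Kx ((sw.tens spi).sl t) ((sw.tens sp).sl t) m01 m00
      (by rw [dx sw spi]; exact m11) (by rw [dx sw sp]; exact m10)
    have ey := ibp_ip Ky ((swi.tens sp).sl t) ((sw.tens sp).sl t) m10 m00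
      (by rw [dy swi sp]; exact m11) (by rw [dy sw sp]; exact m01)
    rw [dx sw spi, dx sw sp] at ex
    rw [dy swi sp, dy sw sp] at ey
    have i1 := m11.integrable_ip m00 Kx.cont hB
    have i2 := m01.integrable_ip m10 Kx.cont hB
    have i3 := m10.integrable_ip m01 Kx.cont hB
    have i4 := m01.integrable_ip m00 Kx.cont' hB'
    have i5 := m10.integrable_ip m00 Kx.cont' hB'
    have i6 := (m10.sub m01).integrable_ip (m10.sub m01) Kx.cont hB
    have i7 := m00.integrable_ip (m10.sub m01) Kx.cont' hB'
    rw [← integral_add i1 i2, ← integral_neg] at ex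
    rw [← integral_add i1 i3, ← integral_neg] at ey
    rw [r1, r2]
    have e7 : (∫ z : E6, kb1 θ h i (z.1 - z.2) * ip (tens w p (t, z))
          (tens wi p (t, z) - tens w pi (t, z))) = ∫ z : E6, 1 * kb1 θ h i (z.1 - z.2) *
          ip (sl (tens w p) t z) (sl (tens wi p) t z - sl (tens w pi) t z) := by
      simp only [one_mul]; rfl
    have e6 : (∫ z : E6, kb θ h (z.1 - z.2) * ip (tens wi p (t, z) - tens w pi (t, z))
          (tens wi p (t, z) - tens w pi (t, z))) = ∫ z : E6, kb θ h (z.1 - z.2) *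
          ip (sl (tens wi p) t z - sl (tens w pi) t z)
          (sl (tens wi p) t z - sl (tens w pi) t z) := rfl
    have e8 : (∫ z : E6, 1 * kb1 θ h i (z.1 - z.2) *
          ip (sl (tens w p) t z) (sl (tens wi p) t z - sl (tens w pi) t z)) =
        (∫ z : E6, 1 * kb1 θ h i (z.1 - z.2) * ip (sl (tens wi p) t z) (sl (tens w p) t z)) -
        ∫ z : E6, 1 * kb1 θ h i (z.1 - z.2) * ip (sl (tens w pi) t z) (sl (tens w p) t z) := by
      rw [← integral_sub i5 i4]
      refine integral_congr_ae (Filter.Eventually.of_forall fun z => ?_)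
      simp only [ip, inner_sub_right, real_inner_comm]
      ring
    have e9 : (∫ z : E6, h ^ 2 * kg θ h (z.1 - z.2) ^ 3 * ‖Y t z‖ ^ 2) =
        (∫ z : E6, kb θ h (z.1 - z.2) * ip (sl (tens wi p) t z - sl (tens w pi) t z)
          (sl (tens wi p) t z - sl (tens w pi) t z)) +
        ((∫ z : E6, kb θ h (z.1 - z.2) * ip (sl (tens wi pi) t z) (sl (tens w p) t z) +
          kb θ h (z.1 - z.2) * ip (sl (tens w pi) t z) (sl (tens wi p) t z)) +
        (∫ z : E6, kb θ h (z.1 - z.2) * ip (sl (tens wi pi) t z) (sl (tens w p) t z) +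
          kb θ h (z.1 - z.2) * ip (sl (tens wi p) t z) (sl (tens w pi) t z))) := by
      have j1 := i1.add i2
      have j2 := i1.add i3
      have j3 := j1.add j2
      simp only [Pi.add_def] at j1 j2 j3
      rw [← integral_add j1 j2, ← integral_add i6 j3]
      refine integral_congr_ae (Filter.Eventually.of_forall fun z => ?_)
      simp only [← ekb, ← ip_self, ip_eq, Y, sl, tens, Complex.add_re, Complex.add_im,
        Complex.sub_re, Complex.sub_im, Complex.mul_re, Complex.mul_im, Complex.conj_re,
        Complex.conj_im]
      ring
    rw [e9, ex, ey, e6, e7, e8, integral_neg, integral_neg]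
    simp only [neg_mul, integral_neg]
    ring
  have := lintegral_le_of_slice_le hab iP hP (H := fun t z => h ^ 2 *
    kg θ h (z.1 - z.2) ^ 3 * ‖Y t z‖ ^ 2)
    (fun t z => mul_nonneg (hg0 _) (sq_nonneg _))
    (fun t ht => by
      have := (mY t ht).integrable_ip (mY t ht) Kx.cont hB
      simpa only [ip_self, ekb] using this)
    (fun t ht => (main t ht).le)
  refine le_trans (le_of_eq ?_) this
  refine lintegral_congr fun t => lintegral_congr fun z => ?_
  rw [ENNReal.ofReal_mul (hg0 _), ENNReal.ofReal_pow (norm_nonneg _), ofReal_norm]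

end

section conv

/-- Smooth compactly supported real kernels on `ℝ³`. -/
structure Mol (Ψ : E3 → ℝ) : Prop where
  sm : ContDiff ℝ ∞ Ψ
  cs : HasCompactSupport Ψ

/-- Spatial convolution of a function on space-time. -/
def Cv (Ψ : E3 → ℝ) (f : ℝ × E3 → ℂ) : ℝ × E3 → ℂ := fun p => ∫ y, (Ψ y : ℂ) * f (p.1, p.2 - y)

variable {Ψ Φ : E3 → ℝ} {f g : ℝ × E3 → ℂ} {a b : ℝ}

lemma Mol.integrable_mul (hΨ : Mol Ψ) {g : E3 → ℂ} (hg : Continuous g) :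
    Integrable fun y => (Ψ y : ℂ) * g y :=
  ((Complex.continuous_ofReal.comp hΨ.sm.continuous).mul hg).integrable_of_hasCompactSupport
    ((hΨ.cs.comp_left (g := fun r : ℝ => (r : ℂ)) (by simp)).mul_right)

lemma Mol.sub (hΨ : Mol Ψ) (hΦ : Mol Φ) : Mol fun y => Ψ y - Φ y :=
  ⟨hΨ.sm.sub hΦ.sm, by
    have := hΨ.cs.add (hΦ.cs.neg (f := Φ))
    rwa [← sub_eq_add_neg] at this⟩

lemma Mol.deriv (hΨ : Mol Ψ) (v : E3) : Mol fun y => fderiv ℝ Ψ y v :=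
  ⟨(hΨ.sm.fderiv_right (m := ∞) (by simp)).clm_apply contDiff_const, hΨ.cs.fderiv_apply ℝ v⟩

lemma cont_shift (hf : Continuous f) (p : ℝ × E3) : Continuous fun y => f (p.1, p.2 - y) :=
  hf.comp (continuous_const.prodMk (continuous_const.sub continuous_id))

lemma Sm.cv (hΨ : Mol Ψ) (hf : Sm f) : Sm (Cv Ψ f) := by
  have hP := hΨ.cs
  let g : ℝ × E3 → E3 → ℂ := fun p z => (Ψ (-z) : ℂ) * f (p.1, p.2 + z)
  have hk : IsCompact (Neg.neg '' tsupport Ψ) := hP.isCompact.image continuous_neg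
  have key := contDiffOn_convolution_right_with_param_comp (μ := (volume : Measure E3)) (n := ⊤)
    (ContinuousLinearMap.mul ℝ ℂ) (s := (univ : Set (ℝ × E3))) (v := fun _ => (0 : E3))
    contDiffOn_const (f := fun _ => (1 : ℂ)) (g := g) isOpen_univ hk (fun p x _ hx => by
      have : Ψ (-x) = 0 := by
        by_contra hne
        exact hx ⟨-x, subset_tsupport _ hne, neg_neg x⟩
      simp [g, this]) (locallyIntegrable_const 1) (by
      refine ContDiff.contDiffOn ?_
      refine ContDiff.mul ?_ ?_
      · exact Complex.ofRealCLM.contDiff.comp (hΨ.sm.comp contDiff_snd.neg)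
      · exact ContDiff.comp hf ((contDiff_fst.comp contDiff_fst).prodMk
          ((contDiff_snd.comp contDiff_fst).add contDiff_snd)))
  rw [contDiffOn_univ] at key
  have e : Cv Ψ f = fun p => convolution (fun _ => (1 : ℂ)) (g p)
      (ContinuousLinearMap.mul ℝ ℂ) volume (0 : E3) := by
    funext p
    simp [Cv, convolution, g, sub_eq_add_neg]
  rw [e]
  exact key

lemma dd_cv (hΨ : Mol Ψ) (hf : Sm f) (v : ℝ × E3) : dd v (Cv Ψ f) = Cv Ψ (dd v f) := by
  funext p
  have hc : Continuous fun q : ℝ × E3 => dd v f (p.1 + q.1 * v.1, p.2 + q.1 • v.2 - q.2) :=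
    (hf.dd v).continuous.comp (by fun_prop)
  obtain ⟨M, hM⟩ := ((isCompact_Icc (a := (-1 : ℝ)) (b := 1)).prod
    hΨ.cs.isCompact).exists_bound_of_continuousOn hc.continuousOn
  have h := hasDerivAt_integral_of_dominated_loc_of_deriv_le (μ := (volume : Measure E3)) (x₀ := 0)
    (F := fun (s : ℝ) y => (Ψ y : ℂ) * f (p.1 + s * v.1, p.2 + s • v.2 - y))
    (F' := fun (s : ℝ) y => (Ψ y : ℂ) * dd v f (p.1 + s * v.1, p.2 + s • v.2 - y))
    (bound := fun y => ‖(Ψ y : ℂ) * (M : ℂ)‖) (s := Icc (-1 : ℝ) 1)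
    (Icc_mem_nhds (by norm_num) (by norm_num))
    (Filter.Eventually.of_forall fun s =>
      (hΨ.integrable_mul (cont_shift hf.continuous (_, _))).aestronglyMeasurable)
    (hΨ.integrable_mul (cont_shift hf.continuous (_, _)))
    (hΨ.integrable_mul (cont_shift (hf.dd v).continuous (_, _))).aestronglyMeasurable
    (Filter.Eventually.of_forall fun y s hs => by
      rw [norm_mul, norm_mul]
      by_cases hy : y ∈ tsupport Ψ
      · gcongr
        exact (hM (s, y) ⟨hs, hy⟩).trans (by simpa using le_abs_self M)
      · simp [image_eq_zero_of_notMem_tsupport hy])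
    (hΨ.integrable_mul continuous_const).norm
    (Filter.Eventually.of_forall fun y s _ => by
      refine HasDerivAt.const_mul _ ?_
      have h1 : HasDerivAt (fun s : ℝ => (p.1 + s * v.1, p.2 + s • v.2 - y)) (1 * v.1, (1 : ℝ) • v.2) s :=
        (((hasDerivAt_id' s).mul_const v.1).const_add p.1).prodMk
          ((((hasDerivAt_id' s).smul_const v.2).const_add p.2).sub_const y)
      have h2 := (hf.differentiable _).hasFDerivAt.comp_hasDerivAt s h1
      rw [one_mul, one_smul] at h2
      exact h2)
  have h3 := (hf.cv hΨ).hasLineDerivAt p v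
  have h4 := HasDerivAt.unique h3 (by simpa [Cv] using h.2)
  simpa [Cv] using h4

lemma cv_add (hΨ : Mol Ψ) (hf : Continuous f) (hg : Continuous g) :
    Cv Ψ (fun p => f p + g p) = fun p => Cv Ψ f p + Cv Ψ g p := by
  funext p
  simp only [Cv, mul_add]
  exact integral_add (hΨ.integrable_mul (cont_shift hf p)) (hΨ.integrable_mul (cont_shift hg p))

lemma cv_sub (hΨ : Mol Ψ) (hf : Continuous f) (hg : Continuous g) :
    Cv Ψ (fun p => f p - g p) = fun p => Cv Ψ f p - Cv Ψ g p := by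
  funext p
  simp only [Cv, mul_sub]
  exact integral_sub (hΨ.integrable_mul (cont_shift hf p)) (hΨ.integrable_mul (cont_shift hg p))

lemma cv_sub_left (hΨ : Mol Ψ) (hΦ : Mol Φ) (hf : Continuous f) :
    Cv (fun y => Ψ y - Φ y) f = fun p => Cv Ψ f p - Cv Φ f p := by
  funext p
  simp only [Cv, Complex.ofReal_sub, sub_mul]
  exact integral_sub (hΨ.integrable_mul (cont_shift hf p)) (hΦ.integrable_mul (cont_shift hf p))

lemma cv_const_mul (c : ℂ) : Cv Ψ (fun p => c * f p) = fun p => c * Cv Ψ f p := by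
  funext p
  simp only [Cv, mul_left_comm _ c]
  exact integral_const_mul _ _

lemma cv_sum (hΨ : Mol Ψ) {ι : Type*} (s : Finset ι) {F : ι → ℝ × E3 → ℂ}
    (hF : ∀ i ∈ s, Continuous (F i)) :
    Cv Ψ (fun p => ∑ i ∈ s, F i p) = fun p => ∑ i ∈ s, Cv Ψ (F i) p := by
  funext p
  simp only [Cv, Finset.mul_sum]
  exact integral_finsetSum _ fun i hi => hΨ.integrable_mul (cont_shift (hF i hi) p)

lemma src3_cv (hΨ : Mol Ψ) (hf : Sm f) : src3 (Cv Ψ f) = Cv Ψ (src3 f) := by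
  have h0 : ∀ i ∈ Finset.univ, Continuous (sd (e3 i) (sd (e3 i) f)) :=
    fun i _ => ((hf.dd _).dd _).continuous
  have h1 : Continuous fun p => ∑ i, sd (e3 i) (sd (e3 i) f) p := continuous_finsetSum _ h0
  have h2 : Continuous fun p => ((1 / 2 : ℝ) : ℂ) * ∑ i, sd (e3 i) (sd (e3 i) f) p :=
    continuous_const.mul h1
  unfold src3 src
  rw [cv_add hΨ (((hf.dd _).const_mul _).continuous) h2, cv_const_mul, cv_const_mul,
    cv_sum hΨ _ h0]
  funext p
  simp only [dd_cv hΨ hf, dd_cv hΨ (hf.dd _)]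

lemma sd_cv_left (hΨ : Mol Ψ) (hf : Sm f) (v : E3) :
    sd v (Cv Ψ f) = Cv (fun y => fderiv ℝ Ψ y v) f := by
  rw [sd, dd_cv hΨ hf]
  funext p
  have i1 := hΨ.integrable_mul (cont_shift hf.continuous p)
  have i2 := hΨ.integrable_mul (cont_shift (hf.dd ((0 : ℝ), v)).continuous p)
  have i3 := (hΨ.deriv v).integrable_mul (cont_shift hf.continuous p)
  have := integral_bilinear_hasLineDerivAt_right_eq_neg_left_of_integrable
    (μ := (volume : Measure E3)) (B := ContinuousLinearMap.mul ℝ ℂ) (v := v)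
    (f := fun y => (Ψ y : ℂ)) (f' := fun y => ((fderiv ℝ Ψ y v : ℝ) : ℂ))
    (g := fun y => f (p.1, p.2 - y)) (g' := fun y => -sd v f (p.1, p.2 - y)) i3
    (by simpa using i2.neg) i1
    (fun y _ => by
      have h := ((hΨ.sm.differentiable (by simp) y).hasFDerivAt.hasLineDerivAt v)
      exact (HasDerivAt.ofReal_comp h))
    (fun y _ => by
      have h1 : HasDerivAt (fun s : ℝ => (p.1, p.2 - (y + s • v))) ((0 : ℝ), -((1 : ℝ) • v)) 0 :=
        (hasDerivAt_const (0 : ℝ) p.1).prodMk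
          ((((hasDerivAt_id' (0 : ℝ)).smul_const v).const_add y).const_sub p.2)
      have h2 := (hf.differentiable (p.1, p.2 - (y + (0 : ℝ) • v))).hasFDerivAt.comp_hasDerivAt 0 h1
      have e : ((0 : ℝ), -v) = -((0 : ℝ), v) := by simp
      have h3 : (fderiv ℝ f (p.1, p.2 - (y + (0 : ℝ) • v))) (0, -((1 : ℝ) • v)) =
        -sd v f (p.1, p.2 - y) := by
        rw [zero_smul, add_zero, one_smul, e, map_neg]
        rfl
      rw [h3] at h2
      exact h2)
  simp only [ContinuousLinearMap.mul_apply', mul_neg, integral_neg, neg_inj] at this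
  exact this

lemma cv_comm (hΨ : Mol Ψ) (hΦ : Mol Φ) (hf : Continuous f) :
    Cv Ψ (Cv Φ f) = Cv Φ (Cv Ψ f) := by
  funext p
  simp only [Cv, ← integral_const_mul]
  have hc : Continuous (Function.uncurry fun y z : E3 =>
      (Ψ y : ℂ) * ((Φ z : ℂ) * f (p.1, p.2 - y - z))) := by
    have h1 := hΨ.sm.continuous
    have h2 := hΦ.sm.continuous
    unfold Function.uncurry
    fun_prop
  rw [integral_integral_swap_of_hasCompactSupport hc]
  · refine integral_congr_ae (Filter.Eventually.of_forall fun z =>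
      integral_congr_ae (Filter.Eventually.of_forall fun y => ?_))
    simp only [sub_right_comm p.2 y z]
    ring
  · refine HasCompactSupport.intro (hΨ.cs.isCompact.prod hΦ.cs.isCompact) fun q hq => ?_
    rw [Set.mem_prod, not_and_or] at hq
    rcases hq with h | h
    · simp [Function.uncurry, image_eq_zero_of_notMem_tsupport h]
    · simp [Function.uncurry, image_eq_zero_of_notMem_tsupport h]

end conv

section norms

variable {Ψ Φ : E3 → ℝ} {f g : ℝ × E3 → ℂ} {a b c t : ℝ}

lemma Mol.integrable (hΨ : Mol Ψ) : Integrable Ψ :=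
  hΨ.sm.continuous.integrable_of_hasCompactSupport hΨ.cs

lemma Mol.lintegral (hΨ : Mol Ψ) : ∫⁻ y, ‖Ψ y‖ₑ = ENNReal.ofReal (∫ y, |Ψ y|) := by
  rw [ofReal_integral_eq_lintegral_ofReal hΨ.integrable.abs
    (Filter.Eventually.of_forall fun y => abs_nonneg _)]
  simp only [← Real.norm_eq_abs, ofReal_norm]

lemma enorm_cv_le (f : ℝ × E3 → ℂ) (p : ℝ × E3) :
    ‖Cv Ψ f p‖ₑ ≤ ∫⁻ y, ‖Ψ y‖ₑ * ‖f (p.1, p.2 - y)‖ₑ := by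
  refine (enorm_integral_le_lintegral_enorm _).trans (le_of_eq (lintegral_congr fun y => ?_))
  rw [enorm_mul, ← ofReal_norm (Ψ y : ℂ), Complex.norm_real, ofReal_norm]

lemma LB.lintegral_shift (h : LB (sl f t) c) (hc : 0 ≤ c) (y : E3) :
    ∫⁻ x, ‖f (t, x - y)‖ₑ ^ 2 ≤ ENNReal.ofReal (c ^ 2) := by
  rw [lintegral_sub_right_eq_self (fun x => ‖f (t, x)‖ₑ ^ 2) y]
  exact ((lb_iff_lintegral hc).1 h).2

lemma LB.cv (hΨ : Mol Ψ) {K : ℝ} (hK : ∫ y, |Ψ y| ≤ K) (hf : Sm f) (hc : 0 ≤ c)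
    (h : LB (sl f t) c) : LB (sl (Cv Ψ f) t) (K * c) := by
  have h0 : 0 ≤ ∫ y, |Ψ y| := integral_nonneg fun y => abs_nonneg _
  have hK0 := h0.trans hK
  rw [lb_iff_lintegral (by positivity)]
  refine ⟨((hf.cv hΨ).sl t).continuous, ?_⟩
  have hcF : Continuous f := hf.continuous
  calc ∫⁻ x, ‖sl (Cv Ψ f) t x‖ₑ ^ 2
      ≤ ∫⁻ x, (∫⁻ y, ‖Ψ y‖ₑ * ‖f (t, x - y)‖ₑ) ^ 2 := by
        gcongr with x; exact enorm_cv_le f (t, x)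
    _ ≤ (∫⁻ y, ‖Ψ y‖ₑ) ^ 2 * ENNReal.ofReal (c ^ 2) :=
        lintegral_average_sq_le hΨ.sm.continuous.enorm.measurable
          (Continuous.measurable (by unfold Function.uncurry; fun_prop))
          fun y => h.lintegral_shift hc y
    _ ≤ _ := by
        rw [hΨ.lintegral, mul_pow, ENNReal.ofReal_mul (by positivity), ENNReal.ofReal_pow hK0]
        gcongr

lemma norm_fderiv_le_sum (φ : E3 →L[ℝ] ℂ) : ‖φ‖ ≤ ∑ i, ‖φ (e3 i)‖ := by
  refine ContinuousLinearMap.opNorm_le_bound _ (Finset.sum_nonneg fun i _ => norm_nonneg _)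
    fun y => ?_
  have hy : y = ∑ i, y i • e3 i := by
    ext j
    simp [e3, Finset.sum_apply, Pi.single_apply]
  conv_lhs => rw [hy, map_sum]
  refine (norm_sum_le _ _).trans ?_
  rw [Finset.sum_mul]
  refine Finset.sum_le_sum fun i _ => ?_
  rw [map_smul, norm_smul, mul_comm]
  exact mul_le_mul_of_nonneg_left (EuclideanSpace.norm_eq y ▸ PiLp.norm_apply_le y i) (norm_nonneg _)

lemma LB.lintegral_fderiv {f : E3 → ℂ} (hf : Sm f) (hc : 0 ≤ c) (h : ∀ i, LB (dd (e3 i) f) c) :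
    ∫⁻ x, ‖fderiv ℝ f x‖ₑ ^ 2 ≤ ENNReal.ofReal ((3 * c) ^ 2) := by
  have hs := LB.sum Finset.univ (fun i x => ((‖dd (e3 i) f x‖ : ℝ) : ℂ)) (fun _ => c)
    (fun i _ => by
      have := (h i).of_norm_le (c := 1) (f := fun x => ((‖dd (e3 i) f x‖ : ℝ) : ℂ))
        (Complex.continuous_ofReal.comp (h i).1.norm) (fun x => by simp) zero_le_one
      rwa [one_mul] at this) fun _ _ => hc
  have e : ∑ _i : Fin 3, c = 3 * c := by simp
  rw [e] at hs
  refine le_trans (lintegral_mono fun x => ?_) ((lb_iff_lintegral (by positivity)).1 hs).2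
  gcongr
  rw [← Complex.ofReal_sum, ← ofReal_norm (fderiv ℝ f x), ← ofReal_norm (Complex.ofReal _),
    Complex.norm_real, Real.norm_of_nonneg (Finset.sum_nonneg fun i _ => norm_nonneg _)]
  exact ENNReal.ofReal_le_ofReal (norm_fderiv_le_sum _)

/-- `L²` modulus of continuity. -/
lemma lintegral_shift_sub_le {f : E3 → ℂ} (hf : Sm f) (hc : 0 ≤ c) (h : ∀ i, LB (dd (e3 i) f) c)
    (y : E3) : ∫⁻ x, ‖f (x - y) - f x‖ₑ ^ 2 ≤ ENNReal.ofReal ((‖y‖ * (3 * c)) ^ 2) := by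
  have hcf : Continuous (fderiv ℝ f) := ContDiff.continuous_fderiv hf (by simp)
  have hp : ∀ x, ‖f (x - y) - f x‖ₑ ≤
      ∫⁻ s in Icc (0 : ℝ) 1, ‖y‖ₑ * ‖fderiv ℝ f (x - s • y)‖ₑ := fun x => by
    have h1 : ∀ s ∈ uIcc (0 : ℝ) 1, HasDerivAt (fun s : ℝ => f (x - s • y))
        (fderiv ℝ f (x - s • y) (-y)) s := fun s _ => by
      have := (hf.differentiable (x - s • y)).hasFDerivAt.comp_hasDerivAt s
        (((hasDerivAt_id' s).smul_const y).const_sub x)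
      rw [one_smul] at this
      exact this
    have h2 := intervalIntegral.integral_eq_sub_of_hasDerivAt h1
      (Continuous.intervalIntegrable (by fun_prop) _ _)
    rw [one_smul, zero_smul, sub_zero] at h2
    rw [← h2, intervalIntegral.integral_of_le zero_le_one, ← integral_Icc_eq_integral_Ioc]
    refine (enorm_integral_le_lintegral_enorm _).trans (lintegral_mono fun s => ?_)
    rw [mul_comm, ← enorm_neg y]
    exact ContinuousLinearMap.le_opNorm_enorm _ _
  calc ∫⁻ x, ‖f (x - y) - f x‖ₑ ^ 2
      ≤ ∫⁻ x, (∫⁻ s in Icc (0 : ℝ) 1, ‖y‖ₑ * ‖fderiv ℝ f (x - s • y)‖ₑ) ^ 2 := by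
        gcongr with x; exact hp x
    _ ≤ (∫⁻ s in Icc (0 : ℝ) 1, ‖y‖ₑ) ^ 2 * ENNReal.ofReal ((3 * c) ^ 2) :=
        lintegral_average_sq_le measurable_const
          (Continuous.measurable (by unfold Function.uncurry; fun_prop)) fun s => by
          rw [lintegral_sub_right_eq_self (fun x => ‖fderiv ℝ f x‖ₑ ^ 2) (s • y)]
          exact LB.lintegral_fderiv hf hc h
    _ = _ := by
        rw [mul_pow ‖y‖, ENNReal.ofReal_mul (by positivity), ENNReal.ofReal_pow (norm_nonneg y),
          ofReal_norm]
        simp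

/-- Nonnegative smooth kernels of unit mass supported in a ball of radius `h`. -/
structure Avg (h : ℝ) (Φ : E3 → ℝ) : Prop extends Mol Φ where
  nonneg : ∀ y, 0 ≤ Φ y
  mass : ∫ y, Φ y = 1
  supp : ∀ y, h < ‖y‖ → Φ y = 0

lemma Avg.abs (hΦ : Avg c Φ) : ∫ y, |Φ y| = 1 := by
  rw [← hΦ.mass]
  exact integral_congr_ae (Filter.Eventually.of_forall fun y => abs_of_nonneg (hΦ.nonneg y))

/-- Averages over a small ball of a family of functions with uniform `L²` bounds. -/
lemma Avg.lb_of_integral {h : ℝ} (hΦ : Avg h Φ) {F : E3 → ℂ} {G : E3 → E3 → ℂ} (hc : 0 ≤ c)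
    (hF : Continuous F) (hG : Continuous (Function.uncurry G))
    (e : ∀ x, F x = ∫ y, (Φ y : ℂ) * G y x)
    (hd : ∀ y, ‖y‖ ≤ h → ∫⁻ x, ‖G y x‖ₑ ^ 2 ≤ ENNReal.ofReal (c ^ 2)) : LB F c := by
  rw [lb_iff_lintegral hc]
  have hm := hΦ.toMol
  refine ⟨hF, ?_⟩
  let S : Set E3 := Metric.closedBall 0 h
  let K : E3 → E3 → ℝ≥0∞ := fun y x => S.indicator (fun y => ‖G y x‖ₑ) y
  have hp : ∀ x, ‖F x‖ₑ ≤ ∫⁻ y, ‖Φ y‖ₑ * K y x := fun x => by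
    rw [e]
    refine (enorm_integral_le_lintegral_enorm _).trans (lintegral_mono fun y => ?_)
    simp only [K]
    by_cases hy : y ∈ S
    · rw [indicator_of_mem hy, enorm_mul, ← ofReal_norm (Φ y : ℂ), Complex.norm_real, ofReal_norm]
    · have : Φ y = 0 := hΦ.supp y (by simpa [S] using hy)
      simp [this]
  have hK : Measurable (Function.uncurry K) := by
    have e : Function.uncurry K = (Prod.fst ⁻¹' S).indicator
        fun q : E3 × E3 => ‖Function.uncurry G q‖ₑ := by
      funext q
      simp only [K, Function.uncurry, indicator]
      rfl
    rw [e]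
    exact Measurable.indicator hG.enorm.measurable
      (measurable_fst Metric.isClosed_closedBall.measurableSet)
  calc ∫⁻ x, ‖F x‖ₑ ^ 2
      ≤ ∫⁻ x, (∫⁻ y, ‖Φ y‖ₑ * K y x) ^ 2 := by
        gcongr with x; exact hp x
    _ ≤ (∫⁻ y, ‖Φ y‖ₑ) ^ 2 * ENNReal.ofReal (c ^ 2) :=
        lintegral_average_sq_le hm.sm.continuous.enorm.measurable hK fun y => by
          simp only [K]
          by_cases hy : y ∈ S
          · simp only [indicator_of_mem hy]
            exact hd y (by simpa [S] using hy)
          · simp [indicator_of_notMem hy]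
    _ = _ := by
        rw [hm.lintegral, hΦ.abs]
        simp

lemma Avg.cv_sub_eq {h : ℝ} (hΦ : Avg h Φ) (hf : Continuous f) (p : ℝ × E3) (z : ℂ) :
    Cv Φ f p - z = ∫ y, (Φ y : ℂ) * (f (p.1, p.2 - y) - z) := by
  simp only [mul_sub]
  rw [integral_sub (hΦ.toMol.integrable_mul (cont_shift hf p))
    (hΦ.toMol.integrable_mul continuous_const), integral_mul_const, integral_complex_ofReal,
    hΦ.mass]
  simp [Cv]

lemma Avg.lb_sub {h : ℝ} (hh : 0 ≤ h) (hΦ : Avg h Φ) (hf : Sm f) (hc : 0 ≤ c)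
    (hd : ∀ i, LB (sl (sd (e3 i) f) t) c) :
    LB (sl (fun p => Cv Φ f p - f p) t) (3 * h * c) := by
  have hcF := hf.continuous
  refine hΦ.lb_of_integral (G := fun y x => f (t, x - y) - f (t, x)) (by positivity)
    (((hf.cv hΦ.toMol).sub hf).sl t).continuous (by unfold Function.uncurry; fun_prop)
    (fun x => hΦ.cv_sub_eq hcF (t, x) _) fun y hy => ?_
  refine (lintegral_shift_sub_le (f := sl f t) (hf.sl t) hc (fun i => by
    rw [dd_sl hf]; exact hd i) y).trans (ENNReal.ofReal_le_ofReal ?_)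
  rw [show 3 * h * c = h * (3 * c) by ring]
  gcongr

/-- Second-order accuracy of averages with even kernels. -/
lemma Avg.lb_sub_two {h : ℝ} (hh : 0 ≤ h) (hΦ : Avg h Φ) (he : ∀ y, Φ (-y) = Φ y) (hf : Sm f)
    (hc : 0 ≤ c) (hd : ∀ i j, LB (sl (sd (e3 j) (sd (e3 i) f)) t) c) :
    LB (sl (fun p => Cv Φ f p - f p) t) (9 * h ^ 2 * c) := by
  have hcF := hf.continuous
  have key : LB (fun x => 2 * sl (fun p => Cv Φ f p - f p) t x) (9 * h ^ 2 * c) := by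
    refine hΦ.lb_of_integral
      (G := fun y x => (f (t, x - y) - f (t, x)) + (f (t, x - -y) - f (t, x))) (by positivity)
      (continuous_const.mul (((hf.cv hΦ.toMol).sub hf).sl t).continuous)
      (by unfold Function.uncurry; fun_prop) (fun x => ?_) fun y hy => ?_
    · have h1 := hΦ.cv_sub_eq hcF (t, x) (f (t, x))
      have h2 : ∫ y, (Φ y : ℂ) * (f (t, x - -y) - f (t, x)) = Cv Φ f (t, x) - f (t, x) := by
        rw [h1, ← integral_neg_eq_self]
        simp only [he, neg_neg]
      simp only [mul_add]
      rw [integral_add (hΦ.toMol.integrable_mul (by fun_prop))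
        (hΦ.toMol.integrable_mul (by fun_prop)), h2, ← h1]
      simp only [sl]
      ring
    · set g : E3 → ℂ := fun x => f (t, x - -y) - f (t, x) with hg
      have sg : Sm g := ((hf.sl t).comp (g := sl f t) (contDiff_id.sub contDiff_const)).sub (hf.sl t)
      have dg : ∀ i, dd (e3 i) g = fun x =>
          sl (sd (e3 i) f) t (x - -y) - sl (sd (e3 i) f) t x := fun i => by
        rw [← dd_sl hf]
        have s1 : Sm fun x => sl f t (x - -y) :=
          (hf.sl t).comp (g := sl f t) (contDiff_id.sub contDiff_const)
        have := dd_sub s1 (hf.sl t) (e3 i)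
        refine this.trans ?_
        funext x
        simp only [dd]
        rw [fderiv_comp_sub]
      have b1 : ∀ i, LB (dd (e3 i) g) (h * (3 * c)) := fun i => by
        rw [lb_iff_lintegral (by positivity)]
        refine ⟨(sg.dd _).continuous, ?_⟩
        rw [dg]
        refine (lintegral_shift_sub_le (f := sl (sd (e3 i) f) t) ((hf.dd _).sl t) hc (fun j => by
          rw [dd_sl (hf.dd _)]; exact hd i j) (-y)).trans (ENNReal.ofReal_le_ofReal ?_)
        rw [norm_neg]
        gcongr
      refine le_trans (le_of_eq ?_) ((lintegral_shift_sub_le sg (by positivity) b1 y).trans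
        (ENNReal.ofReal_le_ofReal ?_))
      · refine lintegral_congr fun x => ?_
        rw [← enorm_neg]
        congr 2
        simp only [hg, sub_neg_eq_add, sub_add_cancel]
        ring
      · rw [show 9 * h ^ 2 * c = h * (3 * (h * (3 * c))) by ring]
        gcongr
  have := (key.const_mul (1 / 2))
  refine LB.mono (by simpa [← mul_assoc] using this) ?_
  norm_num
  have : 0 ≤ h ^ 2 * c := by positivity
  linarith

end norms

section moll

variable {Ψ Φ : E3 → ℝ} {f g : ℝ × E3 → ℂ} {a b c t : ℝ}

lemma UB.cv (hΨ : Mol Ψ) (hf : Sm f) (h : UB a b f) : UB a b (Cv Ψ f) := by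
  obtain ⟨C, h0, hC⟩ := h
  exact ⟨(∫ y, |Ψ y|) * C, mul_nonneg (integral_nonneg fun y => abs_nonneg _) h0,
    fun t ht => (hC t ht).cv hΨ le_rfl hf h0⟩

lemma UB.td_cv (hΨ : Mol Ψ) (hf : Sm f) (h : UB a b f) (h' : UB a b (src3 f)) :
    UB a b (td (Cv Ψ f)) := by
  have e : td (Cv Ψ f) = fun p => -Complex.I * (Cv Ψ (src3 f) p -
      ((1 / 2 : ℝ) : ℂ) * ∑ i, sd (e3 i) (sd (e3 i) (Cv Ψ f)) p) := by
    funext p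
    rw [← src3_cv hΨ hf]
    simp only [src3, src]
    linear_combination (td (Cv Ψ f) p) * Complex.I_mul_I
  rw [e]
  refine ((h'.cv hΨ (hf.src _ _)).sub ((UB.sum fun i _ => ?_).const_mul _)).const_mul _
  rw [sd_cv_left hΨ hf, sd_cv_left (hΨ.deriv _) hf]
  exact h.cv ((hΨ.deriv _).deriv _) hf

lemma WNice.cv (hΨ : Mol Ψ) (hf : Sm f) (h : UB a b f) (h' : UB a b (src3 f)) :
    WNice a b (Cv Ψ f) := by
  refine ⟨hf.cv hΨ, h.cv hΨ hf, h.td_cv hΨ hf h', fun x => ?_, fun x => ?_, fun x y => ?_,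
    fun x y z => ?_⟩
  · rw [sd_cv_left hΨ hf]
    exact h.cv (hΨ.deriv _) hf
  · rw [sd_td (hf.cv hΨ), sd_cv_left hΨ hf]
    exact h.td_cv (hΨ.deriv _) hf h'
  · rw [sd_cv_left hΨ hf, sd_cv_left (hΨ.deriv _) hf]
    exact h.cv ((hΨ.deriv _).deriv _) hf
  · rw [sd_cv_left hΨ hf, sd_cv_left (hΨ.deriv _) hf, sd_cv_left ((hΨ.deriv _).deriv _) hf]
    exact h.cv (((hΨ.deriv _).deriv _).deriv _) hf

lemma exists_phi : ∃ (Cφ : ℝ) (φ : ℝ → E3 → ℝ), 1 ≤ Cφ ∧ ∀ h, 0 < h → Avg h (φ h) ∧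
    (∀ y, φ h y ≤ Cφ / h ^ 3) ∧ ∀ y, φ h (-y) = φ h y := by
  let bump : ∀ h : ℝ, 0 < h → ContDiffBump (0 : E3) := fun h hh => ⟨h / 2, h, by linarith, by linarith⟩
  classical
  let V := (volume : Measure E3).real (Metric.ball 0 1)
  have hV : 0 < V := by
    simp only [V, Measure.real, ENNReal.toReal_pos_iff]
    exact ⟨Metric.measure_ball_pos _ _ one_pos, measure_ball_lt_top⟩
  refine ⟨max 1 (2 ^ 3 / V), fun h => if hh : 0 < h then (bump h hh).normed volume else 0,
    le_max_left _ _, fun h hh => ?_⟩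
  simp only [dif_pos hh]
  refine ⟨⟨⟨(bump h hh).contDiff_normed, (bump h hh).hasCompactSupport_normed⟩,
    (bump h hh).nonneg_normed, (bump h hh).integral_normed, fun y hy => ?_⟩, fun y => ?_,
    fun y => (bump h hh).normed_neg y⟩
  · refine image_eq_zero_of_notMem_tsupport ?_
    rw [(bump h hh).tsupport_normed_eq]
    simpa [bump] using hy
  · refine ((bump h hh).normed_le_div_measure_closedBall_rIn volume y).trans ?_
    have e : (volume : Measure E3).real (Metric.closedBall 0 (bump h hh).rIn) = (h / 2) ^ 3 * V := by
      simp only [V, Measure.real]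
      rw [Measure.addHaar_closedBall _ _ (by simp [bump]; positivity), ENNReal.toReal_mul,
        ENNReal.toReal_ofReal (by simp [bump]; positivity)]
      simp [bump]
    rw [e]
    calc 1 / ((h / 2) ^ 3 * V) = 2 ^ 3 / V / h ^ 3 := by field_simp
      _ ≤ _ := by gcongr; exact le_max_right _ _

/-- Constant in the pointwise bound for the standard mollifiers. -/
def Cφ : ℝ := exists_phi.choose

/-- Standard mollifiers. -/
def φ (h : ℝ) : E3 → ℝ := exists_phi.choose_spec.choose h

lemma one_le_Cφ : 1 ≤ Cφ := exists_phi.choose_spec.choose_spec.1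
lemma avg_phi {h : ℝ} (hh : 0 < h) : Avg h (φ h) := (exists_phi.choose_spec.choose_spec.2 h hh).1
lemma phi_le {h : ℝ} (hh : 0 < h) (y : E3) : φ h y ≤ Cφ / h ^ 3 :=
  (exists_phi.choose_spec.choose_spec.2 h hh).2.1 y
lemma phi_neg {h : ℝ} (hh : 0 < h) (y : E3) : φ h (-y) = φ h y :=
  (exists_phi.choose_spec.choose_spec.2 h hh).2.2 y

lemma Avg.norm_sub_le {h ε : ℝ} (hΦ : Avg h Φ) (hf : Continuous f) (p : ℝ × E3) (z : ℂ)
    (hε : ∀ y : E3, ‖y‖ ≤ h → ‖f (p.1, p.2 - y) - z‖ ≤ ε) : ‖Cv Φ f p - z‖ ≤ ε := by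
  rw [hΦ.cv_sub_eq hf]
  calc _ ≤ ∫ y, Φ y * ε := by
        refine norm_integral_le_of_norm_le (hΦ.toMol.integrable.mul_const ε)
          (Filter.Eventually.of_forall fun y => ?_)
        rw [norm_mul, Complex.norm_real, Real.norm_of_nonneg (hΦ.nonneg y)]
        by_cases hy : ‖y‖ ≤ h
        · exact mul_le_mul_of_nonneg_left (hε y hy) (hΦ.nonneg y)
        · simp [hΦ.supp y (not_le.1 hy)]
    _ = ε := by rw [integral_mul_const, hΦ.mass, one_mul]

lemma tendsto_cv_phi (hf : Continuous f) (p : ℝ × E3) {η : ℕ → ℝ} (h0 : ∀ n, 0 < η n)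
    (hη : Filter.Tendsto η Filter.atTop (𝓝 0)) :
    Filter.Tendsto (fun n => Cv (φ (η n)) f p) Filter.atTop (𝓝 (f p)) := by
  rw [Metric.tendsto_atTop]
  intro ε hε
  have hc := cont_shift hf p
  obtain ⟨r, hr, H⟩ := Metric.continuous_iff.1 hc 0 (ε / 2) (by linarith)
  obtain ⟨N, hN⟩ := (Metric.tendsto_atTop.1 hη) r hr
  refine ⟨N, fun n hn => ?_⟩
  rw [dist_eq_norm]
  refine lt_of_le_of_lt ((avg_phi (h0 n)).norm_sub_le hf p (f p) (ε := ε / 2) fun y hy => ?_)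
    (by linarith)
  have h1 := hN n hn
  rw [Real.dist_0_eq_abs, abs_of_pos (h0 n)] at h1
  have := (H y (by rw [dist_zero_right]; linarith)).le
  simpa [dist_eq_norm] using this

lemma tendsto_cv_phi_cv_phi (hf : Sm f) (p : ℝ × E3) {η : ℕ → ℝ} (h0 : ∀ n, 0 < η n)
    (hη : Filter.Tendsto η Filter.atTop (𝓝 0)) :
    Filter.Tendsto (fun n => Cv (φ (η n)) (Cv (φ (η n)) f) p) Filter.atTop (𝓝 (f p)) := by
  rw [Metric.tendsto_atTop]
  intro ε hε
  have hc := cont_shift hf.continuous p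
  obtain ⟨r, hr, H⟩ := Metric.continuous_iff.1 hc 0 (ε / 2) (by linarith)
  obtain ⟨N, hN⟩ := (Metric.tendsto_atTop.1 hη) (r / 2) (by linarith)
  refine ⟨N, fun n hn => ?_⟩
  rw [dist_eq_norm]
  have hA := avg_phi (h0 n)
  have h1 := hN n hn
  rw [Real.dist_0_eq_abs, abs_of_pos (h0 n)] at h1
  refine lt_of_le_of_lt (hA.norm_sub_le (hf.cv hA.toMol).continuous p (f p) (ε := ε / 2)
    fun y hy => hA.norm_sub_le hf.continuous _ (f p) fun z hz => ?_) (by linarith)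
  have := (H (y + z) (by
    rw [dist_zero_right]
    exact (norm_add_le _ _).trans_lt (by linarith))).le
  simpa [dist_eq_norm, sub_sub] using this

/-- Jensen's inequality for averages. -/
lemma Avg.enorm_sq_le {h : ℝ} (hΦ : Avg h Φ) (hf : Continuous f) (p : ℝ × E3) :
    ‖Cv Φ f p‖ₑ ^ 2 ≤ ∫⁻ y, ‖Φ y‖ₑ * ‖f (p.1, p.2 - y)‖ₑ ^ 2 := by
  have hs := cont_shift hf p
  calc ‖Cv Φ f p‖ₑ ^ 2 ≤ (∫⁻ y, ‖Φ y‖ₑ * ‖f (p.1, p.2 - y)‖ₑ) ^ 2 := by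
        gcongr; exact enorm_cv_le f p
    _ ≤ (∫⁻ y, ‖Φ y‖ₑ) * ∫⁻ y, ‖Φ y‖ₑ * ‖f (p.1, p.2 - y)‖ₑ ^ 2 :=
        lintegral_mul_sq_le hΦ.sm.continuous.enorm.measurable.aemeasurable
          hs.enorm.measurable.aemeasurable
    _ = _ := by rw [hΦ.toMol.lintegral, hΦ.abs]; simp

end moll

section near

variable {w d : ℝ × E3 → ℂ} {h t : ℝ}

lemma kg_near (hh : 0 < h) {θ : Fin 3 → ℝ} (hθ : ∀ j, θ j * θ j = θ j) (hθ1 : ∀ j, θ j ≤ 1) {z : E3}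
    (hz : ‖z‖ ≤ 2 * h) : 1 / (3 * h) ≤ kg θ h z := by
  have h1 := kg_sq hh hθ z
  have h2 := kg_pos hh hθ z
  have h3 : ∑ k, θ k * z k ^ 2 ≤ ‖z‖ ^ 2 := by
    rw [EuclideanSpace.norm_sq_eq]
    refine Finset.sum_le_sum fun i _ => ?_
    rw [Real.norm_eq_abs, sq_abs]
    nlinarith [hθ1 i, sq_nonneg (z i)]
  have h4 : h ^ 2 + ∑ k, θ k * z k ^ 2 ≤ (3 * h) ^ 2 := by nlinarith [norm_nonneg z]
  rw [div_le_iff₀ (by positivity)]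
  by_contra hlt
  push Not at hlt
  have h5 : kg θ h z ^ 2 * (h ^ 2 + ∑ k, θ k * z k ^ 2) ≤ kg θ h z ^ 2 * (3 * h) ^ 2 := by gcongr
  nlinarith [mul_pos h2 (by linarith : 0 < 3 * h)]

/-- The isotropic interaction kernel. -/
def kap (h : ℝ) (z : E3) : ℝ := 15 * h ^ 4 * kg (fun _ => 1) h z ^ 7

/-- The planar interaction kernel. -/
def pla (i : Fin 3) (h : ℝ) (z : E3) : ℝ := h ^ 2 * kg (fun j => if j = i then 1 else 0) h z ^ 3

lemma kap_near (hh : 0 < h) {z : E3} (hz : ‖z‖ ≤ 2 * h) : 1 / h ^ 3 ≤ 146 * kap h z := by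
  have := kg_near (θ := fun _ => 1) hh (by simp) (by simp) hz
  calc 1 / h ^ 3 ≤ 146 * (15 * h ^ 4 * (1 / (3 * h)) ^ 7) := by
        rw [show 146 * (15 * h ^ 4 * (1 / (3 * h)) ^ 7) = (2190 / 2187) * (1 / h ^ 3) by
          field_simp; norm_num]
        have : 0 < 1 / h ^ 3 := by positivity
        linarith
    _ ≤ _ := by unfold kap; gcongr

lemma pla_near (hh : 0 < h) (i : Fin 3) {z : E3} (hz : ‖z‖ ≤ 2 * h) : 1 / h ≤ 27 * pla i h z := by
  have := kg_near (θ := fun j => if j = i then 1 else 0) hh (by intro j; split_ifs <;> simp)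
    (by intro j; split_ifs <;> simp) hz
  calc 1 / h = 27 * (h ^ 2 * (1 / (3 * h)) ^ 3) := by field_simp; norm_num
    _ ≤ _ := by unfold pla; gcongr

lemma continuous_kap (hh : 0 < h) : Continuous (kap h) :=
  continuous_const.mul ((continuous_kg hh (by simp)).pow 7)

lemma continuous_pla (hh : 0 < h) (i : Fin 3) : Continuous (pla i h) :=
  continuous_const.mul ((continuous_kg hh (by intro j; split_ifs <;> simp)).pow 3)

/-- Weighted interaction density. -/
def Bq (h : ℝ) (w p : ℝ × E3 → ℂ) (t : ℝ) : ℝ≥0∞ :=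
  ∫⁻ z : E6, ENNReal.ofReal (kap h (z.1 - z.2)) * (‖w (t, z.1)‖ₑ ^ 2 * ‖p (t, z.2)‖ₑ ^ 2)

/-- Planar interaction density. -/
def Pq (i : Fin 3) (h : ℝ) (w p : ℝ × E3 → ℂ) (t : ℝ) : ℝ≥0∞ :=
  ∫⁻ z : E6, ENNReal.ofReal (pla i h (z.1 - z.2)) *
    ‖sd (e3 i) w (t, z.1) * (starRingEnd ℂ) (p (t, z.2)) +
      w (t, z.1) * (starRingEnd ℂ) (sd (e3 i) p (t, z.2))‖ₑ ^ 2

lemma enorm_phi (hh : 0 < h) (y : E3) : ‖φ h y‖ₑ = ENNReal.ofReal (φ h y) := by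
  rw [← ofReal_norm, Real.norm_of_nonneg ((avg_phi hh).nonneg y)]

lemma phi_jensen (hh : 0 < h) (hd : Continuous d) (x : E3) :
    ‖Cv (φ h) d (t, x)‖ₑ ^ 2 ≤ ∫⁻ y, ENNReal.ofReal (φ h (x - y)) * ‖d (t, y)‖ₑ ^ 2 := by
  refine ((avg_phi hh).enorm_sq_le hd (t, x)).trans (le_of_eq ?_)
  rw [← lintegral_sub_left_eq_self _ x]
  refine lintegral_congr fun y => ?_
  rw [enorm_phi hh]
  simp

lemma phi_pow_four (hh : 0 < h) (hd : Continuous d) (x : E3) :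
    ‖Cv (φ h) d (t, x)‖ₑ ^ 4 ≤ ENNReal.ofReal (146 * Cφ ^ 2 / h ^ 3) * Bq h d d t := by
  have hm : Measurable fun y => ENNReal.ofReal (φ h (x - y)) * ‖d (t, y)‖ₑ ^ 2 := by
    have hφ : Continuous (φ h) := (avg_phi hh).sm.continuous
    have h1 : Continuous fun y => φ h (x - y) := hφ.comp (by fun_prop)
    have h2 : Continuous fun y => d (t, y) := hd.comp (by fun_prop)
    exact h1.measurable.ennreal_ofReal.mul (h2.measurable.enorm.pow_const 2)
  have hk := continuous_kap hh
  have hC := one_le_Cφ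
  calc ‖Cv (φ h) d (t, x)‖ₑ ^ 4 = ‖Cv (φ h) d (t, x)‖ₑ ^ 2 * ‖Cv (φ h) d (t, x)‖ₑ ^ 2 := by ring
    _ ≤ (∫⁻ y, ENNReal.ofReal (φ h (x - y)) * ‖d (t, y)‖ₑ ^ 2) *
        ∫⁻ y, ENNReal.ofReal (φ h (x - y)) * ‖d (t, y)‖ₑ ^ 2 :=
        mul_le_mul' (phi_jensen hh hd x) (phi_jensen hh hd x)
    _ = ∫⁻ z : E6, (ENNReal.ofReal (φ h (x - z.1)) * ‖d (t, z.1)‖ₑ ^ 2) *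
        (ENNReal.ofReal (φ h (x - z.2)) * ‖d (t, z.2)‖ₑ ^ 2) := by
        rw [Measure.volume_eq_prod, lintegral_prod_mul hm.aemeasurable hm.aemeasurable]
    _ ≤ ∫⁻ z : E6, ENNReal.ofReal (146 * Cφ ^ 2 / h ^ 3) * (ENNReal.ofReal (kap h (z.1 - z.2)) *
        (‖d (t, z.1)‖ₑ ^ 2 * ‖d (t, z.2)‖ₑ ^ 2)) := by
        refine lintegral_mono fun z => ?_
        rw [mul_mul_mul_comm, ← mul_assoc (ENNReal.ofReal (146 * Cφ ^ 2 / h ^ 3)),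
          ← ENNReal.ofReal_mul ((avg_phi hh).nonneg _), ← ENNReal.ofReal_mul (by positivity)]
        gcongr ENNReal.ofReal ?_ * _
        by_cases h1 : ‖x - z.1‖ ≤ h
        · by_cases h2 : ‖x - z.2‖ ≤ h
          · have h3 : ‖z.1 - z.2‖ ≤ 2 * h := by
              have : z.1 - z.2 = (x - z.2) - (x - z.1) := by abel
              rw [this]
              exact (norm_sub_le _ _).trans (by linarith)
            have h4 := kap_near hh h3
            calc φ h (x - z.1) * φ h (x - z.2) ≤ (Cφ / h ^ 3) * (Cφ / h ^ 3) :=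
                  mul_le_mul (phi_le hh _) (phi_le hh _) ((avg_phi hh).nonneg _) (by positivity)
              _ = (Cφ ^ 2 / h ^ 3) * (1 / h ^ 3) := by ring
              _ ≤ (Cφ ^ 2 / h ^ 3) * (146 * kap h (z.1 - z.2)) := by gcongr
              _ = _ := by ring
          · rw [(avg_phi hh).supp _ (not_le.1 h2), mul_zero]
            have := kg_pos (θ := fun _ => 1) hh (by simp) (z.1 - z.2)
            unfold kap; positivity
        · rw [(avg_phi hh).supp _ (not_le.1 h1), zero_mul]
          have := kg_pos (θ := fun _ => 1) hh (by simp) (z.1 - z.2)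
          unfold kap; positivity
    _ = _ := by
        rw [lintegral_const_mul]
        · rfl
        · have h1 : Continuous fun z : E6 => kap h (z.1 - z.2) := hk.comp (by fun_prop)
          have h2 : Continuous fun z : E6 => d (t, z.1) := hd.comp (by fun_prop)
          have h3 : Continuous fun z : E6 => d (t, z.2) := hd.comp (by fun_prop)
          exact h1.measurable.ennreal_ofReal.mul
            ((h2.measurable.enorm.pow_const 2).mul (h3.measurable.enorm.pow_const 2))

lemma phi_mul_le (hh : 0 < h) (i : Fin 3) (hw : Sm w) (hd : Sm d) :
    ∫⁻ x, (‖Cv (φ h) d (t, x)‖ₑ * ‖sd (e3 i) w (t, x)‖ₑ) ^ 2 ≤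
      ENNReal.ofReal (54 * Cφ / h ^ 2) * Pq i h w d t +
      ENNReal.ofReal (292 * Cφ) * Bq h w (sd (e3 i) d) t := by
  have hφ : Continuous (φ h) := (avg_phi hh).sm.continuous
  have c0 := hw.continuous
  have c1 : Continuous (sd (e3 i) w) := (hw.dd ((0 : ℝ), e3 i)).continuous
  have c2 := hd.continuous
  have c3 : Continuous (sd (e3 i) d) := (hd.dd ((0 : ℝ), e3 i)).continuous
  have hk := continuous_kap hh
  have hp := continuous_pla hh i
  have hC := one_le_Cφ
  have hconj := Complex.continuous_conj
  have m1 : Measurable fun z : E6 => ENNReal.ofReal (φ h (z.1 - z.2)) :=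
    (hφ.comp (by fun_prop)).measurable.ennreal_ofReal
  have m2 : Measurable fun z : E6 => ENNReal.ofReal (kap h (z.1 - z.2)) :=
    (hk.comp (by fun_prop)).measurable.ennreal_ofReal
  have m3 : Measurable fun z : E6 => ENNReal.ofReal (pla i h (z.1 - z.2)) :=
    (hp.comp (by fun_prop)).measurable.ennreal_ofReal
  have d1 : Measurable fun z : E6 => ‖w (t, z.1)‖ₑ := (c0.comp (by fun_prop)).measurable.enorm
  have d2 : Measurable fun z : E6 => ‖sd (e3 i) w (t, z.1)‖ₑ :=
    (c1.comp (by fun_prop)).measurable.enorm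
  have d3 : Measurable fun z : E6 => ‖d (t, z.2)‖ₑ := (c2.comp (by fun_prop)).measurable.enorm
  have d4 : Measurable fun z : E6 => ‖sd (e3 i) d (t, z.2)‖ₑ :=
    (c3.comp (by fun_prop)).measurable.enorm
  have d5 : Measurable fun z : E6 => ‖sd (e3 i) w (t, z.1) * (starRingEnd ℂ) (d (t, z.2)) +
      w (t, z.1) * (starRingEnd ℂ) (sd (e3 i) d (t, z.2))‖ₑ :=
    (((c1.comp (by fun_prop)).mul (hconj.comp (c2.comp (by fun_prop)))).add
      ((c0.comp (by fun_prop)).mul (hconj.comp (c3.comp (by fun_prop))))).measurable.enorm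
  have d6 : ∀ x, Measurable fun y => ENNReal.ofReal (φ h (x - y)) * ‖d (t, y)‖ₑ ^ 2 := fun x =>
    (m1.mul (d3.pow_const 2)).comp (measurable_prodMk_left (x := x))
  calc ∫⁻ x, (‖Cv (φ h) d (t, x)‖ₑ * ‖sd (e3 i) w (t, x)‖ₑ) ^ 2
      ≤ ∫⁻ x, ∫⁻ y, ENNReal.ofReal (φ h (x - y)) *
          (‖d (t, y)‖ₑ * ‖sd (e3 i) w (t, x)‖ₑ) ^ 2 := by
        refine lintegral_mono fun x => ?_
        simp only [mul_pow, ← mul_assoc]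
        rw [lintegral_mul_const _ (d6 x)]
        gcongr
        exact phi_jensen hh c2 x
    _ = ∫⁻ z : E6, ENNReal.ofReal (φ h (z.1 - z.2)) *
          (‖d (t, z.2)‖ₑ * ‖sd (e3 i) w (t, z.1)‖ₑ) ^ 2 := by
        rw [Measure.volume_eq_prod, lintegral_prod]
        exact (m1.mul ((d3.mul d2).pow_const 2)).aemeasurable
    _ ≤ ∫⁻ z : E6, (ENNReal.ofReal (54 * Cφ / h ^ 2) * (ENNReal.ofReal (pla i h (z.1 - z.2)) *
          ‖sd (e3 i) w (t, z.1) * (starRingEnd ℂ) (d (t, z.2)) +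
          w (t, z.1) * (starRingEnd ℂ) (sd (e3 i) d (t, z.2))‖ₑ ^ 2) +
          ENNReal.ofReal (292 * Cφ) * (ENNReal.ofReal (kap h (z.1 - z.2)) *
          (‖w (t, z.1)‖ₑ ^ 2 * ‖sd (e3 i) d (t, z.2)‖ₑ ^ 2))) := by
        refine lintegral_mono fun z => ?_
        by_cases h1 : ‖z.1 - z.2‖ ≤ h
        swap
        · rw [(avg_phi hh).supp _ (not_le.1 h1)]
          simp
        have p1 := pla_near hh i (by linarith : ‖z.1 - z.2‖ ≤ 2 * h)
        have p2 := kap_near hh (by linarith : ‖z.1 - z.2‖ ≤ 2 * h)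
        have p3 := phi_le hh (z.1 - z.2)
        have p4 := (avg_phi hh).nonneg (z.1 - z.2)
        have p5 : φ h (z.1 - z.2) * 2 ≤ 54 * Cφ / h ^ 2 * pla i h (z.1 - z.2) := by
          calc φ h (z.1 - z.2) * 2 ≤ Cφ / h ^ 3 * 2 := by gcongr
            _ = 2 * Cφ / h ^ 2 * (1 / h) := by field_simp
            _ ≤ 2 * Cφ / h ^ 2 * (27 * pla i h (z.1 - z.2)) := by gcongr
            _ = _ := by ring
        have p6 : φ h (z.1 - z.2) * 2 ≤ 292 * Cφ * kap h (z.1 - z.2) := by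
          calc φ h (z.1 - z.2) * 2 ≤ Cφ / h ^ 3 * 2 := by gcongr
            _ = 2 * Cφ * (1 / h ^ 3) := by field_simp
            _ ≤ 2 * Cφ * (146 * kap h (z.1 - z.2)) := by gcongr
            _ = _ := by ring
        set A := sd (e3 i) w (t, z.1) * (starRingEnd ℂ) (d (t, z.2))
        set A' := w (t, z.1) * (starRingEnd ℂ) (sd (e3 i) d (t, z.2))
        have e1 : ‖d (t, z.2)‖ₑ * ‖sd (e3 i) w (t, z.1)‖ₑ = ENNReal.ofReal ‖A‖ := by
          rw [ofReal_norm, enorm_mul, mul_comm, ← ofReal_norm (starRingEnd ℂ _), RCLike.norm_conj,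
            ofReal_norm]
        have e2 : ‖w (t, z.1)‖ₑ ^ 2 * ‖sd (e3 i) d (t, z.2)‖ₑ ^ 2 = ENNReal.ofReal ‖A'‖ ^ 2 := by
          rw [ofReal_norm, enorm_mul, mul_pow, ← ofReal_norm (starRingEnd ℂ _), RCLike.norm_conj,
            ofReal_norm]
        rw [e1, e2, ← ofReal_norm (A + A')]
        have k1 : 0 ≤ pla i h (z.1 - z.2) := by
          have : 0 < 1 / h := by positivity
          linarith
        have k2 : 0 ≤ kap h (z.1 - z.2) := by
          have : 0 < 1 / h ^ 3 := by positivity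
          linarith
        simp only [← ENNReal.ofReal_pow (norm_nonneg _)]
        rw [← ENNReal.ofReal_mul p4, ← ENNReal.ofReal_mul k1, ← ENNReal.ofReal_mul k2,
          ← ENNReal.ofReal_mul (by positivity), ← ENNReal.ofReal_mul (by positivity),
          ← ENNReal.ofReal_add (by positivity) (by positivity)]
        refine ENNReal.ofReal_le_ofReal ?_
        have q : ‖A‖ ^ 2 ≤ 2 * ‖A + A'‖ ^ 2 + 2 * ‖A'‖ ^ 2 := by
          have : ‖A‖ ≤ ‖A + A'‖ + ‖A'‖ := by
            have := norm_sub_le (A + A') A'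
            rwa [add_sub_cancel_right] at this
          nlinarith [norm_nonneg A, sq_nonneg (‖A + A'‖ - ‖A'‖)]
        nlinarith [mul_le_mul_of_nonneg_left q p4,
          mul_le_mul_of_nonneg_right p5 (sq_nonneg ‖A + A'‖),
          mul_le_mul_of_nonneg_right p6 (sq_nonneg ‖A'‖)]
    _ = _ := by
        have q1 := m3.mul (d5.pow_const 2)
        have q2 := m2.mul ((d1.pow_const 2).mul (d4.pow_const 2))
        refine (lintegral_add_left (q1.const_mul _) _).trans ?_
        exact congrArg₂ _ (lintegral_const_mul _ q1) (lintegral_const_mul _ q2)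

end near

section words
variable {f g : ℝ × E3 → ℂ}

/-- Iterated partial derivatives along a word of coordinate directions. -/
def Dw : List (Fin 3) → (ℝ × E3 → ℂ) → ℝ × E3 → ℂ
  | [], f => f
  | i :: σ, f => sd (e3 i) (Dw σ f)

lemma Sm.dw (hf : Sm f) (σ : List (Fin 3)) : Sm (Dw σ f) := by
  induction σ with
  | nil => exact hf
  | cons i σ ih => exact ih.dd _

lemma src3_dw (hf : Sm f) (σ : List (Fin 3)) : Dw σ (src3 f) = src3 (Dw σ f) := by
  induction σ with
  | nil => rfl
  | cons i σ ih => simp only [Dw, ih]; exact dd_src (hf.dw σ) _ _ _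

end words

section pieces
variable {f g : ℝ × E3 → ℂ} {Ψ Φ : E3 → ℝ} {h t a b A0 A1 A2 : ℝ} {l : ℝ → ℝ}

/-- Frequency-localised convolution kernels at scale `h`. -/
structure IsPc (h : ℝ) (Ψ : E3 → ℝ) : Prop extends Mol Ψ where
  nn : 0 ≤ h
  l2 : ∀ {f : ℝ × E3 → ℂ} {t c : ℝ}, Sm f → 0 ≤ c → LB (sl f t) c → LB (sl (Cv Ψ f) t) (2 * c)
  gain : ∀ {f : ℝ × E3 → ℂ} {t c c1 : ℝ}, Sm f → 0 ≤ c → 0 ≤ c1 → LB (sl f t) c →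
    (∀ i, LB (sl (sd (e3 i) f) t) c1) → LB (sl (Cv Ψ f) t) (6 * h * (c + c1))

lemma isPc_phi_one : IsPc 1 (φ 1) where
  toMol := (avg_phi one_pos).toMol
  nn := zero_le_one
  l2 hf hc h := (h.cv (avg_phi one_pos).toMol (avg_phi one_pos).abs.le hf hc).mono (by linarith)
  gain hf hc hc1 h _ :=
    (h.cv (avg_phi one_pos).toMol (avg_phi one_pos).abs.le hf hc).mono (by linarith)

lemma isPc_sub {h' : ℝ} (hh' : 0 < h') (hh : h' ≤ h) : IsPc h fun y => φ h' y - φ h y where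
  toMol := (avg_phi hh').toMol.sub (avg_phi (hh'.trans_le hh)).toMol
  nn := hh'.le.trans hh
  l2 := by
    intro f t c hf hc h0
    have p := avg_phi hh'
    have q := avg_phi (hh'.trans_le hh)
    rw [cv_sub_left p.toMol q.toMol hf.continuous]
    exact ((h0.cv p.toMol p.abs.le hf hc).sub (h0.cv q.toMol q.abs.le hf hc) (by linarith)
      (by linarith)).mono (by linarith)
  gain := by
    intro f t c c1 hf hc hc1 h0 h1
    have p := avg_phi hh'
    have q := avg_phi (hh'.trans_le hh)
    rw [cv_sub_left p.toMol q.toMol hf.continuous]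
    have e := (p.lb_sub hh'.le hf hc1 h1).sub (q.lb_sub (hh'.le.trans hh) hf hc1 h1)
      (by positivity) (by have := hh'.le.trans hh; positivity)
    have e2 : sl (fun p => Cv (φ h') f p - Cv (φ h) f p) t = fun x =>
      sl (fun p => Cv (φ h') f p - f p) t x - sl (fun p => Cv (φ h) f p - f p) t x := by
      funext x; simp [sl]
    rw [e2]
    refine e.mono ?_
    have : h' * c1 ≤ h * c1 := by gcongr
    have : 0 ≤ h * c := mul_nonneg (hh'.le.trans hh) hc
    nlinarith

lemma Num.pc (hn : Num a b f A0 A1 l) (hf : Sm f) (hl : ∀ t, 0 ≤ l t) (hΨ : IsPc h Ψ) :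
    Num a b (Cv Ψ f) (2 * A0) (2 * A1) l where
  n0 := by have := hn.n0; positivity
  n1 := by have := hn.n1; positivity
  q0 t ht := hΨ.l2 hf hn.n0 (hn.q0 t ht)
  q1 t ht j := by
    rw [sd, dd_cv hΨ.toMol hf]
    exact hΨ.l2 (hf.dd _) hn.n1 (hn.q1 t ht j)
  q2 t ht := by
    rw [src3_cv hΨ.toMol hf, mul_assoc]
    exact hΨ.l2 (hf.src _ _) (mul_nonneg hn.n0 (hl t)) (hn.q2 t ht)
  q3 t ht j := by
    rw [src3_cv hΨ.toMol hf, sd, dd_cv hΨ.toMol (hf.src _ _), mul_assoc]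
    exact hΨ.l2 ((hf.src _ _).dd _) (mul_nonneg hn.n1 (hl t)) (hn.q3 t ht j)

lemma Num.pc_gain (hn : Num a b f A0 A1 l) (hf : Sm f) (hl : ∀ t, 0 ≤ l t) (hΨ : IsPc h Ψ) :
    Num a b (Cv Ψ f) (6 * h * (A0 + A1)) (2 * A1) l where
  n0 := by have := hn.n0; have := hn.n1; have := hΨ.nn; positivity
  n1 := by have := hn.n1; positivity
  q0 t ht := hΨ.gain hf hn.n0 hn.n1 (hn.q0 t ht) (hn.q1 t ht)
  q1 := (hn.pc hf hl hΨ).q1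
  q2 t ht := by
    rw [src3_cv hΨ.toMol hf, mul_assoc, add_mul]
    exact hΨ.gain (hf.src _ _) (mul_nonneg hn.n0 (hl t)) (mul_nonneg hn.n1 (hl t)) (hn.q2 t ht)
      (hn.q3 t ht)
  q3 := (hn.pc hf hl hΨ).q3

lemma Num.pc_gain₂ (hn : Num a b f A0 A1 l) (hn' : ∀ i, Num a b (sd (e3 i) f) A1 A2 l)
    (hf : Sm f) (hl : ∀ t, 0 ≤ l t) (hΨ : IsPc h Ψ) :
    Num a b (Cv Ψ f) (6 * h * (A0 + A1)) (6 * h * (A1 + A2)) l where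
  n0 := (hn.pc_gain hf hl hΨ).n0
  n1 := ((hn' 0).pc_gain (hf.dd _) hl hΨ).n0
  q0 := (hn.pc_gain hf hl hΨ).q0
  q1 t ht j := by
    rw [sd, dd_cv hΨ.toMol hf]
    exact ((hn' j).pc_gain (hf.dd _) hl hΨ).q0 t ht
  q2 := (hn.pc_gain hf hl hΨ).q2
  q3 t ht j := by
    have := ((hn' j).pc_gain (hf.dd _) hl hΨ).q2 t ht
    rwa [← dd_cv hΨ.toMol hf, src3, ← dd_src (hf.cv hΨ.toMol)] at this

lemma Num.avg (hn : Num a b f A0 A1 l) (hf : Sm f) (hl : ∀ t, 0 ≤ l t) (hΦ : Avg h Φ) :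
    Num a b (Cv Φ f) A0 A1 l where
  n0 := hn.n0
  n1 := hn.n1
  q0 t ht := by simpa using (hn.q0 t ht).cv hΦ.toMol hΦ.abs.le hf hn.n0
  q1 t ht j := by
    rw [sd, dd_cv hΦ.toMol hf]
    simpa using (hn.q1 t ht j).cv hΦ.toMol hΦ.abs.le (hf.dd _) hn.n1
  q2 t ht := by
    rw [src3_cv hΦ.toMol hf]
    rw [← one_mul (A0 * l t)]
    exact (hn.q2 t ht).cv hΦ.toMol hΦ.abs.le (hf.src _ _) (mul_nonneg hn.n0 (hl t))
  q3 t ht j := by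
    rw [src3_cv hΦ.toMol hf, sd, dd_cv hΦ.toMol (hf.src _ _)]
    rw [← one_mul (A1 * l t)]
    exact (hn.q3 t ht j).cv hΦ.toMol hΦ.abs.le ((hf.src _ _).dd _) (mul_nonneg hn.n1 (hl t))

/-- Outer scales of the dyadic-type decomposition with ratio `E`. -/
def osc (E : ℝ) : ℕ → ℝ
  | 0 => 1
  | n + 1 => (E ^ (n / 2 + n % 2))⁻¹

/-- Inner scales. -/
def isc (E : ℝ) : ℕ → ℝ
  | 0 => 1
  | n + 1 => (E ^ (n / 2))⁻¹

/-- Kernels of the decomposition. -/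
def psi (E : ℝ) : ℕ → E3 → ℝ
  | 0 => φ 1
  | n + 1 => fun y => φ (E ^ (n / 2 + 1))⁻¹ y - φ (E ^ (n / 2))⁻¹ y

variable {E : ℝ}

lemma osc_pos (hE : 1 ≤ E) (n : ℕ) : 0 < osc E n := by
  have : 0 < E := by linarith
  cases n <;> simp only [osc] <;> positivity

lemma isc_pos (hE : 1 ≤ E) (n : ℕ) : 0 < isc E n := by
  have : 0 < E := by linarith
  cases n <;> simp only [isc] <;> positivity

lemma isc_le (hE : 1 ≤ E) (n : ℕ) : isc E n ≤ E * osc E n := by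
  have h0 : 0 < E := by linarith
  cases n with
  | zero => simpa [isc, osc]
  | succ n =>
    simp only [isc, osc, pow_add, mul_inv]
    have h1 : 1 ≤ E * (E ^ (n % 2))⁻¹ := by
      rw [← div_eq_mul_inv, one_le_div (by positivity)]
      calc E ^ (n % 2) ≤ E ^ 1 := pow_le_pow_right₀ hE (by omega)
        _ = E := pow_one E
    have h2 : 0 < (E ^ (n / 2))⁻¹ := by positivity
    nlinarith

lemma isPc_psi (hE : 1 ≤ E) (n : ℕ) : IsPc (isc E n) (psi E n) := by
  have h0 : 0 < E := by linarith
  cases n with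
  | zero => exact isPc_phi_one
  | succ n =>
    refine isPc_sub (by positivity) ?_
    exact inv_anti₀ (by positivity) (pow_le_pow_right₀ hE (by omega))

lemma norm_le_decomp (hE : 1 ≤ E) (hf : Sm f) (p : ℝ × E3) (J : ℕ) :
    ‖f p‖ ≤ (∑ n ∈ Finset.range (2 * J + 1), ‖Cv (φ (osc E n)) (Cv (psi E n) f) p‖) +
      ‖f p - Cv (φ (E ^ J)⁻¹) (Cv (φ (E ^ J)⁻¹) f) p‖ := by
  have h0 : 0 < E := by linarith
  induction J with
  | zero =>
    simp only [mul_zero, zero_add, Finset.sum_range_one, osc, psi, pow_zero, inv_one]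
    simpa using norm_add_le (Cv (φ 1) (Cv (φ 1) f) p) (f p - Cv (φ 1) (Cv (φ 1) f) p)
  | succ J ih =>
    refine ih.trans ?_
    rw [show 2 * (J + 1) + 1 = 2 * J + 1 + 1 + 1 by ring, Finset.sum_range_succ _ (2 * J + 1 + 1),
      Finset.sum_range_succ _ (2 * J + 1), add_assoc, add_assoc]
    refine add_le_add le_rfl ?_
    have m0 : Mol (φ (E ^ J)⁻¹) := (avg_phi (by positivity)).toMol
    have m1 : Mol (φ (E ^ (J + 1))⁻¹) := (avg_phi (by positivity)).toMol
    have e1 : osc E (2 * J + 1) = (E ^ J)⁻¹ := by simp [osc]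
    have e2 : osc E (2 * J + 1 + 1) = (E ^ (J + 1))⁻¹ := by
      simp only [osc]; congr 2; omega
    have e3 : psi E (2 * J + 1) = fun y => φ (E ^ (J + 1))⁻¹ y - φ (E ^ J)⁻¹ y := by simp [psi]
    have e4 : psi E (2 * J + 1 + 1) = fun y => φ (E ^ (J + 1))⁻¹ y - φ (E ^ J)⁻¹ y := by
      simp only [psi]; rw [show (2 * J + 1) / 2 = J by omega]
    have c0 := (hf.cv m0).continuous
    have c1 := (hf.cv m1).continuous
    rw [e1, e2, e3, e4, cv_sub_left m1 m0 hf.continuous, cv_sub m1 c1 c0, cv_sub m0 c1 c0,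
      cv_comm m1 m0 hf.continuous]
    set x := Cv (φ (E ^ J)⁻¹) (Cv (φ (E ^ J)⁻¹) f) p
    set y := Cv (φ (E ^ J)⁻¹) (Cv (φ (E ^ (J + 1))⁻¹) f) p
    set z := Cv (φ (E ^ (J + 1))⁻¹) (Cv (φ (E ^ (J + 1))⁻¹) f) p
    calc ‖f p - x‖ = ‖(y - x) + ((z - y) + (f p - z))‖ := by congr 1; ring
      _ ≤ _ := (norm_add_le _ _).trans (by gcongr; exact norm_add_le _ _)

end pieces

section trilinear
variable {W : E3 → ℝ} {f g e F F' : E3 → ℂ} {om c : ℝ}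

/-- Convolution of an integrable weight with a bounded function. -/
def Wc (W : E3 → ℝ) (F : E3 → ℂ) : E3 → ℂ := fun x => ∫ z, W z • F (x - z)

/-- Trilinear form underlying the nonlinearity. -/
def Tr (W : E3 → ℝ) (f g e : E3 → ℂ) : E3 → ℂ :=
  fun x => Wc W (fun y => f y * (starRingEnd ℂ) (g y)) x * e x

/-- Smooth with bounded gradient. -/
def Bf (f : E3 → ℂ) : Prop := Sm f ∧ ∃ C, ∀ x, ‖f x‖ ≤ C ∧ ‖fderiv ℝ f x‖ ≤ C

lemma wc_integrable (hW : Integrable W) (hF : Continuous F) {C : ℝ} (hC : ∀ x, ‖F x‖ ≤ C) (x : E3) :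
    Integrable fun z => W z • F (x - z) :=
  hW.smul_bdd (C := C) (hF.comp (by fun_prop : Continuous fun z => x - z)).aestronglyMeasurable
    (Filter.Eventually.of_forall fun z => hC _)

lemma Bf.hasFDerivAt (hW : Integrable W) (hF : Bf F) (x : E3) :
    HasFDerivAt (Wc W F) (∫ z, W z • fderiv ℝ F (x - z)) x := by
  obtain ⟨sF, C, hC⟩ := hF
  have cF : Continuous (fderiv ℝ F) := ContDiff.continuous_fderiv sF (by simp)
  refine hasFDerivAt_integral_of_dominated_of_fderiv_le (s := univ)
    (F' := fun x z => W z • fderiv ℝ F (x - z)) (bound := fun z => |W z| * C)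
    Filter.univ_mem ?_ ?_ ?_ ?_ ?_ ?_
  · exact Filter.Eventually.of_forall fun x =>
      (wc_integrable hW sF.continuous (fun x => (hC x).1) x).aestronglyMeasurable
  · exact wc_integrable hW sF.continuous (fun x => (hC x).1) x
  · exact hW.1.smul (cF.comp (by fun_prop)).aestronglyMeasurable
  · refine Filter.Eventually.of_forall fun z y _ => ?_
    rw [norm_smul, Real.norm_eq_abs]
    exact mul_le_mul_of_nonneg_left (hC _).2 (abs_nonneg _)
  · exact hW.abs.mul_const C
  · refine Filter.Eventually.of_forall fun z y _ => ?_
    have h1 : HasFDerivAt (fun y => F (y - z)) (fderiv ℝ F (y - z)) y := by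
      have := (sF.differentiable (y - z)).hasFDerivAt
      exact this.comp y ((hasFDerivAt_id y).sub_const z)
    exact h1.const_smul (W z)

lemma Bf.dd_wc (hW : Integrable W) (hF : Bf F) (v : E3) : dd v (Wc W F) = Wc W (dd v F) := by
  funext x
  have cF : Continuous (fderiv ℝ F) := ContDiff.continuous_fderiv hF.1 (by simp)
  obtain ⟨C, hC⟩ := hF.2
  rw [dd, (hF.hasFDerivAt hW x).fderiv, ContinuousLinearMap.integral_apply]
  · rfl
  · exact hW.smul_bdd (C := C) (cF.comp (by fun_prop : Continuous fun z => x - z)).aestronglyMeasurable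
      (Filter.Eventually.of_forall fun z => (hC _).2)

lemma Bf.conj (hf : Bf f) : Bf fun x => (starRingEnd ℂ) (f x) := by
  obtain ⟨sf, C, hC⟩ := hf
  refine ⟨sf.conj, C, fun x => ⟨by simpa using (hC x).1, ?_⟩⟩
  refine ContinuousLinearMap.opNorm_le_bound _ ((norm_nonneg _).trans (hC x).1) fun v => ?_
  have : fderiv ℝ (fun x => (starRingEnd ℂ) (f x)) x v = (starRingEnd ℂ) (fderiv ℝ f x v) :=
    congrFun (dd_conj sf v) x
  rw [this, RCLike.norm_conj]
  exact (ContinuousLinearMap.le_opNorm _ _).trans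
    (mul_le_mul_of_nonneg_right (hC x).2 (norm_nonneg _))

lemma Bf.mul (hf : Bf f) (hg : Bf g) : Bf fun x => f x * g x := by
  obtain ⟨sf, C, hC⟩ := hf
  obtain ⟨sg, C', hC'⟩ := hg
  have h0 := (norm_nonneg _).trans (hC 0).1
  have h0' := (norm_nonneg _).trans (hC' 0).1
  refine ⟨sf.mul sg, C * C' + C * C', fun x => ⟨?_, ?_⟩⟩
  · rw [norm_mul]
    nlinarith [mul_le_mul (hC x).1 (hC' x).1 (norm_nonneg _) h0, mul_nonneg h0 h0']
  · refine ContinuousLinearMap.opNorm_le_bound _ (by positivity) fun v => ?_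
    have : fderiv ℝ (fun x => f x * g x) x v = fderiv ℝ f x v * g x + f x * fderiv ℝ g x v :=
      congrFun (dd_mul sf sg v) x
    rw [this]
    have e1 := (ContinuousLinearMap.le_opNorm (fderiv ℝ f x) v).trans
      (mul_le_mul_of_nonneg_right (hC x).2 (norm_nonneg _))
    have e2 := (ContinuousLinearMap.le_opNorm (fderiv ℝ g x) v).trans
      (mul_le_mul_of_nonneg_right (hC' x).2 (norm_nonneg _))
    refine (norm_add_le _ _).trans ?_
    rw [norm_mul, norm_mul]
    have e3 := mul_le_mul e1 (hC' x).1 (norm_nonneg _) (by positivity)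
    have e4 := mul_le_mul (hC x).1 e2 (norm_nonneg _) h0
    nlinarith

lemma wc_add (hW : Integrable W) (hF : Continuous F) (hF' : Continuous F') {C C' : ℝ}
    (hC : ∀ x, ‖F x‖ ≤ C) (hC' : ∀ x, ‖F' x‖ ≤ C') :
    Wc W (fun x => F x + F' x) = fun x => Wc W F x + Wc W F' x := by
  funext x
  simp only [Wc, smul_add]
  exact integral_add (wc_integrable hW hF hC x) (wc_integrable hW hF' hC' x)

lemma differentiable_tr (hW : Integrable W) (hf : Bf f) (hg : Bf g) (he : Sm e) :
    Differentiable ℝ (Tr W f g e) := fun x =>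
  ((hf.mul hg.conj).hasFDerivAt hW x).differentiableAt.mul (he.differentiable x)

lemma Bf.bdd_mul_conj {v : E3} (hf : Bf f) (hg : Bf g) :
    ∃ C, ∀ x, ‖dd v f x * (starRingEnd ℂ) (g x)‖ ≤ C := by
  obtain ⟨sf, C, hC⟩ := hf
  obtain ⟨sg, C', hC'⟩ := hg
  have h0 := (norm_nonneg _).trans (hC 0).1
  refine ⟨C * ‖v‖ * C', fun x => ?_⟩
  rw [norm_mul, RCLike.norm_conj]
  exact mul_le_mul ((ContinuousLinearMap.le_opNorm _ _).trans
    (mul_le_mul_of_nonneg_right (hC x).2 (norm_nonneg _))) (hC' x).1 (norm_nonneg _) (by positivity)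

lemma dd_tr (hW : Integrable W) (hf : Bf f) (hg : Bf g) (he : Sm e) (v : E3) :
    dd v (Tr W f g e) =
      fun x => Tr W (dd v f) g e x + Tr W f (dd v g) e x + Tr W f g (dd v e) x := by
  funext x
  have h1 : HasFDerivAt (Tr W f g e) _ x := ((hf.mul hg.conj).hasFDerivAt hW x).mul
    (he.differentiable x).hasFDerivAt
  have h2 := congrFun ((hf.mul hg.conj).dd_wc hW v) x
  rw [dd, ((hf.mul hg.conj).hasFDerivAt hW x).fderiv] at h2
  rw [dd, h1.fderiv]
  simp only [ContinuousLinearMap.add_apply, ContinuousLinearMap.smul_apply, smul_eq_mul]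
  rw [h2, dd_mul hf.1 hg.1.conj, dd_conj hg.1]
  obtain ⟨C, hC⟩ := hf.bdd_mul_conj (v := v) hg
  obtain ⟨C', hC'⟩ := hg.bdd_mul_conj (v := v) hf
  rw [wc_add hW ((hf.1.dd v).mul hg.1.conj).continuous (hf.1.mul (hg.1.dd v).conj).continuous hC
    (C' := C') (fun x => by
      have := hC' x
      rw [norm_mul, RCLike.norm_conj] at this ⊢
      rwa [mul_comm])]
  simp only [Tr, dd]
  ring

lemma Tr.lb (hW : Integrable W) (hom : ∫ z, |W z| ≤ om) (hf : Bf f) (hg : Bf g) (he : Sm e)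
    (hc : 0 ≤ c)
    (h : ∀ z, ∫⁻ x, (‖f (x - z)‖ₑ * ‖g (x - z)‖ₑ * ‖e x‖ₑ) ^ 2 ≤ ENNReal.ofReal (c ^ 2)) :
    LB (Tr W f g e) (om * c) := by
  have hom0 : 0 ≤ om := (integral_nonneg fun _ => abs_nonneg _).trans hom
  rw [lb_iff_lintegral (by positivity)]
  refine ⟨(differentiable_tr hW hf hg he).continuous, ?_⟩
  set W' := hW.1.mk W
  have hm : Measurable fun z => ‖W' z‖ₑ := hW.1.stronglyMeasurable_mk.measurable.enorm
  have cf := hf.1.continuous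
  have cg := hg.1.continuous
  have ce := he.continuous
  have hF : Measurable (Function.uncurry fun (z x : E3) =>
      ‖f (x - z)‖ₑ * ‖g (x - z)‖ₑ * ‖e x‖ₑ) := by
    have m1 : Measurable fun q : E3 × E3 => ‖f (q.2 - q.1)‖ₑ :=
      (cf.comp (by fun_prop : Continuous fun q : E3 × E3 => q.2 - q.1)).measurable.enorm
    have m2 : Measurable fun q : E3 × E3 => ‖g (q.2 - q.1)‖ₑ :=
      (cg.comp (by fun_prop : Continuous fun q : E3 × E3 => q.2 - q.1)).measurable.enorm
    have m3 : Measurable fun q : E3 × E3 => ‖e q.2‖ₑ :=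
      (ce.comp (by fun_prop : Continuous fun q : E3 × E3 => q.2)).measurable.enorm
    exact (m1.mul m2).mul m3
  have key := lintegral_average_sq_le (μ := volume) (ν := volume) hm hF h
  have hmass : ∫⁻ z, ‖W' z‖ₑ ≤ ENNReal.ofReal om := by
    have : ∫⁻ z, ‖W' z‖ₑ = ∫⁻ z, ‖W z‖ₑ := lintegral_congr_ae (by
      filter_upwards [hW.1.ae_eq_mk] with z hz
      rw [hz])
    rw [this, ← ofReal_integral_norm_eq_lintegral_enorm hW]
    exact ENNReal.ofReal_le_ofReal hom
  calc ∫⁻ x, ‖Tr W f g e x‖ₑ ^ 2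
      ≤ ∫⁻ x, (∫⁻ z, ‖W' z‖ₑ * (‖f (x - z)‖ₑ * ‖g (x - z)‖ₑ * ‖e x‖ₑ)) ^ 2 := by
        refine lintegral_mono fun x => ?_
        gcongr
        rw [Tr, Wc, enorm_mul]
        calc _ ≤ (∫⁻ z, ‖W z • (f (x - z) * (starRingEnd ℂ) (g (x - z)))‖ₑ) * ‖e x‖ₑ := by
              gcongr
              exact enorm_integral_le_lintegral_enorm _
          _ = (∫⁻ z, ‖W' z‖ₑ * (‖f (x - z)‖ₑ * ‖g (x - z)‖ₑ)) * ‖e x‖ₑ := by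
              congr 1
              refine lintegral_congr_ae ?_
              filter_upwards [hW.1.ae_eq_mk] with z hz
              rw [enorm_smul, enorm_mul, RCLike.enorm_conj, hz]
          _ = _ := by
              rw [← lintegral_mul_const' _ _ (by simp)]
              simp only [mul_assoc]
    _ ≤ _ := key
    _ ≤ ENNReal.ofReal om ^ 2 * ENNReal.ofReal (c ^ 2) := by gcongr
    _ = _ := by
        rw [← ENNReal.ofReal_pow hom0, ← ENNReal.ofReal_mul (by positivity), mul_pow]

end trilinear

section products
variable {f1 f2 f3 : E3 → ℂ} {M1 M2 c : ℝ}

lemma lintegral_sup_sup_le (h1 : ∀ x, ‖f1 x‖ ≤ M1) (h2 : ∀ x, ‖f2 x‖ ≤ M2) (hc : 0 ≤ c)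
    (h3 : LB f3 c) :
    ∫⁻ x, (‖f1 x‖ₑ * ‖f2 x‖ₑ * ‖f3 x‖ₑ) ^ 2 ≤ ENNReal.ofReal ((M1 * M2 * c) ^ 2) := by
  have m1 := (norm_nonneg _).trans (h1 0)
  have m2 := (norm_nonneg _).trans (h2 0)
  calc ∫⁻ x, (‖f1 x‖ₑ * ‖f2 x‖ₑ * ‖f3 x‖ₑ) ^ 2
      ≤ ∫⁻ x, ENNReal.ofReal ((M1 * M2) ^ 2) * ‖f3 x‖ₑ ^ 2 := by
        refine lintegral_mono fun x => ?_
        rw [mul_pow, ENNReal.ofReal_pow (by positivity), ENNReal.ofReal_mul m1]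
        gcongr
        · rw [← ofReal_norm]; exact ENNReal.ofReal_le_ofReal (h1 x)
        · rw [← ofReal_norm]; exact ENNReal.ofReal_le_ofReal (h2 x)
    _ = ENNReal.ofReal ((M1 * M2) ^ 2) * ∫⁻ x, ‖f3 x‖ₑ ^ 2 :=
        lintegral_const_mul' _ _ ENNReal.ofReal_ne_top
    _ ≤ ENNReal.ofReal ((M1 * M2) ^ 2) * ENNReal.ofReal (c ^ 2) := by
        gcongr
        exact ((lb_iff_lintegral hc).1 h3).2
    _ = _ := by rw [← ENNReal.ofReal_mul (by positivity), ← mul_pow]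

lemma lintegral_sup_four_le {ℓ D y : ℝ} (hD : 0 < D) (hl : 0 ≤ ℓ) {k1 k2 k3 : ℕ}
    (h1 : ∀ x, ‖f1 x‖ ≤ D ^ k1 * ℓ) (hy : 0 ≤ y) (c2 : Continuous f2)
    (h2 : ∫⁻ x, ‖f2 x‖ₑ ^ 4 ≤ ENNReal.ofReal (D ^ (4 * k2) * y))
    (h3 : ∫⁻ x, ‖f3 x‖ₑ ^ 4 ≤ ENNReal.ofReal (D ^ (4 * k3) * y)) :
    ∫⁻ x, (‖f1 x‖ₑ * ‖f2 x‖ₑ * ‖f3 x‖ₑ) ^ 2 ≤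
      ENNReal.ofReal (D ^ (2 * (k1 + k2 + k3)) * ℓ ^ 2 * y) := by
  set A := D ^ (2 * (k1 + k2 + k3)) * ℓ ^ 2 / 2
  calc ∫⁻ x, (‖f1 x‖ₑ * ‖f2 x‖ₑ * ‖f3 x‖ₑ) ^ 2
      ≤ ∫⁻ x, (ENNReal.ofReal (A / D ^ (4 * k2)) * ‖f2 x‖ₑ ^ 4 +
          ENNReal.ofReal (A / D ^ (4 * k3)) * ‖f3 x‖ₑ ^ 4) := by
        refine lintegral_mono fun x => ?_
        simp only [← ofReal_norm]
        rw [← ENNReal.ofReal_mul (norm_nonneg _), ← ENNReal.ofReal_mul (by positivity),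
          ← ENNReal.ofReal_pow (by positivity), ← ENNReal.ofReal_pow (by positivity),
          ← ENNReal.ofReal_pow (by positivity), ← ENNReal.ofReal_mul (by positivity),
          ← ENNReal.ofReal_mul (by positivity), ← ENNReal.ofReal_add (by positivity) (by positivity)]
        refine ENNReal.ofReal_le_ofReal ?_
        calc (‖f1 x‖ * ‖f2 x‖ * ‖f3 x‖) ^ 2 ≤ (D ^ k1 * ℓ * ‖f2 x‖ * ‖f3 x‖) ^ 2 := by
              gcongr; exact h1 x
          _ = A * (2 * ((‖f2 x‖ / D ^ k2) ^ 2 * (‖f3 x‖ / D ^ k3) ^ 2)) := by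
              simp only [A]; field_simp; ring
          _ ≤ A * (((‖f2 x‖ / D ^ k2) ^ 2) ^ 2 + ((‖f3 x‖ / D ^ k3) ^ 2) ^ 2) := by
              have := two_mul_le_add_sq ((‖f2 x‖ / D ^ k2) ^ 2) ((‖f3 x‖ / D ^ k3) ^ 2)
              have hA : 0 ≤ A := by positivity
              exact mul_le_mul_of_nonneg_left (by linarith) hA
          _ = _ := by field_simp; ring
    _ = ENNReal.ofReal (A / D ^ (4 * k2)) * (∫⁻ x, ‖f2 x‖ₑ ^ 4) +
          ENNReal.ofReal (A / D ^ (4 * k3)) * ∫⁻ x, ‖f3 x‖ₑ ^ 4 := by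
        rw [lintegral_add_left ((c2.measurable.enorm.pow_const 4).const_mul _),
          lintegral_const_mul' _ _ ENNReal.ofReal_ne_top,
          lintegral_const_mul' _ _ ENNReal.ofReal_ne_top]
    _ ≤ ENNReal.ofReal (A / D ^ (4 * k2)) * ENNReal.ofReal (D ^ (4 * k2) * y) +
          ENNReal.ofReal (A / D ^ (4 * k3)) * ENNReal.ofReal (D ^ (4 * k3) * y) := by gcongr
    _ = _ := by
        rw [← ENNReal.ofReal_mul (by positivity), ← ENNReal.ofReal_mul (by positivity),
          ← ENNReal.ofReal_add (by positivity) (by positivity)]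
        congr 1
        simp only [A]; field_simp; ring

end products

section words
variable {W : E3 → ℝ} {g : E3 → ℂ} {f : ℝ × E3 → ℂ}

/-- Iterated partial derivatives of a function of the space variable along a word. -/
def Dx : List (Fin 3) → (E3 → ℂ) → E3 → ℂ
  | [], g => g
  | i :: σ, g => dd (e3 i) (Dx σ g)

lemma dx_sl (hf : Sm f) (σ : List (Fin 3)) (t : ℝ) : Dx σ (sl f t) = sl (Dw σ f) t := by
  induction σ with
  | nil => rfl
  | cons i σ ih => simp only [Dx, Dw, ih]; exact dd_sl (hf.dw σ) _ _

lemma Sm.dx (hg : Sm g) (σ : List (Fin 3)) : Sm (Dx σ g) := by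
  induction σ with
  | nil => exact hg
  | cons i σ ih => exact ih.dd _

/-- The triples of words arising from the Leibniz rule for a product of three factors. -/
def spl : List (Fin 3) → List (List (Fin 3) × List (Fin 3) × List (Fin 3))
  | [] => [([], [], [])]
  | i :: τ => (spl τ).map (fun p => (p.1, p.2.1, i :: p.2.2)) ++
      ((spl τ).map (fun p => (i :: p.1, p.2.1, p.2.2)) ++
        (spl τ).map (fun p => (p.1, i :: p.2.1, p.2.2)))

lemma length_spl (τ : List (Fin 3)) : (spl τ).length = 3 ^ τ.length := by
  induction τ with
  | nil => rfl
  | cons i τ ih => simp only [spl, List.length_append, List.length_map, ih, List.length_cons]; ring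

lemma spl_length {τ : List (Fin 3)} {p} (hp : p ∈ spl τ) :
    p.1.length + p.2.1.length + p.2.2.length = τ.length := by
  induction τ generalizing p with
  | nil => simp only [spl, List.mem_singleton] at hp; subst hp; rfl
  | cons i τ ih =>
    simp only [spl, List.mem_append, List.mem_map] at hp
    rcases hp with ⟨q, hq, rfl⟩ | ⟨q, hq, rfl⟩ | ⟨q, hq, rfl⟩ <;>
      · have := ih hq
        simp only [List.length_cons]
        omega

lemma spl_head (τ : List (Fin 3)) :
    ∃ L, spl τ = ([], [], τ) :: L ∧ ∀ p ∈ L, p.2.2.length < τ.length := by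
  induction τ with
  | nil => exact ⟨[], rfl, by simp⟩
  | cons i τ ih =>
    obtain ⟨L, hL, h⟩ := ih
    have hτ : ∀ q ∈ spl τ, q.2.2.length ≤ τ.length := fun q hq => by
      have := spl_length hq
      omega
    refine ⟨L.map (fun p => (p.1, p.2.1, i :: p.2.2)) ++
      ((spl τ).map (fun p => (i :: p.1, p.2.1, p.2.2)) ++
        (spl τ).map (fun p => (p.1, i :: p.2.1, p.2.2))), by rw [spl, hL]; rfl, fun p hp => ?_⟩
    simp only [List.mem_append, List.mem_map, List.length_cons] at hp ⊢
    rcases hp with ⟨q, hq, rfl⟩ | ⟨q, hq, rfl⟩ | ⟨q, hq, rfl⟩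
    · simpa using h q hq
    · exact Nat.lt_succ_of_le (hτ q hq)
    · exact Nat.lt_succ_of_le (hτ q hq)

lemma dd_list_sum {ι : Type*} (L : List ι) (F : ι → E3 → ℂ)
    (h : ∀ p ∈ L, Differentiable ℝ (F p)) (v : E3) :
    Differentiable ℝ (fun x => (L.map fun p => F p x).sum) ∧
    dd v (fun x => (L.map fun p => F p x).sum) = fun x => (L.map fun p => dd v (F p) x).sum := by
  induction L with
  | nil => exact ⟨by simp, by funext x; simp [dd]⟩
  | cons p L ih =>
    have h1 := h p (by simp)
    obtain ⟨h2, h3⟩ := ih fun q hq => h q (by simp [hq])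
    refine ⟨by simp only [List.map_cons, List.sum_cons]; exact h1.add h2, ?_⟩
    funext x
    have := congrFun h3 x
    simp only [dd, List.map_cons, List.sum_cons] at this ⊢
    rw [fderiv_fun_add (h1 x) (h2 x)]
    simp [this]

/-- The summand of the Leibniz rule attached to a triple of words. -/
abbrev Tw (W : E3 → ℝ) (g : E3 → ℂ) (p : List (Fin 3) × List (Fin 3) × List (Fin 3)) : E3 → ℂ :=
  Tr W (Dx p.1 g) (Dx p.2.1 g) (Dx p.2.2 g)

lemma dx_tr (hW : Integrable W) (hg : ∀ σ, Bf (Dx σ g)) (τ : List (Fin 3)) :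
    Dx τ (Tr W g g g) = fun x => ((spl τ).map fun p => Tw W g p x).sum := by
  induction τ with
  | nil => funext x; simp [spl]; rfl
  | cons i τ ih =>
    simp only [Dx, ih]
    rw [(dd_list_sum (spl τ) (Tw W g) (fun p _ => differentiable_tr hW (hg _) (hg _) (hg _).1)
      (e3 i)).2]
    funext x
    have : ∀ p, dd (e3 i) (Tw W g p) x = Tw W g (p.1, p.2.1, i :: p.2.2) x +
        (Tw W g (i :: p.1, p.2.1, p.2.2) x + Tw W g (p.1, i :: p.2.1, p.2.2) x) := fun p => by
      rw [dd_tr hW (hg _) (hg _) (hg _).1]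
      simp only [Tw, Dx]
      ring
    simp only [this, List.sum_map_add, spl, List.map_append, List.sum_append, List.map_map]
    rfl

lemma LB.list_sum {ι : Type*} (L : List ι) (F : ι → E3 → ℂ) {c : ℝ} (hc : 0 ≤ c)
    (h : ∀ p ∈ L, LB (F p) c) : LB (fun x => (L.map fun p => F p x).sum) (L.length * c) := by
  induction L with
  | nil => simpa using LB.zero
  | cons p L ih =>
    have := (h p (by simp)).add (ih fun q hq => h q (by simp [hq])) hc (by positivity)
    refine LB.mono (by simpa using this) ?_
    push_cast [List.length_cons]
    linarith

end words

section products
variable {b D ℓ : ℝ} {s : ℕ}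

/-- Bounds of order `k` for a function: square-integrable, uniform and quartic. -/
structure Od (s : ℕ) (b D ℓ : ℝ) (k : ℕ) (F : E3 → ℂ) : Prop where
  cont : Continuous F
  l2 : k ≤ s → LB F (b * D ^ (k - 1))
  sup : k + 2 ≤ s → ∀ x, ‖F x‖ ≤ D ^ k * ℓ
  four : s = 2 → k = 1 → ∫⁻ x, ‖F x‖ₑ ^ 4 ≤
    ENNReal.ofReal (D ^ (4 * k) * (9 * ℓ ^ 2 * b ^ 2 / D ^ 2))

lemma Od.shift {k : ℕ} {F : E3 → ℂ} (hb : 0 ≤ b) (hD : 0 < D) (h : Od s b D ℓ k F) (z : E3) :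
    Od s b D ℓ k fun x => F (x - z) where
  cont := h.cont.comp (by fun_prop)
  l2 hk := by
    have := h.l2 hk
    rw [lb_iff_lintegral (by positivity)] at this ⊢
    exact ⟨h.cont.comp (by fun_prop), by
      rw [lintegral_sub_right_eq_self (fun x => ‖F x‖ₑ ^ 2) z]; exact this.2⟩
  sup hk x := h.sup hk _
  four h1 h2 := by
    rw [lintegral_sub_right_eq_self (fun x => ‖F x‖ₑ ^ 4) z]; exact h.four h1 h2

lemma Od.prod_of_le (hs : 2 ≤ s) (hb : 0 ≤ b) (hD : 0 < D) (hl : 0 ≤ ℓ) {k1 k2 k3 : ℕ}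
    {F1 F2 F3 : E3 → ℂ} (h1 : Od s b D ℓ k1 F1) (h2 : Od s b D ℓ k2 F2) (h3 : Od s b D ℓ k3 F3)
    (h12 : k1 ≤ k2) (h23 : k2 ≤ k3) (hk : k1 + k2 + k3 ≤ s) :
    ∫⁻ x, (‖F1 x‖ₑ * ‖F2 x‖ₑ * ‖F3 x‖ₑ) ^ 2 ≤
      ENNReal.ofReal ((3 * b * D ^ (k1 + k2 + k3 - 1) * ℓ ^ 2) ^ 2) := by
  by_cases hk2 : k2 + 2 ≤ s
  · refine (lintegral_sup_sup_le (h1.sup (by omega)) (h2.sup hk2) (by positivity)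
      (h3.l2 (by omega))).trans (ENNReal.ofReal_le_ofReal ?_)
    have : D ^ k1 * ℓ * (D ^ k2 * ℓ) * (b * D ^ (k3 - 1)) = b * D ^ (k1 + k2 + k3 - 1) * ℓ ^ 2 := by
      have e : k1 + k2 + k3 - 1 = k1 + k2 + (k3 - 1) := by omega
      rw [e]; ring
    rw [this]
    have : 0 ≤ b * D ^ (k1 + k2 + k3 - 1) * ℓ ^ 2 := by positivity
    refine pow_le_pow_left₀ this ?_ 2
    linarith
  · obtain rfl : s = 2 := by omega
    obtain rfl : k2 = 1 := by omega
    obtain rfl : k3 = 1 := by omega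
    obtain rfl : k1 = 0 := by omega
    refine (lintegral_sup_four_le hD hl (h1.sup (by omega)) (by positivity) h2.cont (h2.four rfl rfl)
      (h3.four rfl rfl)).trans (ENNReal.ofReal_le_ofReal (le_of_eq ?_))
    field_simp
    ring

lemma Od.prod (hs : 2 ≤ s) (hb : 0 ≤ b) (hD : 0 < D) (hl : 0 ≤ ℓ) {k1 k2 k3 : ℕ}
    {F1 F2 F3 : E3 → ℂ} (h1 : Od s b D ℓ k1 F1) (h2 : Od s b D ℓ k2 F2) (h3 : Od s b D ℓ k3 F3)
    (hk : k1 + k2 + k3 ≤ s) :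
    ∫⁻ x, (‖F1 x‖ₑ * ‖F2 x‖ₑ * ‖F3 x‖ₑ) ^ 2 ≤
      ENNReal.ofReal ((3 * b * D ^ (k1 + k2 + k3 - 1) * ℓ ^ 2) ^ 2) := by
  rcases le_total k1 k2 with h12 | h12 <;> rcases le_total k2 k3 with h23 | h23 <;>
    rcases le_total k1 k3 with h13 | h13
  · exact prod_of_le hs hb hD hl h1 h2 h3 h12 h23 hk
  · exact prod_of_le hs hb hD hl h1 h2 h3 h12 h23 hk
  · have := prod_of_le hs hb hD hl h1 h3 h2 h13 h23 (by omega)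
    rw [show k1 + k3 + k2 = k1 + k2 + k3 by omega] at this
    exact (lintegral_congr fun x => by ring).trans_le this
  · have := prod_of_le hs hb hD hl h3 h1 h2 h13 h12 (by omega)
    rw [show k3 + k1 + k2 = k1 + k2 + k3 by omega] at this
    exact (lintegral_congr fun x => by ring).trans_le this
  · have := prod_of_le hs hb hD hl h2 h1 h3 h12 h13 (by omega)
    rw [show k2 + k1 + k3 = k1 + k2 + k3 by omega] at this
    exact (lintegral_congr fun x => by ring).trans_le this
  · have := prod_of_le hs hb hD hl h2 h3 h1 h23 h13 (by omega)
    rw [show k2 + k3 + k1 = k1 + k2 + k3 by omega] at this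
    exact (lintegral_congr fun x => by ring).trans_le this
  · have := prod_of_le hs hb hD hl h3 h2 h1 h23 h12 (by omega)
    rw [show k3 + k2 + k1 = k1 + k2 + k3 by omega] at this
    exact (lintegral_congr fun x => by ring).trans_le this
  · have := prod_of_le hs hb hD hl h3 h2 h1 h23 h12 (by omega)
    rw [show k3 + k2 + k1 = k1 + k2 + k3 by omega] at this
    exact (lintegral_congr fun x => by ring).trans_le this

/-- Gagliardo-Nirenberg: the fourth power of a derivative. -/
lemma lintegral_dd_four_le {f : E3 → ℂ} {v : E3} {M c : ℝ} (hf : Bf f) (hM : ∀ x, ‖f x‖ ≤ M)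
    (h0 : M2 f) (h1 : M2 (dd v f)) (hc : 0 ≤ c) (h2 : LB (dd v (dd v f)) c) :
    ∫⁻ x, ‖dd v f x‖ₑ ^ 4 ≤ ENNReal.ofReal ((3 * M * c) ^ 2) := by
  have sf := hf.1
  obtain ⟨-, K, hK⟩ := hf
  have hM0 := (norm_nonneg _).trans (hM 0)
  set a := dd v f with ha
  have sa : Sm a := sf.dd v
  have hK' : ∀ x, ‖a x‖ ≤ K * ‖v‖ := fun x => (ContinuousLinearMap.le_opNorm _ _).trans
    (mul_le_mul_of_nonneg_right (hK x).2 (norm_nonneg _))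
  have hK0 : 0 ≤ K * ‖v‖ := (norm_nonneg _).trans (hK' 0)
  have sq : LB (fun x => a x * a x) _ := h1.lb.of_norm_le (sa.mul sa).continuous
    (fun x => by rw [norm_mul]; exact mul_le_mul_of_nonneg_right (hK' x) (norm_nonneg _)) hK0
  set X := ∫ x, ‖a x * a x‖ ^ 2
  have hX : 0 ≤ X := integral_nonneg fun x => by positivity
  have sqX : LB (fun x => a x * a x) (√X) := LB.of_integral (sa.mul sa).continuous sq.integrable_sq
    (sqrt_nonneg _) (by rw [Real.sq_sqrt hX])
  set G := fun x => a x * (starRingEnd ℂ) (a x) * a x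
  have sG : Sm G := (sa.mul sa.conj).mul sa
  have dG : dd v G = fun x => (dd v a x * (starRingEnd ℂ) (a x) + a x * (starRingEnd ℂ) (dd v a x))
      * a x + a x * (starRingEnd ℂ) (a x) * dd v a x := by
    rw [dd_mul (sa.mul sa.conj) sa, dd_mul sa sa.conj, dd_conj sa]
  have bG : ∀ x, ‖dd v G x‖ ≤ 3 * (‖a x * a x‖ * ‖dd v a x‖) := fun x => by
    rw [dG]
    refine (norm_add_le _ _).trans ?_
    rw [norm_mul, norm_mul]
    have := norm_add_le (dd v a x * (starRingEnd ℂ) (a x)) (a x * (starRingEnd ℂ) (dd v a x))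
    simp only [norm_mul, RCLike.norm_conj] at this ⊢
    nlinarith [mul_le_mul_of_nonneg_right this (norm_nonneg (a x))]
  have m2G : M2 G := (sq.of_norm_le sG.continuous (c := K * ‖v‖) (fun x => by
    simp only [G, norm_mul, RCLike.norm_conj]
    nlinarith [mul_le_mul_of_nonneg_right (hK' x) (mul_nonneg (norm_nonneg (a x)) (norm_nonneg (a x)))])
    hK0).m2
  have m2dG : M2 (dd v G) := (h2.of_norm_le (sG.dd v).continuous (c := 3 * (K * ‖v‖ * (K * ‖v‖)))
    (fun x => by
      refine (bG x).trans ?_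
      rw [norm_mul, mul_assoc 3]
      have := mul_le_mul (hK' x) (hK' x) (norm_nonneg _) hK0
      gcongr) (by positivity)).m2
  have hker : Ker v (fun _ : E3 => (1 : ℝ)) (fun _ => 0) :=
    ⟨continuous_const, continuous_const, ⟨1, by simp⟩, ⟨0, by simp⟩, fun x => by
      simpa [HasLineDerivAt] using hasDerivAt_const (0 : ℝ) (1 : ℝ)⟩
  have ibp := ibp_ip hker sf sG h0 m2G h1 m2dG
  simp only [one_mul, zero_mul, integral_zero, neg_zero] at ibp
  have eX : ∫ x, ip (dd v f x) (G x) = X := integral_congr_ae (Filter.Eventually.of_forall fun x => by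
    simp only [G, ← ha, ip_eq, norm_mul, mul_pow, Complex.sq_norm, Complex.normSq_apply]
    simp [Complex.mul_re, Complex.mul_im]
    ring)
  rw [eX] at ibp
  have bd := (sqX.integral_le h2 (sqrt_nonneg _) hc (H := fun x => ip (f x) (dd v G x))
    (K := 3 * M) (by positivity) (sf.continuous.inner (sG.dd v).continuous).aestronglyMeasurable
    (fun x => by
      refine (abs_ip_le _ _).trans ((mul_le_mul (hM x) (bG x) (norm_nonneg _) hM0).trans ?_)
      linarith)).2.1
  have h3 : X ≤ 3 * M * (√X * c) := by
    have : X = -∫ x, ip (f x) (dd v G x) := by linarith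
    exact this.trans_le ((neg_le_abs _).trans bd)
  have h4 : √X ≤ 3 * M * c := by
    rcases (sqrt_nonneg X).eq_or_lt with h | h
    · rw [← h]; positivity
    · refine le_of_mul_le_mul_right ?_ h
      rw [Real.mul_self_sqrt hX]; linarith
  have h5 : LB (fun x => a x * a x) (3 * M * c) := sqX.mono h4
  refine le_trans (le_of_eq ?_) ((lb_iff_lintegral (by positivity)).1 h5).2
  refine lintegral_congr fun x => ?_
  rw [enorm_mul]; ring

end products

section trilinearBounds
variable {W : E3 → ℝ} {g : E3 → ℂ} {b D ℓ om : ℝ} {s : ℕ}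

/-- Bounds for the derivatives up to order `s` of a function at a fixed time. -/
structure Gd (s : ℕ) (b D : ℝ) (g : E3 → ℂ) : Prop where
  bf : ∀ σ, Bf (Dx σ g)
  m2 : ∀ σ, M2 (Dx σ g)
  lb : ∀ σ, σ.length ≤ s → LB (Dx σ g) (b * D ^ (σ.length - 1))

lemma Gd.od (hb : 0 ≤ b) (hD : 0 < D) (hg : Gd s b D g)
    (hl : ∀ σ, σ.length + 2 ≤ s → ∀ x, ‖Dx σ g x‖ ≤ D ^ σ.length * ℓ) (σ : List (Fin 3)) :
    Od s b D ℓ σ.length (Dx σ g) where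
  cont := (hg.bf σ).1.continuous
  l2 h := hg.lb σ h
  sup h := hl σ h
  four h1 h2 := by
    subst h1
    obtain ⟨i, rfl⟩ := List.length_eq_one_iff.1 h2
    have e := hl [] (by simp)
    have := lintegral_dd_four_le (v := e3 i) (hg.bf []) e (hg.m2 []) (hg.m2 [i]) (by positivity)
      (hg.lb [i, i] (by simp))
    refine this.trans (ENNReal.ofReal_le_ofReal (le_of_eq ?_))
    simp only [List.length_cons, List.length_nil]
    field_simp
    ring

lemma Gd.tw_lb (hs : 2 ≤ s) (hb : 0 ≤ b) (hD : 0 < D) (hl0 : 0 ≤ ℓ) (hW : Integrable W)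
    (hom : ∫ z, |W z| ≤ om) (hg : Gd s b D g)
    (hl : ∀ σ, σ.length + 2 ≤ s → ∀ x, ‖Dx σ g x‖ ≤ D ^ σ.length * ℓ) {p}
    (hp : p.1.length + p.2.1.length + p.2.2.length ≤ s) :
    LB (Tw W g p) (om * (3 * b * D ^ (p.1.length + p.2.1.length + p.2.2.length - 1) * ℓ ^ 2)) :=
  Tr.lb hW hom (hg.bf _) (hg.bf _) (hg.bf _).1 (by positivity) fun z =>
    Od.prod hs hb hD hl0 ((hg.od hb hD hl _).shift hb hD z) ((hg.od hb hD hl _).shift hb hD z)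
      (hg.od hb hD hl _) hp

/-- Derivatives of the nonlinearity in `L²`. -/
lemma Gd.tr_lb (hs : 2 ≤ s) (hb : 0 ≤ b) (hD : 0 < D) (hl0 : 0 ≤ ℓ) (hW : Integrable W)
    (hom : ∫ z, |W z| ≤ om) (hg : Gd s b D g)
    (hl : ∀ σ, σ.length + 2 ≤ s → ∀ x, ‖Dx σ g x‖ ≤ D ^ σ.length * ℓ) {τ : List (Fin 3)}
    (hτ : τ.length ≤ s) :
    LB (Dx τ (Tr W g g g)) (b * D ^ (τ.length - 1) * (3 ^ (s + 1) * om * ℓ ^ 2)) := by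
  have hom0 : 0 ≤ om := (integral_nonneg fun _ => abs_nonneg _).trans hom
  rw [dx_tr hW hg.bf]
  refine (LB.list_sum (c := om * (3 * b * D ^ (τ.length - 1) * ℓ ^ 2)) _ _ (by positivity)
    fun p hp => ?_).mono ?_
  · have := hg.tw_lb hs hb hD hl0 hW hom hl (p := p) (by rw [spl_length hp]; exact hτ)
    rwa [spl_length hp] at this
  · rw [length_spl]
    push_cast
    calc (3 : ℝ) ^ τ.length * (om * (3 * b * D ^ (τ.length - 1) * ℓ ^ 2))
        ≤ 3 ^ s * (om * (3 * b * D ^ (τ.length - 1) * ℓ ^ 2)) := by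
          gcongr
          norm_num
      _ = _ := by ring

end trilinearBounds

section remainder
variable {f : ℝ × E3 → ℂ} {t c h : ℝ}

lemma norm_cv_phi_le (hh : 0 < h) {d : ℝ × E3 → ℂ} (hd : Continuous d) (hc : 0 ≤ c)
    (hl : LB (sl d t) c) (x : E3) : ‖Cv (φ h) d (t, x)‖ ≤ √(Cφ / h ^ 3) * c := by
  have hA := avg_phi hh
  have hC := one_le_Cφ
  have h1 : ‖Cv (φ h) d (t, x)‖ₑ ^ 2 ≤ ENNReal.ofReal (Cφ / h ^ 3 * c ^ 2) := by
    refine (hA.enorm_sq_le hd (t, x)).trans ?_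
    calc ∫⁻ y, ‖φ h y‖ₑ * ‖d (t, x - y)‖ₑ ^ 2
        ≤ ∫⁻ y, ENNReal.ofReal (Cφ / h ^ 3) * ‖sl d t (x - y)‖ₑ ^ 2 := by
          refine lintegral_mono fun y => ?_
          refine mul_le_mul_left ?_ _
          rw [← ofReal_norm, Real.norm_of_nonneg (hA.nonneg y)]
          exact ENNReal.ofReal_le_ofReal (phi_le hh y)
      _ = ENNReal.ofReal (Cφ / h ^ 3) * ∫⁻ y, ‖sl d t y‖ₑ ^ 2 := by
          rw [lintegral_const_mul' _ _ ENNReal.ofReal_ne_top,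
            lintegral_sub_left_eq_self (fun y => ‖sl d t y‖ₑ ^ 2)]
      _ ≤ _ := by
          rw [ENNReal.ofReal_mul (by positivity)]
          gcongr
          exact ((lb_iff_lintegral hc).1 hl).2
  rw [← ofReal_norm, ← ENNReal.ofReal_pow (norm_nonneg _),
    ENNReal.ofReal_le_ofReal_iff (by positivity)] at h1
  refine le_of_sq_le_sq ?_ (by positivity)
  rw [mul_pow, Real.sq_sqrt (by positivity)]
  exact h1

/-- Sobolev-Morrey estimate for the double average at scale `h`. -/
lemma norm_sub_cv_phi_le (hh : 0 < h) (hf : Sm f) (hc : 0 ≤ c)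
    (hd : ∀ i j, LB (sl (sd (e3 j) (sd (e3 i) f)) t) c) (x : E3) :
    ‖f (t, x) - Cv (φ h) (Cv (φ h) f) (t, x)‖ ≤ 324 * Cφ * √h * c := by
  have hC := one_le_Cφ
  let η : ℕ → ℝ := fun n => h / 4 ^ n
  have h0 : ∀ n, 0 < η n := fun n => by simp only [η]; positivity
  have hη : Filter.Tendsto η Filter.atTop (𝓝 0) := by
    have := (tendsto_pow_atTop_nhds_zero_of_lt_one (r := (1 / 4 : ℝ)) (by norm_num)
      (by norm_num)).const_mul h
    simpa [η, div_eq_mul_inv] using this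
  have key := dist_le_of_le_geometric_two_of_tendsto₀ (C := 324 * Cφ * √h * c)
    (f := fun n => Cv (φ (η n)) (Cv (φ (η n)) f) (t, x)) (fun n => ?_)
    (tendsto_cv_phi_cv_phi hf (t, x) h0 hη)
  · rw [dist_eq_norm, norm_sub_rev] at key
    simpa [η] using key
  · have A1 := avg_phi (h0 n)
    have A2 := avg_phi (h0 (n + 1))
    have hn4 : η (n + 1) = η n / 4 := by simp only [η, pow_succ]; field_simp
    set k := η n with hk
    have hk0 : 0 < k := h0 n
    set d : ℝ × E3 → ℂ := fun p => Cv (φ k) f p - Cv (φ (η (n + 1))) f p with hdd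
    have sd1 := hf.cv A1.toMol
    have sd2 := hf.cv A2.toMol
    have cd : Continuous d := (sd1.sub sd2).continuous
    have ld : LB (sl d t) (18 * k ^ 2 * c) := by
      have l1 := A1.lb_sub_two hk0.le (phi_neg hk0) hf hc hd
      have l2 := A2.lb_sub_two (h0 _).le (phi_neg (h0 _)) hf hc hd
      have := l1.sub l2 (by positivity) (by positivity)
      refine LB.mono (LB.of_norm_le (c := 1) this ((sd1.sub sd2).sl t).continuous (fun y => ?_)
        zero_le_one) ?_
      · simp [sl, hdd]
      · rw [hn4]
        have : 0 ≤ k ^ 2 * c := by positivity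
        nlinarith
    have e : Cv (φ k) (Cv (φ k) f) (t, x) -
        Cv (φ (η (n + 1))) (Cv (φ (η (n + 1))) f) (t, x) =
        Cv (φ k) d (t, x) + Cv (φ (η (n + 1))) d (t, x) := by
      rw [hdd, cv_sub A1.toMol sd1.continuous sd2.continuous,
        cv_sub A2.toMol sd1.continuous sd2.continuous,
        cv_comm A2.toMol A1.toMol hf.continuous]
      ring
    rw [dist_eq_norm, e]
    refine (norm_add_le _ _).trans ((add_le_add (norm_cv_phi_le hk0 cd (by positivity) ld x)
      (norm_cv_phi_le (h0 _) cd (by positivity) ld x)).trans ?_)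
    have e1 : √(Cφ / η (n + 1) ^ 3) = 8 * √(Cφ / k ^ 3) := by
      rw [hn4, show Cφ / (k / 4) ^ 3 = 8 ^ 2 * (Cφ / k ^ 3) by field_simp; norm_num,
        Real.sqrt_mul (by norm_num), Real.sqrt_sq (by norm_num)]
    have e2 : √k = √h / 2 ^ n := by
      simp only [hk, η]
      rw [Real.sqrt_div hh.le, show (4 : ℝ) ^ n = (2 ^ n) ^ 2 by rw [← pow_mul, mul_comm, pow_mul]; norm_num,
        Real.sqrt_sq (by positivity)]
    have e3 : √(Cφ / k ^ 3) * k ^ 2 ≤ Cφ * √k := by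
      refine le_of_sq_le_sq ?_ (by positivity)
      rw [mul_pow, mul_pow, Real.sq_sqrt (by positivity), Real.sq_sqrt hk0.le]
      rw [show Cφ / k ^ 3 * (k ^ 2) ^ 2 = Cφ * k by field_simp]
      gcongr
      nlinarith
    calc √(Cφ / k ^ 3) * (18 * k ^ 2 * c) + √(Cφ / η (n + 1) ^ 3) * (18 * k ^ 2 * c)
        = 162 * c * (√(Cφ / k ^ 3) * k ^ 2) := by rw [e1]; ring
      _ ≤ 162 * c * (Cφ * √k) := by gcongr
      _ = _ := by rw [e2]; field_simp; ring

end remainder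

section densities
variable {w p : ℝ × E3 → ℂ} {t h c c' : ℝ}

lemma kap_le (hh : 0 < h) (z : E3) : kap h z ≤ 15 / h ^ 3 := by
  have h1 := kg_le (θ := fun _ => 1) hh (by simp) z
  have h0 := kg_pos (θ := fun _ => 1) hh (by simp) z
  calc 15 * h ^ 4 * kg (fun _ => 1) h z ^ 7 ≤ 15 * h ^ 4 * h⁻¹ ^ 7 := by gcongr
    _ = _ := by field_simp

lemma bq_le (hh : 0 < h) (hc : 0 ≤ c) (hc' : 0 ≤ c') (hw : LB (sl w t) c) (hp : LB (sl p t) c') :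
    Bq h w p t ≤ ENNReal.ofReal (15 / h ^ 3 * (c ^ 2 * c' ^ 2)) := by
  have m1 : AEMeasurable (fun x => ‖sl w t x‖ₑ ^ 2) volume :=
    (hw.1.measurable.enorm.pow_const 2).aemeasurable
  have m2 : AEMeasurable (fun x => ‖sl p t x‖ₑ ^ 2) volume :=
    (hp.1.measurable.enorm.pow_const 2).aemeasurable
  calc Bq h w p t ≤ ∫⁻ z : E6, ENNReal.ofReal (15 / h ^ 3) *
        (‖sl w t z.1‖ₑ ^ 2 * ‖sl p t z.2‖ₑ ^ 2) := by
        refine lintegral_mono fun z => ?_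
        exact mul_le_mul_left (ENNReal.ofReal_le_ofReal (kap_le hh _)) _
    _ = ENNReal.ofReal (15 / h ^ 3) * ((∫⁻ x, ‖sl w t x‖ₑ ^ 2) * ∫⁻ x, ‖sl p t x‖ₑ ^ 2) := by
        rw [lintegral_const_mul' _ _ ENNReal.ofReal_ne_top, Measure.volume_eq_prod,
          lintegral_prod_mul m1 m2]
    _ ≤ _ := by
        rw [ENNReal.ofReal_mul (by positivity), ENNReal.ofReal_mul (by positivity)]
        gcongr
        · exact ((lb_iff_lintegral hc).1 hw).2
        · exact ((lb_iff_lintegral hc').1 hp).2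

lemma measurable_bq (hh : 0 < h) (hw : Continuous w) (hp : Continuous p) :
    Measurable (Bq h w p) := by
  have hk := continuous_kap hh
  have h1 : Continuous fun q : ℝ × E6 => kap h (q.2.1 - q.2.2) := hk.comp (by fun_prop)
  have h2 : Continuous fun q : ℝ × E6 => w (q.1, q.2.1) := hw.comp (by fun_prop)
  have h3 : Continuous fun q : ℝ × E6 => p (q.1, q.2.2) := hp.comp (by fun_prop)
  have : Measurable fun q : ℝ × E6 => ENNReal.ofReal (kap h (q.2.1 - q.2.2)) *
      (‖w (q.1, q.2.1)‖ₑ ^ 2 * ‖p (q.1, q.2.2)‖ₑ ^ 2) :=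
    h1.measurable.ennreal_ofReal.mul
      ((h2.measurable.enorm.pow_const 2).mul (h3.measurable.enorm.pow_const 2))
  exact this.lintegral_prod_right'

/-- Words of length at most `n`. -/
def wd (n : ℕ) : Finset (List (Fin 3)) := (List.finite_length_le (Fin 3) n).toFinset

lemma mem_wd {n : ℕ} {σ : List (Fin 3)} : σ ∈ wd n ↔ σ.length ≤ n := by simp [wd]

/-- Weighted interaction density controlling the fourth power of the sup norm of a piece. -/
def xq (E : ℝ) (n : ℕ) (f : ℝ × E3 → ℂ) (t : ℝ) : ℝ :=
  (ENNReal.ofReal (146 * Cφ ^ 2 / osc E n ^ 3) *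
    Bq (osc E n) (Cv (psi E n) f) (Cv (psi E n) f) t).toReal

/-- Majorant of the squared sup norms. -/
def mt (s J : ℕ) (E D A : ℝ) (u : ℝ × E3 → ℂ) (t : ℝ) : ℝ :=
  A + A⁻¹ * ∑ σ ∈ wd (s - 2), ∑ n ∈ Finset.range (2 * J + 1),
    (D ^ (4 * σ.length))⁻¹ * xq E n (Dw σ u) t

end densities

/-- A solution on a short time interval, together with its quantitative bounds. -/
structure Sol (s J : ℕ) (W : E3 → ℝ) (om E D B b a a' : ℝ) (u : ℝ × E3 → ℂ) : Prop where
  hs : 2 ≤ s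
  hab : a ≤ a'
  len : a' ≤ a + 1
  hb : 0 < b
  hbB : b ≤ B
  hB : 1 ≤ B
  hE : 1 ≤ E
  hD : 1 ≤ D
  hDE : D ^ 8 = E ^ J
  hW : Integrable W
  hom : ∫ z, |W z| ≤ om
  sm : Sm u
  eq : ∀ t, sl (src3 u) t = Tr W (sl u t) (sl u t) (sl u t)
  gd : ∀ t ∈ Icc a a', Gd s b D (sl u t)

namespace Sol
variable {s J : ℕ} {W : E3 → ℝ} {om E D B b a a' A : ℝ} {u : ℝ × E3 → ℂ} {m : ℝ → ℝ}

section
variable (hu : Sol s J W om E D B b a a' u)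
include hu

lemma om_nonneg : 0 ≤ om := (integral_nonneg fun _ => abs_nonneg _).trans hu.hom

lemma D_pos : 0 < D := one_pos.trans_le hu.hD

lemma B_pos : 0 < B := one_pos.trans_le hu.hB

lemma lb {σ : List (Fin 3)} (hσ : σ.length ≤ s) {t : ℝ} (ht : t ∈ Icc a a') :
    LB (sl (Dw σ u) t) (b * D ^ (σ.length - 1)) := by
  rw [← dx_sl hu.sm]
  exact (hu.gd t ht).lb σ hσ

lemma ub {σ : List (Fin 3)} (hσ : σ.length ≤ s) : UB a a' (Dw σ u) :=
  ⟨b * D ^ (σ.length - 1), mul_nonneg hu.hb.le (pow_nonneg hu.D_pos.le _), fun t ht => hu.lb hσ ht⟩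

lemma lb_src (hm0 : ∀ t, 0 ≤ m t)
    (hm : ∀ t ∈ Icc a a', ∀ σ : List (Fin 3), σ.length + 2 ≤ s → ∀ x,
      ‖Dw σ u (t, x)‖ ^ 2 ≤ D ^ (2 * σ.length) * m t)
    {τ : List (Fin 3)} (hτ : τ.length ≤ s) {t : ℝ} (ht : t ∈ Icc a a') :
    LB (sl (src3 (Dw τ u)) t) (b * D ^ (τ.length - 1) * (3 ^ (s + 1) * om * m t)) := by
  have hD := hu.D_pos
  rw [← src3_dw hu.sm, ← dx_sl (hu.sm.src _ _), hu.eq]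
  have := (hu.gd t ht).tr_lb (ℓ := √(m t)) hu.hs hu.hb.le hD (Real.sqrt_nonneg _) hu.hW hu.hom
    (fun σ hσ x => ?_) hτ
  · rwa [Real.sq_sqrt (hm0 t)] at this
  · refine le_of_sq_le_sq ?_ (by positivity)
    rw [mul_pow, Real.sq_sqrt (hm0 t), ← pow_mul, mul_comm σ.length, dx_sl hu.sm]
    exact hm t ht σ hσ x

lemma num (hm0 : ∀ t, 0 ≤ m t)
    (hm : ∀ t ∈ Icc a a', ∀ σ : List (Fin 3), σ.length + 2 ≤ s → ∀ x,
      ‖Dw σ u (t, x)‖ ^ 2 ≤ D ^ (2 * σ.length) * m t)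
    {τ : List (Fin 3)} (hτ : τ.length + 1 ≤ s) :
    Num a a' (Dw τ u) (b * D ^ (τ.length - 1)) (b * D ^ τ.length)
      (fun t => 3 ^ (s + 1) * om * m t) where
  n0 := mul_nonneg hu.hb.le (pow_nonneg hu.D_pos.le _)
  n1 := mul_nonneg hu.hb.le (pow_nonneg hu.D_pos.le _)
  q0 t ht := hu.lb (by omega) ht
  q1 t ht j := hu.lb (σ := j :: τ) (by simpa using hτ) ht
  q2 t ht := hu.lb_src hm0 hm (by omega) ht
  q3 t ht j := by
    have := hu.lb_src hm0 hm (τ := j :: τ) (by simpa using hτ) ht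
    rwa [← src3_dw hu.sm, Dw, src3_dw hu.sm] at this

lemma wnice (hm0 : ∀ t, 0 ≤ m t)
    (hm : ∀ t ∈ Icc a a', ∀ σ : List (Fin 3), σ.length + 2 ≤ s → ∀ x,
      ‖Dw σ u (t, x)‖ ^ 2 ≤ D ^ (2 * σ.length) * m t) {M : ℝ} (hM : ∀ t ∈ Icc a a', m t ≤ M)
    {τ : List (Fin 3)} (hτ : τ.length ≤ s) {Ψ : E3 → ℝ} (hΨ : Mol Ψ) : WNice a a' (Cv Ψ (Dw τ u)) := by
  have hD := hu.D_pos
  have hb := hu.hb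
  have hom := hu.om_nonneg
  have hM0 : 0 ≤ M := (hm0 a).trans (hM a ⟨le_rfl, hu.hab⟩)
  refine WNice.cv hΨ (hu.sm.dw τ) (hu.ub hτ)
    ⟨b * D ^ (τ.length - 1) * (3 ^ (s + 1) * om * M), by positivity, fun t ht => ?_⟩
  refine (hu.lb_src hm0 hm hτ ht).mono ?_
  gcongr
  exact hM t ht

lemma xq_le (τ : List (Fin 3)) (hτ : τ.length ≤ s) (n : ℕ) {t : ℝ} (ht : t ∈ Icc a a') :
    Bq (osc E n) (Cv (psi E n) (Dw τ u)) (Cv (psi E n) (Dw τ u)) t ≤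
      ENNReal.ofReal (15 / osc E n ^ 3 * ((2 * (b * D ^ (τ.length - 1))) ^ 2 *
        (2 * (b * D ^ (τ.length - 1))) ^ 2)) := by
  have hD := hu.D_pos
  have hb := hu.hb
  have := (isPc_psi hu.hE n).l2 (hu.sm.dw τ) (by positivity) (hu.lb hτ ht)
  exact bq_le (osc_pos hu.hE n) (by positivity) (by positivity) this this

lemma measurable_xq (τ : List (Fin 3)) (n : ℕ) : Measurable (xq E n (Dw τ u)) := by
  have hc := ((hu.sm.dw τ).cv (isPc_psi hu.hE n).toMol).continuous
  exact ((measurable_bq (osc_pos hu.hE n) hc hc).const_mul _).ennreal_toReal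

end

end Sol

namespace Sol
variable {s J : ℕ} {W : E3 → ℝ} {om E D B b a a' A : ℝ} {u : ℝ × E3 → ℂ} {m : ℝ → ℝ}

lemma xq_nonneg (n : ℕ) (f : ℝ × E3 → ℂ) (t : ℝ) : 0 ≤ xq E n f t := ENNReal.toReal_nonneg

section
variable (hu : Sol s J W om E D B b a a' u)
include hu

lemma xq_bdd {τ : List (Fin 3)} (hτ : τ.length ≤ s) (n : ℕ) :
    ∃ M, 0 ≤ M ∧ ∀ t ∈ Icc a a', xq E n (Dw τ u) t ≤ M := by
  have ho := osc_pos hu.hE n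
  refine ⟨_, ENNReal.toReal_nonneg, fun t ht => ENNReal.toReal_mono ?_
    (mul_le_mul_right (hu.xq_le τ hτ n ht) _)⟩
  exact ENNReal.mul_ne_top ENNReal.ofReal_ne_top ENNReal.ofReal_ne_top

lemma pow_four_le_xq {τ : List (Fin 3)} (hτ : τ.length ≤ s) (n : ℕ) {t : ℝ} (ht : t ∈ Icc a a')
    (x : E3) : ‖Cv (φ (osc E n)) (Cv (psi E n) (Dw τ u)) (t, x)‖ ^ 4 ≤ xq E n (Dw τ u) t := by
  have ho := osc_pos hu.hE n
  have hc := ((hu.sm.dw τ).cv (isPc_psi hu.hE n).toMol).continuous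
  have h1 := phi_pow_four ho hc x (t := t)
  have h2 := ENNReal.toReal_mono (ENNReal.mul_ne_top ENNReal.ofReal_ne_top
    ((hu.xq_le τ hτ n ht).trans_lt ENNReal.ofReal_lt_top).ne) h1
  simpa [xq] using h2

lemma intervalIntegrable_xq {τ : List (Fin 3)} (hτ : τ.length ≤ s) (n : ℕ) :
    IntervalIntegrable (xq E n (Dw τ u)) volume a a' := by
  obtain ⟨M, hM0, hM⟩ := hu.xq_bdd hτ n
  rw [intervalIntegrable_iff_integrableOn_Icc_of_le hu.hab]
  refine Measure.integrableOn_of_bounded (M := M) (by simp)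
    (hu.measurable_xq τ n).aestronglyMeasurable ?_
  refine (ae_restrict_iff' measurableSet_Icc).2 (Filter.Eventually.of_forall fun t ht => ?_)
  rw [Real.norm_of_nonneg (xq_nonneg _ _ _)]
  exact hM t ht

lemma integral_xq_le (hm0 : ∀ t, 0 ≤ m t)
    (hm : ∀ t ∈ Icc a a', ∀ σ : List (Fin 3), σ.length + 2 ≤ s → ∀ x,
      ‖Dw σ u (t, x)‖ ^ 2 ≤ D ^ (2 * σ.length) * m t) {M : ℝ} (hM : ∀ t ∈ Icc a a', m t ≤ M)
    (hmi : IntervalIntegrable m volume a a')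
    {τ : List (Fin 3)} (hτ : τ.length + 1 ≤ s) (n : ℕ) :
    ∫ t in a..a', xq E n (Dw τ u) t ≤ (D ^ (4 * τ.length)) *
      (12 ^ 7 * Cφ ^ 2 * E ^ 3 * b ^ 4 * (1 + 3 ^ (s + 1) * om * ∫ t in a..a', m t)) := by
  have hD := hu.D_pos
  have hb := hu.hb
  have hom := hu.om_nonneg
  have ho := osc_pos hu.hE n
  have hi := isc_pos hu.hE n
  have hΨ := isPc_psi hu.hE n
  have hC := one_le_Cφ
  have hE := hu.hE
  set l : ℝ → ℝ := fun t => 3 ^ (s + 1) * om * m t with hl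
  have hl0 : ∀ t, 0 ≤ l t := fun t => by have := hm0 t; simp only [hl]; positivity
  have hN := (hu.num hm0 hm hτ).pc_gain (hu.sm.dw τ) hl0 hΨ
  have hn := hu.wnice hm0 hm hM (by omega : τ.length ≤ s) hΨ.toMol
  have hr := rim hu.hab hn hn hN hN (hmi.const_mul _) hl0 ho
  have hlI : ∫ t in a..a', l t = 3 ^ (s + 1) * om * ∫ t in a..a', m t := by
    simp only [hl, intervalIntegral.integral_const_mul]
  have hmI : 0 ≤ ∫ t in a..a', m t := intervalIntegral.integral_nonneg hu.hab fun t _ => hm0 t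
  rw [hlI] at hr
  set L := 3 ^ (s + 1) * om * ∫ t in a..a', m t with hL
  have hL0 : 0 ≤ L := by positivity
  set w0 := 6 * isc E n * (b * D ^ (τ.length - 1) + b * D ^ τ.length) with hw0
  set q := b * D ^ τ.length with hq
  have hq0 : 0 < q := by positivity
  have hw0n : 0 ≤ w0 := by positivity
  have hw0le : w0 ≤ 12 * (E * osc E n) * q := by
    have h1 : b * D ^ (τ.length - 1) ≤ q := by
      simp only [hq]
      gcongr
      · exact hu.hD
      · omega
    calc w0 ≤ 6 * (E * osc E n) * (q + q) := by
          simp only [hw0]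
          gcongr
          exact isc_le hu.hE n
      _ = _ := by ring
  have key : ∫⁻ t in Icc a a', ENNReal.ofReal (146 * Cφ ^ 2 / osc E n ^ 3) *
      Bq (osc E n) (Cv (psi E n) (Dw τ u)) (Cv (psi E n) (Dw τ u)) t ≤
      ENNReal.ofReal ((D ^ (4 * τ.length)) * (12 ^ 7 * Cφ ^ 2 * E ^ 3 * b ^ 4 * (1 + L))) := by
    rw [lintegral_const_mul' _ _ ENNReal.ofReal_ne_top]
    refine (mul_le_mul_right (hr : ∫⁻ t in Icc a a',
      Bq (osc E n) (Cv (psi E n) (Dw τ u)) (Cv (psi E n) (Dw τ u)) t ≤ _) _).trans ?_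
    rw [← ENNReal.ofReal_mul (by positivity)]
    refine ENNReal.ofReal_le_ofReal ?_
    calc 146 * Cφ ^ 2 / osc E n ^ 3 * (3 * (w0 * w0 * (2 * q * w0 + w0 * (2 * q))) * (2 + 4 * L))
        = 146 * Cφ ^ 2 / osc E n ^ 3 * (12 * w0 ^ 3 * q * (2 + 4 * L)) := by ring
      _ ≤ 146 * Cφ ^ 2 / osc E n ^ 3 * (12 * (12 * (E * osc E n) * q) ^ 3 * q * (4 + 4 * L)) := by
          gcongr
          norm_num
      _ = 146 * 48 * 12 ^ 3 * Cφ ^ 2 * E ^ 3 * q ^ 4 * (1 + L) := by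
          field_simp
          ring
      _ ≤ 12 ^ 7 * Cφ ^ 2 * E ^ 3 * q ^ 4 * (1 + L) := by
          gcongr
          norm_num
      _ = _ := by
          simp only [hq, mul_pow, ← pow_mul, mul_comm τ.length 4]
          ring
  rw [intervalIntegral.integral_of_le hu.hab, ← integral_Icc_eq_integral_Ioc]
  unfold xq
  have hcc := (hu.sm.dw τ).cv hΨ.toMol |>.continuous
  rw [integral_toReal ((measurable_bq ho hcc hcc).const_mul _).aemeasurable]
  · refine (ENNReal.toReal_mono ENNReal.ofReal_ne_top key).trans_eq ?_
    exact ENNReal.toReal_ofReal (by positivity)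
  · refine (ae_restrict_iff' measurableSet_Icc).2 (Filter.Eventually.of_forall fun t ht => ?_)
    exact ENNReal.mul_lt_top ENNReal.ofReal_lt_top
      ((hu.xq_le τ (by omega) n ht).trans_lt ENNReal.ofReal_lt_top)

end

end Sol

lemma intervalIntegrable_finsetSum {ι : Type*} {s : Finset ι} {f : ι → ℝ → ℝ} {a b : ℝ}
    (h : ∀ i ∈ s, IntervalIntegrable (f i) volume a b) :
    IntervalIntegrable (fun t => ∑ i ∈ s, f i t) volume a b := by
  have := IntervalIntegrable.sum s h
  rwa [show ∑ i ∈ s, f i = fun t => ∑ i ∈ s, f i t from funext fun t => Finset.sum_apply _ _ _] at this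

/-- Constant comparing squared sup norms with their majorant. -/
def K0 (J : ℕ) : ℝ := (2 * (J : ℝ) + 1) ^ 2 + (2 * J + 1) + 2 * (324 * Cφ) ^ 2

lemma K0_pos (J : ℕ) : 0 < K0 J := by
  unfold K0
  positivity

namespace Sol
variable {s J : ℕ} {W : E3 → ℝ} {om E D B b a a' A : ℝ} {u : ℝ × E3 → ℂ} {m : ℝ → ℝ}

lemma mt_nonneg (hD : 0 ≤ D) (hA : 0 ≤ A) (t : ℝ) : 0 ≤ mt s J E D A u t := by
  refine add_nonneg hA (mul_nonneg (inv_nonneg.2 hA) (Finset.sum_nonneg fun σ _ =>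
    Finset.sum_nonneg fun n _ => mul_nonneg (by positivity) (xq_nonneg _ _ _)))

section
variable (hu : Sol s J W om E D B b a a' u)
include hu

lemma mt_bdd (hA : 0 ≤ A) : ∃ M, ∀ t ∈ Icc a a', mt s J E D A u t ≤ M := by
  have hD := hu.D_pos
  have : ∀ σ : List (Fin 3), ∀ n, ∃ M, σ.length ≤ s → ∀ t ∈ Icc a a', xq E n (Dw σ u) t ≤ M := by
    intro σ n
    by_cases h : σ.length ≤ s
    · obtain ⟨M, -, hM⟩ := hu.xq_bdd h n
      exact ⟨M, fun _ => hM⟩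
    · exact ⟨0, fun h' => absurd h' h⟩
  choose M hM using this
  refine ⟨A + A⁻¹ * ∑ σ ∈ wd (s - 2), ∑ n ∈ Finset.range (2 * J + 1),
    (D ^ (4 * σ.length))⁻¹ * M σ n, fun t ht => ?_⟩
  unfold mt
  gcongr with σ hσ n hn
  exact hM σ n ((mem_wd.1 hσ).trans (by omega)) t ht

lemma intervalIntegrable_mt : IntervalIntegrable (mt s J E D A u) volume a a' := by
  unfold mt
  refine IntervalIntegrable.add (f := fun _ => A) (by simp) (IntervalIntegrable.const_mul ?_ _)
  refine intervalIntegrable_finsetSum fun σ hσ => intervalIntegrable_finsetSum fun n hn => ?_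
  exact (hu.intervalIntegrable_xq ((mem_wd.1 hσ).trans (by omega)) n).const_mul _

lemma sqrt_scale : √((E ^ J)⁻¹) = (D ^ 4)⁻¹ := by
  have hD := hu.D_pos
  rw [← hu.hDE, Real.sqrt_inv, show D ^ 8 = (D ^ 4) ^ 2 by ring, Real.sqrt_sq (by positivity)]

lemma remainder_le {σ : List (Fin 3)} (hσ : σ.length + 2 ≤ s) {t : ℝ} (ht : t ∈ Icc a a') (x : E3) :
    ‖Dw σ u (t, x) - Cv (φ (E ^ J)⁻¹) (Cv (φ (E ^ J)⁻¹) (Dw σ u)) (t, x)‖ ≤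
      324 * Cφ * b * (D ^ 4)⁻¹ * D ^ (σ.length + 1) := by
  have hD := hu.D_pos
  have hb := hu.hb
  have hE : 0 < E := one_pos.trans_le hu.hE
  have := norm_sub_cv_phi_le (h := (E ^ J)⁻¹) (t := t) (c := b * D ^ (σ.length + 1)) (by positivity)
    (hu.sm.dw σ) (by positivity) (fun i j => hu.lb (σ := j :: i :: σ) hσ ht) x
  rw [hu.sqrt_scale] at this
  exact this.trans_eq (by ring)

lemma sq_le_mt (hA0 : 0 < A) (hbA : b ^ 2 ≤ A) {t : ℝ} (ht : t ∈ Icc a a') (σ : List (Fin 3))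
    (hσ : σ.length + 2 ≤ s) (x : E3) :
    ‖Dw σ u (t, x)‖ ^ 2 ≤ D ^ (2 * σ.length) * (K0 J * mt s J E D A u t) := by
  have hD := hu.D_pos
  have hD1 := hu.hD
  have hb := hu.hb
  have hC := one_le_Cφ
  set k := σ.length with hk
  set P : ℝ := 2 * (J : ℝ) + 1 with hP
  have hP0 : 0 < P := by positivity
  set Y : ℕ → ℝ := fun n => ‖Cv (φ (osc E n)) (Cv (psi E n) (Dw σ u)) (t, x)‖ with hY
  set r := 324 * Cφ * b with hr
  set S1 := ∑ n ∈ Finset.range (2 * J + 1), (D ^ (4 * k))⁻¹ * xq E n (Dw σ u) t with hS1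
  set S := ∑ σ ∈ wd (s - 2), ∑ n ∈ Finset.range (2 * J + 1),
    (D ^ (4 * σ.length))⁻¹ * xq E n (Dw σ u) t with hS
  have hnn : ∀ σ : List (Fin 3), ∀ n, 0 ≤ (D ^ (4 * σ.length))⁻¹ * xq E n (Dw σ u) t :=
    fun σ n => mul_nonneg (by positivity) (xq_nonneg _ _ _)
  have h1 : S1 ≤ S := Finset.single_le_sum
    (f := fun σ : List (Fin 3) => ∑ n ∈ Finset.range (2 * J + 1),
      (D ^ (4 * σ.length))⁻¹ * xq E n (Dw σ u) t)
    (fun σ _ => Finset.sum_nonneg fun n _ => hnn σ n) (mem_wd.2 (by omega))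
  have hS0 : 0 ≤ S1 := Finset.sum_nonneg fun n _ => hnn σ n
  have hrem : ‖Dw σ u (t, x) - Cv (φ (E ^ J)⁻¹) (Cv (φ (E ^ J)⁻¹) (Dw σ u)) (t, x)‖ ≤ r * D ^ k := by
    refine (hu.remainder_le hσ ht x).trans ?_
    have : (D ^ 4)⁻¹ * D ^ (k + 1) ≤ D ^ k := by
      rw [inv_mul_le_iff₀ (by positivity), ← pow_add]
      exact pow_le_pow_right₀ hD1 (by omega)
    calc 324 * Cφ * b * (D ^ 4)⁻¹ * D ^ (k + 1) = r * ((D ^ 4)⁻¹ * D ^ (k + 1)) := by ring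
      _ ≤ _ := by gcongr
  have h2 : ‖Dw σ u (t, x)‖ ≤ (∑ n ∈ Finset.range (2 * J + 1), Y n) + r * D ^ k :=
    (norm_le_decomp hu.hE (hu.sm.dw σ) (t, x) J).trans (add_le_add le_rfl hrem)
  have h3 : (∑ n ∈ Finset.range (2 * J + 1), Y n) ^ 2 ≤
      P * ∑ n ∈ Finset.range (2 * J + 1), Y n ^ 2 := by
    have := sq_sum_le_card_mul_sum_sq (s := Finset.range (2 * J + 1)) (f := Y)
    rw [Finset.card_range] at this
    push_cast at this
    exact this
  have h4 : ∀ n, Y n ^ 2 ≤ D ^ (2 * k) * ((A + A⁻¹ * ((D ^ (4 * k))⁻¹ * xq E n (Dw σ u) t)) / 2) := by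
    intro n
    have e := hu.pow_four_le_xq (by omega : σ.length ≤ s) n ht x
    set z := Y n ^ 2 / D ^ (2 * k) with hz
    have hz2 : z ^ 2 ≤ (D ^ (4 * k))⁻¹ * xq E n (Dw σ u) t := by
      have : z ^ 2 = (D ^ (4 * k))⁻¹ * Y n ^ 4 := by
        rw [hz, div_pow, ← pow_mul, ← pow_mul, show 2 * k * 2 = 4 * k by ring]
        field_simp
      rw [this]
      gcongr
    have hz3 : z ≤ (A + A⁻¹ * z ^ 2) / 2 := by
      have : A + A⁻¹ * z ^ 2 - 2 * z = A⁻¹ * (A - z) ^ 2 := by field_simp; ring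
      have : 0 ≤ A⁻¹ * (A - z) ^ 2 := by positivity
      linarith
    calc Y n ^ 2 = D ^ (2 * k) * z := by rw [hz]; field_simp
      _ ≤ D ^ (2 * k) * ((A + A⁻¹ * z ^ 2) / 2) := by gcongr
      _ ≤ _ := by gcongr
  have h5 : ∑ n ∈ Finset.range (2 * J + 1), Y n ^ 2 ≤ D ^ (2 * k) * ((P * A + A⁻¹ * S1) / 2) := by
    refine (Finset.sum_le_sum fun n _ => h4 n).trans (le_of_eq ?_)
    rw [← Finset.mul_sum, ← Finset.sum_div, Finset.sum_add_distrib, ← Finset.mul_sum]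
    simp only [Finset.sum_const, Finset.card_range, nsmul_eq_mul, hP, hS1]
    push_cast
    ring
  have hAS : 0 ≤ A⁻¹ * S1 := by positivity
  calc ‖Dw σ u (t, x)‖ ^ 2 ≤ ((∑ n ∈ Finset.range (2 * J + 1), Y n) + r * D ^ k) ^ 2 := by gcongr
    _ ≤ 2 * (∑ n ∈ Finset.range (2 * J + 1), Y n) ^ 2 + 2 * (r * D ^ k) ^ 2 := by
        nlinarith [sq_nonneg ((∑ n ∈ Finset.range (2 * J + 1), Y n) - r * D ^ k)]
    _ ≤ 2 * (P * (D ^ (2 * k) * ((P * A + A⁻¹ * S1) / 2))) + 2 * (r * D ^ k) ^ 2 := by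
        gcongr
        exact h3.trans (by gcongr)
    _ = D ^ (2 * k) * (P ^ 2 * A + P * (A⁻¹ * S1) + 2 * (324 * Cφ) ^ 2 * b ^ 2) := by
        rw [hr, mul_pow _ (D ^ k), ← pow_mul, mul_comm k 2]
        ring
    _ ≤ D ^ (2 * k) * (K0 J * (A + A⁻¹ * S1)) := by
        gcongr
        have : 2 * (324 * Cφ) ^ 2 * b ^ 2 ≤ 2 * (324 * Cφ) ^ 2 * A := by gcongr
        have e : K0 J = P ^ 2 + P + 2 * (324 * Cφ) ^ 2 := rfl
        rw [e]
        have : 0 ≤ (P ^ 2 + 2 * (324 * Cφ) ^ 2) * (A⁻¹ * S1) := by positivity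
        have : 0 ≤ P * A := by positivity
        nlinarith
    _ ≤ _ := by
        have := K0_pos J
        unfold mt
        gcongr

lemma integral_mt_le (hA0 : 0 < A) (hbA : b ^ 2 ≤ A) :
    ∫ t in a..a', mt s J E D A u t ≤ A + A⁻¹ * ((wd (s - 2)).card * (2 * J + 1) *
      (12 ^ 7 * Cφ ^ 2 * E ^ 3 * b ^ 4 *
        (1 + 3 ^ (s + 1) * om * (K0 J * ∫ t in a..a', mt s J E D A u t)))) := by
  have hD := hu.D_pos
  have hK := K0_pos J
  obtain ⟨M, hM⟩ := hu.mt_bdd hA0.le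
  have hs := hu.hs
  have hl : a' - a ≤ 1 := by linarith [hu.len]
  have hX : ∀ σ ∈ wd (s - 2), ∀ n, ∫ t in a..a', (D ^ (4 * σ.length))⁻¹ * xq E n (Dw σ u) t ≤
      12 ^ 7 * Cφ ^ 2 * E ^ 3 * b ^ 4 *
        (1 + 3 ^ (s + 1) * om * (K0 J * ∫ t in a..a', mt s J E D A u t)) := by
    intro σ hσ n
    have := hu.integral_xq_le (m := fun t => K0 J * mt s J E D A u t)
      (fun t => mul_nonneg hK.le (mt_nonneg hD.le hA0.le t))
      (fun t ht σ hσ x => hu.sq_le_mt hA0 hbA ht σ hσ x)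
      (M := K0 J * M) (fun t ht => by gcongr; exact hM t ht)
      (hu.intervalIntegrable_mt.const_mul _) (τ := σ) (by have := mem_wd.1 hσ; omega) n
    rw [intervalIntegral.integral_const_mul] at this ⊢
    rwa [inv_mul_le_iff₀ (by positivity)]
  have hI : ∀ σ ∈ wd (s - 2), ∀ n, IntervalIntegrable
      (fun t => (D ^ (4 * σ.length))⁻¹ * xq E n (Dw σ u) t) volume a a' := fun σ hσ n =>
    (hu.intervalIntegrable_xq ((mem_wd.1 hσ).trans (by omega)) n).const_mul _
  have e : ∫ t in a..a', mt s J E D A u t = (a' - a) * A + A⁻¹ * ∑ σ ∈ wd (s - 2),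
      ∑ n ∈ Finset.range (2 * J + 1), ∫ t in a..a', (D ^ (4 * σ.length))⁻¹ * xq E n (Dw σ u) t := by
    unfold mt
    rw [intervalIntegral.integral_add (by simp), intervalIntegral.integral_const_mul,
      intervalIntegral.integral_finsetSum]
    · rw [intervalIntegral.integral_const, smul_eq_mul]
      congr 2
      refine Finset.sum_congr rfl fun σ hσ => ?_
      rw [intervalIntegral.integral_finsetSum fun n _ => hI σ hσ n]
    · exact fun σ hσ => intervalIntegrable_finsetSum fun n _ => hI σ hσ n
    · exact IntervalIntegrable.const_mul (intervalIntegrable_finsetSum fun σ hσ =>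
        intervalIntegrable_finsetSum fun n _ => hI σ hσ n) _
  conv_lhs => rw [e]
  refine add_le_add (by nlinarith) (mul_le_mul_of_nonneg_left ?_ (by positivity))
  refine (Finset.sum_le_sum fun σ hσ => Finset.sum_le_sum fun n _ => hX σ hσ n).trans ?_
  simp only [Finset.sum_const, Finset.card_range, nsmul_eq_mul]
  push_cast
  exact le_of_eq (by ring)

end

/-- Majorant of the squared sup norms with integrable size. -/
theorem exists_majorant (s J : ℕ) : ∃ K : ℝ, 1 ≤ K ∧ ∀ {W : E3 → ℝ} {om E D B b a a' : ℝ}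
    {u : ℝ × E3 → ℂ}, Sol s J W om E D B b a a' u → ∃ m : ℝ → ℝ, (∀ t, 0 ≤ m t) ∧
      IntervalIntegrable m volume a a' ∧ (∃ M, ∀ t ∈ Icc a a', m t ≤ M) ∧
      (∀ t ∈ Icc a a', ∀ σ : List (Fin 3), σ.length + 2 ≤ s → ∀ x,
        ‖Dw σ u (t, x)‖ ^ 2 ≤ D ^ (2 * σ.length) * m t) ∧
      ∫ t in a..a', m t ≤ K * ((1 + om) * E ^ 3 * B ^ 4) := by
  set Q : ℝ := (wd (s - 2)).card * (2 * J + 1) * (12 ^ 7 * Cφ ^ 2) with hQ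
  have hC := one_le_Cφ
  have hK := K0_pos J
  have hQ0 : 0 ≤ Q := by positivity
  set K2 : ℝ := 1 + 2 * (Q * (1 + 3 ^ (s + 1) * K0 J)) with hK2
  have hK21 : 1 ≤ K2 := by rw [hK2]; linarith [show 0 ≤ 2 * (Q * (1 + 3 ^ (s + 1) * K0 J)) by positivity]
  refine ⟨1 + 4 * K0 J * K2, by linarith [show 0 ≤ 4 * K0 J * K2 by positivity], ?_⟩
  intro W om E D B b a a' u hu
  have hD := hu.D_pos
  have hom := hu.om_nonneg
  have hE := hu.hE
  have hB := hu.hB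
  have hb := hu.hb
  set G : ℝ := (1 + om) * E ^ 3 * B ^ 4 with hG
  have hbB : b ^ 2 ≤ B ^ 4 := by
    calc b ^ 2 ≤ B ^ 2 := by gcongr; exact hu.hbB
      _ ≤ B ^ 4 := pow_le_pow_right₀ hB (by norm_num)
  have hG1 : B ^ 4 ≤ G := by
    calc B ^ 4 = 1 * 1 * B ^ 4 := by ring
      _ ≤ _ := by
        rw [hG]
        gcongr
        · linarith
        · exact one_le_pow₀ hE
  have hG0 : 1 ≤ G := (one_le_pow₀ hB).trans hG1
  have hA0 : 0 < K2 * G := by positivity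
  have hbA : b ^ 2 ≤ K2 * G := by nlinarith
  set I := ∫ t in a..a', mt s J E D (K2 * G) u t with hI
  have hI0 : 0 ≤ I := intervalIntegral.integral_nonneg hu.hab fun t _ => mt_nonneg hD.le hA0.le t
  have key := hu.integral_mt_le hA0 hbA
  rw [← hI] at key
  obtain ⟨M, hM⟩ := hu.mt_bdd hA0.le
  refine ⟨fun t => K0 J * mt s J E D (K2 * G) u t,
    fun t => mul_nonneg hK.le (mt_nonneg hD.le hA0.le t), hu.intervalIntegrable_mt.const_mul _,
    ⟨K0 J * M, fun t ht => mul_le_mul_of_nonneg_left (hM t ht) hK.le⟩,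
    fun t ht σ hσ x => hu.sq_le_mt hA0 hbA ht σ hσ x, ?_⟩
  rw [intervalIntegral.integral_const_mul, ← hI]
  have h1 : (K2 * G)⁻¹ * ((wd (s - 2)).card * (2 * J + 1) *
      (12 ^ 7 * Cφ ^ 2 * E ^ 3 * b ^ 4 * (1 + 3 ^ (s + 1) * om * (K0 J * I)))) ≤ (1 + I) / 2 := by
    rw [inv_mul_le_iff₀ hA0]
    calc _ = Q * (E ^ 3 * b ^ 4) * (1 + 3 ^ (s + 1) * K0 J * om * I) := by rw [hQ]; ring
      _ ≤ Q * (E ^ 3 * B ^ 4) * ((1 + 3 ^ (s + 1) * K0 J) * ((1 + om) * (1 + I))) := by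
          gcongr
          · exact hu.hbB
          · have h1 : 0 ≤ om * I := by positivity
            have h2 : 0 ≤ (3 : ℝ) ^ (s + 1) * K0 J * (1 + om + I) := by positivity
            nlinarith
      _ = (2 * (Q * (1 + 3 ^ (s + 1) * K0 J))) * G * ((1 + I) / 2) := by rw [hG]; ring
      _ ≤ K2 * G * ((1 + I) / 2) := by
          gcongr
          linarith
  have h2 : I ≤ 4 * K2 * G := by nlinarith
  calc K0 J * I ≤ K0 J * (4 * K2 * G) := by gcongr
    _ ≤ _ := by nlinarith

end Sol

section fatou

lemma lintegral_le_of_tendsto {a b : ℝ} {M : ℝ≥0∞} {G : ℕ → ℝ × E3 → ℝ≥0∞} {F : ℝ × E3 → ℝ≥0∞}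
    (hG : ∀ n, Measurable (G n)) (hF : Measurable F)
    (hl : ∀ p, Filter.Tendsto (fun n => G n p) Filter.atTop (𝓝 (F p)))
    (hM : ∀ n, ∫⁻ t in Icc a b, ∫⁻ x, G n (t, x) ≤ M) : ∫⁻ t in Icc a b, ∫⁻ x, F (t, x) ≤ M := by
  rw [← lintegral_prod _ hF.aemeasurable]
  have e : F = fun p => Filter.liminf (fun n => G n p) Filter.atTop :=
    funext fun p => (hl p).liminf_eq.symm
  rw [e]
  refine (lintegral_liminf_le hG).trans (Filter.liminf_le_of_frequently_le'
    (Filter.Frequently.of_forall fun n => ?_))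
  rw [lintegral_prod _ (hG n).aemeasurable]
  exact hM n

lemma enorm_sq_eq (z : ℂ) : ‖z‖ₑ ^ 2 = ENNReal.ofReal (‖z‖ ^ 2) := by
  rw [ENNReal.ofReal_pow (norm_nonneg _), ofReal_norm]

/-- The fourth power of an average is controlled by the interaction density. -/
lemma lintegral_phi_pow_four {h t : ℝ} {d : ℝ × E3 → ℂ} (hh : 0 < h) (hd : Continuous d) :
    ∫⁻ x, ‖Cv (φ h) d (t, x)‖ₑ ^ 4 ≤ ENNReal.ofReal (146 * Cφ) * Bq h d d t := by
  have hφ : Continuous (φ h) := (avg_phi hh).sm.continuous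
  have hk := continuous_kap hh
  have hC := one_le_Cφ
  have hpos := (avg_phi hh).nonneg
  have k0 : ∀ z, 0 ≤ kap h z := fun z => by
    have := kg_pos (θ := fun _ => 1) hh (by simp) z
    unfold kap; positivity
  have hm : ∀ x, Measurable fun y => ENNReal.ofReal (φ h (x - y)) * ‖d (t, y)‖ₑ ^ 2 := fun x => by
    have h1 : Continuous fun y => φ h (x - y) := hφ.comp (by fun_prop)
    have h2 : Continuous fun y => d (t, y) := hd.comp (by fun_prop)
    exact h1.measurable.ennreal_ofReal.mul (h2.measurable.enorm.pow_const 2)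
  have c2 : Continuous fun q : E3 × E6 => d (t, q.2.1) := hd.comp (by fun_prop)
  have c3 : Continuous fun q : E3 × E6 => d (t, q.2.2) := hd.comp (by fun_prop)
  have c4 : Continuous fun q : E3 × E6 => kap h (q.2.1 - q.2.2) := hk.comp (by fun_prop)
  have c5 : Continuous fun q : E3 × E6 => φ h (q.1 - q.2.1) := hφ.comp (by fun_prop)
  have hM : Measurable fun q : E3 × E6 => ENNReal.ofReal (φ h (q.1 - q.2.1)) *
      (ENNReal.ofReal (146 * Cφ) * (ENNReal.ofReal (kap h (q.2.1 - q.2.2)) *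
        (‖d (t, q.2.1)‖ₑ ^ 2 * ‖d (t, q.2.2)‖ₑ ^ 2))) :=
    c5.measurable.ennreal_ofReal.mul ((c4.measurable.ennreal_ofReal.mul
      ((c2.measurable.enorm.pow_const 2).mul (c3.measurable.enorm.pow_const 2))).const_mul _)
  have hone : ∀ y, ∫⁻ x, ENNReal.ofReal (φ h (x - y)) = 1 := fun y => by
    rw [lintegral_sub_right_eq_self (fun x => ENNReal.ofReal (φ h x)),
      ← ofReal_integral_eq_lintegral_ofReal (avg_phi hh).toMol.integrable
        (Filter.Eventually.of_forall hpos), (avg_phi hh).mass, ENNReal.ofReal_one]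
  calc ∫⁻ x, ‖Cv (φ h) d (t, x)‖ₑ ^ 4
      ≤ ∫⁻ x, ∫⁻ z : E6, (ENNReal.ofReal (φ h (x - z.1)) * ‖d (t, z.1)‖ₑ ^ 2) *
          (ENNReal.ofReal (φ h (x - z.2)) * ‖d (t, z.2)‖ₑ ^ 2) := by
        refine lintegral_mono fun x => ?_
        rw [Measure.volume_eq_prod, lintegral_prod_mul (hm x).aemeasurable (hm x).aemeasurable]
        calc ‖Cv (φ h) d (t, x)‖ₑ ^ 4 = ‖Cv (φ h) d (t, x)‖ₑ ^ 2 * ‖Cv (φ h) d (t, x)‖ₑ ^ 2 := by ring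
          _ ≤ _ := mul_le_mul' (phi_jensen hh hd x) (phi_jensen hh hd x)
    _ ≤ ∫⁻ x, ∫⁻ z : E6, ENNReal.ofReal (φ h (x - z.1)) * (ENNReal.ofReal (146 * Cφ) *
          (ENNReal.ofReal (kap h (z.1 - z.2)) * (‖d (t, z.1)‖ₑ ^ 2 * ‖d (t, z.2)‖ₑ ^ 2))) := by
        refine lintegral_mono fun x => lintegral_mono fun z => ?_
        have : φ h (x - z.1) * φ h (x - z.2) ≤ φ h (x - z.1) * (146 * Cφ * kap h (z.1 - z.2)) := by
          by_cases h1 : ‖x - z.1‖ ≤ h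
          · refine mul_le_mul_of_nonneg_left ?_ (hpos _)
            by_cases h2 : ‖x - z.2‖ ≤ h
            · have h3 : ‖z.1 - z.2‖ ≤ 2 * h := by
                have : z.1 - z.2 = (x - z.2) - (x - z.1) := by abel
                rw [this]
                exact (norm_sub_le _ _).trans (by linarith)
              have h4 := kap_near hh h3
              calc φ h (x - z.2) ≤ Cφ / h ^ 3 := phi_le hh _
                _ = Cφ * (1 / h ^ 3) := by ring
                _ ≤ Cφ * (146 * kap h (z.1 - z.2)) := by gcongr
                _ = _ := by ring
            · rw [(avg_phi hh).supp _ (not_le.1 h2)]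
              have := k0 (z.1 - z.2)
              positivity
          · rw [(avg_phi hh).supp _ (not_le.1 h1), zero_mul, zero_mul]
        rw [mul_mul_mul_comm, ← ENNReal.ofReal_mul (hpos _), ← mul_assoc (ENNReal.ofReal (146 * Cφ)),
          ← ENNReal.ofReal_mul (by positivity), ← mul_assoc (ENNReal.ofReal (φ h (x - z.1))),
          ← ENNReal.ofReal_mul (hpos _)]
        gcongr
    _ = ∫⁻ z : E6, ∫⁻ x, ENNReal.ofReal (φ h (x - z.1)) * (ENNReal.ofReal (146 * Cφ) *
          (ENNReal.ofReal (kap h (z.1 - z.2)) * (‖d (t, z.1)‖ₑ ^ 2 * ‖d (t, z.2)‖ₑ ^ 2))) :=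
        lintegral_lintegral_swap hM.aemeasurable
    _ = ∫⁻ z : E6, ENNReal.ofReal (146 * Cφ) *
          (ENNReal.ofReal (kap h (z.1 - z.2)) * (‖d (t, z.1)‖ₑ ^ 2 * ‖d (t, z.2)‖ₑ ^ 2)) := by
        refine lintegral_congr fun z => ?_
        have h1 : Continuous fun x => φ h (x - z.1) := hφ.comp (by fun_prop)
        rw [lintegral_mul_const _ h1.measurable.ennreal_ofReal, hone, one_mul]
    _ = _ := lintegral_const_mul' _ _ ENNReal.ofReal_ne_top

end fatou

/-- A majorant of the squared sup norms of low-order derivatives. -/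
structure Maj (s : ℕ) (D a a' : ℝ) (u : ℝ × E3 → ℂ) (m : ℝ → ℝ) : Prop where
  nn : ∀ t, 0 ≤ m t
  int : IntervalIntegrable m volume a a'
  bdd : ∃ M, ∀ t ∈ Icc a a', m t ≤ M
  sup : ∀ t ∈ Icc a a', ∀ σ : List (Fin 3), σ.length + 2 ≤ s → ∀ x,
    ‖Dw σ u (t, x)‖ ^ 2 ≤ D ^ (2 * σ.length) * m t

namespace Sol
variable {s J : ℕ} {W : E3 → ℝ} {om E D B b a a' A : ℝ} {u : ℝ × E3 → ℂ} {m : ℝ → ℝ}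

/-- Integral of the Gronwall weight. -/
def lam (s : ℕ) (om a a' : ℝ) (m : ℝ → ℝ) : ℝ := ∫ t in a..a', 3 ^ (s + 1) * om * m t

section
variable (hu : Sol s J W om E D B b a a' u) (hm : Maj s D a a' u m)
include hu hm

lemma weight_nonneg (t : ℝ) : 0 ≤ 3 ^ (s + 1) * om * m t := by
  have := hm.nn t
  have := hu.om_nonneg
  positivity

lemma lam_nonneg : 0 ≤ lam s om a a' m :=
  intervalIntegral.integral_nonneg hu.hab fun t _ => hu.weight_nonneg hm t

lemma majWNice {τ : List (Fin 3)} (hτ : τ.length ≤ s) {Ψ : E3 → ℝ} (hΨ : Mol Ψ) :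
    WNice a a' (Cv Ψ (Dw τ u)) := by
  obtain ⟨M, hM⟩ := hm.bdd
  exact hu.wnice hm.nn hm.sup hM hτ hΨ

lemma rim' {w p : ℝ × E3 → ℂ} {w0 w1 p0 p1 h : ℝ} (hw : WNice a a' w) (hp : WNice a a' p)
    (nw : Num a a' w w0 w1 fun t => 3 ^ (s + 1) * om * m t)
    (np : Num a a' p p0 p1 fun t => 3 ^ (s + 1) * om * m t) (hh : 0 < h) :
    ∫⁻ t in Icc a a', Bq h w p t ≤
      ENNReal.ofReal (3 * (w0 * p0 * (w1 * p0 + w0 * p1)) * (2 + 4 * lam s om a a' m)) :=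
  rim hu.hab hw hp nw np (hm.int.const_mul _) (hu.weight_nonneg hm) hh

lemma planewise' {w p : ℝ × E3 → ℂ} {w0 w1 p0 p1 h : ℝ} (hw : WNice a a' w) (hp : WNice a a' p)
    (nw : Num a a' w w0 w1 fun t => 3 ^ (s + 1) * om * m t)
    (np : Num a a' p p0 p1 fun t => 3 ^ (s + 1) * om * m t) (hh : 0 < h) (i : Fin 3) :
    ∫⁻ t in Icc a a', Pq i h w p t ≤
      ENNReal.ofReal (3 * (w0 * p0 * (w1 * p0 + w0 * p1)) * (2 + 4 * lam s om a a' m)) :=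
  planewise hu.hab hw hp nw np (hm.int.const_mul _) (hu.weight_nonneg hm) hh i

/-- Space-time `L⁴` bound for intermediate derivatives. -/
lemma lintegral_pow_four_le {τ : List (Fin 3)} (h1 : 1 ≤ τ.length) (hτ : τ.length + 1 ≤ s) :
    ∫⁻ t in Icc a a', ∫⁻ x, ‖Dw τ u (t, x)‖ₑ ^ 4 ≤
      ENNReal.ofReal (12 ^ 4 * Cφ * (1 + lam s om a a' m) * b ^ 4 * D ^ (4 * τ.length - 3)) := by
  have hD := hu.D_pos
  have hb := hu.hb
  have hC := one_le_Cφ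
  have hL := hu.lam_nonneg hm
  let η : ℕ → ℝ := fun n => 1 / ((n : ℝ) + 1)
  have h0 : ∀ n, 0 < η n := fun n => by simp only [η]; positivity
  have hη : Filter.Tendsto η Filter.atTop (𝓝 0) := tendsto_one_div_add_atTop_nhds_zero_nat
  have hf := hu.sm.dw τ
  have hs1 : ∀ n, Sm (Cv (φ (η n)) (Dw τ u)) := fun n => hf.cv (avg_phi (h0 n)).toMol
  have hs2 : ∀ n, Sm (Cv (φ (η n)) (Cv (φ (η n)) (Dw τ u))) := fun n =>
    (hs1 n).cv (avg_phi (h0 n)).toMol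
  refine lintegral_le_of_tendsto
    (G := fun n p => ‖Cv (φ (η n)) (Cv (φ (η n)) (Dw τ u)) p‖ₑ ^ 4) (F := fun p => ‖Dw τ u p‖ₑ ^ 4)
    (fun n => (hs2 n).continuous.measurable.enorm.pow_const 4)
    (hf.continuous.measurable.enorm.pow_const 4)
    (fun p => ((ENNReal.continuous_pow 4).tendsto _).comp
      ((continuous_enorm.tendsto _).comp (tendsto_cv_phi_cv_phi hf p h0 hη))) fun n => ?_
  have hN := (hu.num hm.nn hm.sup hτ).avg hf (hu.weight_nonneg hm) (avg_phi (h0 n))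
  have hw := hu.majWNice hm (by omega : τ.length ≤ s) (avg_phi (h0 n)).toMol
  calc _ ≤ ∫⁻ t in Icc a a', ENNReal.ofReal (146 * Cφ) *
        Bq (η n) (Cv (φ (η n)) (Dw τ u)) (Cv (φ (η n)) (Dw τ u)) t :=
        lintegral_mono fun t => lintegral_phi_pow_four (h0 n) (hs1 n).continuous
    _ ≤ _ := by
        rw [lintegral_const_mul' _ _ ENNReal.ofReal_ne_top]
        refine (mul_le_mul_right (hu.rim' hm hw hw hN hN (h0 n)) _).trans ?_
        rw [← ENNReal.ofReal_mul (by positivity)]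
        refine ENNReal.ofReal_le_ofReal ?_
        obtain ⟨k, hk⟩ : ∃ k, τ.length = k + 1 := ⟨τ.length - 1, by omega⟩
        rw [hk]
        simp only [Nat.add_sub_cancel]
        rw [show 4 * (k + 1) - 3 = 4 * k + 1 by omega]
        calc _ = 876 * Cφ * (2 + 4 * lam s om a a' m) * b ^ 4 * D ^ (4 * k + 1) := by ring
          _ ≤ 876 * Cφ * (4 + 4 * lam s om a a' m) * b ^ 4 * D ^ (4 * k + 1) := by gcongr; norm_num
          _ = 3504 * Cφ * (1 + lam s om a a' m) * b ^ 4 * D ^ (4 * k + 1) := by ring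
          _ ≤ _ := by gcongr; norm_num

end
end Sol

/-- Constant in the bilinear estimate. -/
def KQ (J : ℕ) : ℝ := (2 * (J : ℝ) + 1) ^ 2 * (12 ^ 6 * Cφ) + 2 * (324 * Cφ) ^ 2

lemma KQ_pos (J : ℕ) : 0 < KQ J := by
  have := one_le_Cφ
  unfold KQ
  positivity

namespace Sol
variable {s J : ℕ} {W : E3 → ℝ} {om E D B b a a' A : ℝ} {u : ℝ × E3 → ℂ} {m : ℝ → ℝ}

section
variable (hu : Sol s J W om E D B b a a' u)
include hu

lemma enorm_sq_le_pieces {t : ℝ} (ht : t ∈ Icc a a') (x : E3) :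
    ‖u (t, x)‖ₑ ^ 2 ≤ ENNReal.ofReal (2 * (2 * J + 1)) * ∑ n ∈ Finset.range (2 * J + 1),
      ‖Cv (φ (osc E n)) (Cv (psi E n) u) (t, x)‖ₑ ^ 2 +
      ENNReal.ofReal (2 * (324 * Cφ * b * (D ^ 3)⁻¹) ^ 2) := by
  have hD := hu.D_pos
  have hb := hu.hb
  have hC := one_le_Cφ
  set Y : ℕ → ℝ := fun n => ‖Cv (φ (osc E n)) (Cv (psi E n) u) (t, x)‖ with hY
  set r := 324 * Cφ * b * (D ^ 3)⁻¹ with hr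
  have hrem : ‖u (t, x) - Cv (φ (E ^ J)⁻¹) (Cv (φ (E ^ J)⁻¹) u) (t, x)‖ ≤ r := by
    refine (hu.remainder_le (σ := []) (by simpa using hu.hs) ht x).trans (le_of_eq ?_)
    simp only [List.length_nil, hr]
    field_simp
    simp
  have h2 : ‖u (t, x)‖ ≤ (∑ n ∈ Finset.range (2 * J + 1), Y n) + r :=
    (norm_le_decomp hu.hE hu.sm (t, x) J).trans (add_le_add le_rfl hrem)
  have h3 : (∑ n ∈ Finset.range (2 * J + 1), Y n) ^ 2 ≤
      (2 * J + 1) * ∑ n ∈ Finset.range (2 * J + 1), Y n ^ 2 := by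
    have := sq_sum_le_card_mul_sum_sq (s := Finset.range (2 * J + 1)) (f := Y)
    rw [Finset.card_range] at this
    push_cast at this
    exact this
  have h4 : ‖u (t, x)‖ ^ 2 ≤
      2 * (2 * J + 1) * (∑ n ∈ Finset.range (2 * J + 1), Y n ^ 2) + 2 * r ^ 2 := by
    calc ‖u (t, x)‖ ^ 2 ≤ ((∑ n ∈ Finset.range (2 * J + 1), Y n) + r) ^ 2 := by gcongr
      _ ≤ 2 * (∑ n ∈ Finset.range (2 * J + 1), Y n) ^ 2 + 2 * r ^ 2 := by
          nlinarith [sq_nonneg ((∑ n ∈ Finset.range (2 * J + 1), Y n) - r)]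
      _ ≤ _ := by linarith
  simp only [enorm_sq_eq]
  rw [← ENNReal.ofReal_sum_of_nonneg (fun n _ => by positivity), ← ENNReal.ofReal_mul (by positivity),
    ← ENNReal.ofReal_add (by positivity) (by positivity)]
  exact ENNReal.ofReal_le_ofReal h4

variable (hm : Maj s D a a' u m)
include hm

lemma lintegral_piece_mul_le {τ : List (Fin 3)} (hτ : τ.length + 1 = s) (i : Fin 3) (n : ℕ) {h : ℝ}
    (hh : 0 < h) :
    ∫⁻ t in Icc a a', ∫⁻ x, (‖Cv (φ (osc E n)) (Cv (psi E n) u) (t, x)‖ₑ *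
      ‖sd (e3 i) (Cv (φ h) (Dw τ u)) (t, x)‖ₑ) ^ 2 ≤
      ENNReal.ofReal (6 * 12 ^ 5 * Cφ * (E ^ 2 * (1 + lam s om a a' m) * b ^ 4 * D ^ (2 * s - 3))) := by
  have hD := hu.D_pos
  have hb := hu.hb
  have hC := one_le_Cφ
  have hE := hu.hE
  have hL := hu.lam_nonneg hm
  have ho := osc_pos hu.hE n
  have hi := isc_pos hu.hE n
  have hΨ := isPc_psi hu.hE n
  have hl := hu.weight_nonneg hm
  have hs := hu.hs
  have hf := hu.sm.dw τ
  have nw := (hu.num hm.nn hm.sup hτ.le).avg hf hl (avg_phi hh)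
  have ww := hu.majWNice hm (by omega : τ.length ≤ s) (avg_phi hh).toMol
  have n0 := hu.num hm.nn hm.sup (τ := []) (by simp; omega)
  have n1 := fun i => hu.num hm.nn hm.sup (τ := [i]) (by simp; omega)
  simp only [List.length_nil, List.length_singleton, Dw, pow_zero, mul_one, zero_le, pow_one,
    Nat.sub_eq_zero_of_le, le_refl] at n0 n1
  have np := n0.pc_gain₂ n1 hu.sm hl hΨ
  have wp := hu.majWNice hm (τ := []) (by simp) hΨ.toMol
  have np' := (n1 i).pc (hu.sm.dd _) hl hΨ
  have wp' := hu.majWNice hm (τ := [i]) (by simp; omega) hΨ.toMol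
  simp only [Dw] at wp wp'
  have r1 := hu.planewise' hm ww wp nw np ho i
  have r2 := hu.rim' hm ww wp' nw np' ho
  have hsm := hu.sm.cv hΨ.toMol
  have hc := hsm.continuous
  have e : sd (e3 i) (Cv (psi E n) u) = Cv (psi E n) (sd (e3 i) u) := dd_cv hΨ.toMol hu.sm _
  have hbq := measurable_bq ho ((hf.cv (avg_phi hh).toMol).continuous)
    (((hu.sm.dd (0, e3 i)).cv hΨ.toMol).continuous)
  obtain ⟨k, hk⟩ : ∃ k, s = k + 2 := ⟨s - 2, by omega⟩
  have hτk : τ.length = k + 1 := by omega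
  have q1 : 0 ≤ isc E n ∧ isc E n ≤ E * osc E n := ⟨hi.le, isc_le hE n⟩
  calc _ ≤ ∫⁻ t in Icc a a', (ENNReal.ofReal (54 * Cφ / osc E n ^ 2) *
          Pq i (osc E n) (Cv (φ h) (Dw τ u)) (Cv (psi E n) u) t +
        ENNReal.ofReal (292 * Cφ) *
          Bq (osc E n) (Cv (φ h) (Dw τ u)) (Cv (psi E n) (sd (e3 i) u)) t) := by
        refine lintegral_mono fun t => ?_
        rw [← e]
        exact phi_mul_le ho i (hf.cv (avg_phi hh).toMol) hsm
    _ ≤ _ := by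
        rw [lintegral_add_right _ (hbq.const_mul _), lintegral_const_mul' _ _ ENNReal.ofReal_ne_top,
          lintegral_const_mul' _ _ ENNReal.ofReal_ne_top]
        refine (add_le_add (mul_le_mul_right r1 _) (mul_le_mul_right r2 _)).trans ?_
        rw [← ENNReal.ofReal_mul (by positivity), ← ENNReal.ofReal_mul (by positivity),
          ← ENNReal.ofReal_add (by positivity) (by positivity)]
        refine ENNReal.ofReal_le_ofReal ?_
        set L := lam s om a a' m with hLd
        rw [hk]
        simp only [hτk, Nat.add_sub_cancel]
        rw [show 2 * (k + 2) - 3 = 2 * k + 1 by omega]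
        have hE2 : 1 ≤ E ^ 2 := one_le_pow₀ hE
        have hD1 : b ≤ b * D := le_mul_of_one_le_right hb.le hu.hD
        have f1 : 6 * isc E n * (b + b) ≤ 12 * (E * osc E n) * b := by nlinarith [q1.2]
        have f2 : 6 * isc E n * (b + b * D) ≤ 12 * (E * osc E n) * (b * D) := by
          calc 6 * isc E n * (b + b * D) ≤ 6 * (E * osc E n) * (b * D + b * D) := by
                gcongr
                exact q1.2
            _ = _ := by ring
        calc _ ≤ 54 * Cφ / osc E n ^ 2 * (3 * (b * D ^ k * (12 * (E * osc E n) * b) *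
                (b * D ^ (k + 1) * (12 * (E * osc E n) * b) +
                  b * D ^ k * (12 * (E * osc E n) * (b * D)))) * (4 + 4 * L)) +
              292 * Cφ * (3 * (b * D ^ k * (2 * b) * (b * D ^ (k + 1) * (2 * b) +
                b * D ^ k * (2 * (b * D)))) * (4 + 4 * L)) := by
              gcongr <;> norm_num
          _ = 186624 * Cφ * ((E ^ 2) * (1 + L) * b ^ 4 * D ^ (2 * k + 1)) +
              28032 * Cφ * (1 * (1 + L) * b ^ 4 * D ^ (2 * k + 1)) := by
              field_simp
              ring
          _ ≤ 186624 * Cφ * ((E ^ 2) * (1 + L) * b ^ 4 * D ^ (2 * k + 1)) +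
              28032 * Cφ * ((E ^ 2) * (1 + L) * b ^ 4 * D ^ (2 * k + 1)) := by gcongr
          _ = 214656 * (Cφ * ((E ^ 2) * (1 + L) * b ^ 4 * D ^ (2 * k + 1))) := by ring
          _ ≤ (6 * 12 ^ 5) * (Cφ * ((E ^ 2) * (1 + L) * b ^ 4 * D ^ (2 * k + 1))) := by
              gcongr
              norm_num
          _ = _ := by ring

/-- Space-time bilinear bound for the top-order derivatives. -/
lemma lintegral_mul_top_le {τ : List (Fin 3)} (hτ : τ.length + 1 = s) (i : Fin 3) :
    ∫⁻ t in Icc a a', ∫⁻ x, (‖u (t, x)‖ₑ * ‖Dw (i :: τ) u (t, x)‖ₑ) ^ 2 ≤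
      ENNReal.ofReal (KQ J * (E ^ 2 * (1 + lam s om a a' m) * b ^ 4 * D ^ (2 * s - 3))) := by
  have hD := hu.D_pos
  have hb := hu.hb
  have hC := one_le_Cφ
  have hE := hu.hE
  have hL := hu.lam_nonneg hm
  have hs := hu.hs
  let η : ℕ → ℝ := fun n => 1 / ((n : ℝ) + 1)
  have h0 : ∀ n, 0 < η n := fun n => by simp only [η]; positivity
  have hη : Filter.Tendsto η Filter.atTop (𝓝 0) := tendsto_one_div_add_atTop_nhds_zero_nat
  have hf := hu.sm.dw τ
  have hfi : Sm (Dw (i :: τ) u) := hu.sm.dw (i :: τ)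
  have e : ∀ n, sd (e3 i) (Cv (φ (η n)) (Dw τ u)) = Cv (φ (η n)) (Dw (i :: τ) u) := fun n =>
    dd_cv (avg_phi (h0 n)).toMol hf _
  have hs1 : ∀ n, Continuous (Cv (φ (η n)) (Dw (i :: τ) u)) := fun n =>
    (hfi.cv (avg_phi (h0 n)).toMol).continuous
  have cu := hu.sm.continuous
  have mu : Measurable fun p => ‖u p‖ₑ ^ 2 := cu.measurable.enorm.pow_const 2
  simp only [mul_pow]
  refine lintegral_le_of_tendsto
    (G := fun n p => ‖u p‖ₑ ^ 2 * ‖Cv (φ (η n)) (Dw (i :: τ) u) p‖ₑ ^ 2)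
    (F := fun p => ‖u p‖ₑ ^ 2 * ‖Dw (i :: τ) u p‖ₑ ^ 2)
    (fun n => mu.mul ((hs1 n).measurable.enorm.pow_const 2))
    (mu.mul (hfi.continuous.measurable.enorm.pow_const 2))
    (fun p => ENNReal.Tendsto.const_mul (((ENNReal.continuous_pow 2).tendsto _).comp
      ((continuous_enorm.tendsto _).comp (tendsto_cv_phi hfi.continuous p h0 hη)))
      (Or.inr (by simp))) fun n => ?_
  set v : ℝ × E3 → ℂ := Cv (φ (η n)) (Dw (i :: τ) u) with hv
  set r := 324 * Cφ * b * (D ^ 3)⁻¹ with hr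
  set Q := E ^ 2 * (1 + lam s om a a' m) * b ^ 4 * D ^ (2 * s - 3) with hQ
  have hQ0 : 0 ≤ Q := by positivity
  set Y : ℕ → ℝ × E3 → ℂ := fun k => Cv (φ (osc E k)) (Cv (psi E k) u) with hY
  have cY : ∀ k, Continuous (Y k) := fun k =>
    ((hu.sm.cv (isPc_psi hE k).toMol).cv (avg_phi (osc_pos hE k)).toMol).continuous
  have mv : Measurable fun p => ‖v p‖ₑ ^ 2 := (hs1 n).measurable.enorm.pow_const 2
  have mYv : ∀ k, Measurable fun p => (‖Y k p‖ₑ * ‖v p‖ₑ) ^ 2 := fun k =>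
    ((cY k).measurable.enorm.mul (hs1 n).measurable.enorm).pow_const 2
  have hvl : ∀ t ∈ Icc a a', ∫⁻ x, ‖v (t, x)‖ₑ ^ 2 ≤ ENNReal.ofReal ((b * D ^ (s - 1)) ^ 2) := by
    intro t ht
    have h1 := hu.lb (σ := i :: τ) (by simp [hτ]) ht
    rw [List.length_cons, hτ] at h1
    have h2 := h1.cv (avg_phi (h0 n)).toMol (avg_phi (h0 n)).abs.le hfi (by positivity)
    rw [one_mul] at h2
    exact ((lb_iff_lintegral (by positivity)).1 h2).2
  have hpt : ∀ t ∈ Icc a a', ∀ x, ‖u (t, x)‖ₑ ^ 2 * ‖v (t, x)‖ₑ ^ 2 ≤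
      ENNReal.ofReal (2 * (2 * J + 1)) * ∑ k ∈ Finset.range (2 * J + 1),
        (‖Y k (t, x)‖ₑ * ‖v (t, x)‖ₑ) ^ 2 + ENNReal.ofReal (2 * r ^ 2) * ‖v (t, x)‖ₑ ^ 2 := by
    intro t ht x
    refine (mul_le_mul_left (hu.enorm_sq_le_pieces ht x) _).trans (le_of_eq ?_)
    have : ∀ k, (‖Y k (t, x)‖ₑ * ‖v (t, x)‖ₑ) ^ 2 = ‖Y k (t, x)‖ₑ ^ 2 * ‖v (t, x)‖ₑ ^ 2 :=
      fun k => mul_pow ..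
    simp only [this, ← Finset.sum_mul]
    rw [add_mul, mul_assoc]
  have e1 : ∀ k t, Measurable fun x => (‖Y k (t, x)‖ₑ * ‖v (t, x)‖ₑ) ^ 2 := fun k t =>
    (mYv k).comp measurable_prodMk_left
  have e2 : ∀ k, Measurable fun t => ∫⁻ x, (‖Y k (t, x)‖ₑ * ‖v (t, x)‖ₑ) ^ 2 := fun k =>
    (mYv k).lintegral_prod_right'
  have mvt : ∀ t, Measurable fun x => ‖v (t, x)‖ₑ ^ 2 := fun t => mv.comp measurable_prodMk_left
  calc ∫⁻ t in Icc a a', ∫⁻ x, ‖u (t, x)‖ₑ ^ 2 * ‖v (t, x)‖ₑ ^ 2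
      ≤ ∫⁻ t in Icc a a', (ENNReal.ofReal (2 * (2 * J + 1)) * (∑ k ∈ Finset.range (2 * J + 1),
        ∫⁻ x, (‖Y k (t, x)‖ₑ * ‖v (t, x)‖ₑ) ^ 2) +
        ENNReal.ofReal (2 * r ^ 2) * ENNReal.ofReal ((b * D ^ (s - 1)) ^ 2)) := by
        refine setLIntegral_mono' measurableSet_Icc fun t ht => ?_
        refine (lintegral_mono (hpt t ht)).trans ?_
        rw [lintegral_add_right _ ((mvt t).const_mul _),
          lintegral_const_mul' _ _ ENNReal.ofReal_ne_top,
          lintegral_const_mul' _ _ ENNReal.ofReal_ne_top, lintegral_finsetSum _ fun k _ => e1 k t]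
        gcongr
        exact hvl t ht
    _ = ENNReal.ofReal (2 * (2 * J + 1)) * (∑ k ∈ Finset.range (2 * J + 1),
        ∫⁻ t in Icc a a', ∫⁻ x, (‖Y k (t, x)‖ₑ * ‖v (t, x)‖ₑ) ^ 2) +
        ENNReal.ofReal (2 * r ^ 2) * ENNReal.ofReal ((b * D ^ (s - 1)) ^ 2) *
          ENNReal.ofReal (a' - a) := by
        rw [lintegral_add_right _ measurable_const, lintegral_const_mul' _ _ ENNReal.ofReal_ne_top,
          lintegral_finsetSum _ fun k _ => e2 k, lintegral_const]
        simp
    _ ≤ ENNReal.ofReal (2 * (2 * J + 1)) * (∑ k ∈ Finset.range (2 * J + 1),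
        ENNReal.ofReal (6 * 12 ^ 5 * Cφ * Q)) +
        ENNReal.ofReal (2 * r ^ 2) * ENNReal.ofReal ((b * D ^ (s - 1)) ^ 2) *
          ENNReal.ofReal 1 := by
        gcongr with k hk
        · have := hu.lintegral_piece_mul_le hm hτ i k (h0 n)
          rwa [e n] at this
        · linarith [hu.len]
    _ ≤ _ := by
        rw [Finset.sum_const, Finset.card_range, nsmul_eq_mul, ← ENNReal.ofReal_natCast,
          ← ENNReal.ofReal_mul (by positivity), ← ENNReal.ofReal_mul (by positivity),
          ← ENNReal.ofReal_mul (by positivity), ← ENNReal.ofReal_mul (by positivity),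
          ← ENNReal.ofReal_add (by positivity) (by positivity)]
        refine ENNReal.ofReal_le_ofReal ?_
        have h3 : 2 * r ^ 2 * (b * D ^ (s - 1)) ^ 2 * 1 ≤ 2 * (324 * Cφ) ^ 2 * Q := by
          have hDs : (D ^ 3)⁻¹ ^ 2 * (D ^ (s - 1)) ^ 2 ≤ D ^ (2 * s - 3) := by
            rw [← mul_pow, ← sq_abs, abs_of_nonneg (by positivity)]
            obtain ⟨k, rfl⟩ : ∃ k, s = k + 2 := ⟨s - 2, by omega⟩
            rw [show 2 * (k + 2) - 3 = 2 * k + 1 by omega]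
            have : (D ^ 3)⁻¹ * D ^ (k + 2 - 1) ≤ D ^ k := by
              rw [inv_mul_le_iff₀ (by positivity), ← pow_add]
              exact pow_le_pow_right₀ hu.hD (by omega)
            calc ((D ^ 3)⁻¹ * D ^ (k + 2 - 1)) ^ 2 ≤ (D ^ k) ^ 2 := by gcongr
              _ = D ^ (2 * k) := by ring
              _ ≤ _ := pow_le_pow_right₀ hu.hD (by omega)
          have h5 : (1 : ℝ) ≤ E ^ 2 * (1 + lam s om a a' m) := by
            have := one_le_pow₀ hE (n := 2)
            nlinarith
          calc 2 * r ^ 2 * (b * D ^ (s - 1)) ^ 2 * 1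
              = 2 * (324 * Cφ) ^ 2 * (1 * b ^ 4 * ((D ^ 3)⁻¹ ^ 2 * (D ^ (s - 1)) ^ 2)) := by
                rw [hr]; ring
            _ ≤ 2 * (324 * Cφ) ^ 2 * (E ^ 2 * (1 + lam s om a a' m) * b ^ 4 * D ^ (2 * s - 3)) := by
                gcongr
        push_cast
        have h4 : 2 * (2 * (J : ℝ) + 1) * ((2 * J + 1) * (6 * 12 ^ 5 * Cφ * Q)) =
          (2 * (J : ℝ) + 1) ^ 2 * (12 ^ 6 * Cφ) * Q := by ring
        rw [h4]
        unfold KQ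
        nlinarith

end
end Sol

section energy
variable {a b : ℝ} {w : ℝ × E3 → ℂ}

lemma ip_I_self (z : ℂ) : ip (Complex.I * z) z = 0 := by
  simp [ip_eq]; ring

lemma integral_ip_I_lap {f : E3 → ℂ} {v : E3} (sf : Sm f) (h0 : M2 f) (h1 : M2 (dd v f))
    (h2 : M2 (dd v (dd v f))) : ∫ x, ip (Complex.I * f x) (dd v (dd v f) x) = 0 := by
  have hker : Ker v (fun _ : E3 => (1 : ℝ)) (fun _ => 0) :=
    ⟨continuous_const, continuous_const, ⟨1, by simp⟩, ⟨0, by simp⟩, fun x => by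
      simpa [HasLineDerivAt] using hasDerivAt_const (0 : ℝ) (1 : ℝ)⟩
  have e : dd v (fun x => Complex.I * f x) = fun x => Complex.I * dd v f x := dd_const_mul sf _ _
  have ibp := ibp_ip hker (sf.const_mul Complex.I) (sf.dd v) (h0.const_mul _) h1
    (by rw [e]; exact h1.const_mul _) h2
  rw [e] at ibp
  simpa only [ip_I_self, one_mul, zero_mul, mul_zero, integral_zero, zero_add, neg_zero] using ibp

lemma energy_identity (hab : a ≤ b) (hw : WNice a b w) :
    (∫ x, ‖w (b, x)‖ ^ 2) - (∫ x, ‖w (a, x)‖ ^ 2) =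
      ∫ t in a..b, ∫ x, 2 * ip (Complex.I * w (t, x)) (src3 w (t, x)) := by
  have sw := hw.sm
  obtain ⟨C, hC0, hC⟩ := hw.u0
  obtain ⟨C', hC0', hC'⟩ := hw.ut
  have hct : Continuous (td w) := (sw.dd _).continuous
  have hcH : Continuous fun p => 2 * ip (w p) (td w p) :=
    continuous_const.mul (sw.continuous.inner hct)
  have hI : ∀ t ∈ Icc a b, _ := fun t ht => (hC t ht).integral_le (hC' t ht) hC0 hC0' (K := 2)
    zero_le_two (H := fun x => 2 * ip (w (t, x)) (td w (t, x)))
    (hcH.comp (by fun_prop : Continuous fun x : E3 => (t, x))).aestronglyMeasurable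
    fun x => by
      rw [norm_mul, Real.norm_eq_abs, Real.norm_eq_abs, abs_two]
      gcongr
      exact abs_ip_le _ _
  have h1 := time_ftc hab (H := fun p => ‖w p‖ ^ 2) hcH (fun t x => by
      have h := sw.hasDerivAt_time t x
      have h' := h.norm_sq
      exact h') (fun t ht => (hC t ht).integrable_sq) (fun t ht => (hI t ht).1)
    (fun t ht => (hI t ht).2.2)
  rw [h1]
  refine intervalIntegral.integral_congr fun t ht => ?_
  rw [uIcc_of_le hab] at ht
  have m0 : M2 (sl w t) := hw.u0.m2 ht
  have m1 : ∀ i, M2 (dd (e3 i) (sl w t)) := fun i => by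
    rw [dd_sl sw]; exact (hw.u1 _).m2 ht
  have m2 : ∀ i, M2 (dd (e3 i) (dd (e3 i) (sl w t))) := fun i => by
    rw [dd_sl sw, dd_sl (sw.dd _)]; exact (hw.u2 _ _).m2 ht
  have i1 : ∀ i, Integrable fun x => ip (Complex.I * w (t, x)) (dd (e3 i) (dd (e3 i) (sl w t)) x) :=
    fun i => by
      have := (m0.const_mul Complex.I).integrable_ip (m2 i) (k := fun _ => 1) (K := 1)
        continuous_const (by simp)
      simp only [one_mul] at this
      exact this
  have e : ∀ x, 2 * ip (Complex.I * w (t, x)) (src3 w (t, x)) = 2 * ip (w (t, x)) (td w (t, x)) +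
      ∑ i, ip (Complex.I * w (t, x)) (dd (e3 i) (dd (e3 i) (sl w t)) x) := fun x => by
    simp_rw [dd_sl sw, dd_sl (sw.dd _)]
    have h2 : ip (Complex.I * w (t, x)) (Complex.I * td w (t, x)) = ip (w (t, x)) (td w (t, x)) := by
      rw [ip_I_mul, ← mul_assoc, Complex.I_mul_I]
      simp [ip_eq]
    have h3 : ∀ z y : ℂ, ip z (((1 / 2 : ℝ) : ℂ) * y) = 1 / 2 * ip z y := fun z y => by
      simp only [ip_eq, Complex.re_ofReal_mul, Complex.im_ofReal_mul]; ring
    have h4 : ∀ z (F : Fin 3 → ℂ), ip z (∑ i, F i) = ∑ i, ip z (F i) := fun z F => by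
      simp only [ip, inner_sum]
    have h5 : ∀ z x y : ℂ, ip z (x + y) = ip z x + ip z y := fun z x y => inner_add_right _ _ _
    unfold src3 src
    rw [h5, h2, h3, h4]
    simp only [sl]
    ring
  simp_rw [e]
  rw [integral_add (hI t ht).1 (integrable_finsetSum _ fun i _ => i1 i),
    integral_finsetSum _ fun i _ => i1 i,
    Finset.sum_eq_zero, add_zero]
  exact fun i _ => integral_ip_I_lap (sw.sl t) m0 (m1 i) (m2 i)

end energy

section qualitative
variable {W : E3 → ℝ} {om : ℝ} {g : E3 → ℂ}

lemma exists_gd (bf : ∀ σ, Bf (Dx σ g)) (m2 : ∀ σ, M2 (Dx σ g)) (n : ℕ) :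
    ∃ b, 0 < b ∧ Gd n b 1 g := by
  have hnn : ∀ σ ∈ wd n, 0 ≤ (eLpNorm (Dx σ g) 2 volume).toReal := fun σ _ => ENNReal.toReal_nonneg
  refine ⟨1 + ∑ σ ∈ wd n, (eLpNorm (Dx σ g) 2 volume).toReal, by
    have := Finset.sum_nonneg hnn
    positivity, bf, m2, fun σ hσ => (m2 σ).lb.mono ?_⟩
  rw [one_pow, mul_one]
  have := Finset.single_le_sum hnn (mem_wd.2 hσ)
  linarith

lemma exists_sup_bound (bf : ∀ σ, Bf (Dx σ g)) (n : ℕ) :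
    ∃ ℓ, 0 ≤ ℓ ∧ ∀ σ, σ.length ≤ n → ∀ x, ‖Dx σ g x‖ ≤ ℓ := by
  choose h0 C hC using bf
  have hnn : ∀ σ ∈ wd n, 0 ≤ C σ := fun σ _ => (norm_nonneg _).trans (hC σ 0).1
  exact ⟨∑ σ ∈ wd n, C σ, Finset.sum_nonneg hnn, fun σ hσ x => (hC σ x).1.trans
    (Finset.single_le_sum hnn (mem_wd.2 hσ))⟩

lemma m2_dx_tr (hW : Integrable W) (bf : ∀ σ, Bf (Dx σ g)) (m2 : ∀ σ, M2 (Dx σ g))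
    (τ : List (Fin 3)) : M2 (Dx τ (Tr W g g g)) := by
  obtain ⟨b, hb, hg⟩ := exists_gd bf m2 (τ.length + 2)
  obtain ⟨ℓ, hl, h⟩ := exists_sup_bound bf (τ.length + 2)
  exact (hg.tr_lb (by omega) hb.le one_pos hl hW le_rfl (fun σ hσ x => by
    rw [one_pow, one_mul]; exact h σ (by omega) x) (by omega)).m2

lemma tendsto_integral_ip {f g : E3 → ℂ} {fn gn : ℕ → E3 → ℂ} {ε δ : ℕ → ℝ} (hf : M2 f) (hg : M2 g)
    (h1 : ∀ n, LB (fun x => fn n x - f x) (ε n)) (h2 : ∀ n, LB (fun x => gn n x - g x) (δ n))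
    (h3 : ∀ n, 0 ≤ ε n) (h4 : ∀ n, 0 ≤ δ n) (hε : Filter.Tendsto ε Filter.atTop (𝓝 0))
    (hδ : Filter.Tendsto δ Filter.atTop (𝓝 0)) :
    Filter.Tendsto (fun n => ∫ x, ip (fn n x) (gn n x)) Filter.atTop (𝓝 (∫ x, ip (f x) (g x))) := by
  set A := (eLpNorm f 2 volume).toReal
  set B := (eLpNorm g 2 volume).toReal
  have hA : 0 ≤ A := ENNReal.toReal_nonneg
  have hB : 0 ≤ B := ENNReal.toReal_nonneg
  have key : ∀ {p q : E3 → ℂ} {P Q : ℝ}, LB p P → LB q Q → 0 ≤ P → 0 ≤ Q →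
      Integrable (fun x => ip (p x) (q x)) ∧ |∫ x, ip (p x) (q x)| ≤ P * Q := fun hp hq h0 h0' => by
    have := hp.ip_bound hq h0 h0' (k := fun _ => 1) continuous_const (by simp)
    simp only [one_mul] at this
    exact ⟨this.1, this.2.1⟩
  rw [tendsto_iff_norm_sub_tendsto_zero]
  refine squeeze_zero (g := fun n => ε n * δ n + ε n * B + A * δ n) (fun n => norm_nonneg _)
    (fun n => ?_) (by simpa using ((hε.mul hδ).add (hε.mul_const B)).add (hδ.const_mul A))
  obtain ⟨i1, b1⟩ := key (h1 n) (h2 n) (h3 n) (h4 n)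
  obtain ⟨i2, b2⟩ := key (h1 n) hg.lb (h3 n) hB
  obtain ⟨i3, b3⟩ := key hf.lb (h2 n) hA (h4 n)
  obtain ⟨i4, -⟩ := key hf.lb hg.lb hA hB
  have e : ∀ x, ip (fn n x) (gn n x) = ip (fn n x - f x) (gn n x - g x) + ip (fn n x - f x) (g x) +
      ip (f x) (gn n x - g x) + ip (f x) (g x) := fun x => by
    simp only [ip_eq, Complex.sub_re, Complex.sub_im]; ring
  simp_rw [e]
  have j1 := i1.add i2
  have j2 := j1.add i3
  rw [integral_add (by exact j2) i4, integral_add (by exact j1) i3, integral_add i1 i2,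
    add_sub_cancel_right, Real.norm_eq_abs]
  exact (abs_add_three _ _ _).trans (add_le_add (add_le_add b1 b2) b3)

end qualitative

namespace Sol
variable {s J : ℕ} {W : E3 → ℝ} {om E D B b a a' : ℝ} {u : ℝ × E3 → ℂ} {m : ℝ → ℝ}

section
variable (hu : Sol s J W om E D B b a a' u)
include hu

lemma sl_src3_dw (σ : List (Fin 3)) (t : ℝ) :
    sl (src3 (Dw σ u)) t = Dx σ (Tr W (sl u t) (sl u t) (sl u t)) := by
  rw [← src3_dw hu.sm, ← dx_sl (hu.sm.src _ _), hu.eq]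

lemma m2_dw (σ : List (Fin 3)) {t : ℝ} (ht : t ∈ Icc a a') : M2 (sl (Dw σ u) t) := by
  rw [← dx_sl hu.sm]; exact (hu.gd t ht).m2 σ

lemma m2_src (σ : List (Fin 3)) {t : ℝ} (ht : t ∈ Icc a a') : M2 (sl (src3 (Dw σ u)) t) := by
  rw [hu.sl_src3_dw]; exact m2_dx_tr hu.hW (hu.gd t ht).bf (hu.gd t ht).m2 σ

variable (hm : Maj s D a a' u m)
include hm

/-- Energy identity for derivatives of the solution. -/
lemma energy_eq {σ : List (Fin 3)} (hσ : σ.length ≤ s) :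
    (∫ x, ‖Dw σ u (a', x)‖ ^ 2) - (∫ x, ‖Dw σ u (a, x)‖ ^ 2) =
      ∫ t in a..a', ∫ x, 2 * ip (Complex.I * Dw σ u (t, x)) (src3 (Dw σ u) (t, x)) := by
  have hD := hu.D_pos
  have hb := hu.hb
  have hom := hu.om_nonneg
  let η : ℕ → ℝ := fun n => 1 / ((n : ℝ) + 1)
  have h0 : ∀ n, 0 < η n := fun n => by simp only [η]; positivity
  have hη : Filter.Tendsto η Filter.atTop (𝓝 0) := tendsto_one_div_add_atTop_nhds_zero_nat
  have hf := hu.sm.dw σ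
  have hF : Sm (src3 (Dw σ u)) := hf.src _ _
  set f := Dw σ u with hfd
  have mol : ∀ n, Mol (φ (η n)) := fun n => (avg_phi (h0 n)).toMol
  have lbI : ∀ {f : E3 → ℂ} {A : ℝ}, LB f A → LB (fun x => Complex.I * f x) A := fun h => by
    simpa using h.const_mul Complex.I
  have rate : ∀ {q : ℝ × E3 → ℂ} {t : ℝ}, Sm q → (∀ i, M2 (sl (sd (e3 i) q) t)) →
      ∃ C, 0 ≤ C ∧ ∀ n, LB (sl (fun p => Cv (φ (η n)) q p - q p) t) (3 * η n * C) := by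
    intro q t hq hd
    have hnn : ∀ i ∈ Finset.univ, 0 ≤ (eLpNorm (sl (sd (e3 i) q) t) 2 volume).toReal :=
      fun i _ => ENNReal.toReal_nonneg
    exact ⟨_, Finset.sum_nonneg hnn, fun n => (avg_phi (h0 n)).lb_sub (h0 n).le hq
      (Finset.sum_nonneg hnn) fun i => (hd i).lb.mono
        (Finset.single_le_sum hnn (Finset.mem_univ i))⟩
  have rz : ∀ C : ℝ, Filter.Tendsto (fun n => 3 * η n * C) Filter.atTop (𝓝 0) := fun C => by
    simpa using (hη.const_mul 3).mul_const C
  have rf : ∀ t ∈ Icc a a', _ := fun t ht => rate (q := f) (t := t) hf fun i => hu.m2_dw (i :: σ) ht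
  have rF : ∀ t ∈ Icc a a', _ := fun t ht => rate (q := src3 f) (t := t) hF fun i => by
    have := hu.m2_src (i :: σ) ht
    rwa [← src3_dw hu.sm, Dw, src3_dw hu.sm] at this
  have lim1 : ∀ t ∈ Icc a a', Filter.Tendsto (fun n => ∫ x, ‖Cv (φ (η n)) f (t, x)‖ ^ 2)
      Filter.atTop (𝓝 (∫ x, ‖f (t, x)‖ ^ 2)) := by
    intro t ht
    obtain ⟨C, hC, h⟩ := rf t ht
    have hp : ∀ n, 0 ≤ 3 * η n * C := fun n => mul_nonneg (mul_nonneg (by norm_num) (h0 n).le) hC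
    simp_rw [← ip_self]
    exact tendsto_integral_ip (hu.m2_dw σ ht) (hu.m2_dw σ ht) h h hp hp (rz C) (rz C)
  have lim2 : ∀ t ∈ Icc a a', Filter.Tendsto (fun n => ∫ x, 2 * ip (Complex.I * Cv (φ (η n)) f (t, x))
      (Cv (φ (η n)) (src3 f) (t, x))) Filter.atTop
      (𝓝 (∫ x, 2 * ip (Complex.I * f (t, x)) (src3 f (t, x)))) := by
    intro t ht
    obtain ⟨C, hC, h⟩ := rf t ht
    obtain ⟨C', hC', h'⟩ := rF t ht
    have hp : ∀ n, 0 ≤ 3 * η n * C := fun n => mul_nonneg (mul_nonneg (by norm_num) (h0 n).le) hC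
    have hp' : ∀ n, 0 ≤ 3 * η n * C' := fun n => mul_nonneg (mul_nonneg (by norm_num) (h0 n).le) hC'
    simp_rw [integral_const_mul]
    refine Filter.Tendsto.const_mul 2 (tendsto_integral_ip ((hu.m2_dw σ ht).const_mul _)
      (hu.m2_src σ ht) (fun n => ?_) h' hp hp' (rz C) (rz C'))
    simp only [sl, ← mul_sub]
    exact lbI (h n)
  refine tendsto_nhds_unique ((lim1 a' (right_mem_Icc.2 hu.hab)).sub
    (lim1 a (left_mem_Icc.2 hu.hab))) ?_
  have id : ∀ n, _ := fun n => energy_identity hu.hab (hu.majWNice hm hσ (mol n))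
  simp_rw [← hfd, src3_cv (mol _) hf] at id
  simp_rw [id]
  obtain ⟨M, hM⟩ := hm.bdd
  set G := b * D ^ (σ.length - 1)
  have hG : 0 ≤ G := by positivity
  refine intervalIntegral.tendsto_integral_filter_of_dominated_convergence
    (fun _ => 2 * (G * (G * (3 ^ (s + 1) * om * M)))) (Filter.Eventually.of_forall fun n => ?_)
    (Filter.Eventually.of_forall fun n => Filter.Eventually.of_forall fun t ht => ?_)
    intervalIntegrable_const (Filter.Eventually.of_forall fun t ht => ?_)
  · have hc : Continuous fun p => 2 * ip (Complex.I * Cv (φ (η n)) f p) (Cv (φ (η n)) (src3 f) p) :=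
      continuous_const.mul ((continuous_const.mul (hf.cv (mol n)).continuous).inner
        (hF.cv (mol n)).continuous)
    exact hc.stronglyMeasurable.integral_prod_right'.aestronglyMeasurable
  · rw [uIoc_of_le hu.hab] at ht
    have ht := Ioc_subset_Icc_self ht
    have hM0 := (hm.nn t).trans (hM t ht)
    have l1 := (hu.lb hσ ht).cv (mol n) (avg_phi (h0 n)).abs.le hf hG
    have l2 := (hu.lb_src hm.nn hm.sup hσ ht).mono
      (mul_le_mul_of_nonneg_left (mul_le_mul_of_nonneg_left (hM t ht) (by positivity)) hG)
    have l3 := l2.cv (mol n) (avg_phi (h0 n)).abs.le hF (by positivity)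
    rw [one_mul] at l1 l3
    have := ((lbI l1).ip_bound l3 hG (by positivity) (k := fun _ => 1) continuous_const (by simp)).2.1
    simp only [one_mul] at this
    rw [integral_const_mul, norm_mul, Real.norm_eq_abs, Real.norm_eq_abs, abs_two]
    exact mul_le_mul_of_nonneg_left this zero_le_two
  · rw [uIoc_of_le hu.hab] at ht
    exact lim2 t (Ioc_subset_Icc_self ht)

end
end Sol

section topOrder
variable {s : ℕ} {D ℓ y : ℝ}

/-- Bounds used for the intermediate factors of a product of total order `s`. -/
structure Oe (s : ℕ) (D ℓ y : ℝ) (k : ℕ) (F : E3 → ℂ) : Prop where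
  cont : Continuous F
  sup : k + 2 ≤ s → ∀ x, ‖F x‖ ≤ D ^ k * ℓ
  four : 1 ≤ k → k + 1 ≤ s → ∫⁻ x, ‖F x‖ₑ ^ 4 ≤ ENNReal.ofReal (D ^ (4 * k) * y)

lemma Oe.shift {k : ℕ} {F : E3 → ℂ} (h : Oe s D ℓ y k F) (z : E3) :
    Oe s D ℓ y k fun x => F (x - z) where
  cont := h.cont.comp (by fun_prop)
  sup hk x := h.sup hk _
  four h1 h2 := by
    rw [lintegral_sub_right_eq_self (fun x => ‖F x‖ₑ ^ 4) z]; exact h.four h1 h2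

lemma Oe.prod_of_le (hs : 2 ≤ s) (hD : 0 < D) (hl : 0 ≤ ℓ) (hy : 0 ≤ y) {k1 k2 k3 : ℕ}
    {F1 F2 F3 : E3 → ℂ} (h1 : Oe s D ℓ y k1 F1) (h2 : Oe s D ℓ y k2 F2) (h3 : Oe s D ℓ y k3 F3)
    (h12 : k1 ≤ k2) (h23 : k2 ≤ k3) (hk : k1 + k2 + k3 = s) (hk3 : k3 < s) :
    ∫⁻ x, (‖F1 x‖ₑ * ‖F2 x‖ₑ * ‖F3 x‖ₑ) ^ 2 ≤ ENNReal.ofReal (D ^ (2 * s) * ℓ ^ 2 * y) := by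
  rw [← hk]
  exact lintegral_sup_four_le hD hl (h1.sup (by omega)) hy h2.cont (h2.four (by omega) (by omega))
    (h3.four (by omega) (by omega))

lemma Oe.prod (hs : 2 ≤ s) (hD : 0 < D) (hl : 0 ≤ ℓ) (hy : 0 ≤ y) {k1 k2 k3 : ℕ}
    {F1 F2 F3 : E3 → ℂ} (h1 : Oe s D ℓ y k1 F1) (h2 : Oe s D ℓ y k2 F2) (h3 : Oe s D ℓ y k3 F3)
    (hk : k1 + k2 + k3 = s) (hk1 : k1 < s) (hk2 : k2 < s) (hk3 : k3 < s) :
    ∫⁻ x, (‖F1 x‖ₑ * ‖F2 x‖ₑ * ‖F3 x‖ₑ) ^ 2 ≤ ENNReal.ofReal (D ^ (2 * s) * ℓ ^ 2 * y) := by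
  rcases le_total k1 k2 with h12 | h12 <;> rcases le_total k2 k3 with h23 | h23 <;>
    rcases le_total k1 k3 with h13 | h13
  · exact prod_of_le hs hD hl hy h1 h2 h3 h12 h23 hk hk3
  · exact prod_of_le hs hD hl hy h1 h2 h3 h12 h23 hk hk3
  · exact (lintegral_congr fun x => by ring).trans_le
      (prod_of_le hs hD hl hy h1 h3 h2 h13 h23 (by omega) hk2)
  · exact (lintegral_congr fun x => by ring).trans_le
      (prod_of_le hs hD hl hy h3 h1 h2 h13 h12 (by omega) hk2)
  · exact (lintegral_congr fun x => by ring).trans_le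
      (prod_of_le hs hD hl hy h2 h1 h3 h12 h13 (by omega) hk3)
  · exact (lintegral_congr fun x => by ring).trans_le
      (prod_of_le hs hD hl hy h2 h3 h1 h23 h13 (by omega) hk1)
  · exact (lintegral_congr fun x => by ring).trans_le
      (prod_of_le hs hD hl hy h3 h2 h1 h23 h12 (by omega) hk1)
  · exact (lintegral_congr fun x => by ring).trans_le
      (prod_of_le hs hD hl hy h3 h2 h1 h23 h12 (by omega) hk1)

lemma lintegral_shift_mul_le {P Q R : E3 → ℂ} {A : ℝ} (hl : 0 ≤ ℓ) (hR : ∀ x, ‖R x‖ ≤ ℓ)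
    (h : ∫⁻ x, (‖P x‖ₑ * ‖Q x‖ₑ) ^ 2 ≤ ENNReal.ofReal A) (z : E3) :
    ∫⁻ x, (‖P (x - z)‖ₑ * ‖Q (x - z)‖ₑ * ‖R x‖ₑ) ^ 2 ≤ ENNReal.ofReal (A * ℓ ^ 2) := by
  calc ∫⁻ x, (‖P (x - z)‖ₑ * ‖Q (x - z)‖ₑ * ‖R x‖ₑ) ^ 2
      ≤ ∫⁻ x, (‖P (x - z)‖ₑ * ‖Q (x - z)‖ₑ) ^ 2 * ENNReal.ofReal (ℓ ^ 2) := by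
        refine lintegral_mono fun x => ?_
        rw [mul_pow, ENNReal.ofReal_pow hl]
        gcongr
        rw [← ofReal_norm]; exact ENNReal.ofReal_le_ofReal (hR x)
    _ = (∫⁻ x, (‖P x‖ₑ * ‖Q x‖ₑ) ^ 2) * ENNReal.ofReal (ℓ ^ 2) := by
        rw [lintegral_mul_const' _ _ ENNReal.ofReal_ne_top,
          lintegral_sub_right_eq_self (fun x => (‖P x‖ₑ * ‖Q x‖ₑ) ^ 2) z]
    _ ≤ ENNReal.ofReal A * ENNReal.ofReal (ℓ ^ 2) := mul_le_mul_left h _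
    _ = _ := by rw [ENNReal.ofReal_mul' (by positivity)]

variable {W : E3 → ℝ} {om b : ℝ} {g : E3 → ℂ}

lemma tw_top_lb (hs : 2 ≤ s) (hD : 0 < D) (hl0 : 0 ≤ ℓ) (hy : 0 ≤ y) (hW : Integrable W)
    (hom : ∫ z, |W z| ≤ om) (bf : ∀ σ, Bf (Dx σ g))
    (hl : ∀ σ, σ.length + 2 ≤ s → ∀ x, ‖Dx σ g x‖ ≤ D ^ σ.length * ℓ)
    (h4 : ∀ τ, 1 ≤ τ.length → τ.length + 1 ≤ s →
      ∫⁻ x, ‖Dx τ g x‖ₑ ^ 4 ≤ ENNReal.ofReal (D ^ (4 * τ.length) * y))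
    (hq : ∀ τ, τ.length = s → ∫⁻ x, (‖g x‖ₑ * ‖Dx τ g x‖ₑ) ^ 2 ≤ ENNReal.ofReal (D ^ (2 * s) * y))
    {p} (hp : p.1.length + p.2.1.length + p.2.2.length = s) (hp' : p.2.2.length < s) :
    LB (Tw W g p) (om * (D ^ s * ℓ * √y)) := by
  obtain ⟨α, β, γ⟩ := p
  simp only at hp hp'
  have ho : ∀ σ, Oe s D ℓ y σ.length (Dx σ g) := fun σ => ⟨(bf σ).1.continuous, hl σ, h4 σ⟩
  have hg : ∀ x, ‖g x‖ ≤ ℓ := fun x => by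
    simpa [Dx] using hl [] (by simpa using hs) x
  refine Tr.lb hW hom (bf _) (bf _) (bf _).1 (by positivity) fun z => ?_
  simp only
  rw [show (D ^ s * ℓ * √y) ^ 2 = D ^ (2 * s) * ℓ ^ 2 * y by
    rw [mul_pow, mul_pow, Real.sq_sqrt hy]; ring]
  by_cases hα : α.length = s
  · obtain rfl : β = [] := List.length_eq_zero_iff.1 (by omega)
    obtain rfl : γ = [] := List.length_eq_zero_iff.1 (by omega)
    have := lintegral_shift_mul_le hl0 hg (hq α hα) z
    refine le_trans (lintegral_congr fun x => ?_).le (this.trans_eq (by ring_nf))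
    simp only [Dx]; ring
  by_cases hβ : β.length = s
  · obtain rfl : α = [] := List.length_eq_zero_iff.1 (by omega)
    obtain rfl : γ = [] := List.length_eq_zero_iff.1 (by omega)
    have := lintegral_shift_mul_le hl0 hg (hq β hβ) z
    refine le_trans (lintegral_congr fun x => ?_).le (this.trans_eq (by ring_nf))
    simp only [Dx]
  exact Oe.prod hs hD hl0 hy ((ho α).shift z) ((ho β).shift z) (ho γ) hp (by omega) (by omega) hp'

lemma wc_mul_conj (x : E3) : Wc W (fun y => g y * (starRingEnd ℂ) (g y)) x =
    ((∫ z, W z * ‖g (x - z)‖ ^ 2 : ℝ) : ℂ) := by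
  unfold Wc
  rw [← integral_complex_ofReal]
  refine integral_congr_ae (Filter.Eventually.of_forall fun z => ?_)
  simp only [Complex.mul_conj, Complex.normSq_eq_norm_sq, Complex.real_smul]
  push_cast
  rfl

/-- The leading term of the differentiated nonlinearity does not contribute to the energy. -/
lemma abs_integral_ip_dx_tr_le (hW : Integrable W) (bf : ∀ σ, Bf (Dx σ g)) {σ : List (Fin 3)}
    {F c : ℝ} (hF : 0 ≤ F) (hc : 0 ≤ c) (hf : LB (Dx σ g) F)
    (h : ∀ p, p.1.length + p.2.1.length + p.2.2.length = σ.length → p.2.2.length < σ.length →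
      LB (Tw W g p) c) :
    |∫ x, 2 * ip (Complex.I * Dx σ g x) (Dx σ (Tr W g g g) x)| ≤ 2 * 3 ^ σ.length * (F * c) := by
  obtain ⟨L, hL, hLt⟩ := spl_head σ
  have hlen : L.length ≤ 3 ^ σ.length := by
    rw [← length_spl, hL]; simp
  have hLm : ∀ p ∈ L, p ∈ spl σ := fun p hp => by rw [hL]; exact List.mem_cons_of_mem _ hp
  have hS := LB.list_sum L (fun p => Tw W g p) hc fun p hp => h p (spl_length (hLm p hp)) (hLt p hp)
  have e : ∀ x, ip (Complex.I * Dx σ g x) (Dx σ (Tr W g g g) x) =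
      ip (Complex.I * Dx σ g x) ((L.map fun p => Tw W g p x).sum) := fun x => by
    rw [dx_tr hW bf, hL]
    simp only [List.map_cons, List.sum_cons, Tw, Tr, Dx]
    rw [wc_mul_conj]
    simp only [ip_eq, Complex.add_re, Complex.add_im, Complex.re_ofReal_mul, Complex.im_ofReal_mul,
      Complex.I_mul_re, Complex.I_mul_im]
    ring
  simp_rw [e]
  rw [integral_const_mul, abs_mul, abs_two]
  have := ((hf.const_mul Complex.I).ip_bound hS (by positivity) (by positivity) (k := fun _ => 1)
    continuous_const (by simp)).2.1
  simp only [one_mul, Complex.norm_I] at this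
  calc _ ≤ 2 * (F * (L.length * c)) := mul_le_mul_of_nonneg_left this zero_le_two
    _ ≤ 2 * (F * ((3 ^ σ.length : ℕ) * c)) := by gcongr
    _ = _ := by push_cast; ring

end topOrder

/-- Pairs of words indexing the bilinear quantities controlled in space-time. -/
def pr (s : ℕ) : Finset (List (Fin 3) × List (Fin 3)) :=
  (wd s ×ˢ wd s).filter fun p =>
    (p.1 = p.2 ∧ 1 ≤ p.1.length ∧ p.1.length + 1 ≤ s) ∨ (p.1 = [] ∧ p.2.length = s)

lemma mem_pr {s : ℕ} {p : List (Fin 3) × List (Fin 3)} : p ∈ pr s ↔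
    (p.1 = p.2 ∧ 1 ≤ p.1.length ∧ p.1.length + 1 ≤ s) ∨ (p.1 = [] ∧ p.2.length = s) := by
  simp only [pr, Finset.mem_filter, Finset.mem_product, mem_wd, and_iff_right_iff_imp]
  rintro (⟨h, -, h'⟩ | ⟨h, h'⟩)
  · rw [← h]; omega
  · rw [h]; simp; omega

/-- Normalised sum of the bilinear quantities at a fixed time. -/
def yq (s : ℕ) (D : ℝ) (u : ℝ × E3 → ℂ) (t : ℝ) : ℝ≥0∞ :=
  ∑ p ∈ pr s, ENNReal.ofReal (D ^ (2 * (p.1.length + p.2.length)))⁻¹ *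
    ∫⁻ x, (‖Dw p.1 u (t, x)‖ₑ * ‖Dw p.2 u (t, x)‖ₑ) ^ 2

lemma le_of_yq {s : ℕ} {D : ℝ} (hD : 0 < D) {u : ℝ × E3 → ℂ} {t : ℝ} (ht : yq s D u t ≠ ⊤) {p}
    (hp : p ∈ pr s) : ∫⁻ x, (‖Dw p.1 u (t, x)‖ₑ * ‖Dw p.2 u (t, x)‖ₑ) ^ 2 ≤
      ENNReal.ofReal (D ^ (2 * (p.1.length + p.2.length)) * (yq s D u t).toReal) := by
  have h := Finset.single_le_sum (f := fun p : List (Fin 3) × List (Fin 3) =>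
    ENNReal.ofReal (D ^ (2 * (p.1.length + p.2.length)))⁻¹ *
    ∫⁻ x, (‖Dw p.1 u (t, x)‖ₑ * ‖Dw p.2 u (t, x)‖ₑ) ^ 2) (fun _ _ => zero_le) hp
  rw [ENNReal.ofReal_mul (by positivity), ENNReal.ofReal_toReal ht]
  refine le_trans (le_of_eq ?_) (mul_le_mul_right h _)
  rw [← mul_assoc, ← ENNReal.ofReal_mul (by positivity), mul_inv_cancel₀ (by positivity),
    ENNReal.ofReal_one, one_mul]

/-- Constant in the space-time bilinear bounds. -/
def KY (J : ℕ) : ℝ := KQ J + 12 ^ 4 * Cφ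

namespace Sol
variable {s J : ℕ} {W : E3 → ℝ} {om E D B b a a' : ℝ} {u : ℝ × E3 → ℂ} {m : ℝ → ℝ}

section
variable (hu : Sol s J W om E D B b a a' u)
include hu

lemma measurable_pair (p : List (Fin 3) × List (Fin 3)) :
    Measurable fun t => ∫⁻ x, (‖Dw p.1 u (t, x)‖ₑ * ‖Dw p.2 u (t, x)‖ₑ) ^ 2 :=
  (((hu.sm.dw _).continuous.measurable.enorm.mul
    (hu.sm.dw _).continuous.measurable.enorm).pow_const 2).lintegral_prod_right'

lemma yq_ne_top {t : ℝ} (ht : t ∈ Icc a a') : yq s D u t ≠ ⊤ := by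
  refine ENNReal.sum_ne_top.2 fun p _ => ENNReal.mul_ne_top ENNReal.ofReal_ne_top ?_
  obtain ⟨-, C, hC⟩ := (hu.gd t ht).bf p.1
  have h2 := (hu.m2_dw p.2 ht).lb
  rw [dx_sl hu.sm] at hC
  have := lintegral_sup_sup_le (f1 := sl (Dw p.1 u) t) (f2 := fun _ : E3 => (1 : ℂ)) (M2 := 1)
    (fun x => (hC x).1) (by simp) ENNReal.toReal_nonneg h2
  refine ne_top_of_le_ne_top ENNReal.ofReal_ne_top (le_trans (lintegral_congr fun x => ?_).le this)
  simp [sl]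

variable (hm : Maj s D a a' u m)
include hm

lemma lintegral_pair_le {p} (hp : p ∈ pr s) :
    ∫⁻ t in Icc a a', ∫⁻ x, (‖Dw p.1 u (t, x)‖ₑ * ‖Dw p.2 u (t, x)‖ₑ) ^ 2 ≤
      ENNReal.ofReal (D ^ (2 * (p.1.length + p.2.length)) *
        (KY J * (E ^ 2 * (1 + lam s om a a' m) * b ^ 4 / D ^ 3))) := by
  have hD := hu.D_pos
  have hb := hu.hb
  have hC := one_le_Cφ
  have hL := hu.lam_nonneg hm
  have hK := KQ_pos J
  have hE2 : 1 ≤ E ^ 2 := one_le_pow₀ hu.hE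
  have hs := hu.hs
  obtain ⟨σ, τ⟩ := p
  rcases mem_pr.1 hp with ⟨h, h1, h2⟩ | ⟨h, h1⟩
  · simp only at h h1 h2 ⊢
    subst h
    refine le_trans (le_of_eq (lintegral_congr fun t => lintegral_congr fun x => by ring))
      ((hu.lintegral_pow_four_le hm h1 h2).trans (ENNReal.ofReal_le_ofReal ?_))
    have e : D ^ (2 * (σ.length + σ.length)) = D ^ (4 * σ.length - 3) * D ^ 3 := by
      rw [← pow_add]; congr 1; omega
    rw [e, show D ^ (4 * σ.length - 3) * D ^ 3 *
        (KY J * (E ^ 2 * (1 + lam s om a a' m) * b ^ 4 / D ^ 3)) =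
      KY J * (E ^ 2 * ((1 + lam s om a a' m) * b ^ 4 * D ^ (4 * σ.length - 3))) by field_simp]
    calc _ = 12 ^ 4 * Cφ * (1 * ((1 + lam s om a a' m) * b ^ 4 * D ^ (4 * σ.length - 3))) := by ring
      _ ≤ _ := by
        have hKY : 12 ^ 4 * Cφ ≤ KY J := by unfold KY; linarith
        have hC4 : 0 ≤ 12 ^ 4 * Cφ := by positivity
        have : 0 ≤ (1 + lam s om a a' m) * b ^ 4 * D ^ (4 * σ.length - 3) := by positivity
        exact mul_le_mul hKY (mul_le_mul_of_nonneg_right hE2 this) (by positivity)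
          (hC4.trans hKY)
  · simp only at h h1 ⊢
    subst h
    obtain ⟨i, τ, rfl⟩ := List.exists_cons_of_length_pos (by omega : 0 < τ.length)
    rw [List.length_cons] at h1
    refine (hu.lintegral_mul_top_le hm h1 i).trans (ENNReal.ofReal_le_ofReal ?_)
    have e : D ^ (2 * (([] : List (Fin 3)).length + (i :: τ).length)) = D ^ (2 * s - 3) * D ^ 3 := by
      rw [← pow_add]; congr 1; simp; omega
    rw [e, show D ^ (2 * s - 3) * D ^ 3 *
        (KY J * (E ^ 2 * (1 + lam s om a a' m) * b ^ 4 / D ^ 3)) =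
      KY J * (E ^ 2 * (1 + lam s om a a' m) * b ^ 4 * D ^ (2 * s - 3)) by field_simp]
    gcongr
    unfold KY
    have : 0 < 12 ^ 4 * Cφ := by positivity
    linarith

lemma lintegral_yq_le : ∫⁻ t in Icc a a', yq s D u t ≤
    ENNReal.ofReal ((pr s).card * (KY J * (E ^ 2 * (1 + lam s om a a' m) * b ^ 4 / D ^ 3))) := by
  have hD := hu.D_pos
  unfold yq
  rw [lintegral_finsetSum _ fun p _ => (hu.measurable_pair p).const_mul _]
  calc _ ≤ ∑ p ∈ pr s, ENNReal.ofReal (KY J * (E ^ 2 * (1 + lam s om a a' m) * b ^ 4 / D ^ 3)) := by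
        refine Finset.sum_le_sum fun p hp => ?_
        rw [lintegral_const_mul' _ _ ENNReal.ofReal_ne_top]
        refine (mul_le_mul_right (hu.lintegral_pair_le hm hp) _).trans (le_of_eq ?_)
        rw [← ENNReal.ofReal_mul (by positivity), inv_mul_cancel_left₀ (by positivity)]
    _ = _ := by
        rw [Finset.sum_const, nsmul_eq_mul, ← ENNReal.ofReal_natCast,
          ← ENNReal.ofReal_mul (by positivity)]

lemma abs_energy_deriv_le {R : ℝ} (hR : 1 ≤ R) (hRD : R ^ 2 = D) {σ : List (Fin 3)}
    (hσ : σ.length ≤ s) {t : ℝ} (ht : t ∈ Icc a a') :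
    |∫ x, 2 * ip (Complex.I * Dw σ u (t, x)) (src3 (Dw σ u) (t, x))| ≤
      6 * 3 ^ s * om * (b ^ 2 * D ^ (2 * s - 2) / R * m t + D ^ (2 * s) * R * (yq s D u t).toReal) := by
  have hD := hu.D_pos
  have hb := hu.hb
  have hom := hu.om_nonneg
  have hs := hu.hs
  have hmt := hm.nn t
  have hR0 : 0 < R := by linarith
  have hg := hu.gd t ht
  have hy : 0 ≤ (yq s D u t).toReal := ENNReal.toReal_nonneg
  have hyt := hu.yq_ne_top ht
  set y := (yq s D u t).toReal with hyd
  have hl : ∀ σ : List (Fin 3), σ.length + 2 ≤ s → ∀ x,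
      ‖Dx σ (sl u t) x‖ ≤ D ^ σ.length * √(m t) := fun σ hσ x => by
    refine le_of_sq_le_sq ?_ (by positivity)
    rw [mul_pow, Real.sq_sqrt hmt, ← pow_mul, mul_comm σ.length, dx_sl hu.sm]
    exact hm.sup t ht σ hσ x
  have key : ∀ c, 0 ≤ c → (∀ p : List (Fin 3) × List (Fin 3) × List (Fin 3),
      p.1.length + p.2.1.length + p.2.2.length = σ.length →
      p.2.2.length < σ.length → LB (Tw W (sl u t) p) c) →
      |∫ x, 2 * ip (Complex.I * Dw σ u (t, x)) (src3 (Dw σ u) (t, x))| ≤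
        2 * 3 ^ s * (b * D ^ (σ.length - 1) * c) := fun c hc h => by
    have := abs_integral_ip_dx_tr_le hu.hW hg.bf (by positivity) hc (hg.lb σ hσ) h
    rw [← hu.sl_src3_dw, dx_sl hu.sm] at this
    refine this.trans ?_
    gcongr
    norm_num
  rcases hσ.lt_or_eq with h | h
  · refine (key (om * (3 * b * D ^ (σ.length - 1) * m t)) (by positivity) fun p hp _ =>
      (hg.tw_lb hs hb.le hD (sqrt_nonneg (m t)) hu.hW hu.hom hl (hp.trans_le hσ)).mono ?_).trans ?_
    · rw [hp, Real.sq_sqrt hmt]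
    · have e1 : D ^ (σ.length - 1) * D ^ (σ.length - 1) ≤ D ^ (2 * s - 2) / R := by
        rw [le_div_iff₀ hR0]
        calc D ^ (σ.length - 1) * D ^ (σ.length - 1) * R ≤ D ^ (s - 2) * D ^ (s - 2) * D ^ 2 := by
              have h1 : D ^ (σ.length - 1) ≤ D ^ (s - 2) := pow_le_pow_right₀ hu.hD (by omega)
              have h2 : R ≤ D ^ 2 := by
                rw [← hRD, ← pow_mul]; exact le_self_pow₀ hR (by norm_num)
              gcongr
          _ = _ := by rw [← pow_add, ← pow_add]; congr 1; omega
      have e2 : 0 ≤ D ^ (2 * s) * R * y := by positivity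
      calc _ = 6 * 3 ^ s * om * (b ^ 2 * (D ^ (σ.length - 1) * D ^ (σ.length - 1)) * m t) := by ring
        _ ≤ 6 * 3 ^ s * om * (b ^ 2 * (D ^ (2 * s - 2) / R) * m t) := by gcongr
        _ = 6 * 3 ^ s * om * (b ^ 2 * D ^ (2 * s - 2) / R * m t) := by ring
        _ ≤ _ := by gcongr; linarith
  · refine (key _ (by positivity) fun p hp hp' => tw_top_lb hs hD (sqrt_nonneg (m t)) hy hu.hW hu.hom
      hg.bf hl (fun τ h1 h2 => ?_) (fun τ h1 => ?_) (hp.trans h) (h ▸ hp')).trans ?_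
    · have := le_of_yq hD hyt (mem_pr.2 (Or.inl ⟨rfl, h1, h2⟩) : (τ, τ) ∈ pr s)
      rw [show 4 * τ.length = 2 * (τ.length + τ.length) by ring, dx_sl hu.sm]
      refine le_trans (lintegral_congr fun x => ?_).le this
      simp only [sl]; ring
    · have := le_of_yq hD hyt (mem_pr.2 (Or.inr ⟨rfl, h1⟩) : ([], τ) ∈ pr s)
      simp only [List.length_nil, zero_add, h1] at this
      rw [dx_sl hu.sm]
      exact this
    · set P := b * D ^ (s - 1) * √(m t) with hP
      set Q := D ^ s * √y with hQ
      have hPQ : P * Q ≤ P ^ 2 / R + R * Q ^ 2 := by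
        have h1 : P ^ 2 / R + R * Q ^ 2 - P * Q = ((P - R * Q) ^ 2 + P * (R * Q)) / R := by
          field_simp; ring
        have h2 : 0 ≤ ((P - R * Q) ^ 2 + P * (R * Q)) / R := by positivity
        linarith
      have hP2 : P ^ 2 / R = b ^ 2 * D ^ (2 * s - 2) / R * m t := by
        rw [hP, mul_pow, mul_pow, Real.sq_sqrt hmt, ← pow_mul,
          show (s - 1) * 2 = 2 * s - 2 by omega]
        ring
      have hQ2 : R * Q ^ 2 = D ^ (2 * s) * R * y := by
        rw [hQ, mul_pow, Real.sq_sqrt hy]; ring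
      rw [hP2, hQ2] at hPQ
      have h3 : 0 ≤ b ^ 2 * D ^ (2 * s - 2) / R * m t + D ^ (2 * s) * R * y := by positivity
      rw [h]
      calc _ = 2 * 3 ^ s * om * (P * Q) := by rw [hP, hQ]; ring
        _ ≤ 6 * 3 ^ s * om * (b ^ 2 * D ^ (2 * s - 2) / R * m t + D ^ (2 * s) * R * y) := by
            gcongr
            norm_num

end

/-- Energy increment over a short time interval. -/
theorem exists_energy_le (s J : ℕ) : ∃ K : ℝ, 1 ≤ K ∧ ∀ {W : E3 → ℝ} {om E D B b a a' : ℝ}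
    {u : ℝ × E3 → ℂ}, Sol s J W om E D B b a a' u → ∀ {R : ℝ}, 1 ≤ R → R ^ 2 = D →
    ∀ σ : List (Fin 3), σ.length ≤ s →
    |(∫ x, ‖Dw σ u (a', x)‖ ^ 2) - ∫ x, ‖Dw σ u (a, x)‖ ^ 2| ≤
      K * ((1 + om) ^ 3 * E ^ 5 * B ^ 6) * (b ^ 2 * D ^ (2 * s - 2) / R) := by
  obtain ⟨K, hK, h⟩ := exists_majorant s J
  have hKY : 0 < KY J := by
    have := KQ_pos J
    have := one_le_Cφ
    unfold KY; positivity
  set c := (pr s).card * KY J with hc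
  have hc0 : 0 ≤ c := by positivity
  refine ⟨6 * 3 ^ s * (K + c * (1 + 3 ^ (s + 1) * K)), ?_, ?_⟩
  · have h1 : (1 : ℝ) ≤ 3 ^ s := one_le_pow₀ (by norm_num)
    have h2 : 0 ≤ c * (1 + 3 ^ (s + 1) * K) := by positivity
    nlinarith
  intro W om E D B b a a' u hu R hR hRD σ hσ
  obtain ⟨m, h1, h2, h3, h4, h5⟩ := h hu
  have hm : Maj s D a a' u m := ⟨h1, h2, h3, h4⟩
  have hD := hu.D_pos
  have hb := hu.hb
  have hB := hu.B_pos
  have hom := hu.om_nonneg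
  have hE := hu.hE
  have hs := hu.hs
  have hR0 : 0 < R := by linarith
  have hL := hu.lam_nonneg hm
  have hI0 : 0 ≤ ∫ t in a..a', m t := intervalIntegral.integral_nonneg hu.hab fun t _ => h1 t
  set A := b ^ 2 * D ^ (2 * s - 2) / R with hA
  have hA0 : 0 ≤ A := by positivity
  set I := ∫ t in a..a', m t with hI
  have hlam : lam s om a a' m = 3 ^ (s + 1) * om * I := intervalIntegral.integral_const_mul _ _
  set Y := c * (E ^ 2 * (1 + lam s om a a' m) * b ^ 4 / D ^ 3) with hY
  have hY0 : 0 ≤ Y := by positivity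
  have step : |∫ t in a..a', ∫ x, 2 * ip (Complex.I * Dw σ u (t, x)) (src3 (Dw σ u) (t, x))| ≤
      6 * 3 ^ s * om * (A * I + D ^ (2 * s) * R * Y) := by
    rw [← ENNReal.ofReal_le_ofReal_iff (by positivity), ← Real.norm_eq_abs, ofReal_norm,
      intervalIntegral.integral_of_le hu.hab]
    refine (enorm_integral_le_lintegral_enorm _).trans ?_
    have mI : IntegrableOn m (Icc a a') := by
      rw [integrableOn_Icc_iff_integrableOn_Ioc]
      exact (intervalIntegrable_iff_integrableOn_Ioc_of_le hu.hab).1 h2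
    calc _ ≤ ∫⁻ t in Icc a a', ‖∫ x, 2 * ip (Complex.I * Dw σ u (t, x)) (src3 (Dw σ u) (t, x))‖ₑ :=
          lintegral_mono_set Ioc_subset_Icc_self
      _ ≤ ∫⁻ t in Icc a a', ENNReal.ofReal (6 * 3 ^ s * om) * (ENNReal.ofReal A * ENNReal.ofReal (m t) +
            ENNReal.ofReal (D ^ (2 * s) * R) * yq s D u t) := by
          refine setLIntegral_mono' measurableSet_Icc fun t ht => ?_
          have hy : 0 ≤ (yq s D u t).toReal := ENNReal.toReal_nonneg
          have hmt := h1 t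
          rw [← ofReal_norm, Real.norm_eq_abs]
          refine (ENNReal.ofReal_le_ofReal (hu.abs_energy_deriv_le hm hR hRD hσ ht)).trans ?_
          rw [ENNReal.ofReal_mul (by positivity), ENNReal.ofReal_add (by positivity) (by positivity),
            ENNReal.ofReal_mul hA0, ENNReal.ofReal_mul (p := D ^ (2 * s) * R) (by positivity),
            ENNReal.ofReal_toReal (hu.yq_ne_top ht)]
      _ = ENNReal.ofReal (6 * 3 ^ s * om) * (ENNReal.ofReal A * (∫⁻ t in Icc a a', ENNReal.ofReal (m t)) +
            ENNReal.ofReal (D ^ (2 * s) * R) * ∫⁻ t in Icc a a', yq s D u t) := by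
          rw [lintegral_const_mul' _ _ ENNReal.ofReal_ne_top, lintegral_add_left',
            lintegral_const_mul' _ _ ENNReal.ofReal_ne_top,
            lintegral_const_mul' _ _ ENNReal.ofReal_ne_top]
          exact mI.1.aemeasurable.ennreal_ofReal.const_mul _
      _ ≤ ENNReal.ofReal (6 * 3 ^ s * om) * (ENNReal.ofReal A * ENNReal.ofReal I +
            ENNReal.ofReal (D ^ (2 * s) * R) * ENNReal.ofReal Y) := by
          gcongr
          · rw [← ofReal_integral_eq_lintegral_ofReal mI (Filter.Eventually.of_forall h1), hI,
              intervalIntegral.integral_of_le hu.hab, integral_Icc_eq_integral_Ioc]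
          · refine (hu.lintegral_yq_le hm).trans (ENNReal.ofReal_le_ofReal (le_of_eq ?_))
            rw [hY, hc]; ring
      _ = _ := by
          rw [← ENNReal.ofReal_mul hA0, ← ENNReal.ofReal_mul (by positivity),
            ← ENNReal.ofReal_add (by positivity) (by positivity), ← ENNReal.ofReal_mul (by positivity)]
  rw [hu.energy_eq hm hσ]
  refine step.trans ?_
  have hDY : D ^ (2 * s) * R * Y = A * (c * (E ^ 2 * (1 + lam s om a a' m) * b ^ 2)) := by
    have : D ^ (2 * s) = D ^ (2 * s - 2) * D ^ 2 := by rw [← pow_add]; congr 1; omega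
    rw [hY, hA, this]
    field_simp
    rw [hRD]
  have hB1 := hu.hB
  have o1 : 1 ≤ 1 + om := by linarith
  set Z := (1 + om) * E ^ 3 * B ^ 4 with hZ
  have hZ1 : 1 ≤ Z := by
    rw [hZ]
    have h6 := one_le_pow₀ hE (n := 3)
    have h7 := one_le_pow₀ hB1 (n := 4)
    exact one_le_mul_of_one_le_of_one_le (one_le_mul_of_one_le_of_one_le o1 h6) h7
  have hZ0 : 0 < Z := by linarith
  rw [hDY, hlam, ← mul_add]
  have f1 : 1 + 3 ^ (s + 1) * om * I ≤ (1 + om) * Z * (1 + 3 ^ (s + 1) * K) := by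
    calc 1 + 3 ^ (s + 1) * om * I ≤ 1 * 1 + 3 ^ (s + 1) * (1 + om) * (K * Z) := by
          gcongr
          · norm_num
          · linarith
      _ ≤ (1 + om) * Z + 3 ^ (s + 1) * (1 + om) * (K * Z) := by gcongr
      _ = _ := by ring
  have f2 : I + c * (E ^ 2 * (1 + 3 ^ (s + 1) * om * I) * b ^ 2) ≤
      (1 + om) * E ^ 2 * B ^ 2 * Z * (K + c * (1 + 3 ^ (s + 1) * K)) := by
    have h6 := one_le_pow₀ hE (n := 2)
    have h7 := one_le_pow₀ hB1 (n := 2)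
    have h8 : 1 ≤ (1 + om) * E ^ 2 * B ^ 2 :=
      one_le_mul_of_one_le_of_one_le (one_le_mul_of_one_le_of_one_le o1 h6) h7
    calc I + c * (E ^ 2 * (1 + 3 ^ (s + 1) * om * I) * b ^ 2)
        ≤ 1 * (K * Z) + c * (E ^ 2 * ((1 + om) * Z * (1 + 3 ^ (s + 1) * K)) * B ^ 2) := by
          gcongr
          · linarith
          · exact hu.hbB
      _ ≤ ((1 + om) * E ^ 2 * B ^ 2) * (K * Z) +
          c * (E ^ 2 * ((1 + om) * Z * (1 + 3 ^ (s + 1) * K)) * B ^ 2) := by gcongr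
      _ = _ := by ring
  calc 6 * 3 ^ s * om * (A * (I + c * (E ^ 2 * (1 + 3 ^ (s + 1) * om * I) * b ^ 2)))
      ≤ 6 * 3 ^ s * (1 + om) * (A * ((1 + om) * E ^ 2 * B ^ 2 * Z * (K + c * (1 + 3 ^ (s + 1) * K)))) := by
        gcongr
        linarith
    _ = _ := by rw [hZ]; ring

end Sol

section schwartz
variable {g : E3 → ℂ}

/-- Functions underlying an element of the Schwartz space. -/
def IsS (g : E3 → ℂ) : Prop := ∃ f : SchwartzMap E3 ℂ, ⇑f = g

lemma isS_of_isSchwartzF (h : IsSchwartzF g) : IsS g :=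
  ⟨⟨g, contDiff_infty.2 h.1, h.2⟩, rfl⟩

lemma IsS.dx (h : IsS g) (σ : List (Fin 3)) : IsS (Dx σ g) := by
  induction σ with
  | nil => exact h
  | cons i σ ih =>
    obtain ⟨f, hf⟩ := ih
    exact ⟨LineDeriv.lineDerivOp (e3 i) f, by
      funext x; rw [SchwartzMap.lineDerivOp_apply_eq_fderiv, hf]; rfl⟩

lemma IsS.sm (h : IsS g) : Sm g := by
  obtain ⟨f, rfl⟩ := h
  exact f.smooth ⊤

lemma IsS.m2 (h : IsS g) : M2 g := by
  obtain ⟨f, rfl⟩ := h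
  exact ⟨f.continuous, f.memLp 2⟩

lemma IsS.bf (h : IsS g) : Bf g := by
  refine ⟨h.sm, ?_⟩
  obtain ⟨f, rfl⟩ := h
  obtain ⟨C, -, hC⟩ := f.decay 0 0
  obtain ⟨C', -, hC'⟩ := f.decay 0 1
  refine ⟨max C C', fun x => ⟨?_, ?_⟩⟩
  · have := hC x
    rw [pow_zero, one_mul, norm_iteratedFDeriv_zero] at this
    exact this.trans (le_max_left _ _)
  · have := hC' x
    rw [pow_zero, one_mul, norm_iteratedFDeriv_one] at this
    exact this.trans (le_max_right _ _)

end schwartz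

section norms
variable {g : E3 → ℂ} {n : ℕ}

/-- The `L²` norm of the derivative along a word. -/
def nrm (τ : List (Fin 3)) (g : E3 → ℂ) : ℝ := √(∫ x, ‖Dx τ g x‖ ^ 2)

lemma nrm_nonneg (τ : List (Fin 3)) : 0 ≤ nrm τ g := sqrt_nonneg _

lemma sq_nrm (τ : List (Fin 3)) : nrm τ g ^ 2 = ∫ x, ‖Dx τ g x‖ ^ 2 :=
  sq_sqrt (integral_nonneg fun _ => by positivity)

lemma IsS.lb_nrm (h : IsS g) (τ : List (Fin 3)) : LB (Dx τ g) (nrm τ g) :=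
  LB.of_integral (h.dx τ).m2.1 ((h.dx τ).m2.lb.integrable_sq) (nrm_nonneg τ) (sq_nrm τ).ge

lemma dx_append (σ τ : List (Fin 3)) : Dx (σ ++ τ) g = Dx σ (Dx τ g) := by
  induction σ with
  | nil => rfl
  | cons i σ ih => simp only [List.cons_append, Dx, ih]

lemma dx_perm (hg : Sm g) {σ τ : List (Fin 3)} (h : σ.Perm τ) : Dx σ g = Dx τ g := by
  induction h with
  | nil => rfl
  | cons i _ ih => simp only [Dx, ih]
  | swap i j σ => exact dd_comm (hg.dx σ) _ _
  | trans _ _ h1 h2 => exact h1.trans h2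

/-- The ordered word attached to a multi-index. -/
def word (σ : Fin 3 → ℕ) : List (Fin 3) :=
  List.replicate (σ 0) 0 ++ (List.replicate (σ 1) 1 ++ List.replicate (σ 2) 2)

lemma length_word (σ : Fin 3 → ℕ) : (word σ).length = mdeg σ := by
  simp [word, mdeg, add_assoc]

lemma iterate_pd (i : Fin 3) (n : ℕ) : (pd i)^[n] g = Dx (List.replicate n i) g := by
  induction n with
  | zero => rfl
  | succ n ih => rw [Function.iterate_succ_apply', ih, List.replicate_succ]; rfl

lemma mpd_eq (σ : Fin 3 → ℕ) : mpd σ g = Dx (word σ) g := by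
  rw [mpd, word, dx_append, dx_append, iterate_pd, iterate_pd, iterate_pd]

lemma word_perm (τ : List (Fin 3)) : τ.Perm (word fun i => τ.count i) := by
  rw [List.perm_iff_count]
  intro i
  fin_cases i <;> simp [word, List.count_replicate]

lemma mem_mIdx {s : ℕ} {σ : Fin 3 → ℕ} : σ ∈ mIdx s ↔ mdeg σ ≤ s := by
  simp only [mIdx, Finset.mem_filter, Fintype.mem_piFinset, Finset.mem_range, and_iff_right_iff_imp]
  intro h i
  unfold mdeg at h
  fin_cases i <;> simp <;> omega

lemma sobNorm_nonneg (s : ℕ) : 0 ≤ sobNorm s g := sqrt_nonneg _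

lemma sq_sobNorm (s : ℕ) : sobNorm s g ^ 2 = ∑ σ ∈ mIdx s, nrm (word σ) g ^ 2 := by
  unfold sobNorm
  rw [sq_sqrt (Finset.sum_nonneg fun σ _ => integral_nonneg fun _ => by positivity)]
  exact Finset.sum_congr rfl fun σ _ => by rw [sq_nrm, mpd_eq]

lemma nrm_le_sobNorm (hg : Sm g) {s : ℕ} {τ : List (Fin 3)} (hτ : τ.length ≤ s) :
    nrm τ g ≤ sobNorm s g := by
  have e : nrm τ g = nrm (word fun i => τ.count i) g := by
    unfold nrm; rw [dx_perm hg (word_perm τ)]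
  have hm : (fun i => τ.count i) ∈ mIdx s := by
    rw [mem_mIdx, ← length_word, ← (word_perm τ).length_eq]; exact hτ
  rw [e]
  refine le_of_sq_le_sq ?_ (sobNorm_nonneg s)
  rw [sq_sobNorm]
  exact Finset.single_le_sum (f := fun σ => nrm (word σ) g ^ 2) (fun _ _ => sq_nonneg _) hm

lemma IsS.sq_nrm_le (h : IsS g) (i : Fin 3) (σ : List (Fin 3)) :
    nrm (i :: σ) g ^ 2 ≤ nrm σ g * nrm (i :: i :: σ) g := by
  have ibp := ibp_ip (Ker.const (e3 i) 1) (h.dx σ).sm (h.dx (i :: σ)).sm (h.dx σ).m2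
    (h.dx (i :: σ)).m2 (h.dx (i :: σ)).m2 (h.dx (i :: i :: σ)).m2
  simp only [one_mul, zero_mul, integral_zero, neg_zero] at ibp
  have hb := ((h.lb_nrm σ).ip_bound (h.lb_nrm (i :: i :: σ)) (nrm_nonneg _) (nrm_nonneg _)
    (k := fun _ => 1) continuous_const (by simp)).2.1
  simp only [one_mul] at hb
  have e : nrm (i :: σ) g ^ 2 = ∫ x, ip (dd (e3 i) (Dx σ g) x) (Dx (i :: σ) g x) := by
    rw [sq_nrm]; simp_rw [← ip_self]; rfl
  rw [e, eq_neg_of_add_eq_zero_left ibp]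
  exact (neg_le_abs _).trans hb

/-- The largest `L²` norm of derivatives of a given order. -/
def mx (k : ℕ) (g : E3 → ℂ) : ℝ := ⨆ τ : Fin k → Fin 3, nrm (List.ofFn τ) g

lemma nrm_le_mx (τ : List (Fin 3)) : nrm τ g ≤ mx τ.length g := by
  have := le_ciSup (Set.finite_range fun τ' : Fin τ.length → Fin 3 =>
    nrm (List.ofFn τ') g).bddAbove τ.get
  rw [List.ofFn_get] at this
  exact this

lemma exists_mx_eq (k : ℕ) : ∃ τ : List (Fin 3), τ.length = k ∧ mx k g = nrm τ g := by
  obtain ⟨τ, h⟩ := exists_eq_ciSup_of_finite (f := fun τ : Fin k → Fin 3 => nrm (List.ofFn τ) g)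
  exact ⟨List.ofFn τ, by simp, h.symm⟩

lemma mx_nonneg (k : ℕ) : 0 ≤ mx k g := by
  obtain ⟨τ, -, h⟩ := exists_mx_eq (g := g) k
  exact h ▸ nrm_nonneg τ

lemma IsS.sq_mx_le (h : IsS g) (k : ℕ) : mx (k + 1) g ^ 2 ≤ mx k g * mx (k + 2) g := by
  obtain ⟨τ, hτ, e⟩ := exists_mx_eq (g := g) (k + 1)
  obtain ⟨i, σ, rfl⟩ := List.exists_cons_of_length_pos (by omega : 0 < τ.length)
  have hσ : σ.length = k := by simpa using hτ
  subst hσ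
  rw [e]
  exact (h.sq_nrm_le i σ).trans
    (mul_le_mul (nrm_le_mx σ) (nrm_le_mx (i :: i :: σ)) (nrm_nonneg _) (mx_nonneg _))

end norms

section interpolation

lemma le_one_of_logConvex {x : ℕ → ℝ} {n : ℕ} (hx : ∀ k, 0 ≤ x k)
    (h : ∀ k, k + 2 ≤ n → x (k + 1) ^ 2 ≤ x k * x (k + 2)) (h0 : x 0 ≤ 1) (hn : x n ≤ 1) :
    ∀ k ≤ n, x k ≤ 1 := by
  have hmax : ∃ k ≤ n, ∀ j ≤ n, x j ≤ x k := by
    obtain ⟨k, hk, h⟩ := (Finset.range (n + 1)).exists_max_image x ⟨0, by simp⟩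
    exact ⟨k, by simpa [Nat.lt_succ_iff] using hk, fun j hj => h j (by simpa [Nat.lt_succ_iff] using hj)⟩
  classical
  have hk := Nat.find_spec hmax
  set k := Nat.find hmax with hkd
  by_contra! hc
  obtain ⟨j, hj, hj1⟩ := hc
  have hk1 : 1 < x k := hj1.trans_le (hk.2 j hj)
  rcases Nat.eq_zero_or_pos k with h' | h'
  · rw [h'] at hk1; linarith
  obtain ⟨l, hl⟩ := Nat.exists_eq_succ_of_ne_zero h'.ne'
  have hkn : k ≠ n := fun e => by rw [e] at hk1; linarith
  have hl1 : x l < x k := by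
    by_contra! hc
    exact Nat.find_min hmax (m := l) (by omega) ⟨by omega, fun j hj => (hk.2 j hj).trans hc⟩
  have hl2 : x (l + 2) ≤ x k := hk.2 _ (by omega)
  have := h l (by omega)
  rw [show l + 1 = k by omega] at this
  nlinarith [hx l, hx (l + 2)]

lemma le_mul_pow_of_logConvex {x : ℕ → ℝ} {n : ℕ} {A D : ℝ} (hA : 0 < A) (hD : 0 < D)
    (hx : ∀ k, 0 ≤ x k) (h : ∀ k, k + 2 ≤ n → x (k + 1) ^ 2 ≤ x k * x (k + 2)) (h0 : x 0 ≤ A)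
    (hn : x n ≤ A * D ^ n) {k : ℕ} (hk : k ≤ n) : x k ≤ A * D ^ k := by
  have := le_one_of_logConvex (x := fun k => x k / (A * D ^ k)) (n := n)
    (fun k => div_nonneg (hx k) (by positivity)) (fun k hk => ?_) (by simpa [div_le_one hA])
    ((div_le_one (by positivity)).2 hn) k hk
  · exact (div_le_one (by positivity)).1 this
  · rw [div_pow, div_mul_div_comm,
      show A * D ^ k * (A * D ^ (k + 2)) = (A * D ^ (k + 1)) ^ 2 by ring]
    exact div_le_div_of_nonneg_right (h k hk) (by positivity)

end interpolation

/-- Global solutions of Schwartz class. -/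
structure Sln (W : E3 → ℝ) (u : ℝ × E3 → ℂ) : Prop where
  hW : Integrable W
  sm : Sm u
  eq : ∀ t, sl (src3 u) t = Tr W (sl u t) (sl u t) (sl u t)
  sch : ∀ t, IsS (sl u t)

lemma sln_of_equation {W : E3 → ℝ} {u : ℝ → E3 → ℂ} (hW : Integrable W)
    (hc : ∀ n : ℕ, ContDiff ℝ n fun p : ℝ × E3 => u p.1 p.2) (hS : ∀ t, IsSchwartzF (u t))
    (he : ∀ t : ℝ, ∀ x : E3, Complex.I * deriv (fun τ => u τ x) t =
      -(1 / 2 : ℂ) * lapC (u t) x + (conv3 W (fun y => ‖u t y‖ ^ 2) x : ℂ) * u t x) :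
    Sln W fun p => u p.1 p.2 := by
  have sm : Sm fun p : ℝ × E3 => u p.1 p.2 := contDiff_infty.2 hc
  refine ⟨hW, sm, fun t => funext fun x => ?_, fun t => isS_of_isSchwartzF (hS t)⟩
  have e1 : td (fun p : ℝ × E3 => u p.1 p.2) (t, x) = deriv (fun τ => u τ x) t :=
    (sm.hasDerivAt_time t x).deriv.symm
  have e2 : ∑ i, sd (e3 i) (sd (e3 i) fun p : ℝ × E3 => u p.1 p.2) (t, x) = lapC (u t) x := by
    refine Finset.sum_congr rfl fun i _ => ?_
    have h1 := congrFun (dd_sl (sm.dd _) (e3 i) t : dd (e3 i) (sl (sd (e3 i) _) t) = _) x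
    rw [← dd_sl sm] at h1
    exact h1.symm
  have e3' : Wc W (fun y => u t y * (starRingEnd ℂ) (u t y)) x =
      (conv3 W (fun y => ‖u t y‖ ^ 2) x : ℂ) := by
    rw [wc_mul_conj]
    congr 1
    have := integral_sub_left_eq_self (fun y => W (x - y) * ‖u t y‖ ^ 2) volume x
    simp only [sub_sub_cancel] at this
    exact this
  have h := he t x
  rw [← e1, ← e2] at h
  change Complex.I * td _ (t, x) + ((1 / 2 : ℝ) : ℂ) * _ = _ * u t x
  rw [h]
  change _ = Wc W (fun y => u t y * (starRingEnd ℂ) (u t y)) x * u t x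
  rw [e3']
  push_cast
  ring

lemma gd_of_le {g : E3 → ℂ} (h : IsS g) {s : ℕ} (hs : 2 ≤ s) {m ρ b D S B : ℝ} (hm : 0 < m)
    (hρ : 0 < ρ) (hD : 1 ≤ D) (hmb : m ≤ b) (hb : b = min B (m * ρ)) (hS1 : S = m * ρ ^ s)
    (hS2 : S = b * D ^ (s - 1)) (h0 : nrm [] g ≤ m) (h1 : ∀ i, nrm [i] g ≤ B)
    (hS : sobNorm s g ≤ S) : Gd s b D g := by
  have hb0 : 0 < b := hm.trans_le hmb
  have x0 : mx 0 g ≤ m := by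
    obtain ⟨τ, hτ, e⟩ := exists_mx_eq (g := g) 0
    rw [List.length_eq_zero_iff] at hτ
    rw [e, hτ]; exact h0
  have xs : mx s g ≤ S := by
    obtain ⟨τ, hτ, e⟩ := exists_mx_eq (g := g) s
    rw [e]; exact (nrm_le_sobNorm h.sm hτ.le).trans hS
  have x1 : mx 1 g ≤ b := by
    rw [hb]
    refine le_min ?_ ?_
    · obtain ⟨τ, hτ, e⟩ := exists_mx_eq (g := g) 1
      obtain ⟨i, rfl⟩ := List.length_eq_one_iff.1 hτ
      rw [e]; exact h1 i
    · have := le_mul_pow_of_logConvex hm hρ (fun k => mx_nonneg (g := g) k)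
        (fun k _ => h.sq_mx_le k) x0 (hS1 ▸ xs) (by omega : 1 ≤ s)
      rwa [pow_one] at this
  refine ⟨fun σ => (h.dx σ).bf, fun σ => (h.dx σ).m2, fun σ hσ =>
    (h.lb_nrm σ).mono ((nrm_le_mx σ).trans ?_)⟩
  rcases Nat.eq_zero_or_pos σ.length with h' | h'
  · rw [h']
    simpa using x0.trans hmb
  · have := le_mul_pow_of_logConvex (x := fun k => mx (k + 1) g) (n := s - 1) hb0 (one_pos.trans_le hD)
      (fun k => mx_nonneg _) (fun k _ => h.sq_mx_le (k + 1)) x1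
      (by rw [show s - 1 + 1 = s by omega, ← hS2]; exact xs)
      (by omega : σ.length - 1 ≤ s - 1)
    simpa only [Nat.sub_add_cancel h'] using this

lemma exists_root {x : ℝ} (hx : 1 ≤ x) {n : ℕ} (hn : n ≠ 0) : ∃ y, 1 ≤ y ∧ y ^ n = x :=
  ⟨x ^ ((n : ℝ)⁻¹), one_le_rpow hx (by positivity), rpow_inv_natCast_pow (by linarith) hn⟩

/-- Choice of the auxiliary parameters in terms of the mass and of the top order norm. -/
lemma exists_scales {s : ℕ} (hs : 2 ≤ s) {m B S : ℝ} (hm : 0 < m) (hmB : m ≤ B) (hmS : m ≤ S) :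
    ∃ ρ b E : ℝ, 0 < ρ ∧ 1 ≤ E ∧ m ≤ b ∧ b = min B (m * ρ) ∧ S = m * ρ ^ s ∧
      S = b * (E ^ 12) ^ (s - 1) ∧ S ≤ m * E ^ (12 * s) := by
  obtain ⟨ρ, hρ, eρ⟩ := exists_root ((one_le_div hm).2 hmS) (by omega : s ≠ 0)
  rw [eq_div_iff hm.ne', mul_comm] at eρ
  have hmb : m ≤ min B (m * ρ) := le_min hmB (le_mul_of_one_le_right hm.le hρ)
  have hb : 0 < min B (m * ρ) := hm.trans_le hmb
  have hbS : min B (m * ρ) ≤ S := by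
    refine (min_le_right _ _).trans ?_
    rw [← eρ]
    exact mul_le_mul_of_nonneg_left (le_self_pow₀ hρ (by omega)) hm.le
  obtain ⟨E, hE, eE⟩ := exists_root ((one_le_div hb).2 hbS) (by omega : 12 * (s - 1) ≠ 0)
  rw [eq_div_iff hb.ne', mul_comm] at eE
  refine ⟨ρ, _, E, by linarith, hE, hmb, rfl, eρ.symm, by rw [← pow_mul, eE], ?_⟩
  have hρE : ρ ≤ E ^ 12 := by
    refine le_of_pow_le_pow_left₀ (n := s - 1) (by omega) (by positivity) ?_
    rw [← pow_mul]
    refine le_of_mul_le_mul_left ?_ hb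
    rw [eE, ← eρ]
    calc min B (m * ρ) * ρ ^ (s - 1) ≤ m * ρ * ρ ^ (s - 1) := by
          gcongr; exact min_le_right _ _
      _ = m * ρ ^ (s - 1 + 1) := by ring
      _ = _ := by rw [Nat.sub_add_cancel (by omega)]
  rw [← eρ, pow_mul]
  gcongr

/-- Increment of the top order energy over a short time interval. -/
theorem exists_sobNorm_increment {s : ℕ} (hs : 2 ≤ s) : ∃ K : ℝ, 1 ≤ K ∧
    ∀ {W : E3 → ℝ} {u : ℝ × E3 → ℂ} {om B a a' μ P : ℝ}, Sln W u → ∫ z, |W z| ≤ om → 1 ≤ B →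
    a ≤ a' → a' ≤ a + 1 → 0 < μ → μ ^ (12 * s) ≤ B → μ ≤ P →
    (∀ t ∈ Icc a a', nrm [] (sl u t) ≤ μ ^ (12 * s)) →
    (∀ t ∈ Icc a a', ∀ i, nrm [i] (sl u t) ≤ B) →
    (∀ t ∈ Icc a a', sobNorm s (sl u t) ≤ P ^ (12 * s)) →
    |sobNorm s (sl u a') ^ 2 - sobNorm s (sl u a) ^ 2| ≤
      K * ((1 + om) ^ 3 * B ^ 6) * (P ^ (2 * (12 * s) - 1) * μ) := by
  obtain ⟨K, hK, h⟩ := Sol.exists_energy_le s 96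
  have hcard : (1 : ℝ) ≤ (mIdx s).card := by
    exact_mod_cast Finset.card_pos.2 ⟨fun _ => 0, mem_mIdx.2 (by simp [mdeg])⟩
  refine ⟨(mIdx s).card * K, by nlinarith, ?_⟩
  intro W u om B a a' μ P hu hom hB h1 h2 hμ hμB hμP hm hB1 hS
  have hP : 0 < P := hμ.trans_le hμP
  have hom0 : 0 ≤ om := (integral_nonneg fun _ => abs_nonneg _).trans hom
  obtain ⟨ρ, b, E, hρ, hE, hmb, hb, hS1, hS2, hSE⟩ := exists_scales hs
    (show 0 < μ ^ (12 * s) by positivity) hμB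
    (show μ ^ (12 * s) ≤ P ^ (12 * s) by gcongr)
  have hE0 : 0 < E := by linarith
  have hb0 : 0 < b := lt_of_lt_of_le (by positivity) hmb
  have sol : Sol s 96 W om E (E ^ 12) B b a a' u :=
    { hs := hs, hab := h1, len := h2, hb := hb0, hbB := hb ▸ min_le_left _ _, hB := hB, hE := hE
      hD := one_le_pow₀ hE, hDE := by ring, hW := hu.hW, hom := hom, sm := hu.sm, eq := hu.eq
      gd := fun t ht => gd_of_le (hu.sch t) hs (by positivity) hρ (one_le_pow₀ hE) hmb hb hS1 hS2
        (hm t ht) (hB1 t ht) (hS t ht) }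
  have hPE : P ≤ μ * E := by
    refine le_of_pow_le_pow_left₀ (n := 12 * s) (by omega) (by positivity) ?_
    rwa [mul_pow]
  have key : ∀ σ ∈ mIdx s, |nrm (word σ) (sl u a') ^ 2 - nrm (word σ) (sl u a) ^ 2| ≤
      K * ((1 + om) ^ 3 * B ^ 6) * (P ^ (2 * (12 * s) - 1) * μ) := fun σ hσ => by
    have := h sol (R := E ^ 6) (one_le_pow₀ hE) (by ring) (word σ)
      (by rw [length_word]; exact mem_mIdx.1 hσ)
    rw [sq_nrm, sq_nrm, dx_sl hu.sm, dx_sl hu.sm]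
    refine this.trans ?_
    have e : b ^ 2 * (E ^ 12) ^ (2 * s - 2) = P ^ (2 * (12 * s) - 1) * P := by
      rw [← pow_succ, Nat.sub_add_cancel (by omega), pow_mul', hS2, mul_pow, ← pow_mul _ (s - 1)]
      congr 2; omega
    rw [e]
    calc _ = K * ((1 + om) ^ 3 * B ^ 6) * (P ^ (2 * (12 * s) - 1) * (P / E)) := by
          field_simp
      _ ≤ _ := by
          gcongr
          rwa [div_le_iff₀ hE0]
  rw [sq_sobNorm, sq_sobNorm, ← Finset.sum_sub_distrib, mul_assoc (_ : ℝ) K, mul_assoc, ← nsmul_eq_mul]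
  exact (Finset.abs_sum_le_sum_abs _ _).trans
    (Finset.sum_le_card_nsmul _ _ _ fun σ hσ => (key σ hσ).trans (by rw [mul_assoc]))

/-- Conservation of mass on intervals where the solution is bounded. -/
lemma Sln.nrm_nil_eq {W : E3 → ℝ} {u : ℝ × E3 → ℂ} (hu : Sln W u) {a a' S : ℝ} (h1 : a ≤ a')
    (h2 : a' ≤ a + 1) (hS : ∀ t ∈ Icc a a', sobNorm 2 (sl u t) ≤ S) :
    nrm [] (sl u a') = nrm [] (sl u a) := by
  have sol : Sol 2 0 W (∫ z, |W z|) 1 1 (max 1 S) (max 1 S) a a' u :=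
    { hs := le_rfl, hab := h1, len := h2, hb := by positivity, hbB := le_rfl
      hB := le_max_left _ _, hE := le_rfl, hD := le_rfl, hDE := by simp, hW := hu.hW
      hom := le_rfl, sm := hu.sm, eq := hu.eq
      gd := fun t ht => ⟨fun σ => ((hu.sch t).dx σ).bf, fun σ => ((hu.sch t).dx σ).m2, fun σ hσ =>
        ((hu.sch t).lb_nrm σ).mono (by
          rw [one_pow, mul_one]
          exact (nrm_le_sobNorm (hu.sch t).sm hσ).trans ((hS t ht).trans (le_max_right _ _)))⟩ }
  have hz : ∀ t ∈ uIcc a a',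
      ∫ x, 2 * ip (Complex.I * Dw [] u (t, x)) (src3 (Dw [] u) (t, x)) = 0 := fun t ht => by
    rw [uIcc_of_le h1] at ht
    have hg := sol.gd t ht
    have := abs_integral_ip_dx_tr_le (σ := []) hu.hW hg.bf (F := max 1 S * 1 ^ 0) (c := 0)
      (by positivity) le_rfl (hg.lb [] (Nat.zero_le _)) fun p _ h => absurd h (Nat.not_lt_zero _)
    rw [← sol.sl_src3_dw, dx_sl hu.sm, mul_zero, mul_zero] at this
    exact abs_nonpos_iff.1 this
  obtain ⟨K, -, hK⟩ := Sol.exists_majorant 2 0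
  obtain ⟨m, m1, m2, m3, m4, -⟩ := hK sol
  have := sol.energy_eq ⟨m1, m2, m3, m4⟩ (σ := []) (Nat.zero_le _)
  rw [intervalIntegral.integral_congr hz, intervalIntegral.integral_zero, sub_eq_zero] at this
  unfold nrm
  rw [dx_sl hu.sm, dx_sl hu.sm]
  exact congrArg _ this

section increments

lemma exists_pos_root {x : ℝ} (hx : 0 < x) {n : ℕ} (hn : n ≠ 0) : ∃ y, 0 < y ∧ y ^ n = x :=
  ⟨x ^ ((n : ℝ)⁻¹), rpow_pos_of_pos hx _, rpow_inv_natCast_pow hx.le hn⟩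

lemma le_add_of_increment {n : ℕ} (hn : n ≠ 0) {I : Set ℝ} {F q : ℝ → ℝ} {κ μ : ℝ}
    (hF : ∀ t, 0 ≤ F t) (hκ : 0 ≤ κ) (hμ : 0 < μ) (hq0 : ∀ t, 0 < q t)
    (hq : ∀ t, q t ^ n = max (F t) (μ ^ n)) (bdd : BddAbove (F '' I))
    (h : ∀ P, μ ≤ P → (∀ t ∈ I, F t ≤ P ^ n) → ∀ t₀ ∈ I, ∀ t ∈ I,
      |F t ^ 2 - F t₀ ^ 2| ≤ κ * (P ^ (2 * n - 1) * μ))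
    {t₀ t : ℝ} (h0 : t₀ ∈ I) (ht : t ∈ I) : q t ≤ q t₀ + κ * μ := by
  obtain ⟨S, hS⟩ := bdd
  have hμq : ∀ t, μ ≤ q t := fun t =>
    le_of_pow_le_pow_left₀ hn (hq0 t).le (hq t ▸ le_max_right _ _)
  have hqS : ∀ t ∈ I, q t ≤ max 1 (max S (μ ^ n)) := fun t ht => by
    rcases le_total (q t) 1 with h1 | h1
    · exact h1.trans (le_max_left _ _)
    · refine (le_self_pow₀ h1 hn).trans ((hq t).le.trans ?_)
      exact (max_le_max (hS ⟨t, ht, rfl⟩) le_rfl).trans (le_max_right _ _)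
  have hbdd : BddAbove (q '' I) := ⟨_, by rintro _ ⟨t, ht, rfl⟩; exact hqS t ht⟩
  set P := sSup (q '' I) with hPd
  have hqP : ∀ t ∈ I, q t ≤ P := fun t ht => le_csSup hbdd ⟨t, ht, rfl⟩
  have hμP : μ ≤ P := (hμq t₀).trans (hqP t₀ h0)
  have hP : 0 < P := hμ.trans_le hμP
  have hFP : ∀ t ∈ I, F t ≤ P ^ n := fun t ht =>
    (le_max_left _ _).trans ((hq t).ge.trans (pow_le_pow_left₀ (hq0 t).le (hqP t ht) n))
  have h2n : 2 * n = 2 * n - 1 + 1 := by omega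
  have hqq : ∀ t, q t ^ (2 * n) = max (F t) (μ ^ n) ^ 2 := fun t => by rw [← hq t]; ring
  have key : ∀ t ∈ I, q t ^ (2 * n) ≤ P ^ (2 * n - 1) * (q t₀ + κ * μ) := fun t ht => by
    have h1 : q t₀ ^ (2 * n) ≤ P ^ (2 * n - 1) * q t₀ := by
      rw [h2n, pow_succ, Nat.add_sub_cancel]
      exact mul_le_mul_of_nonneg_right (pow_le_pow_left₀ (hq0 t₀).le (hqP t₀ h0) _) (hq0 t₀).le
    have h2 := (le_abs_self _).trans (h P hμP hFP t₀ h0 t ht)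
    have h3 : F t₀ ^ 2 ≤ q t₀ ^ (2 * n) := by
      rw [hqq]; exact pow_le_pow_left₀ (hF _) (le_max_left _ _) 2
    have h4 : (μ ^ n) ^ 2 ≤ q t₀ ^ (2 * n) := by
      rw [hqq]; exact pow_le_pow_left₀ (by positivity) (le_max_right _ _) 2
    have h5 : 0 ≤ κ * (P ^ (2 * n - 1) * μ) := by positivity
    rw [hqq]
    rcases max_choice (F t) (μ ^ n) with e | e <;> rw [e] <;> nlinarith
  have hc : 0 < q t₀ + κ * μ := add_pos_of_pos_of_nonneg (hq0 _) (by positivity)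
  obtain ⟨y, hy, ey⟩ := exists_pos_root (x := P ^ (2 * n - 1) * (q t₀ + κ * μ)) (by positivity)
    (by omega : 2 * n ≠ 0)
  have hPy : P ≤ y := by
    refine csSup_le ⟨_, t₀, h0, rfl⟩ ?_
    rintro _ ⟨t, ht, rfl⟩
    exact le_of_pow_le_pow_left₀ (by omega) hy.le (ey ▸ key t ht)
  have hP2 : P ^ (2 * n - 1) * P ≤ P ^ (2 * n - 1) * (q t₀ + κ * μ) := by
    rw [← pow_succ, ← h2n, ← ey]
    exact pow_le_pow_left₀ hP.le hPy _
  exact (hqP t ht).trans (le_of_mul_le_mul_left hP2 (by positivity))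

lemma le_add_mul_of_unit_steps {q : ℝ → ℝ} {c : ℝ} (hc : 0 ≤ c)
    (h : ∀ a t, |t - a| ≤ 1 → q t ≤ q a + c) (t : ℝ) : q t ≤ q 0 + c * (1 + |t|) := by
  set n := ⌊|t|⌋₊ + 1 with hn
  have hn0 : (0 : ℝ) < n := by positivity
  have h1 : |t| ≤ n := by
    have := (Nat.lt_floor_add_one |t|).le
    push_cast [hn]; exact this
  have h2 : (n : ℝ) ≤ 1 + |t| := by
    have := Nat.floor_le (abs_nonneg t)
    push_cast [hn]; linarith
  have key : ∀ k : ℕ, q (k * (t / n)) ≤ q 0 + k * c := fun k => by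
    induction k with
    | zero => simp
    | succ k ih =>
      have := h (k * (t / n)) ((k + 1 : ℕ) * (t / n)) (by
        push_cast
        rw [show ((k : ℝ) + 1) * (t / n) - k * (t / n) = t / n by ring, abs_div, Nat.abs_cast]
        exact div_le_one_of_le₀ h1 hn0.le)
      refine this.trans ?_
      push_cast
      linarith
  have := key n
  rw [mul_div_cancel₀ t hn0.ne'] at this
  nlinarith

end increments

section localBoundedness
variable {F G : ℝ → ℝ}

/-- Local boundedness at a point. -/
def Good (F : ℝ → ℝ) (t : ℝ) : Prop := ∃ M, ∀ᶠ τ in 𝓝 t, F τ ≤ M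

/-- A priori control on bounded intervals. -/
def Ctl (F G : ℝ → ℝ) : Prop := ∀ a a', a ≤ a' → a' ≤ a + 1 → BddAbove (F '' Icc a a') →
  ∀ t₀ ∈ Icc a a', ∀ t ∈ Icc a a', ∀ M, F t₀ ≤ M → F t ≤ G M

lemma isOpen_good : IsOpen {t | Good F t} := by
  simp only [Good, setOf_exists]
  exact isOpen_iUnion fun M => isOpen_setOfPred_eventually_nhds

lemma bddAbove_image_of_good {K : Set ℝ} (hK : IsCompact K) (h : ∀ t ∈ K, Good F t) :
    BddAbove (F '' K) := by
  refine hK.induction_on (p := fun s => BddAbove (F '' s)) (by simp)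
    (fun s t hst ht => ht.mono (image_mono hst)) (fun s t hs ht => ?_) fun t ht => ?_
  · rw [image_union]; exact hs.union ht
  · obtain ⟨M, hM⟩ := h t ht
    exact ⟨_, mem_nhdsWithin_of_mem_nhds hM, M, by rintro _ ⟨τ, hτ, rfl⟩; exact hτ⟩

lemma Ctl.neg (h : Ctl F G) : Ctl (fun t => F (-t)) G := by
  intro a a' h1 h2 hb t₀ h0 t ht M hM
  refine h (-a') (-a) (by linarith) (by linarith) ?_ (-t₀) ⟨by linarith [h0.2], by linarith [h0.1]⟩
    (-t) ⟨by linarith [ht.2], by linarith [ht.1]⟩ M hM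
  refine hb.mono ?_
  rintro _ ⟨τ, hτ, rfl⟩
  exact ⟨-τ, ⟨by linarith [hτ.2], by linarith [hτ.1]⟩, by simp⟩

lemma Good.neg {t : ℝ} (h : Good F t) : Good (fun t => F (-t)) (-t) := by
  obtain ⟨M, hM⟩ := h
  refine ⟨M, ?_⟩
  have : Filter.Tendsto (fun t : ℝ => -t) (𝓝 (-t)) (𝓝 t) := by
    simpa using (continuous_neg (G := ℝ)).tendsto (-t)
  exact this.eventually hM

lemma Ctl.le_of_good (h : Ctl F G) {a t M : ℝ} (hat : a < t) (ht : t ≤ a + 1)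
    (hg : ∀ τ ∈ Ioc a t, Good F τ) (hM : F a ≤ M) : F t ≤ G M := by
  refine h a t hat.le ht ⟨max (F a) (G (F t)), ?_⟩ a ⟨le_rfl, hat.le⟩ t ⟨hat.le, le_rfl⟩ M hM
  rintro _ ⟨τ, hτ, rfl⟩
  rcases hτ.1.eq_or_lt with rfl | h1
  · exact le_max_left _ _
  · refine le_max_of_le_right (h τ t hτ.2 (by linarith) ?_ t ⟨hτ.2, le_rfl⟩ τ ⟨le_rfl, hτ.2⟩ _ le_rfl)
    exact bddAbove_image_of_good isCompact_Icc fun x hx => hg x ⟨h1.trans_le hx.1, hx.2⟩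

lemma Ctl.le_right (h : Ctl F G) {e t M : ℝ} (het : e ≤ t) (ht : t ≤ e + 1) (he : ¬ Good F e)
    (hM : ∀ τ ∈ Icc e t, ¬ Good F τ → F τ ≤ M) : F t ≤ max M (G M) := by
  by_cases hgt : Good F t
  · set A := {τ | Good F τ}ᶜ ∩ Icc e t with hA
    have hAc : IsCompact A := isCompact_Icc.inter_left isOpen_good.isClosed_compl
    have hAn : A.Nonempty := ⟨e, he, le_rfl, het⟩
    obtain ⟨h1, h2⟩ := hAc.sSup_mem hAn
    have hlt : sSup A < t := lt_of_le_of_ne h2.2 fun e' => h1 (by rw [e']; exact hgt)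
    refine le_max_of_le_right (h.le_of_good hlt (by linarith [h2.1]) (fun τ hτ => ?_) (hM _ h2 h1))
    by_contra hc
    exact hτ.1.not_ge (le_csSup hAc.bddAbove ⟨hc, h2.1.trans hτ.1.le, hτ.2⟩)
  · exact le_max_of_le_left (hM t ⟨het, le_rfl⟩ hgt)

lemma Ctl.good (h : Ctl F G) (hcl : ∀ n : ℕ, IsClosed {t | F t ≤ n}) (t : ℝ) : Good F t := by
  by_contra hbad
  set A := {τ | Good F τ}ᶜ with hA
  have hAc : IsClosed A := isOpen_good.isClosed_compl
  haveI : CompleteSpace A := hAc.completeSpace_coe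
  haveI : Nonempty A := ⟨⟨t, hbad⟩⟩
  obtain ⟨n, ⟨e, he⟩, hn⟩ := nonempty_interior_of_iUnion_of_closed
    (f := fun n : ℕ => {x : A | F x ≤ n}) (fun n => (hcl n).preimage continuous_subtype_val)
    (by
      refine eq_univ_of_forall fun x => mem_iUnion.2 ?_
      exact exists_nat_ge (F x))
  rw [mem_interior_iff_mem_nhds, Metric.mem_nhds_iff] at hn
  obtain ⟨ε, hε, hn⟩ := hn
  have hM : ∀ τ, |τ - e| < ε → ¬ Good F τ → F τ ≤ n := fun τ h1 h2 => by
    have : (⟨τ, h2⟩ : A) ∈ Metric.ball (⟨e, he⟩ : A) ε := by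
      rw [Metric.mem_ball, Subtype.dist_eq, Real.dist_eq]; exact h1
    exact hn this
  refine he ⟨max n (G n), Metric.eventually_nhds_iff.2 ⟨min ε 1, by positivity, fun τ hτ => ?_⟩⟩
  rw [Real.dist_eq, lt_min_iff] at hτ
  rcases le_total e τ with h1 | h1
  · rw [abs_of_nonneg (by linarith)] at hτ
    refine h.le_right h1 (by linarith) he fun x hx hx' => hM x ?_ hx'
    rw [abs_of_nonneg (by linarith [hx.1])]
    linarith [hx.2]
  · rw [abs_of_nonpos (by linarith)] at hτ
    have := h.neg.le_right (e := -e) (t := -τ) (M := n) (by linarith) (by linarith)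
      (fun hc => he (by simpa using hc.neg)) fun x hx hx' => hM (-x) ?_ fun hc => hx' (by
        simpa using hc.neg)
    · simpa using this
    · rw [abs_of_nonpos (by linarith [hx.1])]
      linarith [hx.2]

end localBoundedness

section semicontinuity
variable {u : ℝ × E3 → ℂ}

lemma isClosed_sobNorm_le (sm : Sm u) (hS : ∀ t, IsS (sl u t)) (s : ℕ) {c : ℝ} (hc : 0 ≤ c) :
    IsClosed {t | sobNorm s (sl u t) ≤ c} := by
  have key : ∀ t, sobNorm s (sl u t) ≤ c ↔
      ∫⁻ x, ∑ σ ∈ mIdx s, ‖Dw (word σ) u (t, x)‖ₑ ^ 2 ≤ ENNReal.ofReal (c ^ 2) := fun t => by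
    have hm : ∀ σ, Measurable fun x => ‖Dw (word σ) u (t, x)‖ₑ ^ 2 := fun σ =>
      ((sm.dw _).sl t).continuous.measurable.enorm.pow_const 2
    have hgint : ∀ σ, ∫⁻ x, ‖Dw (word σ) u (t, x)‖ₑ ^ 2 =
        ENNReal.ofReal (nrm (word σ) (sl u t) ^ 2) := fun σ => by
      have := lintegral_enorm_sq ((hS t).lb_nrm (word σ)).integrable_sq
      rw [← sq_nrm, dx_sl sm] at this
      exact this
    rw [lintegral_finsetSum _ fun σ _ => hm σ]
    simp_rw [hgint]
    rw [← ENNReal.ofReal_sum_of_nonneg fun _ _ => sq_nonneg _, ← sq_sobNorm,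
      ENNReal.ofReal_le_ofReal_iff (sq_nonneg _), sq_le_sq₀ (sobNorm_nonneg s) hc]
  simp only [key]
  refine IsSeqClosed.isClosed fun τ t hτ ht => ?_
  have hcont : ∀ x, Continuous fun t => ∑ σ ∈ mIdx s, ‖Dw (word σ) u (t, x)‖ₑ ^ 2 := fun x =>
    continuous_finsetSum _ fun σ _ =>
      (ENNReal.continuous_pow 2).comp
        (((sm.dw (word σ)).continuous.comp (by fun_prop : Continuous fun t : ℝ => (t, x))).enorm)
  calc ∫⁻ x, ∑ σ ∈ mIdx s, ‖Dw (word σ) u (t, x)‖ₑ ^ 2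
      = ∫⁻ x, Filter.liminf (fun n => ∑ σ ∈ mIdx s, ‖Dw (word σ) u (τ n, x)‖ₑ ^ 2) Filter.atTop :=
        lintegral_congr fun x => (((hcont x).tendsto t).comp ht).liminf_eq.symm
    _ ≤ Filter.liminf (fun n => ∫⁻ x, ∑ σ ∈ mIdx s, ‖Dw (word σ) u (τ n, x)‖ₑ ^ 2) Filter.atTop :=
        lintegral_liminf_le fun n => Finset.measurable_sum _ fun σ _ =>
          ((sm.dw _).sl (τ n)).continuous.measurable.enorm.pow_const 2
    _ ≤ _ := Filter.liminf_le_of_frequently_le' (Filter.Frequently.of_forall hτ)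

end semicontinuity

section growth
variable {W : E3 → ℝ} {u : ℝ × E3 → ℂ} {om B : ℝ}

/-- The quantitative short-time bound, in a form that can be iterated. -/
theorem exists_root_sobNorm_le {s : ℕ} (hs : 2 ≤ s) : ∃ K : ℝ, 1 ≤ K ∧
    ∀ {W : E3 → ℝ} {u : ℝ × E3 → ℂ} {om B a a' μ : ℝ} {q : ℝ → ℝ}, Sln W u → ∫ z, |W z| ≤ om →
    1 ≤ B → a' ≤ a + 1 → 0 < μ → μ ^ (12 * s) ≤ B →
    (∀ t, nrm [] (sl u t) ≤ μ ^ (12 * s)) → (∀ t i, nrm [i] (sl u t) ≤ B) →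
    (∀ t, 0 < q t) → (∀ t, q t ^ (12 * s) = max (sobNorm s (sl u t)) (μ ^ (12 * s))) →
    BddAbove ((fun t => sobNorm s (sl u t)) '' Icc a a') →
    ∀ t₀ ∈ Icc a a', ∀ t ∈ Icc a a', q t ≤ q t₀ + K * ((1 + om) ^ 3 * B ^ 6) * μ := by
  obtain ⟨K, hK, h⟩ := exists_sobNorm_increment hs
  refine ⟨K, hK, ?_⟩
  intro W u om B a a' μ q hu hom hB h2 hμ hμB hm h1 hq0 hq hbdd t₀ ht₀ t ht
  have hom0 : 0 ≤ om := (integral_nonneg fun _ => abs_nonneg _).trans hom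
  refine le_add_of_increment (by omega : 12 * s ≠ 0) (fun t => sobNorm_nonneg s) (by positivity) hμ
    hq0 hq hbdd (fun P hP hF => ?_) ht₀ ht
  have key : ∀ x ∈ Icc a a', ∀ y ∈ Icc a a', x ≤ y →
      |sobNorm s (sl u y) ^ 2 - sobNorm s (sl u x) ^ 2| ≤
        K * ((1 + om) ^ 3 * B ^ 6) * (P ^ (2 * (12 * s) - 1) * μ) := fun x hx y hy hxy =>
    h hu hom hB hxy (by linarith [hx.1, hy.2]) hμ hμB hP (fun t _ => hm t) (fun t _ => h1 t)
      fun t ht => hF t ⟨hx.1.trans ht.1, ht.2.trans hy.2⟩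
  intro x hx y hy
  rcases le_total x y with hxy | hxy
  · exact key x hx y hy hxy
  · rw [abs_sub_comm]; exact key y hy x hx hxy

lemma Sln.bddAbove_sobNorm (hu : Sln W u) {s : ℕ} (hs : 2 ≤ s) (hB : 1 ≤ B)
    (h : ∀ t, sobNorm 1 (sl u t) ≤ B) (a a' : ℝ) :
    BddAbove ((fun t => sobNorm s (sl u t)) '' Icc a a') := by
  obtain ⟨K, hK, hstep⟩ := exists_root_sobNorm_le hs
  have hN : 12 * s ≠ 0 := by omega
  obtain ⟨μ, hμ, eμ⟩ := exists_pos_root (one_pos.trans_le hB) hN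
  choose q hq0 hq using fun t => exists_pos_root
    (lt_max_of_lt_right (by positivity) : 0 < max (sobNorm s (sl u t)) (μ ^ (12 * s))) hN
  have hn : ∀ t (τ : List (Fin 3)), τ.length ≤ 1 → nrm τ (sl u t) ≤ B := fun t τ hτ =>
    (nrm_le_sobNorm (hu.sch t).sm hτ).trans (h t)
  have hctl : Ctl (fun t => sobNorm s (sl u t)) fun M =>
      (1 + max M (μ ^ (12 * s)) + K * ((1 + ∫ z, |W z|) ^ 3 * B ^ 6) * μ) ^ (12 * s) := by
    intro a a' h1 h2 hb t₀ h0 t ht M hM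
    have := hstep hu le_rfl hB h2 hμ eμ.le (fun t => eμ ▸ hn t [] (by simp))
      (fun t i => hn t [i] (by simp)) hq0 hq hb t₀ h0 t ht
    refine (le_max_left _ _).trans ((hq t).ge.trans (pow_le_pow_left₀ (hq0 t).le ?_ _))
    refine this.trans (add_le_add_left ?_ _)
    have hm : 0 < max M (μ ^ (12 * s)) := lt_max_of_lt_right (by positivity)
    rcases le_total (q t₀) 1 with h | h
    · linarith
    · have := (le_self_pow₀ h hN).trans ((hq t₀).le.trans (max_le_max hM le_rfl))
      linarith
  exact bddAbove_image_of_good isCompact_Icc fun t _ =>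
    hctl.good (fun n => isClosed_sobNorm_le hu.sm hu.sch s n.cast_nonneg) t

lemma Sln.nrm_nil_le (hu : Sln W u) (hB : 1 ≤ B) (h : ∀ t, sobNorm 1 (sl u t) ≤ B) (t : ℝ) :
    nrm [] (sl u t) ≤ nrm [] (sl u 0) := by
  have key : ∀ a a', a ≤ a' → a' ≤ a + 1 → nrm [] (sl u a') = nrm [] (sl u a) := fun a a' h1 h2 => by
    obtain ⟨S, hS⟩ := hu.bddAbove_sobNorm le_rfl hB h a a'
    exact hu.nrm_nil_eq h1 h2 fun t ht => hS ⟨t, ht, rfl⟩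
  have := le_add_mul_of_unit_steps (q := fun t => nrm [] (sl u t)) (c := 0) le_rfl
    (fun a t hat => ?_) t
  · simpa using this
  · rw [abs_le] at hat
    rw [add_zero]
    rcases le_total a t with h1 | h1
    · exact (key a t h1 (by linarith)).le
    · exact (key t a h1 (by linarith)).ge

/-- Polynomial growth of the top order norm, with an explicit exponent. -/
theorem exists_sobNorm_le {s : ℕ} (hs : 2 ≤ s) : ∃ K : ℝ, 1 ≤ K ∧
    ∀ {W : E3 → ℝ} {u : ℝ × E3 → ℂ} {B : ℝ}, Sln W u → 1 ≤ B → (∀ t, sobNorm 1 (sl u t) ≤ B) →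
    ∀ t, sobNorm s (sl u t) ≤
      (2 * K * ((1 + ∫ z, |W z|) ^ 3 * B ^ 6) * (1 + |t|)) ^ (12 * s) * sobNorm s (sl u 0) := by
  obtain ⟨K, hK, hstep⟩ := exists_root_sobNorm_le hs
  refine ⟨K, hK, fun {W u B} hu hB h t => ?_⟩
  have hN : 12 * s ≠ 0 := by omega
  have hom : 0 ≤ ∫ z, |W z| := integral_nonneg fun _ => abs_nonneg _
  set κ := K * ((1 + ∫ z, |W z|) ^ 3 * B ^ 6) with hκ
  have hκ1 : 1 ≤ κ := by
    have h1 : (1 : ℝ) ≤ (1 + ∫ z, |W z|) ^ 3 := one_le_pow₀ (by linarith)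
    exact one_le_mul_of_one_le_of_one_le hK
      (one_le_mul_of_one_le_of_one_le h1 (one_le_pow₀ hB))
  set F₀ := sobNorm s (sl u 0) with hF₀
  have hF0 : 0 ≤ F₀ := sobNorm_nonneg s
  set C := (1 + κ * (1 + |t|)) ^ (12 * s) with hC
  have hC0 : 0 < C := by positivity
  have main : ∀ η > 0, sobNorm s (sl u t) ≤ C * (F₀ + η) := fun η hη => by
    obtain ⟨ν, hν, eν⟩ := exists_pos_root (by positivity : 0 < F₀ + η) hN
    obtain ⟨μ, hμ, eμ⟩ := exists_pos_root
      (lt_min (one_pos.trans_le hB) (by positivity) : 0 < min B (F₀ + η)) hN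
    have hμν : μ ≤ ν := le_of_pow_le_pow_left₀ hN hν.le (by rw [eμ, eν]; exact min_le_right _ _)
    choose q hq0 hq using fun t => exists_pos_root
      (lt_max_of_lt_right (by positivity) : 0 < max (sobNorm s (sl u t)) (μ ^ (12 * s))) hN
    have hm : ∀ t, nrm [] (sl u t) ≤ μ ^ (12 * s) := fun t => by
      rw [eμ]
      refine (hu.nrm_nil_le hB h t).trans (le_min ?_ ?_)
      · exact (nrm_le_sobNorm (hu.sch 0).sm (by simp)).trans (h 0)
      · have := nrm_le_sobNorm (hu.sch 0).sm (by simp : ([] : List (Fin 3)).length ≤ s)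
        linarith
    have hun := le_add_mul_of_unit_steps (q := q) (c := κ * μ) (by positivity) (fun a t hat => ?_) t
    · have h0 : q 0 ≤ ν := le_of_pow_le_pow_left₀ hN hν.le (by
        rw [hq, eν, eμ]
        exact max_le (by linarith) (min_le_right _ _))
      calc sobNorm s (sl u t) ≤ q t ^ (12 * s) := (le_max_left _ _).trans (hq t).ge
        _ ≤ ((1 + κ * (1 + |t|)) * ν) ^ (12 * s) := by
          refine pow_le_pow_left₀ (hq0 t).le (hun.trans ?_) _
          have : κ * μ * (1 + |t|) ≤ κ * ν * (1 + |t|) := by gcongr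
          linarith
        _ = C * (F₀ + η) := by rw [mul_pow, eν]
    · have hle : ∀ i, ∀ t, nrm [i] (sl u t) ≤ B := fun i t =>
        (nrm_le_sobNorm (hu.sch t).sm (by simp)).trans (h t)
      rw [abs_le] at hat
      exact hstep hu le_rfl hB (a := min a t) (a' := max a t)
        (max_le (by rcases le_total a t with h | h <;> simp [h] <;> linarith)
          (by rcases le_total a t with h | h <;> simp [h] <;> linarith)) hμ
        (eμ ▸ min_le_left _ _) hm (fun t i => hle i t) hq0 hq (hu.bddAbove_sobNorm hs hB h _ _)
        a ⟨min_le_left _ _, le_max_left _ _⟩ t ⟨min_le_right _ _, le_max_right _ _⟩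
  have h1 : sobNorm s (sl u t) ≤ C * F₀ := by
    refine le_of_forall_pos_le_add fun η hη => ?_
    have := main (η / C) (by positivity)
    rwa [mul_add, mul_div_cancel₀ _ hC0.ne'] at this
  refine h1.trans (mul_le_mul_of_nonneg_right (pow_le_pow_left₀ (by positivity) ?_ _) hF0)
  have : 1 ≤ κ * (1 + |t|) := one_le_mul_of_one_le_of_one_le hκ1 (by linarith [abs_nonneg t])
  linarith

end growth

lemma pow_rearrange (K A B T F : ℝ) (N : ℕ) :
    (2 * K * (A ^ 3 * B ^ 6) * T) ^ N * F =
      (2 * K) ^ N * B ^ (6 * N) * A ^ (3 * N) * F * T ^ N := by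
  rw [pow_mul, pow_mul]
  simp only [mul_pow]
  ring

end NLS

/-- **Polynomial-in-time growth of Sobolev norms** for the cubic NLS with convolution
nonlinearity `i∂_t u = -(1/2)Δu + (W∗|u|²)u` on `ℝ³`.  For `s ≥ 2` there are constants
`δ > 0`, `δ₁, δ₂ ≥ 0`, `C₁ > 0`, depending only on `s`, such that for every nonnegative
`W ∈ L¹`, every `B ≥ 1` and every smooth Schwartz-in-`x` solution with
`sup_t ‖u(t)‖_{H¹} ≤ B` one has
`‖u(t)‖_{H^s} ≤ C₁ B^{δ₁} (1 + ‖W‖_{L¹})^{δ₂} ‖u(0)‖_{H^s} (1 + |t|)^{(s-1)/δ}`. -/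
theorem nls_polynomial_sobolev_growth (s : ℕ) (hs : 2 ≤ s) :
    ∃ δ > (0 : ℝ), ∃ δ₁ ≥ (0 : ℝ), ∃ δ₂ ≥ (0 : ℝ), ∃ C₁ > (0 : ℝ),
      ∀ W : E3 → ℝ, Integrable W → (∀ x, 0 ≤ W x) →
      ∀ B : ℝ, 1 ≤ B →
      ∀ u : ℝ → E3 → ℂ,
        (∀ n : ℕ, ContDiff ℝ n fun p : ℝ × E3 => u p.1 p.2) →
        (∀ t : ℝ, IsSchwartzF (u t)) →
        (∀ t : ℝ, ∀ x : E3,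
          Complex.I * deriv (fun τ => u τ x) t =
            -(1 / 2 : ℂ) * lapC (u t) x +
              (conv3 W (fun y => ‖u t y‖ ^ 2) x : ℂ) * u t x) →
        (∀ t : ℝ, sobNorm 1 (u t) ≤ B) →
      ∀ t : ℝ,
        sobNorm s (u t) ≤
          C₁ * B ^ δ₁ * (1 + ∫ x : E3, |W x|) ^ δ₂ * sobNorm s (u 0) *
            (1 + |t|) ^ (((s : ℝ) - 1) / δ) := by
  obtain ⟨K, hK, h⟩ := NLS.exists_sobNorm_le hs
  have hs1 : (0 : ℝ) < (s : ℝ) - 1 := by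
    have : (2 : ℝ) ≤ s := by exact_mod_cast hs
    linarith
  have hN : (0 : ℝ) < (12 * s : ℕ) := by
    have : 0 < 12 * s := by omega
    exact_mod_cast this
  refine ⟨((s : ℝ) - 1) / (12 * s : ℕ), by positivity, (6 * (12 * s) : ℕ), by positivity,
    (3 * (12 * s) : ℕ), by positivity, (2 * K) ^ (12 * s), by positivity, ?_⟩
  intro W hW _ B hB u hc hS he hb t
  refine (h (NLS.sln_of_equation hW hc hS he) hB hb t).trans (le_of_eq ?_)
  rw [div_div_cancel₀ hs1.ne', rpow_natCast, rpow_natCast, rpow_natCast]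
  exact NLS.pow_rearrange _ _ _ _ _ _
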